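/- Let p_n denote the n-th prime. Then liminf_{n→∞} (p_{n+2} − p_n) ≤ 398130, liminf_{n→∞} (p_{n+3} − p_n) ≤ 24797814, liminf_{n→∞} (p_{n+4} − p_n) ≤ 1431556072, and liminf_{n→∞} (p_{n+5} − p_n) ≤ 80550202480. -/

import Mathlib

set_option linter.unusedSectionVars false

namespace PrimeGaps

section

open Complex MeasureTheory Set Filter Asymptotics DirichletCharacter

section CharacterSums

variable {r : ℕ} [NeZero r] {χ : DirichletCharacter ℂ r}

lemma sum_range_period_eq_zero (hχ : χ ≠ 1) (m : ℕ) :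
    ∑ i ∈ Finset.range r, χ ((m + i : ℕ) : ZMod r) = 0 := by
  have h0 : ∑ i ∈ Finset.range r, χ ((i : ℕ) : ZMod r) = 0 := by
    rw [← MulChar.sum_eq_zero_of_ne_one hχ]
    obtain ⟨s, rfl⟩ := Nat.exists_eq_succ_of_ne_zero (NeZero.ne r)
    rw [← Fin.sum_univ_eq_sum_range (fun i => χ ((i : ℕ) : ZMod (s + 1)))]
    refine Finset.sum_congr rfl fun i _ => ?_
    congr 1
    exact Fin.cast_val_eq_self i
  induction m with
  | zero => simpa using h0
  | succ m ih =>
    have h1 := Finset.sum_range_succ (fun i => χ ((m + i : ℕ) : ZMod r)) r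
    have h2 := Finset.sum_range_succ' (fun i => χ ((m + i : ℕ) : ZMod r)) r
    rw [ih, zero_add] at h1
    rw [h1] at h2
    have h3 : χ ((m + r : ℕ) : ZMod r) = χ ((m + 0 : ℕ) : ZMod r) := by simp
    rw [h3] at h2
    have h4 := left_eq_add.mp (h2.trans (add_comm _ _))
    rw [← h4]
    refine Finset.sum_congr rfl fun i _ => ?_
    congr 2; ring

lemma norm_sum_range_le (hχ : χ ≠ 1) (a n : ℕ) :
    ‖∑ i ∈ Finset.range n, χ ((a + i : ℕ) : ZMod r)‖ ≤ r := by
  induction n using Nat.strong_induction_on generalizing a with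
  | _ n ih =>
    rcases lt_or_ge n r with h | h
    · refine (norm_sum_le _ _).trans ((Finset.sum_le_card_nsmul _ _ 1 fun i _ => χ.norm_le_one _).trans ?_)
      simpa using h.le
    · obtain ⟨m, rfl⟩ := Nat.exists_eq_add_of_le h
      rw [Finset.sum_range_add, sum_range_period_eq_zero hχ, zero_add]
      have := ih m (by have := NeZero.pos r; omega) (a + r)
      simpa [add_assoc] using this

lemma norm_sum_Icc_le (hχ : χ ≠ 1) (n : ℕ) : ‖∑ k ∈ Finset.Icc 1 n, χ (k : ZMod r)‖ ≤ r := by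
  have h := norm_sum_range_le hχ 1 n
  rwa [show ∑ i ∈ Finset.range n, χ ((1 + i : ℕ) : ZMod r) = ∑ k ∈ Finset.Icc 1 n, χ (k : ZMod r) by
    rw [Finset.range_eq_Ico, Finset.sum_Ico_add (fun k => χ ((k : ℕ) : ZMod r)) 0 n 1]
    refine Finset.sum_congr ?_ fun _ _ => rfl
    ext x; simp] at h

lemma norm_sum_Icc_le_card (χ : DirichletCharacter ℂ r) (n : ℕ) :
    ‖∑ k ∈ Finset.Icc 1 n, χ (k : ZMod r)‖ ≤ n := by
  refine (norm_sum_le _ _).trans ((Finset.sum_le_card_nsmul _ _ 1 fun i _ => χ.norm_le_one _).trans ?_)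
  simp

/-- The summatory function of a character, restricted to `t > 1`. -/
noncomputable def charSum (χ : DirichletCharacter ℂ r) : ℝ → ℂ :=
  indicator (Ioi 1) fun t => ∑ k ∈ Finset.Icc 1 ⌊t⌋₊, χ (k : ZMod r)

lemma measurable_charSum (χ : DirichletCharacter ℂ r) : Measurable (charSum χ) := by
  refine Measurable.indicator ?_ measurableSet_Ioi
  exact (measurable_from_nat (f := fun n => ∑ k ∈ Finset.Icc 1 n, χ (k : ZMod r))).comp
    Nat.measurable_floor

lemma norm_charSum_le (hχ : χ ≠ 1) (t : ℝ) : ‖charSum χ t‖ ≤ r := by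
  unfold charSum
  by_cases ht : t ∈ Ioi (1 : ℝ)
  · rw [indicator_of_mem ht]; exact norm_sum_Icc_le hχ _
  · rw [indicator_of_notMem ht]; simp

lemma norm_charSum_le_self (χ : DirichletCharacter ℂ r) {t : ℝ} (ht : 0 ≤ t) :
    ‖charSum χ t‖ ≤ t := by
  unfold charSum
  by_cases ht' : t ∈ Ioi (1 : ℝ)
  · rw [indicator_of_mem ht']; exact (norm_sum_Icc_le_card χ _).trans (Nat.floor_le ht)
  · rw [indicator_of_notMem ht']; simpa

lemma norm_charSum_le_rpow (hχ : χ ≠ 1) {t θ : ℝ} (ht : 0 ≤ t) (h0 : 0 ≤ θ) (h1 : θ ≤ 1) :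
    ‖charSum χ t‖ ≤ (r : ℝ) ^ θ * t ^ (1 - θ) := by
  have ha := norm_charSum_le hχ t
  have hb := norm_charSum_le_self χ ht
  rcases eq_or_lt_of_le (norm_nonneg (charSum χ t)) with h | h
  · rw [← h]; positivity
  · calc ‖charSum χ t‖ = ‖charSum χ t‖ ^ θ * ‖charSum χ t‖ ^ (1 - θ) := by
          rw [← Real.rpow_add h]; simp
      _ ≤ _ := by gcongr

lemma mellin_charSum_differentiableAt (hχ : χ ≠ 1) {s : ℂ} (hs : s.re < 0) :
    DifferentiableAt ℂ (mellin (charSum χ)) s := by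
  refine mellin_differentiableAt_of_isBigO_rpow (a := 0) (b := s.re - 1) ?_ ?_ (by simpa) ?_ (by linarith)
  · refine LocallyIntegrable.locallyIntegrableOn ?_ _
    refine (locallyIntegrable_const (r : ℝ)).mono (measurable_charSum χ).aestronglyMeasurable ?_
    exact Eventually.of_forall fun t => by simpa using norm_charSum_le hχ t
  · refine IsBigO.of_bound r (Eventually.of_forall fun t => ?_)
    simpa using norm_charSum_le hχ t
  · refine IsBigO.of_bound 1 ?_
    have : ∀ᶠ t : ℝ in nhdsWithin 0 (Ioi 0), t < 1 :=
      nhdsWithin_le_nhds (Iio_mem_nhds (by norm_num))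
    filter_upwards [this] with t ht
    rw [charSum, indicator_of_notMem (by simpa using ht.le)]
    simp

lemma LFunction_eq_mul_mellin (hχ : χ ≠ 1) {s : ℂ} (hs : 0 < s.re) :
    LFunction χ s = s * mellin (charSum χ) (-s) := by
  have key : ∀ s : ℂ, 1 < s.re → LFunction χ s = s * mellin (charSum χ) (-s) := by
    intro s hs
    rw [LFunction_eq_LSeries χ hs, LSeries_eq_mul_integral (fun n => χ (n : ZMod r)) le_rfl
      (by linarith) (LSeriesSummable_of_one_lt_re χ hs)]
    · congr 1
      rw [mellin, ← integral_indicator measurableSet_Ioi, ← integral_indicator measurableSet_Ioi]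
      congr 1; ext t
      by_cases ht : 1 < t
      · rw [indicator_of_mem (by simpa using ht), indicator_of_mem (show t ∈ Ioi 0 from by
          simpa using zero_lt_one.trans ht), charSum, indicator_of_mem (by simpa using ht), smul_eq_mul,
          mul_comm]
        congr 2; ring
      · rw [indicator_of_notMem (by simpa using ht)]
        symm
        rw [indicator_apply_eq_zero]; intro _
        rw [charSum, indicator_of_notMem (by simpa using ht), smul_zero]
    · refine IsBigO.of_bound r (Eventually.of_forall fun n => ?_)
      simpa using norm_sum_Icc_le hχ n
  have hU : IsOpen {s : ℂ | 0 < s.re} := isOpen_lt continuous_const continuous_re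
  have hd2 : DifferentiableOn ℂ (fun s => s * mellin (charSum χ) (-s)) {s : ℂ | 0 < s.re} := by
    intro z hz
    refine (DifferentiableAt.mul differentiableAt_id ?_).differentiableWithinAt
    exact (mellin_charSum_differentiableAt hχ (s := -z) (by simpa using hz)).comp z
      differentiableAt_id.neg
  refine AnalyticOnNhd.eqOn_of_preconnected_of_eventuallyEq (z₀ := 2)
    ((differentiable_LFunction hχ).differentiableOn.analyticOnNhd hU) (hd2.analyticOnNhd hU)
    (convex_halfSpace_re_gt 0).isPreconnected (by simp) ?_ hs
  filter_upwards [(isOpen_lt continuous_const continuous_re).mem_nhds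
    (show (1 : ℝ) < (2 : ℂ).re by norm_num)] with z hz using key z hz

/-- Near the line `re s = 1`, an `L`-function is at most logarithmic in the conductor. -/
lemma norm_LFunction_le (hχ : χ ≠ 1) {l : ℝ} (hl : 1 ≤ l) (hr : Real.log r ≤ l) {s : ℂ}
    (hs : 1 - 1 / (2 * l) ≤ s.re) : ‖LFunction χ s‖ ≤ 6 * l * ‖s‖ := by
  have hl0 : 0 < l := by linarith
  have hθ : 1 / l ≤ 1 := by rw [div_le_one hl0]; exact hl
  have hhalf : 1 / (2 * l) = (1 / l) / 2 := by field_simp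
  have hθ0 : 0 < 1 / l := by positivity
  have hs0 : 0 < s.re := by linarith
  have hr0 : (0 : ℝ) < r := by exact_mod_cast NeZero.pos r
  rw [LFunction_eq_mul_mellin hχ hs0, norm_mul, mul_comm]
  gcongr
  have hre : (r : ℝ) ^ (1 / l) ≤ Real.exp 1 := by
    rw [Real.rpow_def_of_pos hr0]
    gcongr
    rw [mul_one_div, div_le_one hl0]; exact hr
  have ha : -s.re - 1 / l < -1 := by linarith
  have h1 : ‖mellin (charSum χ) (-s)‖ ≤
      ∫ t in Ioi (1 : ℝ), (r : ℝ) ^ (1 / l) * t ^ (-s.re - 1 / l) := by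
    rw [mellin, ← integral_indicator measurableSet_Ioi, ← integral_indicator measurableSet_Ioi]
    refine norm_integral_le_of_norm_le (IntegrableOn.integrable_indicator
      (Integrable.const_mul (integrableOn_Ioi_rpow_of_lt ha one_pos) _) measurableSet_Ioi) (Eventually.of_forall fun t => ?_)
    by_cases ht : 1 < t
    · have ht0 : 0 < t := by linarith
      rw [indicator_of_mem (by simpa using ht0), indicator_of_mem (by simpa using ht), norm_smul,
        norm_cpow_eq_rpow_re_of_pos ht0]
      calc t ^ (-s - 1).re * ‖charSum χ t‖ ≤ t ^ (-s - 1).re * ((r : ℝ) ^ (1 / l) * t ^ (1 - 1 / l)) := by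
            gcongr; exact norm_charSum_le_rpow hχ ht0.le hθ0.le hθ
        _ = (r : ℝ) ^ (1 / l) * (t ^ (-s - 1).re * t ^ (1 - 1 / l)) := by ring
        _ = _ := by
          rw [← Real.rpow_add ht0]; congr 2; simp
    · rw [indicator_of_notMem (s := Ioi 1) (by simpa using ht)]
      apply le_of_eq
      rw [norm_eq_zero, indicator_apply_eq_zero]; intro _
      rw [charSum, indicator_of_notMem (by simpa using ht), smul_zero]
  refine h1.trans ?_
  rw [integral_const_mul, integral_Ioi_rpow_of_lt ha one_pos, Real.one_rpow]
  have h2 : -1 / (-s.re - 1 / l + 1) ≤ 2 * l := by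
    rw [neg_div, ← div_neg, div_le_iff₀ (by linarith)]
    have : 2 * l * (1 / (2 * l)) = 1 := by field_simp
    nlinarith [mul_le_mul_of_nonneg_left hs hl0.le]
  have h3 : 0 ≤ -1 / (-s.re - 1 / l + 1) := by
    rw [neg_div, ← div_neg]; apply div_nonneg <;> linarith
  calc _ ≤ Real.exp 1 * (2 * l) := by gcongr
    _ ≤ 6 * l := by nlinarith [Real.exp_one_lt_d9]

lemma norm_deriv_LFunction_le (hχ : χ ≠ 1) {l : ℝ} (hl : 1 ≤ l) (hr : Real.log r ≤ l) {s : ℂ}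
    (hs : 1 - 1 / (4 * l) ≤ s.re) : ‖deriv (LFunction χ) s‖ ≤ 24 * l ^ 2 * (‖s‖ + 1) := by
  have hl0 : 0 < l := by linarith
  have h4 : 1 / (2 * l) = 1 / (4 * l) + 1 / (4 * l) := by field_simp; norm_num
  have h5 : 1 / (4 * l) ≤ 1 := by rw [div_le_one (by positivity)]; linarith
  have := norm_deriv_le_of_forall_mem_sphere_norm_le (c := s) (R := 1 / (4 * l))
    (C := 6 * l * (‖s‖ + 1)) (f := LFunction χ) (by positivity)
    (differentiable_LFunction hχ).diffContOnCl ?_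
  · refine this.trans (le_of_eq ?_)
    field_simp; ring
  · intro z hz
    have hz' : ‖z - s‖ = 1 / (4 * l) := by simpa using hz
    have h6 : |(z - s).re| ≤ 1 / (4 * l) := hz' ▸ abs_re_le_norm _
    rw [sub_re, abs_le] at h6
    refine (norm_LFunction_le hχ hl hr (by linarith)).trans ?_
    gcongr
    have : ‖z‖ ≤ ‖z - s‖ + ‖s‖ := by simpa using norm_add_le (z - s) s
    linarith

end CharacterSums

lemma norm_riemannZeta_le {s : ℂ} (hs : 1 < s.re) :
    ‖riemannZeta s‖ ≤ ‖s‖ / ‖s - 1‖ + ‖s‖ := by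
  have hs0 : 0 < s.re := by linarith
  have h1 : riemannZeta s = s * ∫ t in Ioi (1 : ℝ), (⌊t⌋₊ : ℂ) * (t : ℂ) ^ (-(s + 1)) := by
    have h := LSeries_eq_mul_integral (fun _ => (1 : ℂ)) zero_le_one hs
      (LSeriesSummable_one_iff.mpr hs) ?_
    · rw [← LSeries_one_eq_riemannZeta hs]
      refine (show LSeries 1 s = _ from h).trans ?_
      simp
    · refine IsBigO.of_bound 1 (Eventually.of_forall fun n => ?_)
      simp
  have hint1 : IntegrableOn (fun t : ℝ => (t : ℂ) ^ (-s)) (Ioi 1) :=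
    integrableOn_Ioi_cpow_of_lt (by simpa using hs) one_pos
  have hint2 : IntegrableOn (fun t : ℝ => t ^ (-s.re - 1)) (Ioi 1) :=
    integrableOn_Ioi_rpow_of_lt (by linarith) one_pos
  have hbd : ∀ t : ℝ, 1 < t → ‖(⌊t⌋₊ : ℂ) * (t : ℂ) ^ (-(s + 1)) - (t : ℂ) ^ (-s)‖ ≤ t ^ (-s.re - 1) := by
    intro t ht
    have ht0 : 0 < t := by linarith
    have e : (t : ℂ) ^ (-s) = t * (t : ℂ) ^ (-(s + 1)) := by
      rw [show -(s + 1) = -s - 1 by ring, cpow_sub _ _ (by exact_mod_cast ht0.ne'), cpow_one]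
      field_simp [show (t : ℂ) ≠ 0 by exact_mod_cast ht0.ne']
    rw [e, ← sub_mul, norm_mul, norm_cpow_eq_rpow_re_of_pos ht0]
    have h3 : ‖(⌊t⌋₊ : ℂ) - t‖ ≤ 1 := by
      rw [← ofReal_natCast, ← ofReal_sub, norm_real, Real.norm_eq_abs, abs_le]
      have := Nat.floor_le ht0.le
      have := Nat.lt_floor_add_one t
      constructor <;> linarith
    calc _ ≤ 1 * t ^ (-(s + 1)).re := by gcongr
      _ = _ := by rw [one_mul]; congr 1; simp; ring
  have hmeas : AEStronglyMeasurable (fun t : ℝ => (⌊t⌋₊ : ℂ) * (t : ℂ) ^ (-(s + 1)) - (t : ℂ) ^ (-s))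
      (volume.restrict (Ioi 1)) := by
    refine AEStronglyMeasurable.sub (AEStronglyMeasurable.mul ?_ ?_) hint1.1
    · exact ((measurable_from_nat (f := fun n : ℕ => (n : ℂ))).comp
        Nat.measurable_floor).aestronglyMeasurable
    · exact (integrableOn_Ioi_cpow_of_lt (a := -(s + 1)) (by simp; linarith) one_pos).1
  have hint3 : IntegrableOn (fun t : ℝ => (⌊t⌋₊ : ℂ) * (t : ℂ) ^ (-(s + 1)) - (t : ℂ) ^ (-s)) (Ioi 1) := by
    refine Integrable.mono' hint2 hmeas ?_
    exact (ae_restrict_iff' measurableSet_Ioi).mpr (Eventually.of_forall fun t ht => hbd t ht)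
  have h2 : ∫ t in Ioi (1 : ℝ), (⌊t⌋₊ : ℂ) * (t : ℂ) ^ (-(s + 1)) =
      (∫ t in Ioi (1 : ℝ), (t : ℂ) ^ (-s)) +
        ∫ t in Ioi (1 : ℝ), ((⌊t⌋₊ : ℂ) * (t : ℂ) ^ (-(s + 1)) - (t : ℂ) ^ (-s)) := by
    rw [← integral_add hint1 hint3]; congr 1; ext t; ring
  have h3 : ‖∫ t in Ioi (1 : ℝ), (t : ℂ) ^ (-s)‖ = 1 / ‖s - 1‖ := by
    rw [integral_Ioi_cpow_of_lt (by simpa using hs) one_pos]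
    simp only [ofReal_one, one_cpow, norm_div, norm_neg, norm_one]
    rw [show -s + 1 = -(s - 1) by ring, norm_neg]
  have h4 : ‖∫ t in Ioi (1 : ℝ), ((⌊t⌋₊ : ℂ) * (t : ℂ) ^ (-(s + 1)) - (t : ℂ) ^ (-s))‖ ≤ 1 := by
    refine (norm_integral_le_of_norm_le hint2 ((ae_restrict_iff' measurableSet_Ioi).mpr
      (Eventually.of_forall fun t ht => hbd t ht))).trans ?_
    rw [integral_Ioi_rpow_of_lt (by linarith) one_pos, Real.one_rpow]
    rw [neg_div, ← div_neg, div_le_one (by linarith)]; linarith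
  rw [h1, h2, norm_mul]
  calc _ ≤ ‖s‖ * (1 / ‖s - 1‖ + 1) := by
        gcongr; refine (norm_add_le _ _).trans ?_; rw [h3]; gcongr
    _ = _ := by ring

lemma prod_one_add_inv_le {r : ℕ} (hr : Squarefree r) :
    ∏ p ∈ r.primeFactors, (1 + 1 / (p : ℝ)) ≤ 1 + Real.log r := by
  let f : ArithmeticFunction ℝ := ⟨fun n => 1 / (n : ℝ), by simp⟩
  have hf : f.IsMultiplicative := by
    refine ⟨by simp [f], fun {m n} _ => ?_⟩
    simp [f, mul_comm]
  have h1 := hf.prodPrimeFactors_one_add_of_squarefree hr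
  have h0 : r ≠ 0 := hr.ne_zero
  calc ∏ p ∈ r.primeFactors, (1 + 1 / (p : ℝ)) = ∑ d ∈ r.divisors, f d := h1
    _ ≤ ∑ d ∈ Finset.Icc 1 r, (1 / (d : ℝ)) := by
      refine Finset.sum_le_sum_of_subset_of_nonneg ?_ fun d _ _ => by
        show (0 : ℝ) ≤ 1 / (d : ℝ)
        positivity
      intro d hd
      rw [Nat.mem_divisors] at hd
      exact Finset.mem_Icc.mpr ⟨Nat.pos_of_dvd_of_pos hd.1 (Nat.pos_of_ne_zero h0),
        Nat.le_of_dvd (Nat.pos_of_ne_zero h0) hd.1⟩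
    _ = (harmonic r : ℝ) := by
      rw [harmonic_eq_sum_Icc]; simp
    _ ≤ _ := harmonic_le_one_add_log r

section LowerBounds

variable {r : ℕ} [NeZero r] {χ : DirichletCharacter ℂ r} {l : ℝ}

lemma norm_LFunctionTrivChar_le (hr : Squarefree r) (hl : 1 ≤ l) (hrl : Real.log r ≤ l) {s : ℂ}
    (hs : 1 < s.re) : ‖LFunctionTrivChar r s‖ ≤ 2 * l * (‖s‖ / ‖s - 1‖ + ‖s‖) := by
  rw [LFunctionTrivChar_eq_mul_riemannZeta (by rintro rfl; simp at hs), norm_mul]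
  refine mul_le_mul ?_ (norm_riemannZeta_le hs) (norm_nonneg _) (by linarith)
  rw [norm_prod]
  calc _ ≤ ∏ p ∈ r.primeFactors, (1 + 1 / (p : ℝ)) := by
        refine Finset.prod_le_prod (fun _ _ => norm_nonneg _) fun p hp => ?_
        have hp := Nat.prime_of_mem_primeFactors hp
        have hp0 : (0 : ℝ) < p := by exact_mod_cast hp.pos
        refine (norm_sub_le _ _).trans ?_
        rw [norm_one, norm_natCast_cpow_of_pos hp.pos]
        gcongr
        rw [one_div, ← Real.rpow_neg_one]
        refine Real.rpow_le_rpow_of_exponent_le (by exact_mod_cast hp.one_le) ?_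
        simp; linarith
    _ ≤ 1 + Real.log r := prod_one_add_inv_le hr
    _ ≤ 2 * l := by linarith

lemma norm_LFunction_sub_le (hχ : χ ≠ 1) (hl : 1 ≤ l) (hr : Real.log r ≤ l) {τ : ℝ} {s s' : ℂ}
    (hs : 1 - 1 / (4 * l) ≤ s.re) (hs' : 1 - 1 / (4 * l) ≤ s'.re) (h : ‖s‖ + 1 ≤ τ)
    (h' : ‖s'‖ + 1 ≤ τ) : ‖LFunction χ s - LFunction χ s'‖ ≤ 24 * l ^ 2 * τ * ‖s - s'‖ := by
  have hc : Convex ℝ ({z : ℂ | 1 - 1 / (4 * l) ≤ z.re} ∩ Metric.closedBall 0 (τ - 1)) :=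
    (convex_halfSpace_re_ge _).inter (convex_closedBall _ _)
  refine hc.norm_image_sub_le_of_norm_deriv_le (𝕜 := ℂ) (fun z _ => differentiable_LFunction hχ z)
    (fun z hz => ?_) ⟨hs', by simp; linarith⟩ ⟨hs, by simp; linarith⟩
  refine (norm_deriv_LFunction_le hχ hl hr hz.1).trans ?_
  have : ‖z‖ ≤ τ - 1 := by simpa using hz.2
  gcongr; linarith

/-- A real character is *exceptional* at scale `l` if its `L`-function is very small near `1`. -/
def NonExceptional (χ : DirichletCharacter ℂ r) (l : ℝ) : Prop :=
  χ ^ 2 = 1 → 2 / l ^ 5 ≤ ‖LFunction χ (1 + ((1 / l ^ 8 : ℝ) : ℂ))‖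

lemma one_add_re (x y : ℝ) : (1 + x + I * y : ℂ).re = 1 + x := by simp

lemma norm_one_add_le {x : ℝ} (hx : 0 < x) (hx1 : x ≤ 1) (y : ℝ) : ‖(1 + x + I * y : ℂ)‖ ≤ 2 + |y| := by
  refine (norm_add_le _ _).trans ?_
  rw [norm_mul, norm_I, one_mul, norm_real, Real.norm_eq_abs, ← ofReal_one, ← ofReal_add, norm_real,
    Real.norm_eq_abs, abs_of_pos (by linarith)]
  linarith

lemma pow_four_lower (hsq : Squarefree r) (hl : 1 ≤ l) (hr : Real.log r ≤ l)
    {x y y₁ : ℝ} (hx : 0 < x) (hx1 : x ≤ 1) (hy₁ : 0 < y₁) (hy₁1 : y₁ ≤ 1)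
    (hy : χ ^ 2 = 1 → y₁ ≤ |y|) :
    x ^ 3 * y₁ / (6144 * l ^ 4 * (|y| + 3)) ≤ ‖LFunction χ (1 + x + I * y)‖ ^ 4 := by
  have hl0 : 0 < l := by linarith
  set τ := |y| + 3 with hτ
  have hτ0 : 3 ≤ τ := by have := abs_nonneg y; linarith
  have h341 := norm_LFunction_product_ge_one χ hx y
  rw [norm_mul, norm_mul, norm_pow, norm_pow] at h341
  have hA : ‖LFunctionTrivChar r (1 + x)‖ ≤ 8 * l / x := by
    refine (norm_LFunctionTrivChar_le hsq hl hr (by simpa using hx)).trans ?_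
    have e1 : ‖(1 + x : ℂ)‖ = 1 + x := by
      rw [← ofReal_one, ← ofReal_add, norm_real, Real.norm_eq_abs, abs_of_pos (by linarith)]
    have e2 : ‖(1 + x : ℂ) - 1‖ = x := by simp [abs_of_pos hx]
    rw [e1, e2, show 8 * l / x = 2 * l * (4 / x) by ring]
    gcongr
    rw [div_add' _ _ _ hx.ne']
    gcongr; nlinarith
  have hs2 : ‖(1 + x + 2 * I * y : ℂ)‖ ≤ 2 * τ := by
    have := norm_one_add_le hx hx1 (2 * y)
    rw [abs_mul, abs_two] at this
    rw [show (1 + x + 2 * I * y : ℂ) = 1 + x + I * (2 * y : ℝ) by push_cast; ring]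
    linarith
  have hre2 : (1 + x + 2 * I * y : ℂ).re = 1 + x := by simp
  have hB : ‖LFunction (χ ^ 2) (1 + x + 2 * I * y)‖ ≤ 12 * l * τ / y₁ := by
    by_cases h2 : χ ^ 2 = 1
    · rw [h2]
      refine (norm_LFunctionTrivChar_le hsq hl hr (by rw [hre2]; linarith)).trans ?_
      have e2 : 2 * y₁ ≤ ‖(1 + x + 2 * I * y : ℂ) - 1‖ := by
        have := abs_im_le_norm ((1 + x + 2 * I * y : ℂ) - 1)
        have e3 : ((1 + x + 2 * I * y : ℂ) - 1).im = 2 * y := by simp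
        rw [e3, abs_mul, abs_two] at this
        linarith [hy h2]
      calc _ ≤ 2 * l * (2 * τ / (2 * y₁) + 2 * τ) := by gcongr
        _ ≤ 2 * l * (2 * τ / (2 * y₁) + 2 * τ / y₁) := by
          gcongr; rw [le_div_iff₀ hy₁]; nlinarith
        _ = 6 * l * τ / y₁ := by field_simp; ring
        _ ≤ _ := by gcongr; norm_num
    · refine (norm_LFunction_le h2 hl hr (by rw [hre2]; have : 0 < 1 / (2 * l) := by positivity
                                             linarith)).trans ?_
      calc _ ≤ 6 * l * (2 * τ) := by gcongr
        _ = 12 * l * τ / 1 := by ring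
        _ ≤ _ := by gcongr
  have h5 : 1 ≤ (8 * l / x) ^ 3 * ‖LFunction χ (1 + x + I * y)‖ ^ 4 * (12 * l * τ / y₁) := by
    refine h341.le.trans ?_
    gcongr
  rw [div_le_iff₀ (by positivity)]
  calc x ^ 3 * y₁ = x ^ 3 * y₁ * 1 := by ring
    _ ≤ x ^ 3 * y₁ * ((8 * l / x) ^ 3 * ‖LFunction χ (1 + x + I * y)‖ ^ 4 * (12 * l * τ / y₁)) := by
      gcongr
    _ = _ := by field_simp; ring

lemma norm_LFunction_lower_aux (hχ : χ ≠ 1) (hsq : Squarefree r) (hl : 1 ≤ l) (hr : Real.log r ≤ l)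
    {x y y₁ : ℝ} (hx : 0 < x) (hx1 : x ≤ 1) (hy₁ : 0 < y₁) (hy₁1 : y₁ ≤ 1)
    (hy : χ ^ 2 = 1 → y₁ ≤ |y|) :
    24 * y₁ / (4 * 10 ^ 10 * l ^ 10 * (|y| + 3) ^ 4) ≤ ‖LFunction χ (1 + x + I * y)‖ := by
  have hl0 : 0 < l := by linarith
  set τ := |y| + 3 with hτ
  have hτ0 : 3 ≤ τ := by have := abs_nonneg y; linarith
  set x₁ := y₁ / (4 * 10 ^ 10 * l ^ 12 * τ ^ 5) with hx₁
  have hx₁0 : 0 < x₁ := by positivity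
  have hx₁1 : x₁ ≤ 1 := by
    rw [hx₁, div_le_one (by positivity)]
    have : (1 : ℝ) ≤ 4 * 10 ^ 10 * l ^ 12 * τ ^ 5 := by
      have h1 : (1 : ℝ) ≤ l ^ 12 := one_le_pow₀ hl
      have h2 : (1 : ℝ) ≤ τ ^ 5 := one_le_pow₀ (by linarith)
      nlinarith [mul_le_mul h1 h2 zero_le_one (by positivity)]
    linarith
  have key : ∀ x', x₁ ≤ x' → x' ≤ 1 → 48 * l ^ 2 * τ * x₁ ≤ ‖LFunction χ (1 + x' + I * y)‖ := by
    intro x' h1 h2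
    have h := pow_four_lower hsq hl hr (hx₁0.trans_le h1) h2 hy₁ hy₁1 hy
    refine le_of_pow_le_pow_left₀ (n := 4) (by norm_num) (norm_nonneg _) (le_trans ?_ h)
    rw [← hτ, le_div_iff₀ (by positivity)]
    calc (48 * l ^ 2 * τ * x₁) ^ 4 * (6144 * l ^ 4 * τ) = 48 ^ 4 * 6144 * l ^ 12 * τ ^ 5 * x₁ * x₁ ^ 3 := by ring
      _ = 48 ^ 4 * 6144 * (l ^ 12 * τ ^ 5 * x₁ ^ 4) := by ring
      _ ≤ 4 * 10 ^ 10 * (l ^ 12 * τ ^ 5 * x₁ ^ 4) :=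
        mul_le_mul_of_nonneg_right (by norm_num) (by positivity)
      _ = (4 * 10 ^ 10 * l ^ 12 * τ ^ 5 * x₁) * x₁ ^ 3 := by ring
      _ = y₁ * x₁ ^ 3 := by rw [hx₁]; field_simp
      _ ≤ x' ^ 3 * y₁ := by rw [mul_comm]; gcongr
  have e : 24 * y₁ / (4 * 10 ^ 10 * l ^ 10 * τ ^ 4) = 24 * l ^ 2 * τ * x₁ := by
    rw [hx₁]; field_simp
  rw [e]
  rcases le_total x₁ x with h | h
  · refine le_trans ?_ (key x h hx1)
    gcongr; norm_num
  · have h1 := key x₁ le_rfl hx₁1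
    have hpos : 0 < 1 / (4 * l) := by positivity
    have h2 := norm_LFunction_sub_le hχ hl hr (τ := τ) (s := 1 + x₁ + I * y) (s' := 1 + x + I * y)
      (by rw [one_add_re]; linarith) (by rw [one_add_re]; linarith)
      (by have := norm_one_add_le hx₁0 hx₁1 y; linarith) (by have := norm_one_add_le hx hx1 y; linarith)
    have h3 : ‖(1 + x₁ + I * y : ℂ) - (1 + x + I * y)‖ ≤ x₁ := by
      rw [show (1 + x₁ + I * y : ℂ) - (1 + x + I * y) = ((x₁ - x : ℝ) : ℂ) by push_cast; ring, norm_real,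
        Real.norm_eq_abs, abs_of_nonneg (by linarith)]
      linarith
    have h4 := norm_sub_norm_le (LFunction χ (1 + x₁ + I * y)) (LFunction χ (1 + x + I * y))
    have h5 : 24 * l ^ 2 * τ * ‖(1 + x₁ + I * y : ℂ) - (1 + x + I * y)‖ ≤ 24 * l ^ 2 * τ * x₁ := by gcongr
    linarith

lemma norm_LFunction_real_lower (hχ : χ ≠ 1) (hl : 400 ≤ l) (hr : Real.log r ≤ l)
    (he : 2 / l ^ 5 ≤ ‖LFunction χ (1 + ((1 / l ^ 8 : ℝ) : ℂ))‖) {x : ℝ} (hx : 0 < x)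
    (hx1 : x ≤ 1 / l ^ 8) : 1 / l ^ 5 ≤ ‖LFunction χ (1 + x)‖ := by
  have hl0 : 0 < l := by linarith
  have h8 : (1 : ℝ) / l ^ 8 ≤ 1 := by
    rw [div_le_one (by positivity)]; exact one_le_pow₀ (by linarith)
  have hpos : 0 < 1 / (4 * l) := by positivity
  have n1 := norm_one_add_le (x := 1 / l ^ 8) (by positivity) h8 0
  have n2 := norm_one_add_le hx (hx1.trans h8) 0
  simp only [ofReal_zero, mul_zero, add_zero, abs_zero] at n1 n2
  have h2 := norm_LFunction_sub_le hχ (by linarith) hr (τ := 3) (s := 1 + ((1 / l ^ 8 : ℝ) : ℂ)) (s' := 1 + x)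
    (by rw [add_re, ofReal_re, one_re]; have : (0 : ℝ) < 1 / l ^ 8 := by positivity
        linarith) (by rw [add_re, one_re, ofReal_re]; linarith) (by linarith) (by linarith)
  have h3 : ‖(1 + ((1 / l ^ 8 : ℝ) : ℂ)) - (1 + x)‖ ≤ 1 / l ^ 8 := by
    rw [show (1 + ((1 / l ^ 8 : ℝ) : ℂ)) - (1 + x) = ((1 / l ^ 8 - x : ℝ) : ℂ) by push_cast; ring, norm_real,
      Real.norm_eq_abs, abs_of_nonneg (by linarith)]
    linarith
  have h4 := norm_sub_norm_le (LFunction χ (1 + ((1 / l ^ 8 : ℝ) : ℂ))) (LFunction χ (1 + x))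
  have h5 : 24 * l ^ 2 * 3 * ‖(1 + ((1 / l ^ 8 : ℝ) : ℂ)) - (1 + x)‖ ≤ 24 * l ^ 2 * 3 * (1 / l ^ 8) := by gcongr
  have h6 : 24 * l ^ 2 * 3 * (1 / l ^ 8) ≤ 1 / l ^ 5 := by
    rw [show 24 * l ^ 2 * 3 * (1 / l ^ 8) = (72 / l) * (1 / l ^ 5) by field_simp; norm_num]
    have : 72 / l ≤ 1 := by rw [div_le_one hl0]; linarith
    exact mul_le_of_le_one_left (by positivity) this
  have h7 : 2 / l ^ 5 = 1 / l ^ 5 + 1 / l ^ 5 := by ring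
  linarith

lemma norm_LFunction_lower (hχ : χ ≠ 1) (hsq : Squarefree r) (hl : 400 ≤ l) (hr : Real.log r ≤ l)
    (he : NonExceptional χ l) {x : ℝ} (hx : 0 < x) (hx1 : x ≤ 1 / l ^ 8) (y : ℝ) :
    1 / (10 ^ 12 * l ^ 17 * (|y| + 3) ^ 4) ≤ ‖LFunction χ (1 + x + I * y)‖ := by
  have hl0 : 0 < l := by linarith
  have h8 : (1 : ℝ) / l ^ 8 ≤ 1 := by
    rw [div_le_one (by positivity)]; exact one_le_pow₀ (by linarith)
  set τ := |y| + 3 with hτ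
  have hτ0 : 3 ≤ τ := by have := abs_nonneg y; linarith
  by_cases hc : χ ^ 2 = 1 ∧ |y| < 1 / (200 * l ^ 7)
  · have h1 := norm_LFunction_real_lower hχ hl hr (he hc.1) hx hx1
    have hpos : 0 < 1 / (4 * l) := by positivity
    have hy1 : |y| ≤ 1 := by
      refine hc.2.le.trans ?_
      rw [div_le_one (by positivity)]
      nlinarith [one_le_pow₀ (n := 7) (show 1 ≤ l by linarith)]
    have n1 := norm_one_add_le hx (hx1.trans h8) y
    have n2 := norm_one_add_le hx (hx1.trans h8) 0
    simp only [ofReal_zero, mul_zero, add_zero, abs_zero] at n2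
    have h2 := norm_LFunction_sub_le hχ (by linarith) hr (τ := 4) (s := 1 + x) (s' := 1 + x + I * y)
      (by rw [add_re, one_re, ofReal_re]; linarith) (by rw [one_add_re]; linarith) (by linarith) (by linarith)
    have h3 : ‖(1 + x : ℂ) - (1 + x + I * y)‖ ≤ 1 / (200 * l ^ 7) := by
      rw [show (1 + x : ℂ) - (1 + x + I * y) = -(I * y) by ring, norm_neg, norm_mul, norm_I, one_mul,
        norm_real]
      exact hc.2.le
    have h4 := norm_sub_norm_le (LFunction χ (1 + x)) (LFunction χ (1 + x + I * y))
    have h5 : 24 * l ^ 2 * 4 * ‖(1 + x : ℂ) - (1 + x + I * y)‖ ≤ 24 * l ^ 2 * 4 * (1 / (200 * l ^ 7)) := by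
      gcongr
    have h6 : 24 * l ^ 2 * 4 * (1 / (200 * l ^ 7)) ≤ 1 / 2 * (1 / l ^ 5) := by
      rw [show 24 * l ^ 2 * 4 * (1 / (200 * l ^ 7)) = 96 / 200 * (1 / l ^ 5) by
        field_simp; norm_num]
      exact mul_le_mul_of_nonneg_right (by norm_num) (by positivity)
    have h7 : 1 / (10 ^ 12 * l ^ 17 * τ ^ 4) ≤ 1 / 2 * (1 / l ^ 5) := by
      rw [← one_div_mul_one_div_rev, one_div_mul_one_div_rev, one_div_mul_one_div_rev]
      apply one_div_le_one_div_of_le (by positivity)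
      have a1 : (1 : ℝ) ≤ τ ^ 4 := one_le_pow₀ (by linarith)
      have a2 : l ^ 5 ≤ l ^ 17 := pow_le_pow_right₀ (by linarith) (by norm_num)
      have a3 : 0 < l ^ 5 := by positivity
      nlinarith [mul_le_mul a2 a1 zero_le_one (by positivity)]
    linarith
  · push Not at hc
    refine le_trans ?_ (norm_LFunction_lower_aux (y₁ := 1 / (200 * l ^ 7)) hχ hsq (by linarith) hr hx
      (hx1.trans h8) (by positivity) ?_ hc)
    · rw [← hτ, show 24 * (1 / (200 * l ^ 7)) / (4 * 10 ^ 10 * l ^ 10 * τ ^ 4) =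
        1 / (800 * 10 ^ 10 / 24 * l ^ 17 * τ ^ 4) by field_simp; norm_num]
      apply one_div_le_one_div_of_le (by positivity)
      gcongr; norm_num
    · rw [div_le_one (by positivity)]
      nlinarith [one_le_pow₀ (n := 7) (show 1 ≤ l by linarith)]

/-- In a small disc around a point just right of the line `re s = 1`, the logarithmic derivative
is bounded by the inverse of the radius. -/
lemma norm_logDeriv_LFunction_le (hχ : χ ≠ 1) (hsq : Squarefree r) (hl : 400 ≤ l) (hr : Real.log r ≤ l)
    (he : NonExceptional χ l) {x : ℝ} (hx : 0 < x) (hx1 : x ≤ 1 / l ^ 8) (y : ℝ) {s : ℂ}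
    (hs : ‖s - (1 + x + I * y)‖ ≤ 1 / (10 ^ 14 * l ^ 19 * (|y| + 3) ^ 5)) :
    LFunction χ s ≠ 0 ∧
    ‖deriv (LFunction χ) s / LFunction χ s‖ ≤ 10 ^ 14 * l ^ 19 * (|y| + 3) ^ 5 := by
  have hl0 : 0 < l := by linarith
  have h8 : (1 : ℝ) / l ^ 8 ≤ 1 := by
    rw [div_le_one (by positivity)]; exact one_le_pow₀ (by linarith)
  have h0 := norm_LFunction_lower hχ hsq hl hr he hx hx1 y
  set τ := |y| + 3 with hτ
  have hτ0 : 3 ≤ τ := by have := abs_nonneg y; linarith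
  have hη1 : 1 / (10 ^ 14 * l ^ 19 * τ ^ 5) ≤ 1 / (4 * l) := by
    apply one_div_le_one_div_of_le (by positivity)
    have a1 : (1 : ℝ) ≤ τ ^ 5 := one_le_pow₀ (by linarith)
    have a2 : l ≤ l ^ 19 := le_self_pow₀ (by linarith) (by norm_num)
    nlinarith [mul_le_mul a2 a1 zero_le_one (by positivity)]
  have hη2 : 1 / (4 * l) ≤ 1 := by rw [div_le_one (by positivity)]; linarith
  have hre : |(s - (1 + x + I * y)).re| ≤ 1 / (4 * l) := (abs_re_le_norm _).trans (hs.trans hη1)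
  have hre' : 1 - 1 / (4 * l) ≤ s.re := by
    rw [abs_le] at hre
    rw [sub_re, one_add_re] at hre
    linarith [hre.1]
  have hn : ‖s‖ + 1 ≤ 2 * τ := by
    have a := norm_add_le (s - (1 + x + I * y)) (1 + x + I * y)
    rw [sub_add_cancel] at a
    have := norm_one_add_le hx (hx1.trans h8) y
    linarith
  have hn0 : ‖(1 + x + I * y : ℂ)‖ + 1 ≤ 2 * τ := by
    have := norm_one_add_le hx (hx1.trans h8) y
    linarith
  have h2 := norm_LFunction_sub_le hχ (by linarith) hr (τ := 2 * τ) (s := 1 + x + I * y) (s' := s)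
    (by rw [one_add_re]; have : 0 < 1 / (4 * l) := by positivity
        linarith) hre' hn0 hn
  rw [norm_sub_rev (1 + x + I * y : ℂ)] at h2
  have h3 : 24 * l ^ 2 * (2 * τ) * ‖s - (1 + x + I * y)‖ ≤ 1 / 2 * (1 / (10 ^ 12 * l ^ 17 * τ ^ 4)) := by
    calc _ ≤ 24 * l ^ 2 * (2 * τ) * (1 / (10 ^ 14 * l ^ 19 * τ ^ 5)) := by gcongr
      _ = 48 / 100 * (1 / (10 ^ 12 * l ^ 17 * τ ^ 4)) := by field_simp; norm_num
      _ ≤ _ := mul_le_mul_of_nonneg_right (by norm_num) (by positivity)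
  have h4 := norm_sub_norm_le (LFunction χ (1 + x + I * y)) (LFunction χ s)
  have h5 : 1 / 2 * (1 / (10 ^ 12 * l ^ 17 * τ ^ 4)) ≤ ‖LFunction χ s‖ := by linarith
  have h6 : 0 < 1 / 2 * (1 / (10 ^ 12 * l ^ 17 * τ ^ 4)) := by positivity
  refine ⟨fun h => by rw [h, norm_zero] at h5; linarith, ?_⟩
  rw [norm_div]
  have h7 := norm_deriv_LFunction_le hχ (by linarith) hr hre'
  calc _ ≤ 24 * l ^ 2 * (2 * τ) / (1 / 2 * (1 / (10 ^ 12 * l ^ 17 * τ ^ 4))) := by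
        gcongr; exact h7.trans (by gcongr)
    _ = 96 * 10 ^ 12 * l ^ 19 * τ ^ 5 := by field_simp; norm_num
    _ ≤ _ := by gcongr; norm_num

end LowerBounds

/-- The smooth cutoff `(1 - x)₊ ^ J`. -/
noncomputable def wt (J : ℕ) (x : ℝ) : ℝ := (max 0 (1 - x)) ^ J

lemma wt_nonneg (J : ℕ) (x : ℝ) : 0 ≤ wt J x := pow_nonneg (le_max_left _ _) _

lemma wt_le_one (J : ℕ) {x : ℝ} (hx : 0 ≤ x) : wt J x ≤ 1 :=
  pow_le_one₀ (le_max_left _ _) (max_le (by norm_num) (by linarith))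

lemma wt_eq_zero {J : ℕ} (hJ : J ≠ 0) {x : ℝ} (hx : 1 ≤ x) : wt J x = 0 := by
  rw [wt, max_eq_left (by linarith), zero_pow hJ]

lemma wt_eq_pow {J : ℕ} {x : ℝ} (hx : x ≤ 1) : wt J x = (1 - x) ^ J := by
  rw [wt, max_eq_right (by linarith)]

lemma wt_antitone (J : ℕ) : Antitone (wt J) := fun x y h =>
  pow_le_pow_left₀ (le_max_left _ _) (max_le_max le_rfl (by linarith)) _

lemma continuous_wt (J : ℕ) : Continuous (wt J) := by unfold wt; fun_prop

/-- The Mellin transform of `wt J`. -/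
noncomputable def kern (J : ℕ) (s : ℂ) : ℂ := (J.factorial : ℂ) / ∏ j ∈ Finset.range (J + 1), (s + j)

lemma hasMellin_wt {J : ℕ} (hJ : J ≠ 0) {s : ℂ} (hs : 0 < s.re) :
    HasMellin (fun x => (wt J x : ℂ)) s (kern J s) := by
  have e : ∀ x : ℝ, 0 < x → ((x : ℂ) ^ (s - 1) • (wt J x : ℂ)) =
      indicator (Ioc 0 1) (fun x : ℝ => (x : ℂ) ^ (s - 1) * (1 - x : ℂ) ^ ((J : ℂ) + 1 - 1)) x := by
    intro x hx
    by_cases hx1 : x ≤ 1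
    · rw [indicator_of_mem (show x ∈ Ioc (0 : ℝ) 1 from ⟨hx, hx1⟩), wt_eq_pow hx1, smul_eq_mul,
        add_sub_cancel_right, cpow_natCast]
      push_cast; rfl
    · rw [indicator_of_notMem (by simp [hx1]), wt_eq_zero hJ (by linarith)]; simp
  have hconv := betaIntegral_convergent (u := s) (v := (J : ℂ) + 1) hs (by simp; positivity)
  rw [intervalIntegrable_iff_integrableOn_Ioc_of_le zero_le_one] at hconv
  have hI : Integrable (indicator (Ioc (0 : ℝ) 1)
      (fun x : ℝ => (x : ℂ) ^ (s - 1) * (1 - x : ℂ) ^ ((J : ℂ) + 1 - 1))) :=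
    hconv.integrable_indicator measurableSet_Ioc
  constructor
  · exact (integrableOn_congr_fun (fun x hx => e x hx) measurableSet_Ioi).mpr hI.integrableOn
  · rw [mellin, setIntegral_congr_fun measurableSet_Ioi (fun x hx => e x hx), setIntegral_indicator
      measurableSet_Ioc, kern, ← betaIntegral_eval_nat_add_one_right hs, betaIntegral,
      intervalIntegral.integral_of_le zero_le_one]
    congr 2
    ext x; simp

lemma norm_kern_le {J : ℕ} {s : ℂ} (hs : 1 / 2 ≤ s.re) :
    ‖kern J s‖ ≤ J.factorial * 3 ^ (J + 1) / (|s.im| + 1) ^ (J + 1) := by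
  rw [kern, norm_div, norm_prod, norm_natCast, mul_div_assoc, ← div_pow, div_eq_mul_inv]
  gcongr
  rw [← Finset.prod_inv_distrib, ← Finset.card_range (J + 1), ← Finset.prod_const,
    Finset.card_range]
  refine Finset.prod_le_prod (fun _ _ => by positivity) fun j _ => ?_
  have h0 := abs_nonneg s.im
  rw [← inv_div]
  apply inv_anti₀ (by positivity)
  have h1 := abs_re_le_norm (s + j)
  have h2 := abs_im_le_norm (s + j)
  have h3 := le_abs_self (s + j).re
  simp only [add_re, natCast_re, add_im, natCast_im, add_zero] at h1 h2 h3
  have h4 : (0 : ℝ) ≤ j := by positivity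
  linarith

lemma add_ne_zero_of_re_pos {s : ℂ} (hs : 0 < s.re) (j : ℕ) : s + j ≠ 0 := by
  intro h
  have := congrArg re h
  simp at this
  have h4 : (0 : ℝ) ≤ j := by positivity
  linarith

lemma differentiableAt_kern {J : ℕ} {s : ℂ} (hs : 0 < s.re) : DifferentiableAt ℂ (kern J) s := by
  unfold kern
  refine DifferentiableAt.div (by fun_prop) (by fun_prop) ?_
  exact Finset.prod_ne_zero_iff.mpr fun j _ => add_ne_zero_of_re_pos hs j

lemma continuous_kern_vertical {J : ℕ} {σ : ℝ} (hσ : 0 < σ) :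
    Continuous fun t : ℝ => kern J (σ + t * I) := by
  rw [continuous_iff_continuousAt]
  intro t
  have h1 : ContinuousAt (kern J) (σ + t * I) :=
    (differentiableAt_kern (by simpa using hσ)).continuousAt
  have h2 : Continuous fun t : ℝ => (σ + t * I : ℂ) :=
    continuous_const.add (continuous_ofReal.mul continuous_const)
  exact ContinuousAt.comp (f := fun t : ℝ => (σ + t * I : ℂ)) h1 h2.continuousAt

lemma integrable_inv_abs_add_sq {c : ℝ} (hc : 0 < c) : Integrable fun t : ℝ => 1 / (|t| + c) ^ 2 := by
  have h := (integrable_inv_one_add_sq).const_mul (1 + 1 / c ^ 2)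
  refine h.mono' ?_ (Eventually.of_forall fun t => ?_)
  · refine (Continuous.div (by fun_prop) (by fun_prop) fun t => ?_).aestronglyMeasurable
    have := abs_nonneg t; positivity
  · have h0 := abs_nonneg t
    rw [Real.norm_eq_abs, abs_of_nonneg (by positivity), div_le_iff₀ (by positivity),
      mul_assoc, inv_mul_eq_div, mul_div_assoc', le_div_iff₀ (by positivity), one_mul]
    have h1 : t ^ 2 = |t| ^ 2 := (sq_abs t).symm
    have h2 : 1 ≤ 1 / c ^ 2 * (|t| + c) ^ 2 := by
      rw [div_mul_eq_mul_div, one_mul, le_div_iff₀ (by positivity)]; nlinarith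
    nlinarith

lemma integrable_kern {J : ℕ} (hJ : J ≠ 0) {σ : ℝ} (hσ : 1 / 2 ≤ σ) :
    Integrable fun t : ℝ => kern J (σ + t * I) := by
  refine ((integrable_inv_abs_add_sq one_pos).const_mul (J.factorial * 3 ^ (J + 1))).mono'
    (continuous_kern_vertical (by linarith)).aestronglyMeasurable (Eventually.of_forall fun t => ?_)
  refine (norm_kern_le (by simpa using hσ)).trans ?_
  rw [mul_one_div]
  have h0 := abs_nonneg t
  simp only [add_im, ofReal_im, mul_im, ofReal_re, I_im, mul_one, I_re, mul_zero, add_zero, zero_add]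
  exact div_le_div_of_nonneg_left (by positivity) (by positivity)
    (pow_le_pow_right₀ (by linarith) (by omega))

lemma wt_eq_integral {J : ℕ} (hJ : J ≠ 0) {σ : ℝ} (hσ : 1 / 2 ≤ σ) {x : ℝ} (hx : 0 < x) :
    (2 * Real.pi : ℂ) * wt J x = ∫ t : ℝ, (x : ℂ) ^ (-(σ + t * I : ℂ)) * kern J (σ + t * I) := by
  have hm : ∀ t : ℝ, mellin (fun x => (wt J x : ℂ)) (σ + t * I) = kern J (σ + t * I) := fun t =>
    (hasMellin_wt hJ (by simp; linarith)).2
  have hv : VerticalIntegrable (mellin fun x => (wt J x : ℂ)) σ volume := by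
    unfold VerticalIntegrable
    simp_rw [hm]; exact integrable_kern hJ hσ
  have h := mellinInv_mellin_eq σ (fun x => (wt J x : ℂ)) hx
    (hasMellin_wt hJ (s := σ) (by simp; linarith)).1 hv
    (continuous_ofReal.comp (continuous_wt J)).continuousAt
  rw [mellinInv] at h
  simp_rw [hm, smul_eq_mul] at h
  rw [← h, real_smul]
  push_cast
  rw [← mul_assoc, mul_one_div_cancel (by simp [Real.pi_ne_zero]), one_mul]

/-- Smoothed Perron formula. -/
lemma tsum_mul_wt_eq_integral {J : ℕ} (hJ : J ≠ 0) {σ : ℝ} (hσ : 1 / 2 ≤ σ) {N : ℝ} (hN : 0 < N)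
    {c : ℕ → ℂ} (hc0 : c 0 = 0) (hc : LSeriesSummable c σ) :
    (2 * Real.pi : ℂ) * ∑' n, c n * wt J (n / N) =
      ∫ t : ℝ, (N : ℂ) ^ (σ + t * I : ℂ) * kern J (σ + t * I) * LSeries c (σ + t * I) := by
  have hNc : (N : ℂ) ≠ 0 := by exact_mod_cast hN.ne'
  set F : ℕ → ℝ → ℂ := fun n t =>
    (N : ℂ) ^ (σ + t * I : ℂ) * kern J (σ + t * I) * LSeries.term c (σ + t * I) n with hF
  have hFn : ∀ n t, ‖F n t‖ = N ^ σ * ‖LSeries.term c σ n‖ * ‖kern J (σ + t * I)‖ := by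
    intro n t
    simp only [hF, norm_mul, norm_cpow_eq_rpow_re_of_pos hN]
    rw [LSeries.norm_term_eq, LSeries.norm_term_eq]
    simp only [add_re, ofReal_re, mul_re, I_re, mul_zero, ofReal_im, I_im, mul_one, sub_self, add_zero]
    ring
  have hFint : ∀ n, Integrable (F n) := by
    intro n
    have hm : Continuous (F n) := by
      refine Continuous.mul (Continuous.mul ?_ (continuous_kern_vertical (by linarith))) ?_
      · exact Continuous.const_cpow (by fun_prop) (Or.inl hNc)
      · rcases eq_or_ne n 0 with rfl | hn
        · simp only [LSeries.term_zero]; fun_prop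
        · simp only [LSeries.term_of_ne_zero hn]
          refine Continuous.div (by fun_prop) (Continuous.const_cpow (by fun_prop)
            (Or.inl (by exact_mod_cast hn))) fun t => ?_
          simp [cpow_eq_zero_iff, hn]
    refine ((integrable_kern hJ hσ).norm.const_mul (N ^ σ * ‖LSeries.term c σ n‖)).mono'
      hm.aestronglyMeasurable (Eventually.of_forall fun t => (hFn n t).le)
  have hsum : Summable fun n => ∫ t, ‖F n t‖ := by
    simp_rw [hFn, integral_const_mul]
    exact (hc.norm.mul_left _).mul_right _
  have h := hasSum_integral_of_summable_integral_norm hFint hsum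
  have h1 : ∀ n, ∫ t, F n t = (2 * Real.pi : ℂ) * (c n * wt J (n / N)) := by
    intro n
    rcases eq_or_ne n 0 with rfl | hn
    · simp [hF, hc0]
    · have hn0 : (0 : ℝ) < n := by positivity
      rw [mul_left_comm, wt_eq_integral hJ hσ (div_pos hn0 hN), ← integral_const_mul]
      congr 1; ext t
      simp only [hF, LSeries.term_of_ne_zero hn]
      rw [cpow_neg, ofReal_div, ← ofReal_natCast, div_cpow_ofReal_nonneg hn0.le hN.le]
      rw [inv_div, div_eq_mul_inv, div_eq_mul_inv]; ring
  have h2 : ∀ t, ∑' n, F n t = (N : ℂ) ^ (σ + t * I : ℂ) * kern J (σ + t * I) * LSeries c (σ + t * I) := by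
    intro t; simp only [hF]; rw [tsum_mul_left]; rfl
  simp_rw [h1, h2] at h
  rw [← tsum_mul_left, h.tsum_eq]

/-- Fourier decay from integrability of derivatives. -/
lemma norm_fourier_mul_pow_le {f : ℝ → ℂ} {j : ℕ} (hf : ContDiff ℝ j f)
    (hi : ∀ i ≤ j, Integrable (iteratedDeriv i f)) (y : ℝ) :
    ‖∫ t : ℝ, cexp (I * y * t) * f t‖ * |y| ^ j ≤ ∫ t, ‖iteratedDeriv j f t‖ := by
  have h := congrFun (Real.fourier_iteratedDeriv (N := j) (n := j) (by exact_mod_cast hf)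
    (fun i hij => hi i (by exact_mod_cast hij)) le_rfl) (-y / (2 * Real.pi))
  have e : FourierTransform.fourier f (-y / (2 * Real.pi)) = ∫ t : ℝ, cexp (I * y * t) * f t := by
    rw [Real.fourier_eq']
    congr 1; ext t
    rw [smul_eq_mul]; congr 2
    have hpi : (Real.pi : ℂ) ≠ 0 := by exact_mod_cast Real.pi_ne_zero
    simp; field_simp
  rw [e] at h
  have h2 := congrArg norm h
  rw [norm_smul, norm_pow] at h2
  have e2 : ‖(2 * Real.pi * I * ((-y / (2 * Real.pi) : ℝ) : ℂ) : ℂ)‖ = |y| := by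
    have hpi : (Real.pi : ℂ) ≠ 0 := by exact_mod_cast Real.pi_ne_zero
    rw [show (2 * Real.pi * I * ((-y / (2 * Real.pi) : ℝ) : ℂ) : ℂ) = -(I * y) by
      push_cast; field_simp, norm_neg, norm_mul, norm_I, one_mul, norm_real, Real.norm_eq_abs]
  rw [e2] at h2
  rw [mul_comm, ← h2, Real.fourier_eq]
  refine (norm_integral_le_integral_norm _).trans (le_of_eq ?_)
  congr 1; ext t; simp

end

section

open Complex MeasureTheory Set Filter Asymptotics DirichletCharacter ArithmeticFunction

lemma iteratedDeriv_vertical {G : ℂ → ℂ} {U : Set ℂ} (hU : IsOpen U) (hG : DifferentiableOn ℂ G U)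
    {b : ℂ} (hb : ∀ t : ℝ, b + t * I ∈ U) (i : ℕ) :
    iteratedDeriv i (fun t : ℝ => G (b + t * I)) = fun t : ℝ => I ^ i * iteratedDeriv i G (b + t * I) := by
  induction i with
  | zero => ext t; simp
  | succ i ih =>
    rw [iteratedDeriv_succ, ih]
    ext t
    have h1 : DifferentiableAt ℂ (iteratedDeriv i G) (b + t * I) :=
      ((hG.analyticOnNhd hU).iterated_deriv i _ (hb t) |>.differentiableAt) |> fun h => by
        rwa [← iteratedDeriv_eq_iterate] at h
    have h2 : HasDerivAt (fun t : ℝ => b + t * I) I t := by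
      simpa using ((hasDerivAt_id t).ofReal_comp.mul_const I).const_add b
    have h3 := (h1.hasDerivAt.scomp t h2).const_mul (I ^ i)
    have h4 := h3.deriv
    simp only [Function.comp_def, smul_eq_mul] at h4
    rw [h4, iteratedDeriv_succ, pow_succ]; ring

lemma contDiff_vertical {G : ℂ → ℂ} {U : Set ℂ} (hU : IsOpen U) (hG : DifferentiableOn ℂ G U)
    {b : ℂ} (hb : ∀ t : ℝ, b + t * I ∈ U) (j : ℕ) :
    ContDiff ℝ j (fun t : ℝ => G (b + t * I)) := by
  rw [contDiff_iff_contDiffAt]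
  intro t
  have h1 : ContDiffAt ℝ j G (b + t * I) :=
    (((hG.contDiffOn hU).contDiffAt (hU.mem_nhds (hb t))).restrict_scalars ℝ)
  have h2 : ContDiff ℝ j fun t : ℝ => b + t * I := by
    have : ContDiff ℝ j fun t : ℝ => (t : ℂ) := ofRealCLM.contDiff
    fun_prop
  exact ContDiffAt.comp (f := fun t : ℝ => b + t * I) t h1 h2.contDiffAt

/-- The smoothed sum `∑ Λ(n) χ(n) w(n / N)`. -/
noncomputable def psiW (J : ℕ) (N : ℝ) {r : ℕ} (χ : DirichletCharacter ℂ r) : ℂ :=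
  ∑ n ∈ Finset.Icc 1 ⌊N⌋₊, (vonMangoldt n : ℂ) * χ (n : ZMod r) * wt J (n / N)

section

variable {r : ℕ} [NeZero r] {χ : DirichletCharacter ℂ r} {l : ℝ}

lemma psiW_eq_integral {J : ℕ} (hJ : J ≠ 0) {N x : ℝ} (hN : 0 < N) (hx : 0 < x) :
    (2 * Real.pi : ℂ) * psiW J N χ = -∫ t : ℝ, (N : ℂ) ^ (1 + x + t * I : ℂ) *
      (kern J (1 + x + t * I) *
        (deriv (LFunction χ) (1 + x + t * I) / LFunction χ (1 + x + t * I))) := by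
  set c : ℕ → ℂ := (fun n : ℕ => χ (n : ZMod r)) * fun n : ℕ => (vonMangoldt n : ℂ) with hc
  have hs : ∀ t : ℝ, 1 < (1 + x + t * I : ℂ).re := fun t => by simp [hx]
  have h := tsum_mul_wt_eq_integral hJ (σ := 1 + x) (by linarith) hN (c := c) (by simp [hc])
    (LSeriesSummable_twist_vonMangoldt χ (by simp [hx]))
  have h1 : psiW J N χ = ∑' n, c n * wt J (n / N) := by
    rw [tsum_eq_sum (s := Finset.Icc 1 ⌊N⌋₊)]
    · refine Finset.sum_congr rfl fun n _ => ?_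
      simp [hc, mul_comm]
    · intro n hn
      rcases Nat.eq_zero_or_pos n with rfl | h0
      · simp [hc]
      · have : ⌊N⌋₊ < n := by
          by_contra hcon; exact hn (Finset.mem_Icc.mpr ⟨h0, not_lt.mp hcon⟩)
        rw [wt_eq_zero hJ]
        · simp
        · rw [le_div_iff₀ hN, one_mul]
          exact (Nat.lt_of_floor_lt this).le
  rw [h1, h, ← integral_neg]
  congr 1; ext t
  push_cast
  rw [LSeries_twist_vonMangoldt_eq χ (hs t), LFunction_eq_LSeries χ (hs t),
    deriv_LFunction_eq_deriv_LSeries χ (hs t)]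
  ring

theorem exists_norm_psiW_le (j : ℕ) : ∃ C : ℝ, 0 < C ∧ ∀ (r : ℕ) [NeZero r] (χ : DirichletCharacter ℂ r)
    (l N : ℝ), 0 < N → χ ≠ 1 → Squarefree r → 400 ≤ l → Real.log r ≤ l → NonExceptional χ l →
    l ^ 8 ≤ Real.log N → ‖psiW (5 * j + 6) N χ‖ ≤ C * N * l ^ (19 * (j + 1)) / Real.log N ^ j := by
  set J := 5 * j + 6 with hJ
  set A : ℝ := j.factorial * (J.factorial * 18 ^ (J + 1)) * (10 ^ 14) ^ (j + 1) with hA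
  set B : ℝ := ∫ t : ℝ, 1 / (|t| + 3) ^ 2 with hB
  have hB0 : 0 ≤ B := integral_nonneg fun t => by positivity
  refine ⟨Real.exp 1 * A * (B + 1), by positivity, fun r _ χ l N hN0 hχ hsq hl hr he hN => ?_⟩
  have hl0 : 0 < l := by linarith
  have hl8 : (1 : ℝ) ≤ l ^ 8 := one_le_pow₀ (by linarith)
  have hlog : 1 ≤ Real.log N := hl8.trans hN
  set x := 1 / Real.log N with hx
  have hx0 : 0 < x := by positivity
  have hx8 : x ≤ 1 / l ^ 8 := one_div_le_one_div_of_le (by positivity) hN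
  set G : ℂ → ℂ := fun s => kern J s * (deriv (LFunction χ) s / LFunction χ s) with hG
  set U : Set ℂ := {s | 0 < s.re} ∩ {s | LFunction χ s ≠ 0} with hU
  have hLd := differentiable_LFunction hχ
  have hUo : IsOpen U := (isOpen_lt continuous_const continuous_re).inter
    (isOpen_ne_fun hLd.continuous continuous_const)
  have hGd : DifferentiableOn ℂ G U := by
    intro s hs
    refine ((differentiableAt_kern hs.1).mul (DifferentiableAt.div ?_ (hLd s) hs.2)).differentiableWithinAt
    exact (hLd.differentiableOn (s := univ)).analyticOnNhd isOpen_univ |>.deriv s (mem_univ _) |>.differentiableAt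
  have hpt : ∀ t : ℝ, (1 + x + t * I : ℂ) = 1 + x + I * t := fun t => by ring
  have hdisc : ∀ t : ℝ, ∀ s : ℂ, ‖s - (1 + x + t * I)‖ ≤ 1 / (10 ^ 14 * l ^ 19 * (|t| + 3) ^ 5) →
      s ∈ U ∧ ‖G s‖ ≤ J.factorial * 18 ^ (J + 1) / (|t| + 3) ^ (J + 1) * (10 ^ 14 * l ^ 19 * (|t| + 3) ^ 5) := by
    intro t s hs
    have h0 := abs_nonneg t
    rw [hpt] at hs
    have h1 := norm_logDeriv_LFunction_le hχ hsq hl hr he hx0 hx8 t hs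
    have hη : 1 / (10 ^ 14 * l ^ 19 * (|t| + 3) ^ 5) ≤ 1 / 2 := by
      apply one_div_le_one_div_of_le (by norm_num)
      have a1 : (1 : ℝ) ≤ (|t| + 3) ^ 5 := one_le_pow₀ (by linarith)
      have a2 : 1 ≤ l ^ 19 := one_le_pow₀ (by linarith)
      nlinarith [mul_le_mul a2 a1 zero_le_one (by positivity)]
    have hre := (abs_re_le_norm _).trans (hs.trans hη)
    have him := (abs_im_le_norm _).trans (hs.trans hη)
    rw [sub_re, one_add_re, abs_le] at hre
    have e : (1 + x + I * t : ℂ).im = t := by simp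
    rw [sub_im, e] at him
    have h3 : 1 / 2 ≤ s.re := by linarith [hre.1]
    refine ⟨⟨by show 0 < s.re; linarith, h1.1⟩, ?_⟩
    rw [hG, norm_mul]
    refine mul_le_mul ((norm_kern_le h3).trans ?_) h1.2 (norm_nonneg _) (by positivity)
    have h4 : (|t| + 3) / 6 ≤ |s.im| + 1 := by
      have := abs_sub_abs_le_abs_sub t s.im
      rw [abs_sub_comm] at this
      linarith
    calc _ ≤ J.factorial * 3 ^ (J + 1) / ((|t| + 3) / 6) ^ (J + 1) := by gcongr
      _ = _ := by rw [div_pow, div_div_eq_mul_div, show (18 : ℝ) = 3 * 6 by norm_num, mul_pow]; ring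
  have hUt : ∀ t : ℝ, (1 + x + t * I : ℂ) ∈ U := fun t =>
    (hdisc t _ (by rw [sub_self, norm_zero]; positivity)).1
  have hbd : ∀ i ≤ j, ∀ t : ℝ, ‖iteratedDeriv i (fun t : ℝ => G (1 + x + t * I)) t‖ ≤
      A * l ^ (19 * (j + 1)) * (1 / (|t| + 3) ^ 2) := by
    intro i hij t
    have h0 := abs_nonneg t
    have hH : (1 : ℝ) ≤ 10 ^ 14 * l ^ 19 * (|t| + 3) ^ 5 := by
      have a1 : (1 : ℝ) ≤ (|t| + 3) ^ 5 := one_le_pow₀ (by linarith)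
      have a2 : 1 ≤ l ^ 19 := one_le_pow₀ (by linarith)
      nlinarith [mul_le_mul a2 a1 zero_le_one (by positivity)]
    rw [iteratedDeriv_vertical hUo hGd hUt, norm_mul, norm_pow, norm_I, one_pow, one_mul]
    have hR : 0 < 1 / (10 ^ 14 * l ^ 19 * (|t| + 3) ^ 5) := by positivity
    have h1 := norm_iteratedDeriv_le_of_forall_mem_sphere_norm_le (f := G) (c := 1 + x + t * I) i hR
      (C := J.factorial * 18 ^ (J + 1) / (|t| + 3) ^ (J + 1) * (10 ^ 14 * l ^ 19 * (|t| + 3) ^ 5))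
      (by
        refine DifferentiableOn.diffContOnCl (hGd.mono fun s hs => ?_)
        have := Metric.closure_ball_subset_closedBall hs
        exact (hdisc t s (by simpa [dist_eq_norm] using this)).1)
      (fun s hs => (hdisc t s (by rw [mem_sphere_iff_norm] at hs; exact hs.le)).2)
    refine h1.trans ?_
    rw [one_div, inv_pow, div_inv_eq_mul]
    calc _ ≤ (j.factorial : ℝ) * (J.factorial * 18 ^ (J + 1) / (|t| + 3) ^ (J + 1) *
          (10 ^ 14 * l ^ 19 * (|t| + 3) ^ 5)) * (10 ^ 14 * l ^ 19 * (|t| + 3) ^ 5) ^ j := by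
          gcongr
      _ = A * l ^ (19 * (j + 1)) * ((|t| + 3) ^ (5 * (j + 1)) / (|t| + 3) ^ (J + 1)) := by
        rw [hA]
        generalize |t| + 3 = τ
        generalize (10 : ℝ) ^ 14 = K
        rw [mul_pow, mul_pow]; ring
      _ = _ := by
        rw [hJ, show 5 * j + 6 + 1 = 5 * (j + 1) + 2 by ring, pow_add (|t| + 3)]
        field_simp
  have hcd := contDiff_vertical hUo hGd hUt
  have hne_int : ∀ i ≤ j, Integrable (iteratedDeriv i (fun t : ℝ => G (1 + x + t * I))) := by
    intro i hij
    refine ((integrable_inv_abs_add_sq (c := 3) (by norm_num)).const_mul (A * l ^ (19 * (j + 1)))).mono'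
      ?_ (Eventually.of_forall (hbd i hij))
    exact ((hcd j).continuous_iteratedDeriv i (by exact_mod_cast hij)).aestronglyMeasurable
  have hF := norm_fourier_mul_pow_le (hcd j) hne_int (Real.log N)
  have hF2 : ∫ t, ‖iteratedDeriv j (fun t : ℝ => G (1 + x + t * I)) t‖ ≤ A * l ^ (19 * (j + 1)) * B := by
    rw [hB, ← integral_const_mul]
    exact integral_mono (hne_int j le_rfl).norm
      ((integrable_inv_abs_add_sq (by norm_num)).const_mul _) (hbd j le_rfl)
  have hNx : N ^ (1 + x) = N * Real.exp 1 := by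
    rw [Real.rpow_add hN0, Real.rpow_one, Real.rpow_def_of_pos hN0, hx, mul_one_div_cancel (by linarith)]
  have hpsi := psiW_eq_integral (χ := χ) (J := J) (by omega) hN0 hx0
  have hrew : ∫ t : ℝ, (N : ℂ) ^ (1 + x + t * I : ℂ) * (kern J (1 + x + t * I) *
        (deriv (LFunction χ) (1 + x + t * I) / LFunction χ (1 + x + t * I))) =
      ((N ^ (1 + x) : ℝ) : ℂ) * ∫ t : ℝ, cexp (I * Real.log N * t) * G (1 + x + t * I) := by
    rw [← integral_const_mul]
    congr 1; ext t
    have hNc : (N : ℂ) ≠ 0 := by exact_mod_cast hN0.ne'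
    rw [cpow_add _ _ hNc, ofReal_cpow hN0.le, ← mul_assoc, ← mul_assoc, ← mul_assoc]
    congr 3
    · push_cast; rfl
    · rw [cpow_def_of_ne_zero hNc, ofReal_log hN0.le]; congr 1; ring
  rw [hrew] at hpsi
  have hn := congrArg norm hpsi
  rw [norm_mul (2 * Real.pi : ℂ), norm_neg, norm_mul ((N ^ (1 + x) : ℝ) : ℂ), norm_real, Real.norm_eq_abs,
    abs_of_pos (by positivity : 0 < N ^ (1 + x)), hNx] at hn
  have h2pi : 1 ≤ ‖(2 * Real.pi : ℂ)‖ := by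
    rw [norm_mul, norm_real, Real.norm_eq_abs, abs_of_pos Real.pi_pos]
    simp; linarith [Real.pi_gt_three]
  rw [abs_of_pos (by linarith)] at hF
  rw [le_div_iff₀ (by positivity)]
  set Z := ‖∫ t : ℝ, cexp (I * Real.log N * t) * G (1 + x + t * I)‖ with hZ
  calc ‖psiW J N χ‖ * Real.log N ^ j ≤ (‖(2 * Real.pi : ℂ)‖ * ‖psiW J N χ‖) * Real.log N ^ j := by
        gcongr; exact le_mul_of_one_le_left (norm_nonneg _) h2pi
    _ = N * Real.exp 1 * (Z * Real.log N ^ j) := by rw [hn]; ring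
    _ ≤ N * Real.exp 1 * (A * l ^ (19 * (j + 1)) * B) := mul_le_mul_of_nonneg_left (hF.trans hF2) (by positivity)
    _ ≤ N * Real.exp 1 * (A * l ^ (19 * (j + 1)) * (B + 1)) := by gcongr; linarith
    _ = _ := by ring

end

lemma apply_trichotomy {r : ℕ} {χ : DirichletCharacter ℂ r} (h : χ ^ 2 = 1) (a : ZMod r) :
    χ a = 0 ∨ χ a = 1 ∨ χ a = -1 := by
  by_cases ha : IsUnit a
  · right
    rw [← sq_eq_one_iff]
    have := congrArg (fun ψ : DirichletCharacter ℂ r => ψ a) h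
    simpa [MulChar.pow_apply' χ two_ne_zero, MulChar.one_apply ha] using this
  · left; exact χ.map_nonunit ha

lemma norm_quad_le_one {u : ℝ} (h0 : 0 < u) (h1 : u < 1) {v₁ v₂ : ℂ} (hv₁ : v₁ = 0 ∨ v₁ = 1 ∨ v₁ = -1)
    (hv₂ : v₂ = 0 ∨ v₂ = 1 ∨ v₂ = -1) :
    ‖(1 - (u : ℂ)) * (1 - v₁ * u) * (1 - v₂ * u) * (1 - v₁ * v₂ * u)‖ ≤ 1 := by
  have a1 : (1 - u) ≤ 1 := by linarith
  have a0 : 0 ≤ 1 - u := by linarith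
  have b0 : 0 ≤ 1 - u ^ 2 := by nlinarith
  have b1 : 1 - u ^ 2 ≤ 1 := by nlinarith
  have key : ∀ w : ℝ, 0 ≤ w → w ≤ 1 → ‖(w : ℂ)‖ ≤ 1 := fun w hw hw1 => by
    rw [norm_real, Real.norm_eq_abs, abs_of_nonneg hw]; exact hw1
  rcases hv₁ with rfl | rfl | rfl <;> rcases hv₂ with rfl | rfl | rfl
  · convert key (1 - u) a0 a1 using 2; push_cast; ring
  · convert key ((1 - u) ^ 2) (by positivity) (pow_le_one₀ a0 a1) using 2; push_cast; ring
  · convert key (1 - u ^ 2) b0 b1 using 2; push_cast; ring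
  · convert key ((1 - u) ^ 2) (by positivity) (pow_le_one₀ a0 a1) using 2; push_cast; ring
  · convert key ((1 - u) ^ 4) (by positivity) (pow_le_one₀ a0 a1) using 2; push_cast; ring
  · convert key ((1 - u ^ 2) ^ 2) (by positivity) (pow_le_one₀ b0 b1) using 2; push_cast; ring
  · convert key (1 - u ^ 2) b0 b1 using 2; push_cast; ring
  · convert key ((1 - u ^ 2) ^ 2) (by positivity) (pow_le_one₀ b0 b1) using 2; push_cast; ring
  · convert key ((1 - u ^ 2) ^ 2) (by positivity) (pow_le_one₀ b0 b1) using 2; push_cast; ring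

section

variable {r₁ r₂ : ℕ} [NeZero r₁] [NeZero r₂] (χ₁ : DirichletCharacter ℂ r₁) (χ₂ : DirichletCharacter ℂ r₂)

/-- The product of two characters, at the product of their levels. -/
noncomputable def charMul : DirichletCharacter ℂ (r₁ * r₂) :=
  changeLevel (dvd_mul_right r₁ r₂) χ₁ * changeLevel (dvd_mul_left r₂ r₁) χ₂

lemma charMul_apply (n : ℕ) : charMul χ₁ χ₂ (n : ZMod (r₁ * r₂)) = χ₁ (n : ZMod r₁) * χ₂ (n : ZMod r₂) := by
  by_cases h : n.Coprime (r₁ * r₂)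
  · have hc : IsCoprime ((n : ℕ) : ℤ) ((r₁ * r₂ : ℕ) : ℤ) := Nat.isCoprime_iff_coprime.mpr h
    have e1 := changeLevel_eq_cast_of_dvd' χ₁ (dvd_mul_right r₁ r₂) hc
    have e2 := changeLevel_eq_cast_of_dvd' χ₂ (dvd_mul_left r₂ r₁) hc
    simp only [Int.cast_natCast] at e1 e2
    rw [charMul, MulChar.mul_apply, e1, e2]
  · have h1 : charMul χ₁ χ₂ (n : ZMod (r₁ * r₂)) = 0 :=
      MulChar.map_nonunit _ (by rwa [ZMod.isUnit_iff_coprime])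
    rw [h1, eq_comm, mul_eq_zero]
    rw [Nat.coprime_mul_iff_right, not_and_or] at h
    rcases h with h | h
    · left; exact MulChar.map_nonunit _ (by rwa [ZMod.isUnit_iff_coprime])
    · right; exact MulChar.map_nonunit _ (by rwa [ZMod.isUnit_iff_coprime])

lemma charMul_ne_one (h₁ : χ₁.IsPrimitive) (h₂ : χ₂.IsPrimitive) (h : r₁ ≠ r₂) : charMul χ₁ χ₂ ≠ 1 := by
  intro h1
  have h2 : changeLevel (dvd_mul_left r₂ r₁) χ₂ = (changeLevel (dvd_mul_right r₁ r₂) χ₁)⁻¹ :=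
    eq_inv_of_mul_eq_one_right h1
  have h3 := congrArg conductor h2
  rw [conductor_inv, conductor_changeLevel, conductor_changeLevel] at h3
  exact h (h₁.symm.trans (h3.symm.trans h₂))

lemma one_le_norm_LFunction_mul (hχ₁ : χ₁ ^ 2 = 1) (hχ₂ : χ₂ ^ 2 = 1) {x : ℝ} (hx : 0 < x) :
    1 ≤ ‖riemannZeta (1 + x)‖ * ‖LFunction χ₁ (1 + x)‖ * ‖LFunction χ₂ (1 + x)‖ *
      ‖LFunction (charMul χ₁ χ₂) (1 + x)‖ := by
  have hs : 1 < (1 + x : ℂ).re := by simp [hx]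
  have H := (((riemannZeta_eulerProduct_hasProd hs).mul (LSeries_eulerProduct_hasProd χ₁ hs)).mul
    (LSeries_eulerProduct_hasProd χ₂ hs)).mul (LSeries_eulerProduct_hasProd (charMul χ₁ χ₂) hs)
  rw [← LFunction_eq_LSeries _ hs, ← LFunction_eq_LSeries _ hs, ← LFunction_eq_LSeries _ hs] at H
  rw [← norm_mul, ← norm_mul, ← norm_mul]
  have H2 := (continuous_norm.tendsto _).comp H
  refine ge_of_tendsto' H2 fun S => ?_
  simp only [Function.comp_apply, norm_prod]
  refine Finset.prod_induction _ (fun y : ℝ => 1 ≤ y) (fun a b ha hb => one_le_mul_of_one_le_of_one_le ha hb)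
    le_rfl fun p _ => ?_
  have hp := p.2
  have hp1 : (1 : ℝ) < (p : ℕ) := by exact_mod_cast hp.one_lt
  set u : ℝ := ((p : ℕ) : ℝ) ^ (-(1 + x)) with hu
  have hu0 : 0 < u := by positivity
  have hu1 : u < 1 := Real.rpow_lt_one_of_one_lt_of_neg hp1 (by linarith)
  have hcast : (((p : ℕ) : ℂ) ^ (-(1 + x) : ℂ)) = (u : ℂ) := by
    rw [hu, ofReal_cpow (by positivity)]; push_cast; rfl
  have hq := norm_quad_le_one hu0 hu1 (apply_trichotomy hχ₁ (p : ℕ)) (apply_trichotomy hχ₂ (p : ℕ))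
  rw [charMul_apply, hcast, ← mul_inv, ← mul_inv, ← mul_inv, norm_inv]
  refine one_le_inv_iff₀.mpr ⟨?_, hq⟩
  rw [norm_pos_iff]
  have hne : ∀ v : ℂ, (v = 0 ∨ v = 1 ∨ v = -1) → 1 - v * u ≠ 0 := by
    intro v hv h
    have h2 : v * u = 1 := (sub_eq_zero.mp h).symm
    have h3 := congrArg norm h2
    rw [norm_mul, norm_real, Real.norm_eq_abs, abs_of_pos hu0, norm_one] at h3
    rcases hv with rfl | rfl | rfl <;> simp at h3 <;> linarith
  have t1 := apply_trichotomy hχ₁ (p : ℕ)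
  have t2 := apply_trichotomy hχ₂ (p : ℕ)
  refine mul_ne_zero (mul_ne_zero (mul_ne_zero ?_ (hne _ t1)) (hne _ t2)) (hne _ ?_)
  · simpa using hne 1 (by simp)
  · rcases t1 with h | h | h <;> rcases t2 with h' | h' | h' <;> simp [h, h']

lemma nonExceptional_or (h₁ : χ₁.IsPrimitive) (h₂ : χ₂.IsPrimitive) (h : r₁ ≠ r₂) {l : ℝ} (hl : 400 ≤ l)
    (hr₁ : Real.log r₁ ≤ l) (hr₂ : Real.log r₂ ≤ l) : NonExceptional χ₁ l ∨ NonExceptional χ₂ l := by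
  by_contra hcon
  simp only [NonExceptional, not_or, Classical.not_imp, not_le] at hcon
  obtain ⟨⟨q1, e1⟩, ⟨q2, e2⟩⟩ := hcon
  have hl0 : 0 < l := by linarith
  set x : ℝ := 1 / l ^ 8 with hx
  have hx0 : 0 < x := by positivity
  have hx1 : x ≤ 1 := by
    rw [hx, div_le_one (by positivity)]; exact one_le_pow₀ (by linarith)
  have h0 := one_le_norm_LFunction_mul χ₁ χ₂ q1 q2 hx0
  have hn : ‖(1 + x : ℂ)‖ ≤ 2 := by
    have := norm_one_add_le hx0 hx1 0
    simpa using this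
  have hz : ‖riemannZeta (1 + x)‖ ≤ 4 * l ^ 8 := by
    refine (norm_riemannZeta_le (by simp [hx0])).trans ?_
    have e2 : ‖(1 + x : ℂ) - 1‖ = x := by simp [abs_of_pos hx0]
    rw [e2]
    calc _ ≤ 2 / x + 2 := by gcongr
      _ ≤ 2 / x + 2 / x := by gcongr; rw [le_div_iff₀ hx0]; linarith
      _ = _ := by rw [hx]; field_simp; norm_num
  have hL : ‖LFunction (charMul χ₁ χ₂) (1 + x)‖ ≤ 24 * l := by
    have : NeZero (r₁ * r₂) := ⟨mul_ne_zero (NeZero.ne _) (NeZero.ne _)⟩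
    refine (norm_LFunction_le (l := 2 * l) (charMul_ne_one χ₁ χ₂ h₁ h₂ h) (by linarith) ?_ ?_).trans ?_
    · push_cast
      rw [Real.log_mul (by exact_mod_cast NeZero.ne r₁) (by exact_mod_cast NeZero.ne r₂)]; linarith
    · rw [add_re, one_re, ofReal_re]
      have : 0 < 1 / (2 * (2 * l)) := by positivity
      linarith
    · calc _ ≤ 6 * (2 * l) * 2 := by gcongr
        _ = _ := by ring
  have : ‖riemannZeta (1 + x)‖ * ‖LFunction χ₁ (1 + x)‖ * ‖LFunction χ₂ (1 + x)‖ *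
      ‖LFunction (charMul χ₁ χ₂) (1 + x)‖ ≤ 4 * l ^ 8 * (2 / l ^ 5) * (2 / l ^ 5) * (24 * l) := by
    gcongr
  have e : 4 * l ^ 8 * (2 / l ^ 5) * (2 / l ^ 5) * (24 * l) = 384 / l := by field_simp; norm_num
  rw [e] at this
  have h4 : 384 / l < 1 := by rw [div_lt_one hl0]; linarith
  linarith

end

lemma eventually_nonExceptional (P : ℕ) : ∀ᶠ l : ℝ in atTop, ∀ r ∈ Finset.Icc 1 P,
    ∀ χ : DirichletCharacter ℂ r, χ ≠ 1 → ∀ [NeZero r], NonExceptional χ l := by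
  rw [Filter.eventually_all_finset]
  intro r hr
  have : NeZero r := ⟨by have := (Finset.mem_Icc.mp hr).1; omega⟩
  rw [Filter.eventually_all]
  intro χ
  by_cases hχ : χ = 1
  · exact Eventually.of_forall fun l h => absurd hχ h
  have h1 : Tendsto (fun l : ℝ => ‖LFunction χ (1 + ((1 / l ^ 8 : ℝ) : ℂ))‖) atTop (nhds ‖LFunction χ 1‖) := by
    refine (continuous_norm.tendsto _).comp ?_
    refine ((differentiable_LFunction hχ).continuous.tendsto _).comp ?_
    have h2 : Tendsto (fun l : ℝ => (1 / l ^ 8 : ℝ)) atTop (nhds 0) := by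
      simpa [Function.comp_def] using tendsto_inv_atTop_zero.comp (tendsto_pow_atTop (α := ℝ) (n := 8) (by norm_num))
    have h3 := (continuous_ofReal.tendsto _).comp h2
    simpa using h3.const_add (1 : ℂ)
  have h2 : Tendsto (fun l : ℝ => 2 / l ^ 5) atTop (nhds 0) := by
    have := (tendsto_inv_atTop_zero.comp (tendsto_pow_atTop (α := ℝ) (n := 5) (by norm_num))).const_mul 2
    simpa [div_eq_mul_inv, Function.comp_def] using this
  have hpos : 0 < ‖LFunction χ 1‖ := norm_pos_iff.mpr (LFunction_apply_one_ne_zero hχ)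
  filter_upwards [h2.eventually_lt h1 hpos] with l hl
  intro _ _ _
  exact hl.le

/-- All primitive characters of small squarefree conductor are non-exceptional, provided the conductor
avoids the multiples of a suitable prime. -/
theorem exists_exceptional_prime (D : ℕ) : ∃ l₀ : ℝ, 400 ≤ l₀ ∧ ∀ l ≥ l₀, ∃ p : ℕ, p.Prime ∧ D < p ∧
    ∀ (r : ℕ) [NeZero r] (χ : DirichletCharacter ℂ r), χ ≠ 1 → χ.IsPrimitive → Squarefree r →
      Real.log r ≤ l → ¬ p ∣ r → NonExceptional χ l := by
  obtain ⟨l₁, h₁⟩ := Filter.eventually_atTop.mp (eventually_nonExceptional (primorial D))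
  refine ⟨max l₁ 400, le_max_right _ _, fun l hl => ?_⟩
  have hl1 : l₁ ≤ l := (le_max_left _ _).trans hl
  have hl4 : 400 ≤ l := (le_max_right _ _).trans hl
  by_cases hex : ∃ (r : ℕ) (_ : NeZero r) (χ : DirichletCharacter ℂ r), χ ≠ 1 ∧ χ.IsPrimitive ∧ Squarefree r ∧
      Real.log r ≤ l ∧ ¬ NonExceptional χ l
  · obtain ⟨r, _, χ, hχ, hprim, hsq, hrl, hbad⟩ := hex
    have hr : ¬ r ∣ primorial D := by
      intro hdvd
      refine hbad (h₁ l hl1 r (Finset.mem_Icc.mpr ⟨NeZero.pos r, Nat.le_of_dvd (primorial_pos D) hdvd⟩) χ hχ)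
    have : ∃ p ∈ r.primeFactors, D < p := by
      by_contra hcon
      push Not at hcon
      apply hr
      rw [← Nat.prod_primeFactors_of_squarefree hsq]
      refine Finset.prod_dvd_prod_of_subset _ _ _ fun p hp => ?_
      have := Nat.prime_of_mem_primeFactors hp
      simp [this, Nat.lt_succ_of_le (hcon p hp)]
    obtain ⟨p, hp, hDp⟩ := this
    refine ⟨p, Nat.prime_of_mem_primeFactors hp, hDp, fun r' _ χ' hχ' hprim' hsq' hrl' hpr' => ?_⟩
    have hne : r ≠ r' := by
      rintro rfl; exact hpr' (Nat.dvd_of_mem_primeFactors hp)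
    exact (nonExceptional_or χ χ' hprim hprim' hne hl4 hrl hrl').resolve_left hbad
  · obtain ⟨p, hp1, hp2⟩ := Nat.exists_infinite_primes (D + 1)
    refine ⟨p, hp2, hp1, fun r _ χ hχ hprim hsq hrl _ => ?_⟩
    by_contra hbad
    exact hex ⟨r, inferInstance, χ, hχ, hprim, hsq, hrl, hbad⟩

end

section

open Complex MeasureTheory Finset Filter Asymptotics DirichletCharacter ArithmeticFunction
open scoped ComplexConjugate

noncomputable instance decidableIsPrimitive {r : ℕ} (χ : DirichletCharacter ℂ r) : Decidable χ.IsPrimitive :=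
  inferInstanceAs (Decidable (conductor χ = r))

/-- Duality for the large sieve: a bound for the row sums of the Gram matrix bounds the operator norm. -/
lemma sum_norm_sq_le_of_gram {ι κ : Type*} (s : Finset ι) (t : Finset κ) (c : ι → κ → ℂ) (a : κ → ℂ) {Δ : ℝ} (hΔ : 0 ≤ Δ)
    (h : ∀ x ∈ s, ∑ y ∈ s, ‖∑ i ∈ t, c x i * conj (c y i)‖ ≤ Δ) :
    ∑ x ∈ s, ‖∑ i ∈ t, a i * c x i‖ ^ 2 ≤ Δ * ∑ i ∈ t, ‖a i‖ ^ 2 := by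
  classical
  set b : ι → ℂ := fun x => ∑ i ∈ t, a i * c x i with hb
  set B := ∑ x ∈ s, ‖b x‖ ^ 2 with hB
  set w : κ → ℂ := fun i => ∑ x ∈ s, conj (b x) * c x i with hw
  have h1 : (B : ℂ) = ∑ i ∈ t, a i * w i := by
    simp only [hw, mul_sum]
    rw [sum_comm, hB]
    push_cast
    refine sum_congr rfl fun x _ => ?_
    rw [← Complex.conj_mul', hb]
    simp only [mul_sum]
    exact sum_congr rfl fun i _ => by ring
  have hW : ∑ i ∈ t, ‖w i‖ ^ 2 ≤ Δ * B := by
    have e : ((∑ i ∈ t, ‖w i‖ ^ 2 : ℝ) : ℂ) =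
        ∑ x ∈ s, ∑ y ∈ s, conj (b x) * b y * ∑ i ∈ t, c x i * conj (c y i) := by
      push_cast
      simp only [mul_sum]
      calc _ = ∑ i ∈ t, ∑ x ∈ s, ∑ y ∈ s, conj (b x) * b y * (c x i * conj (c y i)) := by
            refine sum_congr rfl fun i _ => ?_
            rw [← Complex.mul_conj', hw]
            simp only [map_sum, sum_mul_sum, map_mul, Complex.conj_conj]
            exact sum_congr rfl fun x _ => sum_congr rfl fun y _ => by ring
        _ = _ := by
            rw [sum_comm]
            exact sum_congr rfl fun x _ => sum_comm
    have hsymm : ∀ x y, ‖∑ i ∈ t, c x i * conj (c y i)‖ = ‖∑ i ∈ t, c y i * conj (c x i)‖ := by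
      intro x y
      rw [← Complex.norm_conj]
      simp only [map_sum, map_mul, Complex.conj_conj]
      congr 1
      exact sum_congr rfl fun i _ => by ring
    calc ∑ i ∈ t, ‖w i‖ ^ 2 = ‖((∑ i ∈ t, ‖w i‖ ^ 2 : ℝ) : ℂ)‖ := by
          rw [norm_real, Real.norm_of_nonneg (sum_nonneg fun _ _ => by positivity)]
      _ ≤ ∑ x ∈ s, ∑ y ∈ s, ‖b x‖ * ‖b y‖ * ‖∑ i ∈ t, c x i * conj (c y i)‖ := by
          rw [e]
          refine (norm_sum_le _ _).trans (sum_le_sum fun x _ => (norm_sum_le _ _).trans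
            (sum_le_sum fun y _ => ?_))
          rw [norm_mul, norm_mul, Complex.norm_conj]
      _ ≤ ∑ x ∈ s, ∑ y ∈ s, (‖b x‖ ^ 2 / 2 * ‖∑ i ∈ t, c x i * conj (c y i)‖ +
            ‖b y‖ ^ 2 / 2 * ‖∑ i ∈ t, c y i * conj (c x i)‖) := by
          refine sum_le_sum fun x _ => sum_le_sum fun y _ => ?_
          rw [hsymm y x, ← add_mul]
          exact mul_le_mul_of_nonneg_right (by nlinarith [sq_nonneg (‖b x‖ - ‖b y‖)]) (norm_nonneg _)
      _ = ∑ x ∈ s, ‖b x‖ ^ 2 * ∑ y ∈ s, ‖∑ i ∈ t, c x i * conj (c y i)‖ := by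
          simp only [sum_add_distrib]
          rw [sum_comm (f := fun x y => ‖b y‖ ^ 2 / 2 * ‖∑ i ∈ t, c y i * conj (c x i)‖),
            ← sum_add_distrib]
          refine sum_congr rfl fun x _ => ?_
          rw [← mul_sum]; ring
      _ ≤ ∑ x ∈ s, ‖b x‖ ^ 2 * Δ := sum_le_sum fun x hx => by
          exact mul_le_mul_of_nonneg_left (h x hx) (by positivity)
      _ = Δ * B := by rw [← sum_mul]; ring
  have hB0 : 0 ≤ B := sum_nonneg fun _ _ => by positivity
  have h2 : B ≤ ∑ i ∈ t, ‖a i‖ * ‖w i‖ := by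
    calc B = ‖(B : ℂ)‖ := by rw [norm_real, Real.norm_of_nonneg hB0]
      _ ≤ _ := by
        rw [h1]; exact (norm_sum_le _ _).trans (sum_le_sum fun i _ => (norm_mul _ _).le)
  have h3 : B ^ 2 ≤ (∑ i ∈ t, ‖a i‖ ^ 2) * (Δ * B) :=
    (pow_le_pow_left₀ hB0 h2 2).trans ((sum_mul_sq_le_sq_mul_sq _ _ _).trans
      (mul_le_mul_of_nonneg_left hW (sum_nonneg fun _ _ => by positivity)))
  rcases hB0.eq_or_lt with h0 | h0
  · rw [← h0]; exact mul_nonneg hΔ (sum_nonneg fun _ _ => by positivity)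
  · nlinarith

/-- The exponential `exp (2 π i x)`. -/
noncomputable def ee (x : ℝ) : ℂ := cexp (I * (2 * Real.pi * x : ℝ))

lemma norm_ee (x : ℝ) : ‖ee x‖ = 1 := by
  rw [ee, mul_comm, norm_exp_ofReal_mul_I]

lemma ee_add (x y : ℝ) : ee (x + y) = ee x * ee y := by
  rw [ee, ee, ee, ← Complex.exp_add]; congr 1; push_cast; ring

lemma ee_int (m : ℤ) : ee m = 1 := by
  rw [ee, Complex.exp_eq_one_iff]; exact ⟨m, by push_cast; ring⟩

lemma ee_nat_mul (n : ℕ) (x : ℝ) : ee (n * x) = ee x ^ n := by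
  rw [ee, ee, ← Complex.exp_nat_mul]; congr 1; push_cast; ring

lemma conj_ee (x : ℝ) : conj (ee x) = ee (-x) := by
  rw [ee, ee, ← Complex.exp_conj, map_mul, conj_I, conj_ofReal]; congr 1; push_cast; ring

lemma norm_ee_sub_one_ge {t : ℝ} (h0 : 0 < t) (h1 : t < 1) :
    4 * (t * (1 - t)) ≤ ‖ee t - 1‖ := by
  have hsin : ∀ u : ℝ, 0 < u → u ≤ 1 / 2 → 4 * (u * (1 - u)) ≤ 2 * Real.sin (Real.pi * u) := by
    intro u hu hu2
    have := Real.mul_le_sin (x := Real.pi * u) (by positivity) (by nlinarith [Real.pi_pos])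
    have e : 2 / Real.pi * (Real.pi * u) = 2 * u := by field_simp
    rw [e] at this
    nlinarith
  have hn : ‖ee t - 1‖ = 2 * Real.sin (Real.pi * t) := by
    rw [ee, Complex.norm_exp_I_mul_ofReal_sub_one, Real.norm_eq_abs, show 2 * Real.pi * t / 2 = Real.pi * t by ring,
      abs_of_nonneg]
    have := Real.sin_nonneg_of_nonneg_of_le_pi (x := Real.pi * t) (by positivity) (by nlinarith [Real.pi_pos])
    positivity
  rw [hn]
  rcases le_total t (1 / 2) with h | h
  · exact hsin t h0 h
  · have := hsin (1 - t) (by linarith) (by linarith)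
    rw [show Real.pi * (1 - t) = Real.pi - Real.pi * t by ring, Real.sin_pi_sub] at this
    linarith

lemma norm_sum_ee_le (n : ℕ) {t : ℝ} (h0 : 0 < t) (h1 : t < 1) :
    ‖∑ i ∈ range n, ee (i * t)‖ ≤ 1 / (2 * t) + 1 / (2 * (1 - t)) := by
  have h2 := norm_ee_sub_one_ge h0 h1
  have h3 : 0 < t * (1 - t) := mul_pos h0 (by linarith)
  have h4 : ee t ≠ 1 := by
    intro h; rw [h] at h2; simp at h2; linarith
  simp only [ee_nat_mul]
  rw [geom_sum_eq h4, norm_div]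
  have h5 : ‖ee t ^ n - 1‖ ≤ 2 := by
    refine (norm_sub_le _ _).trans ?_
    rw [norm_pow, norm_ee]; norm_num
  have h6 : 1 / (2 * t) + 1 / (2 * (1 - t)) = 2 / (4 * (t * (1 - t))) := by
    have : 1 - t ≠ 0 := by linarith
    field_simp; ring
  rw [h6]
  gcongr

/-- Well-spaced points have a logarithmic sum of reciprocals. -/
lemma sum_inv_le_of_spaced {ι : Type*} (s : Finset ι) (t : ι → ℝ) {L : ℕ} (hL : 0 < L)
    (h0 : ∀ x ∈ s, 1 / (L : ℝ) ≤ t x) (h1 : ∀ x ∈ s, t x ≤ 1)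
    (hsp : ∀ x ∈ s, ∀ y ∈ s, x ≠ y → 1 / (L : ℝ) ≤ |t x - t y|) :
    ∑ x ∈ s, 1 / t x ≤ L * (1 + Real.log L) := by
  have hLr : (0 : ℝ) < L := by exact_mod_cast hL
  have hmem : ∀ x ∈ s, ⌊t x * L⌋₊ ∈ Icc 1 L := by
    intro x hx
    rw [mem_Icc]
    constructor
    · apply Nat.le_floor
      have := h0 x hx
      rw [div_le_iff₀ hLr] at this
      simpa using this
    · apply Nat.floor_le_of_le
      nlinarith [h1 x hx]
  have hpos : ∀ x ∈ s, 0 < t x := fun x hx => lt_of_lt_of_le (by positivity) (h0 x hx)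
  have hinj : Set.InjOn (fun x => ⌊t x * L⌋₊) s := by
    intro x hx y hy hxy
    by_contra hne
    have h := hsp x hx y hy hne
    have hxy' : ⌊t x * L⌋₊ = ⌊t y * L⌋₊ := hxy
    have a1 := Nat.floor_le (mul_nonneg (hpos x hx).le hLr.le)
    have a2 := Nat.lt_floor_add_one (t x * L)
    have a3 := Nat.floor_le (mul_nonneg (hpos y hy).le hLr.le)
    have a4 := Nat.lt_floor_add_one (t y * L)
    rw [hxy'] at a1 a2
    rw [div_le_iff₀ hLr] at h
    have : |t x - t y| * L < 1 := by
      rw [← abs_of_pos hLr, ← abs_mul, abs_lt]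
      constructor <;> linarith
    linarith
  calc ∑ x ∈ s, 1 / t x ≤ ∑ x ∈ s, L * (1 / (⌊t x * L⌋₊ : ℝ)) := by
        refine sum_le_sum fun x hx => ?_
        have a1 := Nat.floor_le (mul_nonneg (hpos x hx).le hLr.le)
        have a0 : (0 : ℝ) < ⌊t x * L⌋₊ := by exact_mod_cast (mem_Icc.mp (hmem x hx)).1
        have := hpos x hx
        rw [mul_one_div, div_le_div_iff₀ this a0]
        linarith
    _ = ∑ j ∈ s.image (fun x => ⌊t x * L⌋₊), L * (1 / (j : ℝ)) := by
        rw [sum_image hinj]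
    _ ≤ ∑ j ∈ Icc 1 L, L * (1 / (j : ℝ)) := by
        refine sum_le_sum_of_subset_of_nonneg ?_ fun _ _ _ => by positivity
        intro j hj
        obtain ⟨x, hx, rfl⟩ := mem_image.mp hj
        exact hmem x hx
    _ ≤ _ := by
        rw [← mul_sum]
        refine mul_le_mul_of_nonneg_left ?_ hLr.le
        have := harmonic_le_one_add_log L
        rw [harmonic_eq_sum_Icc] at this
        push_cast at this
        simpa using this

/-- Reduced fractions in `[0, 1)` with denominator at most `R`, as pairs (denominator, numerator). -/
def farey (R : ℕ) : Finset (ℕ × ℕ) :=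
  (Icc 1 R ×ˢ range R).filter fun x => x.2 < x.1 ∧ x.2.Coprime x.1

lemma farey_spacing {R : ℕ} {x y : ℕ × ℕ} (hx : x ∈ farey R) (hy : y ∈ farey R) (hne : x ≠ y) (m : ℤ) :
    1 / ((R ^ 2 : ℕ) : ℝ) ≤ |(x.2 / x.1 - y.2 / y.1 - m : ℝ)| := by
  obtain ⟨r, b⟩ := x
  obtain ⟨r', b'⟩ := y
  simp only [farey, mem_filter, mem_product, mem_Icc, mem_range] at hx hy
  obtain ⟨⟨⟨hr, hrR⟩, -⟩, hb, hc⟩ := hx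
  obtain ⟨⟨⟨hr', hrR'⟩, -⟩, hb', hc'⟩ := hy
  have hne_int : (b * r' - b' * r - m * r * r' : ℤ) ≠ 0 := by
    intro h
    have d1 : r' ∣ r := by
      have : (r' : ℤ) ∣ b' * r := ⟨b - m * r, by linarith⟩
      exact hc'.symm.dvd_of_dvd_mul_left (by exact_mod_cast this)
    have d2 : r ∣ r' := by
      have : (r : ℤ) ∣ b * r' := ⟨b' + m * r', by linarith⟩
      exact hc.symm.dvd_of_dvd_mul_left (by exact_mod_cast this)
    have hrr : r = r' := Nat.dvd_antisymm d2 d1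
    subst hrr
    have h2 : (b : ℤ) - b' - m * r = 0 := by
      have : ((b : ℤ) - b' - m * r) * r = 0 := by linarith
      rcases mul_eq_zero.mp this with h | h
      · exact h
      · omega
    have hm : m = 0 := by
      by_contra hm
      rcases lt_or_gt_of_ne hm with h | h
      · nlinarith
      · nlinarith
    rw [hm] at h2
    apply hne
    have : b = b' := by omega
    rw [this]
  have h1 : (1 : ℝ) ≤ |((b * r' - b' * r - m * r * r' : ℤ) : ℝ)| := by
    exact_mod_cast Int.one_le_abs hne_int
  have hr0 : (0 : ℝ) < r := by exact_mod_cast hr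
  have hr0' : (0 : ℝ) < r' := by exact_mod_cast hr'
  have e : (b / r - b' / r' - m : ℝ) = ((b * r' - b' * r - m * r * r' : ℤ) : ℝ) / (r * r') := by
    push_cast; field_simp
  simp only
  rw [e, abs_div, abs_of_pos (mul_pos hr0 hr0')]
  have hle : (r * r' : ℝ) ≤ ((R ^ 2 : ℕ) : ℝ) := by
    push_cast; rw [sq]
    exact_mod_cast Nat.mul_le_mul hrR hrR'
  gcongr

/-- The additive large sieve inequality, up to a logarithm. -/
theorem additive_large_sieve (R N : ℕ) (a : ℕ → ℂ) :
    ∑ x ∈ farey R, ‖∑ n ∈ range N, a n * ee (n * (x.2 / x.1 : ℝ))‖ ^ 2 ≤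
      (N + R ^ 2 * (1 + 2 * Real.log R)) * ∑ n ∈ range N, ‖a n‖ ^ 2 := by
  classical
  refine sum_norm_sq_le_of_gram _ _ (fun (x : ℕ × ℕ) (n : ℕ) => ee (n * (x.2 / x.1 : ℝ))) a (by
    have := Real.log_natCast_nonneg R; positivity) fun x hx => ?_
  have hR : 0 < R := by
    simp only [farey, mem_filter, mem_product, mem_Icc] at hx; omega
  set v : ℕ × ℕ → ℝ := fun y => x.2 / x.1 - y.2 / y.1 with hv
  set t : ℕ × ℕ → ℝ := fun y => Int.fract (v y) with ht
  have hker : ∀ y, ∑ n ∈ range N, ee (n * (x.2 / x.1 : ℝ)) * conj (ee (n * (y.2 / y.1 : ℝ))) =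
      ∑ n ∈ range N, ee (n * t y) := by
    intro y
    refine sum_congr rfl fun n _ => ?_
    rw [conj_ee, ← ee_add]
    have : (n * (x.2 / x.1 : ℝ) + -(n * (y.2 / y.1 : ℝ))) = n * t y + ((n * ⌊v y⌋ : ℤ) : ℝ) := by
      have := Int.fract_add_floor (v y)
      rw [ht]; push_cast
      linear_combination (-(n : ℝ)) * this
    rw [this, ee_add, ee_int, mul_one]
  simp only [hker]
  rw [← add_sum_erase _ _ hx]
  have hL : 0 < R ^ 2 := by positivity
  have hLr : (0 : ℝ) < 1 / ((R ^ 2 : ℕ) : ℝ) := by positivity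
  have hts : ∀ y ∈ (farey R).erase x, 1 / ((R ^ 2 : ℕ) : ℝ) ≤ t y ∧ 1 / ((R ^ 2 : ℕ) : ℝ) ≤ 1 - t y := by
    intro y hy
    have hy' := mem_erase.mp hy
    have e : t y = v y - ⌊v y⌋ := rfl
    have h0 := Int.fract_nonneg (v y)
    have h1 := Int.fract_lt_one (v y)
    constructor
    · have := farey_spacing hx hy'.2 hy'.1.symm ⌊v y⌋
      rwa [show (x.2 / x.1 - y.2 / y.1 - ⌊v y⌋ : ℝ) = t y from rfl, abs_of_nonneg h0] at this
    · have := farey_spacing hx hy'.2 hy'.1.symm (⌊v y⌋ + 1)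
      rwa [show (x.2 / x.1 - y.2 / y.1 - ((⌊v y⌋ + 1 : ℤ) : ℝ) : ℝ) = -(1 - t y) by
        push_cast; rw [e]; simp only [hv]; ring, abs_neg, abs_of_nonneg (by linarith)] at this
  have hsp : ∀ y ∈ (farey R).erase x, ∀ z ∈ (farey R).erase x, y ≠ z →
      1 / ((R ^ 2 : ℕ) : ℝ) ≤ |t y - t z| := by
    intro y hy z hz hyz
    have := farey_spacing (mem_erase.mp hz).2 (mem_erase.mp hy).2 hyz.symm (⌊v y⌋ - ⌊v z⌋)
    have e : t y - t z = (z.2 / z.1 - y.2 / y.1 - ((⌊v y⌋ - ⌊v z⌋ : ℤ) : ℝ) : ℝ) := by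
      have e1 : t y = v y - ⌊v y⌋ := rfl
      have e2 : t z = v z - ⌊v z⌋ := rfl
      rw [e1, e2]; push_cast; simp only [hv]; ring
    rwa [e]
  have s1 := sum_inv_le_of_spaced _ t hL (fun y hy => (hts y hy).1) (fun y hy => by linarith [(hts y hy).2]) hsp
  have s2 := sum_inv_le_of_spaced _ (fun y => 1 - t y) hL (fun y hy => (hts y hy).2)
    (fun y hy => by linarith [(hts y hy).1]) (fun y hy z hz hyz => by
      rw [show (1 - t y) - (1 - t z) = -(t y - t z) by ring, abs_neg]; exact hsp y hy z hz hyz)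
  have h0 : ‖∑ n ∈ range N, ee (n * t x)‖ ≤ N := by
    refine (norm_sum_le _ _).trans ?_
    simp [norm_ee]
  have h1 : ∑ y ∈ (farey R).erase x, ‖∑ n ∈ range N, ee (n * t y)‖ ≤
      ∑ y ∈ (farey R).erase x, (1 / 2 * (1 / t y) + 1 / 2 * (1 / (1 - t y))) := by
    refine sum_le_sum fun y hy => ?_
    have := hts y hy
    refine (norm_sum_ee_le N (by linarith) (by linarith)).trans (le_of_eq ?_)
    rw [one_div_mul_one_div, one_div_mul_one_div]
  rw [sum_add_distrib, ← mul_sum, ← mul_sum] at h1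
  push_cast at s1 s2
  rw [Real.log_pow] at s1 s2
  push_cast at s1 s2
  linarith

section

variable {r : ℕ} [NeZero r]

lemma conj_apply (χ : DirichletCharacter ℂ r) (a : ZMod r) : conj (χ a) = χ⁻¹ a :=
  MulChar.star_apply' χ a

/-- The absolute value of the Gauss sum of a primitive character. -/
lemma norm_gaussSum_sq {χ : DirichletCharacter ℂ r} (hχ : χ.IsPrimitive) :
    ‖gaussSum χ (ZMod.stdAddChar (N := r))‖ ^ 2 = r := by
  have h : (‖gaussSum χ (ZMod.stdAddChar (N := r))‖ ^ 2 : ℂ) = r := by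
    rw [← Complex.conj_mul']
    conv_lhs => enter [1]; rw [gaussSum]
    rw [map_sum, sum_mul]
    calc _ = ∑ a : ZMod r, ∑ b : ZMod r, χ b * ZMod.stdAddChar (a * (b - 1)) := by
          refine sum_congr rfl fun a _ => ?_
          rw [map_mul, conj_apply, mul_right_comm, ← gaussSum_mulShift_of_isPrimitive _ hχ, gaussSum,
            sum_mul]
          refine sum_congr rfl fun b _ => ?_
          rw [AddChar.mulShift_apply, ← AddChar.map_neg_eq_conj, mul_assoc, ← AddChar.map_add_eq_mul]
          ring_nf
      _ = ∑ b : ZMod r, χ b * ∑ a : ZMod r, ZMod.stdAddChar (a * (b - 1)) := by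
          rw [sum_comm]; simp only [mul_sum]
      _ = _ := by
          simp only [AddChar.sum_mulShift _ (ZMod.isPrimitive_stdAddChar r), sub_eq_zero]
          simp [ZMod.card]
  exact_mod_cast h

lemma primitive_sum_le (N : ℕ) (a : ℕ → ℂ) :
    ∑ χ : DirichletCharacter ℂ r with χ.IsPrimitive, ‖∑ n ∈ range N, a n * χ (n : ZMod r)‖ ^ 2 ≤
      ∑ b ∈ (range r).filter (fun b => b.Coprime r),
        ‖∑ n ∈ range N, conj (a n) * ee (n * (b / r : ℝ))‖ ^ 2 := by
  classical
  set S : ZMod r → ℂ := fun b => ∑ n ∈ range N, conj (a n) * ZMod.stdAddChar ((n : ZMod r) * b) with hS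
  have hr : (0 : ℝ) < r := by exact_mod_cast NeZero.pos r
  have h1 : ∀ χ : DirichletCharacter ℂ r, χ.IsPrimitive →
      r * ‖∑ n ∈ range N, a n * χ (n : ZMod r)‖ ^ 2 = ‖∑ b : ZMod r, S b * χ b‖ ^ 2 := by
    intro χ hχ
    rw [← norm_gaussSum_sq hχ, ← mul_pow, ← Complex.norm_conj (∑ n ∈ range N, a n * χ (n : ZMod r)), ← norm_mul]
    congr 2
    rw [map_sum, mul_sum]
    simp only [hS, sum_mul]
    rw [sum_comm]
    refine sum_congr rfl fun n _ => ?_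
    rw [map_mul, conj_apply]
    calc _ = conj (a n) * (χ⁻¹ (n : ZMod r) * gaussSum χ ZMod.stdAddChar) := by ring
      _ = _ := by
        rw [← gaussSum_mulShift_of_isPrimitive _ hχ, gaussSum, mul_sum]
        refine sum_congr rfl fun b _ => ?_
        rw [AddChar.mulShift_apply]; ring
  have h2 : ∑ χ : DirichletCharacter ℂ r, ‖∑ b ∈ univ.filter (fun b : ZMod r => IsUnit b), S b * χ b‖ ^ 2 ≤
      r * ∑ b ∈ univ.filter (fun b : ZMod r => IsUnit b), ‖S b‖ ^ 2 := by
    refine sum_norm_sq_le_of_gram _ _ (fun (χ : DirichletCharacter ℂ r) b => χ b) S hr.le fun χ _ => ?_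
    rw [sum_eq_single χ]
    · refine (norm_sum_le _ _).trans ?_
      calc _ ≤ ∑ b ∈ univ.filter (fun b : ZMod r => IsUnit b), (1 : ℝ) := by
            refine sum_le_sum fun b _ => ?_
            rw [norm_mul, Complex.norm_conj]
            exact mul_le_one₀ (χ.norm_le_one b) (norm_nonneg _) (χ.norm_le_one b)
        _ ≤ ∑ b : ZMod r, (1 : ℝ) :=
            sum_le_sum_of_subset_of_nonneg (filter_subset _ _) fun _ _ _ => zero_le_one
        _ = r := by simp [ZMod.card]
    · intro ψ _ hne
      rw [norm_eq_zero]
      have : ∑ b : ZMod r, (χ * ψ⁻¹) b = 0 := by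
        apply MulChar.sum_eq_zero_of_ne_one
        rw [Ne, mul_inv_eq_one]; exact hne.symm
      rw [← this]
      rw [sum_filter]
      refine sum_congr rfl fun b _ => ?_
      rw [MulChar.mul_apply, conj_apply]
      split_ifs with hb
      · rfl
      · rw [MulChar.map_nonunit _ hb, zero_mul]
    · simp
  have h3 : ∑ b ∈ univ.filter (fun b : ZMod r => IsUnit b), ‖S b‖ ^ 2 =
      ∑ b ∈ (range r).filter (fun b => b.Coprime r),
        ‖∑ n ∈ range N, conj (a n) * ee (n * (b / r : ℝ))‖ ^ 2 := by
    refine sum_nbij' (fun b => b.val) (fun b => (b : ZMod r)) ?_ ?_ ?_ ?_ ?_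
    · intro b hb
      have hb' := (mem_filter.mp hb).2
      refine mem_filter.mpr ⟨mem_range.mpr (ZMod.val_lt b), ?_⟩
      rwa [← ZMod.isUnit_iff_coprime, ZMod.natCast_zmod_val]
    · intro b hb
      have hb' := (mem_filter.mp hb).2
      exact mem_filter.mpr ⟨mem_univ _, (ZMod.isUnit_iff_coprime _ _).mpr hb'⟩
    · intro b _; exact ZMod.natCast_zmod_val b
    · intro b hb
      exact ZMod.val_cast_of_lt (mem_range.mp (mem_filter.mp hb).1)
    · intro b _
      simp only [hS]
      congr 2
      refine sum_congr rfl fun n _ => ?_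
      congr 1
      have : (n : ZMod r) * b = ((n * b.val : ℤ) : ZMod r) := by push_cast; rw [ZMod.natCast_zmod_val]
      rw [this, ZMod.stdAddChar_coe, ee]
      congr 1; push_cast; ring
  rw [← h3]
  have h4 : ∑ χ : DirichletCharacter ℂ r with χ.IsPrimitive, r * ‖∑ n ∈ range N, a n * χ (n : ZMod r)‖ ^ 2 ≤
      r * ∑ b ∈ univ.filter (fun b : ZMod r => IsUnit b), ‖S b‖ ^ 2 := by
    refine le_trans ?_ h2
    calc _ = ∑ χ : DirichletCharacter ℂ r with χ.IsPrimitive, ‖∑ b ∈ univ.filter (fun b : ZMod r => IsUnit b), S b * χ b‖ ^ 2 := by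
          refine sum_congr rfl fun χ hχ => ?_
          rw [h1 χ (mem_filter.mp hχ).2, sum_filter]
          congr 2
          refine sum_congr rfl fun b _ => ?_
          split_ifs with hb
          · rfl
          · rw [MulChar.map_nonunit _ hb, mul_zero]
      _ ≤ _ := sum_le_sum_of_subset_of_nonneg (filter_subset _ _) fun _ _ _ => by positivity
  rw [← mul_sum] at h4
  exact le_of_mul_le_mul_left h4 hr

end

/-- The large sieve inequality for primitive characters, up to a logarithm. -/
theorem large_sieve (R N : ℕ) (a : ℕ → ℂ) :
    ∑ r ∈ Icc 1 R, ∑ χ : DirichletCharacter ℂ r with χ.IsPrimitive,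
        ‖∑ n ∈ range N, a n * χ (n : ZMod r)‖ ^ 2 ≤
      (N + R ^ 2 * (1 + 2 * Real.log R)) * ∑ n ∈ range N, ‖a n‖ ^ 2 := by
  have h := additive_large_sieve R N (fun n => conj (a n))
  simp only [Complex.norm_conj] at h
  refine le_trans ?_ h
  rw [farey, sum_filter, sum_product]
  refine sum_le_sum fun r hr => ?_
  have hr' := mem_Icc.mp hr
  have : NeZero r := ⟨by omega⟩
  refine (primitive_sum_le N a).trans ?_
  rw [← sum_filter]
  refine sum_le_sum_of_subset_of_nonneg ?_ fun _ _ _ => by positivity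
  intro b hb
  simp only [mem_filter, mem_range] at hb ⊢
  exact ⟨by omega, hb.1, hb.2⟩

lemma norm_sum_antitone_mul_le {f : ℕ → ℝ} (hf : Antitone f) (h0 : ∀ n, 0 ≤ f n) {z : ℕ → ℂ} {B : ℝ}
    (hz : ∀ n, ‖∑ i ∈ range n, z i‖ ≤ B) (n : ℕ) :
    ‖∑ i ∈ range n, (f i : ℂ) * z i‖ ≤ f 0 * B := by
  have hB : 0 ≤ B := (norm_nonneg _).trans (hz 0)
  have := sum_range_by_parts (fun i => (f i : ℂ)) z n
  simp only [smul_eq_mul] at this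
  rw [this]
  refine (norm_sub_le _ _).trans ?_
  have h1 : ‖∑ i ∈ range (n - 1), ((f (i + 1) : ℂ) - f i) * ∑ j ∈ range (i + 1), z j‖ ≤
      ∑ i ∈ range (n - 1), (f i - f (i + 1)) * B := by
    refine (norm_sum_le _ _).trans (sum_le_sum fun i _ => ?_)
    rw [norm_mul, ← ofReal_sub, norm_real, Real.norm_eq_abs, abs_of_nonpos (by linarith [hf (Nat.le_succ i)])]
    have := hf (Nat.le_succ i)
    simp only [Nat.succ_eq_add_one] at this
    have := mul_le_mul_of_nonneg_left (hz (i + 1)) (by linarith : 0 ≤ f i - f (i + 1))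
    linarith
  rw [← sum_mul, sum_range_sub'] at h1
  have h2 : ‖(f (n - 1) : ℂ) * ∑ j ∈ range n, z j‖ ≤ f (n - 1) * B := by
    rw [norm_mul, norm_real, Real.norm_of_nonneg (h0 _)]
    exact mul_le_mul_of_nonneg_left (hz n) (h0 _)
  linarith

lemma norm_sum_monotone_mul_le {f : ℕ → ℝ} (hf : Monotone f) (h0 : ∀ n, 0 ≤ f n) {z : ℕ → ℂ} {B : ℝ}
    (hz : ∀ n, ‖∑ i ∈ range n, z i‖ ≤ B) (n : ℕ) :
    ‖∑ i ∈ range n, (f i : ℂ) * z i‖ ≤ 2 * f (n - 1) * B := by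
  have hB : 0 ≤ B := (norm_nonneg _).trans (hz 0)
  have := sum_range_by_parts (fun i => (f i : ℂ)) z n
  simp only [smul_eq_mul] at this
  rw [this]
  refine (norm_sub_le _ _).trans ?_
  have h1 : ‖∑ i ∈ range (n - 1), ((f (i + 1) : ℂ) - f i) * ∑ j ∈ range (i + 1), z j‖ ≤
      ∑ i ∈ range (n - 1), (f (i + 1) - f i) * B := by
    refine (norm_sum_le _ _).trans (sum_le_sum fun i _ => ?_)
    have := hf (Nat.le_succ i)
    simp only [Nat.succ_eq_add_one] at this
    rw [norm_mul, ← ofReal_sub, norm_real, Real.norm_eq_abs, abs_of_nonneg (by linarith)]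
    exact mul_le_mul_of_nonneg_left (hz (i + 1)) (by linarith)
  rw [← sum_mul, sum_range_sub] at h1
  have h2 : ‖(f (n - 1) : ℂ) * ∑ j ∈ range n, z j‖ ≤ f (n - 1) * B := by
    rw [norm_mul, norm_real, Real.norm_of_nonneg (h0 _)]
    exact mul_le_mul_of_nonneg_left (hz n) (h0 _)
  nlinarith [h0 0]

lemma sum_Icc_one_eq_sum_range {M : Type*} [AddCommMonoid M] (f : ℕ → M) (X : ℕ) :
    ∑ l ∈ Icc 1 X, f l = ∑ i ∈ range X, f (i + 1) := by
  rw [range_eq_Ico, sum_Ico_add' f 0 X 1]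
  exact sum_congr (by ext; simp) fun _ _ => rfl

section

variable {r : ℕ} [NeZero r] {χ : DirichletCharacter ℂ r}

lemma norm_sum_mul_wt_le (hχ : χ ≠ 1) (J : ℕ) {t : ℝ} (ht : 0 ≤ t) (X : ℕ) :
    ‖∑ l ∈ Icc 1 X, χ (l : ZMod r) * wt J (l * t)‖ ≤ r := by
  rw [sum_Icc_one_eq_sum_range]
  have h := norm_sum_antitone_mul_le (f := fun i : ℕ => wt J (((i + 1 : ℕ) : ℝ) * t))
    (fun i j hij => wt_antitone J (by gcongr)) (fun i => wt_nonneg _ _)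
    (z := fun i => χ ((i + 1 : ℕ) : ZMod r)) (B := r)
    (fun n => by simpa only [add_comm] using norm_sum_range_le hχ 1 n) X
  calc _ = ‖∑ i ∈ range X, ((wt J (((i + 1 : ℕ) : ℝ) * t) : ℝ) : ℂ) * χ ((i + 1 : ℕ) : ZMod r)‖ := by
        congr 1; exact sum_congr rfl fun i _ => mul_comm _ _
    _ ≤ _ := h.trans (mul_le_of_le_one_left (by positivity) (wt_le_one _ (by positivity)))

lemma norm_sum_mul_log_wt_le (hχ : χ ≠ 1) (J : ℕ) {t : ℝ} (ht : 0 ≤ t) (X : ℕ) :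
    ‖∑ l ∈ Icc 1 X, Real.log l * χ (l : ZMod r) * wt J (l * t)‖ ≤ 2 * Real.log X * r := by
  rcases X.eq_zero_or_pos with rfl | hX
  · simp
  rw [sum_Icc_one_eq_sum_range]
  have h := norm_sum_monotone_mul_le (f := fun i : ℕ => Real.log ((i + 1 : ℕ) : ℝ))
    (fun i j hij => Real.log_le_log (by positivity) (by exact_mod_cast Nat.succ_le_succ hij))
    (fun i => Real.log_natCast_nonneg _)
    (z := fun i => χ ((i + 1 : ℕ) : ZMod r) * wt J (((i + 1 : ℕ) : ℝ) * t)) (B := r)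
    (fun n => by rw [← sum_Icc_one_eq_sum_range (fun l => χ (l : ZMod r) * wt J (l * t))]
                 exact norm_sum_mul_wt_le hχ J ht n) X
  rw [Nat.sub_add_cancel hX] at h
  refine le_trans (le_of_eq ?_) h
  congr 1; exact sum_congr rfl fun i _ => by ring

end

/-- Dirichlet convolution opens up to a double sum against a function vanishing beyond `X`. -/
lemma sum_mul_arith {M : Type*} [CommSemiring M] (X : ℕ) (f g F : ℕ → M)
    (hF : ∀ n, X < n → F n = 0) :
    ∑ n ∈ Icc 1 X, (∑ x ∈ n.divisorsAntidiagonal, f x.1 * g x.2) * F n =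
      ∑ m ∈ Icc 1 X, ∑ l ∈ Icc 1 X, f m * g l * F (m * l) := by
  classical
  rw [← sum_product']
  have h1 : ∑ x ∈ Icc 1 X ×ˢ Icc 1 X, f x.1 * g x.2 * F (x.1 * x.2) =
      ∑ x ∈ (Icc 1 X ×ˢ Icc 1 X).filter (fun x => x.1 * x.2 ≤ X), f x.1 * g x.2 * F (x.1 * x.2) := by
    rw [sum_filter]
    refine sum_congr rfl fun x _ => ?_
    split_ifs with h
    · rfl
    · rw [hF _ (not_le.mp h), mul_zero]
  rw [h1, ← sum_fiberwise_of_maps_to (t := Icc 1 X) (g := fun x : ℕ × ℕ => x.1 * x.2)]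
  · refine sum_congr rfl fun n hn => ?_
    rw [mem_Icc] at hn
    rw [sum_mul]
    refine sum_congr ?_ fun x hx => ?_
    · ext ⟨a, b⟩
      simp only [Nat.mem_divisorsAntidiagonal, mem_filter, mem_product, mem_Icc]
      constructor
      · rintro ⟨rfl, h⟩
        have ha : 0 < a := Nat.pos_of_ne_zero fun h => by simp_all
        have hb : 0 < b := Nat.pos_of_ne_zero fun h => by simp_all
        exact ⟨⟨⟨⟨ha, (Nat.le_mul_of_pos_right a hb).trans hn.2⟩, ⟨hb, (Nat.le_mul_of_pos_left b ha).trans hn.2⟩⟩, hn.2⟩, rfl⟩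
      · rintro ⟨_, rfl⟩
        exact ⟨rfl, by omega⟩
    · rw [(mem_filter.mp hx).2]
  · intro x hx
    simp only [mem_filter, mem_product, mem_Icc] at hx ⊢
    exact ⟨Nat.mul_pos hx.1.1.1 hx.1.2.1, hx.2⟩

/-- Restriction of an arithmetic function to arguments at most `U`. -/
def lowPart (U : ℕ) (f : ArithmeticFunction ℝ) : ArithmeticFunction ℝ :=
  ⟨fun n => if n ≤ U then f n else 0, by simp⟩

/-- Restriction of an arithmetic function to arguments exceeding `U`. -/
def highPart (U : ℕ) (f : ArithmeticFunction ℝ) : ArithmeticFunction ℝ :=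
  ⟨fun n => if n ≤ U then 0 else f n, by simp⟩

lemma lowPart_apply (U : ℕ) (f : ArithmeticFunction ℝ) (n : ℕ) :
    lowPart U f n = if n ≤ U then f n else 0 := rfl

lemma highPart_apply (U : ℕ) (f : ArithmeticFunction ℝ) (n : ℕ) :
    highPart U f n = if n ≤ U then 0 else f n := rfl

lemma highPart_eq (U : ℕ) (f : ArithmeticFunction ℝ) : highPart U f = f - lowPart U f := by
  ext n
  rw [sub_eq_add_neg, ArithmeticFunction.add_apply, ArithmeticFunction.neg_apply, highPart_apply, lowPart_apply]
  split_ifs <;> simp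

/-- The Möbius function with real values. -/
noncomputable def moebR : ArithmeticFunction ℝ := ((moebius : ArithmeticFunction ℤ) : ArithmeticFunction ℝ)

/-- The zeta function with real values. -/
noncomputable def zetaR : ArithmeticFunction ℝ := ((zeta : ArithmeticFunction ℕ) : ArithmeticFunction ℝ)

lemma moebR_mul_zetaR : moebR * zetaR = 1 := by
  rw [moebR, zetaR]; exact coe_moebius_mul_coe_zeta

lemma abs_moebR_le_one (n : ℕ) : |moebR n| ≤ 1 := by
  rw [moebR, intCoe_apply]; exact_mod_cast abs_moebius_le_one

lemma zetaR_apply {n : ℕ} (hn : n ≠ 0) : zetaR n = 1 := by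
  rw [zetaR, natCoe_apply, zeta_apply_ne hn]; simp

theorem vaughan_identity (U : ℕ) :
    Λ = lowPart U Λ + lowPart U moebR * ArithmeticFunction.log - lowPart U Λ * lowPart U moebR * zetaR +
      highPart U Λ * (highPart U moebR * zetaR) := by
  have h1 : Λ * zetaR = ArithmeticFunction.log := vonMangoldt_mul_zeta
  rw [highPart_eq, highPart_eq, ← h1]
  linear_combination (-Λ + lowPart U Λ) * moebR_mul_zetaR

section

variable {r : ℕ} {χ : DirichletCharacter ℂ r}

/-- The twisted smooth sum of an arithmetic function. -/
noncomputable def twSum (J : ℕ) (N : ℝ) (χ : DirichletCharacter ℂ r) (f : ArithmeticFunction ℝ) : ℂ :=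
  ∑ n ∈ Icc 1 ⌊N⌋₊, (f n : ℂ) * (χ (n : ZMod r) * wt J (n / N))

lemma twSum_add (J : ℕ) (N : ℝ) (f g : ArithmeticFunction ℝ) :
    twSum J N χ (f + g) = twSum J N χ f + twSum J N χ g := by
  simp only [twSum, ArithmeticFunction.add_apply, ofReal_add, add_mul, sum_add_distrib]

lemma twSum_sub (J : ℕ) (N : ℝ) (f g : ArithmeticFunction ℝ) :
    twSum J N χ (f - g) = twSum J N χ f - twSum J N χ g := by
  simp only [twSum, sub_eq_add_neg, ArithmeticFunction.add_apply, ArithmeticFunction.neg_apply, ofReal_add, ofReal_neg,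
    add_mul, neg_mul, sum_add_distrib, sum_neg_distrib]

lemma twSum_mul {J : ℕ} (hJ : J ≠ 0) {N : ℝ} (hN : 0 < N) (f g : ArithmeticFunction ℝ) :
    twSum J N χ (f * g) = ∑ m ∈ Icc 1 ⌊N⌋₊, (f m * χ (m : ZMod r)) *
      ∑ l ∈ Icc 1 ⌊N⌋₊, (g l : ℂ) * χ (l : ZMod r) * wt J (l * (m / N)) := by
  have h := sum_mul_arith ⌊N⌋₊ (fun n => (f n : ℂ)) (fun n => (g n : ℂ)) (fun n => χ (n : ZMod r) * wt J (n / N)) (fun n hn => by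
      rw [wt_eq_zero hJ, ofReal_zero, mul_zero]
      rw [one_le_div hN]
      exact (Nat.lt_of_floor_lt hn).le)
  rw [twSum]
  refine Eq.trans (sum_congr rfl fun n _ => ?_) (h.trans (sum_congr rfl fun m _ => ?_))
  · rw [ArithmeticFunction.mul_apply]; push_cast; rfl
  · rw [mul_sum]
    refine sum_congr rfl fun l _ => ?_
    rw [show ((m * l : ℕ) : ℝ) / N = l * (m / N) by push_cast; ring]
    push_cast
    rw [map_mul]; ring

lemma psiW_eq_twSum (J : ℕ) (N : ℝ) (χ : DirichletCharacter ℂ r) : psiW J N χ = twSum J N χ Λ := by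
  rw [psiW, twSum]; exact sum_congr rfl fun n _ => by ring

end

section

variable {r : ℕ} [NeZero r] {χ : DirichletCharacter ℂ r}

lemma abs_lowPart_mul_le (U n : ℕ) : |(lowPart U Λ * lowPart U moebR) n| ≤ Real.log n := by
  rw [ArithmeticFunction.mul_apply, ← vonMangoldt_sum, Nat.sum_divisorsAntidiagonal (fun a b => lowPart U Λ a * lowPart U moebR b)]
  refine (abs_sum_le_sum_abs _ _).trans (sum_le_sum fun d _ => ?_)
  rw [abs_mul]
  have h1 : |lowPart U Λ d| ≤ Λ d := by
    rw [lowPart_apply]; split_ifs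
    · rw [abs_of_nonneg vonMangoldt_nonneg]
    · simp [vonMangoldt_nonneg]
  have h2 : |lowPart U moebR (n / d)| ≤ 1 := by
    rw [lowPart_apply]; split_ifs
    · exact abs_moebR_le_one _
    · simp
  exact (mul_le_mul h1 h2 (abs_nonneg _) vonMangoldt_nonneg).trans (mul_one _).le

lemma lowPart_mul_eq_zero {U n : ℕ} (hn : U ^ 2 < n) : (lowPart U Λ * lowPart U moebR) n = 0 := by
  rw [ArithmeticFunction.mul_apply]
  refine sum_eq_zero fun x hx => ?_
  have h := (Nat.mem_divisorsAntidiagonal.mp hx).1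
  rw [lowPart_apply, lowPart_apply]
  split_ifs with h1 h2
  · exfalso
    have := Nat.mul_le_mul h1 h2
    rw [h] at this; nlinarith
  all_goals simp

lemma norm_type_I_le (hχ : χ ≠ 1) {J : ℕ} (hJ : J ≠ 0) {N : ℝ} {U : ℕ} (hU : 1 ≤ U) (hUN : U ^ 2 ≤ N) :
    ‖psiW J N χ - twSum J N χ (highPart U Λ * (highPart U moebR * zetaR))‖ ≤ 4 * U ^ 2 * r * Real.log N := by
  have hU1 : (1 : ℝ) ≤ U := by exact_mod_cast hU
  have hN1 : 1 ≤ N := by nlinarith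
  have hN : 0 < N := by linarith
  have hr1 : (1 : ℝ) ≤ r := by exact_mod_cast NeZero.pos r
  have hlog : 0 ≤ Real.log N := Real.log_nonneg hN1
  set X := ⌊N⌋₊ with hX
  have hXN : (X : ℝ) ≤ N := Nat.floor_le hN.le
  have hlogle : ∀ m ∈ Icc 1 X, Real.log m ≤ Real.log N := fun m hm => by
    rw [mem_Icc] at hm
    exact Real.log_le_log (by exact_mod_cast hm.1) (le_trans (by exact_mod_cast hm.2) hXN)
  have hlogX : Real.log X ≤ Real.log N := by
    refine hlogle X (mem_Icc.mpr ⟨?_, le_rfl⟩)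
    exact Nat.le_floor (by simpa using hN1)
  have hUU : (U : ℝ) ≤ U ^ 2 := by nlinarith
  have key : ∀ (f : ℕ → ℝ) (V : ℕ) (B : ℝ), 0 ≤ B → (∀ m ∈ Icc 1 X, f m ≤ B) → (∀ m, V < m → f m ≤ 0) →
      ∑ m ∈ Icc 1 X, f m ≤ V * B := by
    intro f V B hB h1 h2
    calc ∑ m ∈ Icc 1 X, f m ≤ ∑ m ∈ Icc 1 X, if m ≤ V then B else 0 := by
          refine sum_le_sum fun m hm => ?_
          split_ifs with h
          · exact h1 m hm
          · exact h2 m (not_le.mp h)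
      _ = ∑ m ∈ (Icc 1 X).filter (fun m => m ≤ V), B := by rw [sum_filter]
      _ ≤ ∑ m ∈ Icc 1 V, B := sum_le_sum_of_subset_of_nonneg
          (fun m hm => by simp only [mem_filter, mem_Icc] at hm ⊢; omega) fun _ _ _ => hB
      _ = V * B := by simp
  have t1 : ‖twSum J N χ (lowPart U Λ)‖ ≤ U * Real.log N := by
    refine (norm_sum_le _ _).trans (key _ U _ hlog ?_ ?_)
    · intro m hm
      rw [norm_mul, norm_mul, norm_real, norm_real, Real.norm_of_nonneg (wt_nonneg _ _), Real.norm_eq_abs]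
      have h1 : |lowPart U Λ m| ≤ Real.log N := by
        rw [lowPart_apply]; split_ifs
        · rw [abs_of_nonneg vonMangoldt_nonneg]; exact vonMangoldt_le_log.trans (hlogle m hm)
        · simpa using hlog
      have h2 : ‖χ (m : ZMod r)‖ * wt J (m / N) ≤ 1 :=
        mul_le_one₀ (χ.norm_le_one _) (wt_nonneg _ _) (wt_le_one _ (by positivity))
      calc _ ≤ Real.log N * 1 := mul_le_mul h1 h2 (mul_nonneg (norm_nonneg _) (wt_nonneg _ _)) hlog
        _ = _ := mul_one _
    · intro m hm
      rw [lowPart_apply, if_neg (by omega)]; simp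
  have t2 : ‖twSum J N χ (lowPart U moebR * ArithmeticFunction.log)‖ ≤ U * (2 * Real.log N * r) := by
    rw [twSum_mul hJ hN]
    refine (norm_sum_le _ _).trans (key _ U _ (by positivity) ?_ ?_)
    · intro m hm
      rw [norm_mul, norm_mul, norm_real, Real.norm_eq_abs]
      have h1 : |lowPart U moebR m| ≤ 1 := by
        rw [lowPart_apply]; split_ifs
        · exact abs_moebR_le_one _
        · simp
      have h2 := norm_sum_mul_log_wt_le hχ J (t := m / N) (by positivity) X
      simp only [ArithmeticFunction.log_apply]
      calc _ ≤ (1 * 1) * (2 * Real.log X * r) := by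
            refine mul_le_mul (mul_le_mul h1 (χ.norm_le_one _) (norm_nonneg _) zero_le_one) h2 (norm_nonneg _) (by norm_num)
        _ ≤ _ := by rw [one_mul, one_mul]; gcongr
    · intro m hm
      rw [lowPart_apply, if_neg (by omega)]; simp
  have t3 : ‖twSum J N χ (lowPart U Λ * lowPart U moebR * zetaR)‖ ≤ (U ^ 2 : ℕ) * (Real.log N * r) := by
    rw [twSum_mul hJ hN]
    refine (norm_sum_le _ _).trans (key _ (U ^ 2) _ (by positivity) ?_ ?_)
    · intro m hm
      rw [norm_mul, norm_mul, norm_real, Real.norm_eq_abs]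
      have h1 := (abs_lowPart_mul_le U m).trans (hlogle m hm)
      have h2 := norm_sum_mul_wt_le hχ J (t := m / N) (by positivity) X
      have h3 : ∑ l ∈ Icc 1 X, (zetaR l : ℂ) * χ (l : ZMod r) * wt J (l * (m / N)) =
          ∑ l ∈ Icc 1 X, χ (l : ZMod r) * wt J (l * (m / N)) := by
        refine sum_congr rfl fun l hl => ?_
        rw [zetaR_apply (by have := mem_Icc.mp hl; omega), ofReal_one, one_mul]
      rw [h3]
      calc _ ≤ (Real.log N * 1) * r := by
            refine mul_le_mul (mul_le_mul h1 (χ.norm_le_one _) (norm_nonneg _) hlog) h2 (norm_nonneg _) (by positivity)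
        _ = _ := by ring
    · intro m hm
      rw [lowPart_mul_eq_zero hm]; simp
  have e : psiW J N χ - twSum J N χ (highPart U Λ * (highPart U moebR * zetaR)) =
      twSum J N χ (lowPart U Λ) + twSum J N χ (lowPart U moebR * ArithmeticFunction.log) -
        twSum J N χ (lowPart U Λ * lowPart U moebR * zetaR) := by
    rw [psiW_eq_twSum, ← twSum_add, ← twSum_sub, ← twSum_sub]
    congr 1
    nth_rewrite 1 [vaughan_identity U]
    ring
  rw [e]
  refine (norm_sub_le _ _).trans ?_
  have hn := norm_add_le (twSum J N χ (lowPart U Λ)) (twSum J N χ (lowPart U moebR * ArithmeticFunction.log))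
  push_cast at t3
  have h1 : (U : ℝ) * Real.log N ≤ U ^ 2 * (Real.log N * r) := by
    apply mul_le_mul hUU _ hlog (by positivity)
    exact le_mul_of_one_le_right hlog hr1
  have h2 : (U : ℝ) * (2 * Real.log N * r) ≤ U ^ 2 * (2 * Real.log N * r) := by gcongr
  linarith

end

/-- The `L¹` norm of the Mellin transform of the weight on the line `Re s = 1/2`. -/
noncomputable def kernNorm (J : ℕ) : ℝ := ∫ t : ℝ, ‖kern J (((1 / 2 : ℝ) : ℂ) + t * I)‖

lemma kernNorm_nonneg (J : ℕ) : 0 ≤ kernNorm J := integral_nonneg fun _ => norm_nonneg _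

/-- A Dirichlet polynomial on the line `Re s = 1/2`. -/
noncomputable def dpoly (a c : ℕ → ℂ) (M : ℕ) (t : ℝ) : ℂ :=
  ∑ m ∈ range M, a m * (m : ℂ) ^ (-(((1 / 2 : ℝ) : ℂ) + t * I)) * c m

lemma norm_natCast_cpow_half {m : ℕ} (hm : m ≠ 0) (t : ℝ) :
    ‖(m : ℂ) ^ (-(((1 / 2 : ℝ) : ℂ) + t * I))‖ ^ 2 = 1 / m := by
  rw [norm_natCast_cpow_of_pos (Nat.pos_of_ne_zero hm)]
  have e : (-(((1 / 2 : ℝ) : ℂ) + t * I)).re = -(1 / 2) := by simp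
  rw [e, ← Real.rpow_natCast, ← Real.rpow_mul (by positivity)]
  norm_num [Real.rpow_neg_one]

lemma continuous_dpoly (a c : ℕ → ℂ) (ha : a 0 = 0) (M : ℕ) : Continuous (dpoly a c M) := by
  unfold dpoly
  refine continuous_finsetSum _ fun m _ => ?_
  rcases eq_or_ne m 0 with rfl | hm
  · simp only [ha, zero_mul]; exact continuous_const
  · refine (continuous_const.mul ?_).mul continuous_const
    have : (m : ℂ) ≠ 0 := by exact_mod_cast hm
    exact Continuous.const_cpow (by fun_prop) (Or.inl this)

lemma sum_norm_dpoly_sq_le {ι : Type*} (S : Finset ι) (c : ι → ℕ → ℂ) (M : ℕ) {D : ℝ}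
    (hD : ∀ a : ℕ → ℂ, ∑ i ∈ S, ‖∑ m ∈ range M, a m * c i m‖ ^ 2 ≤ D * ∑ m ∈ range M, ‖a m‖ ^ 2)
    (a : ℕ → ℂ) (ha : a 0 = 0) (t : ℝ) :
    ∑ i ∈ S, ‖dpoly a (c i) M t‖ ^ 2 ≤ D * ∑ m ∈ range M, ‖a m‖ ^ 2 / m := by
  refine (hD fun m => a m * (m : ℂ) ^ (-(((1 / 2 : ℝ) : ℂ) + t * I))).trans (le_of_eq ?_)
  congr 1
  refine sum_congr rfl fun m _ => ?_
  rcases eq_or_ne m 0 with rfl | hm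
  · simp [ha]
  · rw [norm_mul, mul_pow, norm_natCast_cpow_half hm]; ring

/-- Bilinear sums with a smooth cross condition, bounded in mean by a large sieve. -/
theorem sum_norm_bilinear_le {ι : Type*} (S : Finset ι) (c : ι → ℕ → ℂ) (M L : ℕ) {D₁ D₂ : ℝ}
    (hD₁ : ∀ a : ℕ → ℂ, ∑ i ∈ S, ‖∑ m ∈ range M, a m * c i m‖ ^ 2 ≤ D₁ * ∑ m ∈ range M, ‖a m‖ ^ 2)
    (hD₂ : ∀ a : ℕ → ℂ, ∑ i ∈ S, ‖∑ m ∈ range L, a m * c i m‖ ^ 2 ≤ D₂ * ∑ m ∈ range L, ‖a m‖ ^ 2)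
    (a b : ℕ → ℂ) (ha : a 0 = 0) (hb : b 0 = 0) {J : ℕ} (hJ : J ≠ 0) {N : ℝ} (hN : 0 < N) :
    ∑ i ∈ S, ‖∑ m ∈ range M, ∑ l ∈ range L, a m * c i m * (b l * c i l) * wt J (l * (m / N))‖ ≤
      kernNorm J * √N * √((D₁ * ∑ m ∈ range M, ‖a m‖ ^ 2 / m) * (D₂ * ∑ l ∈ range L, ‖b l‖ ^ 2 / l)) := by
  have hNc : (N : ℂ) ≠ 0 := by exact_mod_cast hN.ne'
  set G := √((D₁ * ∑ m ∈ range M, ‖a m‖ ^ 2 / m) * (D₂ * ∑ l ∈ range L, ‖b l‖ ^ 2 / l)) with hG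
  set k : ℝ → ℂ := fun t => kern J (((1 / 2 : ℝ) : ℂ) + t * I) with hk
  have hki : Integrable k := integrable_kern hJ le_rfl
  have hterm : ∀ m l : ℕ, ∀ z : ℂ, m ≠ 0 → l ≠ 0 → (2 * Real.pi : ℂ) * (z * wt J (l * (m / N))) =
      ∫ t : ℝ, (N : ℂ) ^ (((1 / 2 : ℝ) : ℂ) + t * I) * k t * (z * ((m : ℂ) ^ (-(((1 / 2 : ℝ) : ℂ) + t * I)) *
        (l : ℂ) ^ (-(((1 / 2 : ℝ) : ℂ) + t * I)))) := by
    intro m l z hm hl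
    have hm' : (0 : ℝ) < m := by positivity
    have hl' : (0 : ℝ) < l := by positivity
    rw [mul_left_comm, wt_eq_integral hJ (le_refl (1 / 2 : ℝ)) (by positivity), ← integral_const_mul]
    congr 1; ext t
    have e : ∀ z : ℂ, ((l * (m / N) : ℝ) : ℂ) ^ (-z) = (N : ℂ) ^ z * ((m : ℂ) ^ (-z) * (l : ℂ) ^ (-z)) := by
      intro z
      rw [ofReal_mul, mul_cpow_ofReal_nonneg hl'.le (by positivity), show m / N = m * N⁻¹ from div_eq_mul_inv _ _,
        ofReal_mul, mul_cpow_ofReal_nonneg hm'.le (by positivity), ofReal_inv,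
        inv_cpow _ _ (by rw [arg_ofReal_of_nonneg hN.le]; exact Real.pi_pos.ne), ← cpow_neg, neg_neg]
      push_cast; ring
    rw [e]; ring
  have hint1 : ∀ m l : ℕ, ∀ z : ℂ, m ≠ 0 → l ≠ 0 → Integrable fun t : ℝ =>
      (N : ℂ) ^ (((1 / 2 : ℝ) : ℂ) + t * I) * k t * (z * ((m : ℂ) ^ (-(((1 / 2 : ℝ) : ℂ) + t * I)) *
        (l : ℂ) ^ (-(((1 / 2 : ℝ) : ℂ) + t * I)))) := by
    intro m l z hm hl
    have hm' : (m : ℂ) ≠ 0 := by exact_mod_cast hm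
    have hl' : (l : ℂ) ≠ 0 := by exact_mod_cast hl
    refine (hki.norm.const_mul (√N * ‖z‖)).mono' ?_ (Eventually.of_forall fun t => ?_)
    · refine Continuous.aestronglyMeasurable ?_
      refine ((Continuous.const_cpow (by fun_prop) (Or.inl hNc)).mul (continuous_kern_vertical (by norm_num))).mul
        (continuous_const.mul ((Continuous.const_cpow (by fun_prop) (Or.inl hm')).mul
          (Continuous.const_cpow (by fun_prop) (Or.inl hl'))))
    · have h1 : ∀ n : ℕ, n ≠ 0 → ‖(n : ℂ) ^ (-(((1 / 2 : ℝ) : ℂ) + t * I))‖ ≤ 1 := by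
        intro n hn
        have h := norm_natCast_cpow_half hn t
        have hn1 : (1 : ℝ) ≤ n := by exact_mod_cast Nat.pos_of_ne_zero hn
        have h2 : (1 : ℝ) / n ≤ 1 := by rw [div_le_one (by linarith)]; exact hn1
        nlinarith [norm_nonneg ((n : ℂ) ^ (-(((1 / 2 : ℝ) : ℂ) + t * I)))]
      have h2 : ‖(N : ℂ) ^ (((1 / 2 : ℝ) : ℂ) + t * I)‖ = √N := by
        rw [norm_cpow_eq_rpow_re_of_pos hN, Real.sqrt_eq_rpow]; congr 1; simp
      rw [norm_mul, norm_mul, norm_mul, norm_mul, h2]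
      calc _ ≤ √N * ‖k t‖ * (‖z‖ * (1 * 1)) := by
            gcongr
            · exact h1 m hm
            · exact h1 l hl
        _ = _ := by ring
  have hT : ∀ i ∈ S, ‖∑ m ∈ range M, ∑ l ∈ range L, a m * c i m * (b l * c i l) * wt J (l * (m / N))‖ ≤
      √N * ∫ t : ℝ, ‖k t‖ * (‖dpoly a (c i) M t‖ * ‖dpoly b (c i) L t‖) := by
    intro i _
    have e : (2 * Real.pi : ℂ) * ∑ m ∈ range M, ∑ l ∈ range L, a m * c i m * (b l * c i l) * wt J (l * (m / N)) =
        ∫ t : ℝ, (N : ℂ) ^ (((1 / 2 : ℝ) : ℂ) + t * I) * k t * (dpoly a (c i) M t * dpoly b (c i) L t) := by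
      have e1 : ∀ m l : ℕ, (2 * Real.pi : ℂ) * (a m * c i m * (b l * c i l) * wt J (l * (m / N))) =
          ∫ t : ℝ, (N : ℂ) ^ (((1 / 2 : ℝ) : ℂ) + t * I) * k t * (a m * c i m * (b l * c i l) *
            ((m : ℂ) ^ (-(((1 / 2 : ℝ) : ℂ) + t * I)) * (l : ℂ) ^ (-(((1 / 2 : ℝ) : ℂ) + t * I)))) := by
        intro m l
        rcases eq_or_ne m 0 with rfl | hm
        · simp [ha]
        rcases eq_or_ne l 0 with rfl | hl
        · simp [hb]
        exact hterm m l _ hm hl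
      have e2 : ∀ m l : ℕ, Integrable fun t : ℝ => (N : ℂ) ^ (((1 / 2 : ℝ) : ℂ) + t * I) * k t * (a m * c i m * (b l * c i l) *
            ((m : ℂ) ^ (-(((1 / 2 : ℝ) : ℂ) + t * I)) * (l : ℂ) ^ (-(((1 / 2 : ℝ) : ℂ) + t * I)))) := by
        intro m l
        rcases eq_or_ne m 0 with rfl | hm
        · simp [ha]
        rcases eq_or_ne l 0 with rfl | hl
        · simp [hb]
        exact hint1 m l _ hm hl
      simp only [mul_sum, e1]
      have e3 : ∀ m, ∑ l ∈ range L, ∫ t : ℝ, (N : ℂ) ^ (((1 / 2 : ℝ) : ℂ) + t * I) * k t * (a m * c i m * (b l * c i l) *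
            ((m : ℂ) ^ (-(((1 / 2 : ℝ) : ℂ) + t * I)) * (l : ℂ) ^ (-(((1 / 2 : ℝ) : ℂ) + t * I)))) =
          ∫ t : ℝ, ∑ l ∈ range L, (N : ℂ) ^ (((1 / 2 : ℝ) : ℂ) + t * I) * k t * (a m * c i m * (b l * c i l) *
            ((m : ℂ) ^ (-(((1 / 2 : ℝ) : ℂ) + t * I)) * (l : ℂ) ^ (-(((1 / 2 : ℝ) : ℂ) + t * I)))) := fun m =>
        (integral_finsetSum _ fun l _ => e2 m l).symm
      simp only [e3]
      rw [← integral_finsetSum _ fun m _ => integrable_finsetSum _ fun l _ => e2 m l]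
      congr 1; ext t
      rw [dpoly, dpoly, sum_mul_sum]
      simp only [mul_sum]
      exact sum_congr rfl fun m _ => sum_congr rfl fun l _ => by ring
    have hn := congrArg norm e
    rw [norm_mul] at hn
    have h2pi : 1 ≤ ‖(2 * Real.pi : ℂ)‖ := by
      rw [norm_mul, norm_real, Real.norm_eq_abs, abs_of_pos Real.pi_pos]
      simp; linarith [Real.pi_gt_three]
    refine (le_mul_of_one_le_left (norm_nonneg _) h2pi).trans (hn.le.trans ((norm_integral_le_integral_norm _).trans
      (le_of_eq ?_)))
    rw [← integral_const_mul]
    congr 1; ext t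
    rw [norm_mul, norm_mul, norm_mul, norm_cpow_eq_rpow_re_of_pos hN]
    have : (((1 / 2 : ℝ) : ℂ) + t * I).re = 1 / 2 := by simp
    rw [this, ← Real.sqrt_eq_rpow]; ring
  have hCS : ∀ t : ℝ, ∑ i ∈ S, ‖dpoly a (c i) M t‖ * ‖dpoly b (c i) L t‖ ≤ G := by
    intro t
    refine Real.le_sqrt_of_sq_le ((sum_mul_sq_le_sq_mul_sq _ _ _).trans ?_)
    exact mul_le_mul (sum_norm_dpoly_sq_le S c M hD₁ a ha t) (sum_norm_dpoly_sq_le S c L hD₂ b hb t)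
      (sum_nonneg fun _ _ => by positivity)
      ((sum_nonneg fun _ _ => by positivity).trans (sum_norm_dpoly_sq_le S c M hD₁ a ha t))
  have hInt : ∀ i ∈ S, Integrable fun t : ℝ => ‖k t‖ * (‖dpoly a (c i) M t‖ * ‖dpoly b (c i) L t‖) := by
    intro i hi
    refine (hki.norm.mul_const G).mono' ?_ (Eventually.of_forall fun t => ?_)
    · refine Continuous.aestronglyMeasurable ?_
      exact (continuous_kern_vertical (by norm_num)).norm.mul
        ((continuous_dpoly a (c i) ha M).norm.mul (continuous_dpoly b (c i) hb L).norm)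
    · rw [Real.norm_of_nonneg (by positivity)]
      refine mul_le_mul_of_nonneg_left (le_trans ?_ (hCS t)) (norm_nonneg _)
      exact single_le_sum (f := fun i => ‖dpoly a (c i) M t‖ * ‖dpoly b (c i) L t‖)
        (fun _ _ => by positivity) hi
  refine (sum_le_sum hT).trans ?_
  rw [← mul_sum, ← integral_finsetSum _ hInt, mul_comm (kernNorm J), mul_assoc]
  refine mul_le_mul_of_nonneg_left ?_ (Real.sqrt_nonneg _)
  rw [kernNorm, ← integral_mul_const]
  refine integral_mono (integrable_finsetSum _ hInt) (hki.norm.mul_const G) fun t => ?_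
  simp only
  rw [← mul_sum]
  exact mul_le_mul_of_nonneg_left (hCS t) (norm_nonneg _)

lemma sum_mul_arith_le (X : ℕ) (f g : ℕ → ℝ) (hf : ∀ n, 0 ≤ f n) (hg : ∀ n, 0 ≤ g n) :
    ∑ n ∈ Icc 1 X, (∑ x ∈ n.divisorsAntidiagonal, f x.1 * g x.2) / n ≤
      (∑ m ∈ Icc 1 X, f m / m) * ∑ l ∈ Icc 1 X, g l / l := by
  have h := sum_mul_arith X f g (fun n => if n ≤ X then 1 / (n : ℝ) else 0) (fun n hn => if_neg (by omega))
  calc _ = ∑ n ∈ Icc 1 X, (∑ x ∈ n.divisorsAntidiagonal, f x.1 * g x.2) * (if n ≤ X then 1 / (n : ℝ) else 0) := by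
        refine sum_congr rfl fun n hn => ?_
        rw [if_pos (mem_Icc.mp hn).2]; ring
    _ ≤ _ := by
        rw [h, sum_mul_sum]
        refine sum_le_sum fun m _ => sum_le_sum fun l _ => ?_
        rw [div_mul_div_comm]
        have := mul_nonneg (hf m) (hg l)
        split_ifs
        · push_cast; rw [mul_one_div]
        · rw [mul_zero]; positivity

lemma card_divisors_mul_le (a b : ℕ) : (a * b).divisors.card ≤ a.divisors.card * b.divisors.card := by
  rw [Nat.divisors_mul]; exact card_mul_le

lemma sum_inv_le_log (X : ℕ) : ∑ m ∈ Icc 1 X, (1 : ℝ) / m ≤ 1 + Real.log X := by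
  have := harmonic_le_one_add_log X
  rw [harmonic_eq_sum_Icc] at this
  push_cast at this
  simpa using this

lemma card_divisorsAntidiagonal_eq (n : ℕ) : n.divisorsAntidiagonal.card = n.divisors.card := by
  rw [← Nat.map_div_right_divisors, card_map]

lemma sum_card_divisors_sq_le (X : ℕ) :
    ∑ n ∈ Icc 1 X, (n.divisors.card : ℝ) ^ 2 / n ≤ (1 + Real.log X) ^ 4 := by
  have h1 : ∑ n ∈ Icc 1 X, (n.divisors.card : ℝ) / n ≤ (1 + Real.log X) ^ 2 := by
    have := sum_mul_arith_le X (fun _ => 1) (fun _ => 1) (by simp) (by simp)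
    refine le_trans (le_of_eq (sum_congr rfl fun n _ => ?_)) (this.trans ?_)
    · simp [card_divisorsAntidiagonal_eq]
    · rw [← sq]
      exact pow_le_pow_left₀ (sum_nonneg fun _ _ => by positivity) (sum_inv_le_log X) 2
  have h2 := sum_mul_arith_le X (fun n => (n.divisors.card : ℝ)) (fun n => (n.divisors.card : ℝ))
    (fun _ => by positivity) (fun _ => by positivity)
  calc _ ≤ _ := sum_le_sum fun n _ => ?_
    _ ≤ _ := h2
    _ ≤ (1 + Real.log X) ^ 2 * (1 + Real.log X) ^ 2 := by
        have h0 : 0 ≤ ∑ n ∈ Icc 1 X, (n.divisors.card : ℝ) / n := sum_nonneg fun _ _ => by positivity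
        gcongr
    _ = _ := by ring
  gcongr
  calc (n.divisors.card : ℝ) ^ 2 = ∑ x ∈ n.divisorsAntidiagonal, (n.divisors.card : ℝ) := by
        rw [sum_const, card_divisorsAntidiagonal_eq, nsmul_eq_mul, sq]
    _ ≤ _ := by
        refine sum_le_sum fun x hx => ?_
        rw [← (Nat.mem_divisorsAntidiagonal.mp hx).1]
        exact_mod_cast card_divisors_mul_le _ _

/-- The primitive characters with modulus in `[1, R]`. -/
noncomputable def primChars (R : ℕ) : Finset (Σ r : ℕ, DirichletCharacter ℂ r) :=
  (Icc 1 R).sigma fun r => univ.filter fun χ : DirichletCharacter ℂ r => χ.IsPrimitive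

lemma large_sieve_primChars (R N : ℕ) (a : ℕ → ℂ) :
    ∑ x ∈ primChars R, ‖∑ n ∈ range N, a n * x.2 (n : ZMod x.1)‖ ^ 2 ≤
      (N + R ^ 2 * (1 + 2 * Real.log R)) * ∑ n ∈ range N, ‖a n‖ ^ 2 := by
  rw [primChars, sum_sigma]; exact large_sieve R N a

/-- The part of a function supported on `[2 ^ i, 2 ^ (i + 1)) ∩ [1, X]`. -/
noncomputable def dyadicPart (f : ArithmeticFunction ℝ) (X i m : ℕ) : ℂ :=
  if m ∈ Icc 1 X ∧ Nat.log 2 m = i then (f m : ℂ) else 0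

lemma twSum_mul_eq_sum_dyadic {J : ℕ} (hJ : J ≠ 0) {N : ℝ} (hN : 0 < N) (f g : ArithmeticFunction ℝ)
    {r : ℕ} (χ : DirichletCharacter ℂ r) :
    twSum J N χ (f * g) = ∑ i ∈ range (Nat.log 2 ⌊N⌋₊ + 1),
      ∑ m ∈ range (2 ^ (i + 1)), ∑ l ∈ range (⌊N⌋₊ / 2 ^ i + 1),
        dyadicPart f ⌊N⌋₊ i m * χ (m : ZMod r) * ((g l : ℂ) * χ (l : ZMod r)) * wt J (l * (m / N)) := by
  set X := ⌊N⌋₊ with hX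
  rw [twSum_mul hJ hN, ← hX, ← sum_fiberwise_of_maps_to (t := range (Nat.log 2 X + 1)) (g := Nat.log 2)]
  swap
  · intro m hm
    rw [mem_range, Nat.lt_succ_iff]
    exact Nat.log_mono_right (mem_Icc.mp hm).2
  refine sum_congr rfl fun i _ => ?_
  have hz : ∀ m l : ℕ, X < m * l → wt J (l * (m / N)) = 0 := by
    intro m l h
    apply wt_eq_zero hJ
    rw [mul_div_assoc', one_le_div hN]
    have := (Nat.lt_of_floor_lt h).le
    push_cast at this; linarith
  calc ∑ m ∈ (Icc 1 X).filter (fun m => Nat.log 2 m = i), (f m * χ (m : ZMod r)) *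
        ∑ l ∈ Icc 1 X, (g l : ℂ) * χ (l : ZMod r) * wt J (l * (m / N))
      = ∑ m ∈ (Icc 1 X).filter (fun m => Nat.log 2 m = i), ∑ l ∈ range (X / 2 ^ i + 1),
        dyadicPart f X i m * χ (m : ZMod r) * ((g l : ℂ) * χ (l : ZMod r)) * wt J (l * (m / N)) := by
        refine sum_congr rfl fun m hm => ?_
        rw [mem_filter] at hm
        rw [dyadicPart, if_pos hm, mul_sum]
        have hm1 : 2 ^ i ≤ m := by
          have := Nat.pow_log_le_self 2 (x := m) (by have := mem_Icc.mp hm.1; omega)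
          rwa [hm.2] at this
        have hsub : Icc 1 (X / 2 ^ i) ⊆ Icc 1 X := Icc_subset_Icc_right (Nat.div_le_self _ _)
        have hsub2 : Icc 1 (X / 2 ^ i) ⊆ range (X / 2 ^ i + 1) := fun l hl => by
          simp only [mem_Icc, mem_range] at hl ⊢; omega
        rw [← sum_subset hsub, ← sum_subset hsub2]
        · exact sum_congr rfl fun l _ => by ring
        · intro l hl1 hl2
          have : l = 0 := by
            simp only [mem_Icc, mem_range] at hl1 hl2; omega
          rw [this]; simp
        · intro l hl1 hl2
          rw [hz m l, ofReal_zero, mul_zero, mul_zero]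
          simp only [mem_Icc, not_and, not_le] at hl1 hl2
          have := hl2 hl1.1
          have := Nat.lt_mul_of_div_lt this (by positivity)
          calc X < l * 2 ^ i := by linarith
            _ ≤ l * m := Nat.mul_le_mul_left _ hm1
            _ = m * l := mul_comm _ _
    _ = _ := by
        refine sum_subset (fun m hm => ?_) fun m hm1 hm2 => ?_
        · rw [mem_filter] at hm
          rw [mem_range, ← hm.2]
          exact Nat.lt_pow_succ_log_self (by norm_num) m
        · refine sum_eq_zero fun l _ => ?_
          rw [mem_filter] at hm2
          rw [dyadicPart, if_neg hm2]; simp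

lemma abs_highPart_mul_zeta_le (U l : ℕ) : |(highPart U moebR * zetaR) l| ≤ l.divisors.card := by
  rw [ArithmeticFunction.mul_apply, ← card_divisorsAntidiagonal_eq, card_eq_sum_ones]
  push_cast
  refine (abs_sum_le_sum_abs _ _).trans (sum_le_sum fun x hx => ?_)
  have h := Nat.mem_divisorsAntidiagonal.mp hx
  rw [zetaR_apply (fun h0 => h.2 (by rw [← h.1, h0, mul_zero])), mul_one, highPart_apply]
  split_ifs
  · simp
  · exact abs_moebR_le_one _

lemma highPart_mul_zeta_eq_zero {U l : ℕ} (hl : l ≤ U) : (highPart U moebR * zetaR) l = 0 := by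
  rw [ArithmeticFunction.mul_apply]
  refine sum_eq_zero fun x hx => ?_
  have h := Nat.mem_divisorsAntidiagonal.mp hx
  rw [highPart_apply, if_pos, zero_mul]
  exact (Nat.le_of_dvd (Nat.pos_of_ne_zero h.2) ⟨x.2, h.1.symm⟩).trans hl

lemma block_product_le {N U R M : ℝ} (hN : 0 < N) (hU0 : 0 < U) (hR : 0 ≤ R) (hM0 : 0 < M) (hM1 : M ≤ N / U)
    (hM2 : 1 / M ≤ 2 / U) :
    (2 * M + R ^ 2) * (2 * N / M + R ^ 2) ≤ (3 * (√N + R * √N / √U + R ^ 2)) ^ 2 := by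
  have hsU : √U ^ 2 = U := Real.sq_sqrt hU0.le
  have hsN : √N ^ 2 = N := Real.sq_sqrt hN.le
  have e1 : (2 * M + R ^ 2) * (2 * N / M + R ^ 2) = 4 * N + 2 * R ^ 2 * M + 2 * N * R ^ 2 * (1 / M) + R ^ 4 := by
    field_simp; ring
  have h1 : 2 * R ^ 2 * M ≤ 2 * R ^ 2 * (N / U) := by gcongr
  have h2 : 2 * N * R ^ 2 * (1 / M) ≤ 2 * N * R ^ 2 * (2 / U) := by gcongr
  have e2 : (R * √N / √U) ^ 2 = R ^ 2 * (N / U) := by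
    rw [div_pow, mul_pow, hsU, hsN]; ring
  have h3 : 0 ≤ R * √N / √U := by positivity
  have hx : 0 ≤ R ^ 2 := sq_nonneg R
  rw [e1]
  calc _ ≤ 4 * √N ^ 2 + 6 * (R * √N / √U) ^ 2 + (R ^ 2 : ℝ) ^ 2 := by
        rw [e2, hsN]
        have : 2 * N * R ^ 2 * (2 / U) = 4 * (R ^ 2 * (N / U)) := by ring
        linarith
    _ ≤ _ := by
        have hs := Real.sqrt_nonneg N
        generalize R * √N / √U = y at *
        generalize √N = z at *
        set x := R ^ 2
        nlinarith [mul_nonneg hs h3, mul_nonneg hs hx, mul_nonneg h3 hx, sq_nonneg y, sq_nonneg z, sq_nonneg x]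

set_option maxHeartbeats 1000000 in
/-- Mean value of type II sums over primitive characters. -/
theorem sum_type_II_le {J : ℕ} (hJ : J ≠ 0) {N : ℝ} {U R : ℕ} (hU : 1 ≤ U) (hN1 : 1 ≤ N) (hR : 1 ≤ R) (hRN : R ≤ N) :
    ∑ x ∈ primChars R, ‖twSum J N x.2 (highPart U Λ * (highPart U moebR * zetaR))‖ ≤
      12 * kernNorm J * (1 + Real.log N) ^ 6 * (N + R * N / √U + R ^ 2 * √N) := by
  have hN : 0 < N := by linarith
  set L := 1 + Real.log N with hL
  have hlog : 0 ≤ Real.log N := Real.log_nonneg hN1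
  have hL1 : 1 ≤ L := by linarith
  have hK := kernNorm_nonneg J
  set X := ⌊N⌋₊ with hX
  have hXN : (X : ℝ) ≤ N := Nat.floor_le hN.le
  have hX1 : 1 ≤ X := Nat.le_floor (by simpa using hN1)
  have hX1r : (1 : ℝ) ≤ X := by exact_mod_cast hX1
  have hlogX : Real.log X ≤ Real.log N := Real.log_le_log (by linarith) hXN
  have hU0 : (0 : ℝ) < U := by exact_mod_cast hU
  have hR1 : (1 : ℝ) ≤ R := by exact_mod_cast hR
  set b := highPart U moebR * zetaR with hb
  set B := 6 * kernNorm J * L ^ 5 * (N + R * N / √U + R ^ 2 * √N) with hB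
  have hB0 : 0 ≤ B := by positivity
  have hblock : ∀ i ∈ range (Nat.log 2 X + 1), ∑ x ∈ primChars R,
      ‖∑ m ∈ range (2 ^ (i + 1)), ∑ l ∈ range (X / 2 ^ i + 1),
        dyadicPart (highPart U Λ) X i m * x.2 (m : ZMod x.1) * ((b l : ℂ) * x.2 (l : ZMod x.1)) * wt J (l * (m / N))‖ ≤ B := by
    intro i hi
    have hiX : 2 ^ i ≤ X := by
      have : i ≤ Nat.log 2 X := by rw [mem_range] at hi; omega
      exact (Nat.pow_le_pow_right (by norm_num) this).trans (Nat.pow_log_le_self 2 (by omega))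
    by_cases hs : 2 ^ (i + 1) ≤ U + 1
    · have : ∀ m ∈ range (2 ^ (i + 1)), dyadicPart (highPart U Λ) X i m = 0 := by
        intro m hm
        rw [mem_range] at hm
        have h0 : highPart U Λ m = 0 := by rw [highPart_apply, if_pos (by omega)]
        rw [dyadicPart, h0]; simp
      rw [sum_eq_zero fun x _ => ?_]
      · exact hB0
      · rw [norm_eq_zero]
        refine sum_eq_zero fun m hm => sum_eq_zero fun l _ => ?_
        rw [this m hm]; simp
    by_cases hs2 : X / 2 ^ i ≤ U
    · rw [sum_eq_zero fun x _ => ?_]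
      · exact hB0
      · rw [norm_eq_zero]
        refine sum_eq_zero fun m hm => sum_eq_zero fun l hl => ?_
        rw [mem_range] at hl
        rw [hb, highPart_mul_zeta_eq_zero (by omega)]; simp
    have key := sum_norm_bilinear_le (primChars R) (fun x n => x.2 (n : ZMod x.1)) (2 ^ (i + 1)) (X / 2 ^ i + 1)
      (large_sieve_primChars R _) (large_sieve_primChars R _) (dyadicPart (highPart U Λ) X i) (fun l => (b l : ℂ))
      (by simp [dyadicPart]) (by simp) hJ hN
    refine key.trans ?_
    have hA2 : ∑ m ∈ range (2 ^ (i + 1)), ‖dyadicPart (highPart U Λ) X i m‖ ^ 2 / m ≤ L ^ 3 := by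
      calc _ ≤ ∑ m ∈ range (2 ^ (i + 1)), if m ∈ Icc 1 X then L ^ 2 * (1 / m) else 0 := by
            refine sum_le_sum fun m _ => ?_
            rw [dyadicPart]
            by_cases hm : m ∈ Icc 1 X
            · have h1 : ‖if m ∈ Icc 1 X ∧ Nat.log 2 m = i then ((highPart U Λ m : ℝ) : ℂ) else 0‖ ≤ L := by
                split_ifs with h
                · rw [norm_real, highPart_apply]
                  split_ifs
                  · simp; linarith
                  · rw [Real.norm_of_nonneg vonMangoldt_nonneg]
                    refine vonMangoldt_le_log.trans ?_
                    have hm' := mem_Icc.mp hm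
                    have : Real.log m ≤ Real.log X :=
                      Real.log_le_log (by exact_mod_cast hm'.1) (by exact_mod_cast hm'.2)
                    linarith
                · simp; linarith
              rw [if_pos hm, mul_one_div]
              gcongr
            · rw [if_neg (fun h => hm h.1), if_neg hm]; simp
        _ = ∑ m ∈ (range (2 ^ (i + 1))).filter (fun m => m ∈ Icc 1 X), L ^ 2 * (1 / (m : ℝ)) := by
            rw [sum_filter]
        _ ≤ ∑ m ∈ Icc 1 X, L ^ 2 * (1 / (m : ℝ)) :=
            sum_le_sum_of_subset_of_nonneg (fun m hm => (mem_filter.mp hm).2) fun _ _ _ => by positivity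
        _ ≤ L ^ 2 * L := by
            rw [← mul_sum]
            refine mul_le_mul_of_nonneg_left ((sum_inv_le_log X).trans (by linarith)) (by positivity)
        _ = L ^ 3 := by ring
    have hB2 : ∑ l ∈ range (X / 2 ^ i + 1), ‖(b l : ℂ)‖ ^ 2 / l ≤ L ^ 4 := by
      calc _ ≤ ∑ l ∈ range (X / 2 ^ i + 1), (l.divisors.card : ℝ) ^ 2 / l := by
            refine sum_le_sum fun l _ => ?_
            rw [norm_real, Real.norm_eq_abs]
            gcongr
            exact abs_highPart_mul_zeta_le U l
        _ ≤ ∑ l ∈ range (X + 1), (l.divisors.card : ℝ) ^ 2 / l :=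
            sum_le_sum_of_subset_of_nonneg (range_mono (by
              have := Nat.div_le_self X (2 ^ i); omega)) fun _ _ _ => by positivity
        _ = ∑ l ∈ Icc 1 X, (l.divisors.card : ℝ) ^ 2 / l := by
            rw [sum_range_succ', sum_Icc_one_eq_sum_range]; simp
        _ ≤ (1 + Real.log X) ^ 4 := sum_card_divisors_sq_le X
        _ ≤ _ := pow_le_pow_left₀ (by have := Real.log_nonneg hX1r; linarith) (by linarith) 4
    have hlogR : 1 + 2 * Real.log R ≤ 2 * L := by
      have := Real.log_le_log (by linarith) hRN
      linarith
    have hlR0 : 0 ≤ Real.log R := Real.log_nonneg hR1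
    set M : ℝ := 2 ^ i with hM
    have hM0 : 0 < M := by positivity
    have hMX : M ≤ X := by rw [hM]; exact_mod_cast hiX
    have hD1 : (((2 ^ (i + 1) : ℕ) : ℝ) + R ^ 2 * (1 + 2 * Real.log R)) ≤ 2 * L * (2 * M + R ^ 2) := by
      have : ((2 ^ (i + 1) : ℕ) : ℝ) = 2 * M := by push_cast; rw [pow_succ]; ring
      rw [this]
      nlinarith [sq_nonneg (R : ℝ), mul_le_mul_of_nonneg_left hlogR (sq_nonneg (R : ℝ))]
    have hD2 : (((X / 2 ^ i + 1 : ℕ) : ℝ) + R ^ 2 * (1 + 2 * Real.log R)) ≤ 2 * L * (2 * N / M + R ^ 2) := by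
      have h1 : ((X / 2 ^ i : ℕ) : ℝ) ≤ X / M := by
        have := Nat.cast_div_le (α := ℝ) (m := X) (n := 2 ^ i)
        push_cast at this; exact this
      have h2 : (X : ℝ) / M ≤ N / M := by gcongr
      have h3 : 1 ≤ N / M := by rw [one_le_div hM0]; linarith
      have h4 : 2 * N / M = 2 * (N / M) := by ring
      rw [h4]
      push_cast
      nlinarith [sq_nonneg (R : ℝ), mul_le_mul_of_nonneg_left hlogR (sq_nonneg (R : ℝ))]
    have hM1 : M ≤ N / U := by
      rw [le_div_iff₀ hU0]
      have : 2 ^ i * U ≤ X := by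
        have h : U < X / 2 ^ i := by omega
        have := (Nat.le_div_iff_mul_le (by positivity)).mp h.le
        linarith
      have : (2 : ℝ) ^ i * U ≤ X := by exact_mod_cast this
      linarith
    have hM2 : 1 / M ≤ 2 / U := by
      rw [div_le_div_iff₀ hM0 hU0, one_mul]
      have : U ≤ 2 ^ (i + 1) := by omega
      have : (U : ℝ) ≤ 2 ^ (i + 1) := by exact_mod_cast this
      rw [pow_succ] at this; linarith
    have hsN : √N ^ 2 = N := Real.sq_sqrt hN.le
    have hprod := block_product_le hN hU0 (R := R) (by linarith) hM0 hM1 hM2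
    have hs0 : 0 ≤ √N + R * √N / √U + R ^ 2 := by positivity
    have hsqrt : √(((((2 ^ (i + 1) : ℕ) : ℝ) + R ^ 2 * (1 + 2 * Real.log R)) *
          ∑ m ∈ range (2 ^ (i + 1)), ‖dyadicPart (highPart U Λ) X i m‖ ^ 2 / m) *
        ((((X / 2 ^ i + 1 : ℕ) : ℝ) + R ^ 2 * (1 + 2 * Real.log R)) *
          ∑ l ∈ range (X / 2 ^ i + 1), ‖(b l : ℂ)‖ ^ 2 / l)) ≤ 6 * L ^ 5 * (√N + R * √N / √U + R ^ 2) := by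
      apply Real.sqrt_le_iff.mpr
      refine ⟨by positivity, ?_⟩
      calc _ ≤ ((2 * L * (2 * M + R ^ 2)) * L ^ 3) * ((2 * L * (2 * N / M + R ^ 2)) * L ^ 4) := by
            have z1 : 0 ≤ ∑ m ∈ range (2 ^ (i + 1)), ‖dyadicPart (highPart U Λ) X i m‖ ^ 2 / (m : ℝ) :=
              sum_nonneg fun _ _ => by positivity
            have z2 : 0 ≤ ∑ l ∈ range (X / 2 ^ i + 1), ‖(b l : ℂ)‖ ^ 2 / (l : ℝ) :=
              sum_nonneg fun _ _ => by positivity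
            exact mul_le_mul (mul_le_mul hD1 hA2 z1 (by positivity)) (mul_le_mul hD2 hB2 z2 (by positivity))
              (mul_nonneg (by positivity) z2) (by positivity)
        _ = 4 * L ^ 9 * ((2 * M + R ^ 2) * (2 * N / M + R ^ 2)) := by ring
        _ ≤ 4 * L ^ 10 * (3 * (√N + R * √N / √U + R ^ 2)) ^ 2 := by
            refine mul_le_mul ?_ hprod (by positivity) (by positivity)
            exact mul_le_mul_of_nonneg_left (pow_le_pow_right₀ hL1 (by norm_num)) (by norm_num)
        _ = _ := by ring
    calc _ ≤ kernNorm J * √N * (6 * L ^ 5 * (√N + R * √N / √U + R ^ 2)) :=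
          mul_le_mul_of_nonneg_left hsqrt (by positivity)
      _ = 6 * kernNorm J * L ^ 5 * (√N ^ 2 + R * √N ^ 2 / √U + R ^ 2 * √N) := by ring
      _ = B := by rw [hsN]
  have hcount : ((Nat.log 2 X + 1 : ℕ) : ℝ) ≤ 2 * L := by
    have h1 : (Nat.log 2 X : ℝ) * Real.log 2 ≤ Real.log X := by
      rw [← Real.log_pow]
      refine Real.log_le_log (by positivity) ?_
      exact_mod_cast Nat.pow_log_le_self 2 (by omega)
    have h2 := Real.log_two_gt_d9
    have h3 : (0 : ℝ) ≤ Nat.log 2 X := Nat.cast_nonneg _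
    push_cast
    nlinarith
  calc _ ≤ ∑ x ∈ primChars R, ∑ i ∈ range (Nat.log 2 X + 1),
        ‖∑ m ∈ range (2 ^ (i + 1)), ∑ l ∈ range (X / 2 ^ i + 1),
        dyadicPart (highPart U Λ) X i m * x.2 (m : ZMod x.1) * ((b l : ℂ) * x.2 (l : ZMod x.1)) * wt J (l * (m / N))‖ := by
        refine sum_le_sum fun x _ => ?_
        rw [twSum_mul_eq_sum_dyadic hJ hN]
        exact norm_sum_le _ _
    _ ≤ ∑ i ∈ range (Nat.log 2 X + 1), B := by
        rw [sum_comm]; exact sum_le_sum hblock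
    _ = ((Nat.log 2 X + 1 : ℕ) : ℝ) * B := by simp
    _ ≤ 2 * L * B := mul_le_mul_of_nonneg_right hcount hB0
    _ = _ := by rw [hB]; ring

lemma card_primitive_le (r : ℕ) [NeZero r] :
    ((univ.filter fun χ : DirichletCharacter ℂ r => χ.IsPrimitive).card : ℝ) ≤ r := by
  have h1 : (univ.filter fun χ : DirichletCharacter ℂ r => χ.IsPrimitive).card ≤ r := by
    refine (card_le_univ _).trans ?_
    rw [← Nat.card_eq_fintype_card, card_eq_totient_of_hasEnoughRootsOfUnity]
    exact Nat.totient_le r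
  exact_mod_cast h1

lemma ne_one_of_isPrimitive {r : ℕ} [NeZero r] {χ : DirichletCharacter ℂ r} (h : χ.IsPrimitive) (hr : r ≠ 1) : χ ≠ 1 := by
  rintro rfl
  rw [isPrimitive_def, conductor_one] at h
  exact hr h.symm

/-- Mean value of `psiW` over primitive characters. -/
theorem sum_primitive_psiW_le {J : ℕ} (hJ : J ≠ 0) {N : ℝ} {U R : ℕ} (hU : 1 ≤ U) (hUN : U ^ 2 ≤ N) (hRN : R ≤ N) :
    ∑ r ∈ Icc 2 R, ∑ χ : DirichletCharacter ℂ r with χ.IsPrimitive, ‖psiW J N χ‖ ≤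
      (12 * kernNorm J + 4) * (1 + Real.log N) ^ 6 * (N + R * N / √U + R ^ 2 * √N + R ^ 3 * U ^ 2) := by
  have hU1 : (1 : ℝ) ≤ U := by exact_mod_cast hU
  have hN1 : 1 ≤ N := by nlinarith
  have hN : 0 < N := by linarith
  have hK := kernNorm_nonneg J
  have hlog : 0 ≤ Real.log N := Real.log_nonneg hN1
  rcases Nat.eq_zero_or_pos R with rfl | hR
  · simp; positivity
  have h2 := sum_type_II_le hJ hU hN1 hR hRN
  rw [primChars, sum_sigma] at h2
  have hsub : Icc 2 R ⊆ Icc 1 R := Icc_subset_Icc_left (by norm_num)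
  set T : ∀ r : ℕ, DirichletCharacter ℂ r → ℂ := fun r χ => twSum J N χ (highPart U Λ * (highPart U moebR * zetaR)) with hT
  have h1 : ∑ r ∈ Icc 2 R, ∑ χ : DirichletCharacter ℂ r with χ.IsPrimitive, ‖psiW J N χ - T r χ‖ ≤
      4 * Real.log N * (R ^ 3 * U ^ 2) := by
    calc _ ≤ ∑ r ∈ Icc 2 R, (4 * U ^ 2 * Real.log N * R ^ 2 : ℝ) := by
          refine sum_le_sum fun r hr => ?_
          rw [mem_Icc] at hr
          have : NeZero r := ⟨by omega⟩
          have hrR : (r : ℝ) ≤ R := by exact_mod_cast hr.2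
          calc _ ≤ ∑ χ : DirichletCharacter ℂ r with χ.IsPrimitive, 4 * U ^ 2 * r * Real.log N :=
                sum_le_sum fun χ hχ =>
                  norm_type_I_le (ne_one_of_isPrimitive (mem_filter.mp hχ).2 (by omega)) hJ hU hUN
            _ = ((univ.filter fun χ : DirichletCharacter ℂ r => χ.IsPrimitive).card : ℝ) *
                (4 * U ^ 2 * r * Real.log N) := by rw [sum_const, nsmul_eq_mul]
            _ ≤ r * (4 * U ^ 2 * r * Real.log N) := mul_le_mul_of_nonneg_right (card_primitive_le r) (by positivity)
            _ = 4 * U ^ 2 * Real.log N * r ^ 2 := by ring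
            _ ≤ _ := by gcongr
      _ ≤ R * (4 * U ^ 2 * Real.log N * R ^ 2) := by
          rw [sum_const, nsmul_eq_mul]
          refine mul_le_mul_of_nonneg_right ?_ (by positivity)
          rw [Nat.card_Icc]; exact_mod_cast (by omega : R + 1 - 2 ≤ R)
      _ = _ := by ring
  have h3 : ∑ r ∈ Icc 2 R, ∑ χ : DirichletCharacter ℂ r with χ.IsPrimitive, ‖T r χ‖ ≤
      12 * kernNorm J * (1 + Real.log N) ^ 6 * (N + R * N / √U + R ^ 2 * √N) :=
    (sum_le_sum_of_subset_of_nonneg hsub fun _ _ _ => sum_nonneg fun _ _ => norm_nonneg _).trans h2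
  have hL : Real.log N ≤ (1 + Real.log N) ^ 6 :=
    (by linarith : Real.log N ≤ 1 + Real.log N).trans (le_self_pow₀ (by linarith) (by norm_num))
  calc _ ≤ ∑ r ∈ Icc 2 R, ∑ χ : DirichletCharacter ℂ r with χ.IsPrimitive, (‖psiW J N χ - T r χ‖ + ‖T r χ‖) := by
        refine sum_le_sum fun r _ => sum_le_sum fun χ _ => ?_
        have := norm_add_le (psiW J N χ - T r χ) (T r χ)
        rwa [sub_add_cancel] at this
    _ ≤ 4 * Real.log N * (R ^ 3 * U ^ 2) + 12 * kernNorm J * (1 + Real.log N) ^ 6 * (N + R * N / √U + R ^ 2 * √N) := by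
        simp only [sum_add_distrib]; exact add_le_add h1 h3
    _ ≤ 4 * (1 + Real.log N) ^ 6 * (R ^ 3 * U ^ 2) + 12 * kernNorm J * (1 + Real.log N) ^ 6 * (N + R * N / √U + R ^ 2 * √N) := by
        gcongr
    _ ≤ _ := by
        have e1 : 0 ≤ (1 + Real.log N) ^ 6 * (N + R * N / √U + R ^ 2 * √N) := by positivity
        have e2 : 0 ≤ kernNorm J * (1 + Real.log N) ^ 6 * (R ^ 3 * U ^ 2) := by positivity
        nlinarith

lemma le_totient_mul {r : ℕ} (hr : Squarefree r) : (r : ℝ) ≤ r.totient * (1 + Real.log r) ^ 2 := by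
  have h1 : (r.totient : ℝ) = r * ∏ p ∈ r.primeFactors, (1 - (p : ℝ)⁻¹) := by
    have := Nat.totient_eq_mul_prod_factors r
    have h := congrArg (fun x : ℚ => (x : ℝ)) this
    push_cast at h
    exact h
  have h2 : 1 ≤ (∏ p ∈ r.primeFactors, (1 - (p : ℝ)⁻¹)) * (∏ p ∈ r.primeFactors, (1 + 1 / (p : ℝ))) ^ 2 := by
    rw [← prod_pow, ← prod_mul_distrib]
    refine (prod_le_prod (f := fun _ => (1 : ℝ)) (fun _ _ => zero_le_one) fun p hp => ?_).trans' (by simp)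
    have h2 : (2 : ℝ) ≤ p := by exact_mod_cast (Nat.prime_of_mem_primeFactors hp).two_le
    have e : (1 - (p : ℝ)⁻¹) * (1 + 1 / (p : ℝ)) ^ 2 = (p - 1) * (p + 1) ^ 2 / p ^ 3 := by field_simp
    rw [e, le_div_iff₀ (by positivity)]
    nlinarith
  have h3 : (∏ p ∈ r.primeFactors, (1 + 1 / (p : ℝ))) ^ 2 ≤ (1 + Real.log r) ^ 2 :=
    pow_le_pow_left₀ (prod_nonneg fun _ _ => by positivity) (prod_one_add_inv_le hr) 2
  have h4 : 0 ≤ ∏ p ∈ r.primeFactors, (1 - (p : ℝ)⁻¹) := by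
    refine prod_nonneg fun p hp => ?_
    have := (Nat.prime_of_mem_primeFactors hp).one_lt
    have : (1 : ℝ) ≤ p := by exact_mod_cast this.le
    have := inv_le_one_of_one_le₀ this
    linarith
  rw [h1]
  calc (r : ℝ) = r * 1 := (mul_one _).symm
    _ ≤ r * ((∏ p ∈ r.primeFactors, (1 - (p : ℝ)⁻¹)) * (∏ p ∈ r.primeFactors, (1 + 1 / (p : ℝ))) ^ 2) := by gcongr
    _ ≤ r * ((∏ p ∈ r.primeFactors, (1 - (p : ℝ)⁻¹)) * (1 + Real.log r) ^ 2) := by gcongr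
    _ = _ := by ring

lemma one_div_totient_le {r : ℕ} (hr : Squarefree r) {L : ℝ} (hL : 1 + Real.log r ≤ L) :
    1 / (r.totient : ℝ) ≤ L ^ 2 * (1 / r) := by
  have h0 : 0 < r := Nat.pos_of_ne_zero hr.ne_zero
  have h1 : (0 : ℝ) < r := by exact_mod_cast h0
  have h2 : (0 : ℝ) < r.totient := by exact_mod_cast Nat.totient_pos.mpr h0
  have h3 : 0 ≤ Real.log r := Real.log_natCast_nonneg r
  rw [mul_one_div, div_le_div_iff₀ h2 h1, one_mul]
  refine (le_totient_mul hr).trans ?_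
  rw [mul_comm]
  gcongr

/-- Sum of `1/φ(q)` over squarefree multiples of `r`. -/
lemma sum_one_div_totient_le {r Q : ℕ} (hr : r ≠ 0) {L : ℝ} (hL : 1 + Real.log Q ≤ L) (s : Finset ℕ)
    (hs : ∀ q ∈ s, q ∈ Icc 1 Q ∧ Squarefree q ∧ r ∣ q) :
    ∑ q ∈ s, 1 / (q.totient : ℝ) ≤ L ^ 3 * (1 / r.totient) := by
  have hL0 : 0 ≤ L := by have := Real.log_natCast_nonneg Q; linarith
  have hinj : Set.InjOn (fun q => q / r) (s : Set ℕ) := by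
    intro a ha b hb hab
    have h1 := (hs a ha).2.2
    have h2 := (hs b hb).2.2
    rw [← Nat.div_mul_cancel h1, ← Nat.div_mul_cancel h2]
    simp only at hab
    rw [hab]
  calc ∑ q ∈ s, 1 / (q.totient : ℝ) ≤ ∑ q ∈ s, L ^ 2 * (1 / ((q / r : ℕ) : ℝ)) * (1 / r.totient) := by
        refine sum_le_sum fun q hq => ?_
        obtain ⟨hq1, hsq, d, rfl⟩ := hs q hq
        rw [Nat.mul_div_cancel_left _ (Nat.pos_of_ne_zero hr)]
        have hcop : Nat.Coprime r d := Nat.coprime_of_squarefree_mul hsq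
        rw [Nat.totient_mul hcop]
        push_cast
        rw [← one_div_mul_one_div, mul_comm]
        refine mul_le_mul_of_nonneg_right ?_ (by positivity)
        refine one_div_totient_le (hsq.squarefree_of_dvd (Dvd.intro_left r rfl)) (le_trans ?_ hL)
        rw [mem_Icc] at hq1
        have hd0 : 0 < d := Nat.pos_of_ne_zero fun h => by simp [h] at hq1
        have : d ≤ Q := (Nat.le_mul_of_pos_left d (Nat.pos_of_ne_zero hr)).trans hq1.2
        have : Real.log d ≤ Real.log Q := Real.log_le_log (by exact_mod_cast hd0) (by exact_mod_cast this)
        linarith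
    _ = L ^ 2 * (1 / r.totient) * ∑ d ∈ s.image (fun q => q / r), 1 / (d : ℝ) := by
        rw [sum_image hinj, mul_sum]
        exact sum_congr rfl fun _ _ => by ring
    _ ≤ L ^ 2 * (1 / r.totient) * ∑ d ∈ Icc 1 Q, 1 / (d : ℝ) := by
        refine mul_le_mul_of_nonneg_left (sum_le_sum_of_subset_of_nonneg ?_ fun _ _ _ => by positivity)
          (by positivity)
        intro d hd
        obtain ⟨q, hq, rfl⟩ := mem_image.mp hd
        obtain ⟨hq1, hsq, hd⟩ := hs q hq
        rw [mem_Icc] at hq1 ⊢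
        exact ⟨Nat.div_pos (Nat.le_of_dvd (by omega) hd) (Nat.pos_of_ne_zero hr), (Nat.div_le_self _ _).trans hq1.2⟩
    _ ≤ L ^ 2 * (1 / r.totient) * L := by
        refine mul_le_mul_of_nonneg_left ((sum_inv_le_log Q).trans hL) (by positivity)
    _ = _ := by ring

/-- Prime powers not coprime to `q` contribute little. -/
lemma sum_vonMangoldt_not_coprime_le {q : ℕ} (hq : q ≠ 0) {N L : ℝ} (hN : 1 ≤ N) (hqN : q ≤ N) (hL : 1 + Real.log N ≤ L) :
    ∑ n ∈ (Icc 1 ⌊N⌋₊).filter (fun n => ¬ n.Coprime q), Λ n ≤ 4 * L ^ 3 := by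
  classical
  have hlog : 0 ≤ Real.log N := Real.log_nonneg hN
  set X := ⌊N⌋₊ with hX
  have hXN : (X : ℝ) ≤ N := Nat.floor_le (by linarith)
  have hlog2 : ∀ m : ℕ, (m : ℝ) ≤ N → ((Nat.log 2 m + 1 : ℕ) : ℝ) ≤ 2 * L := by
    intro m hm
    rcases Nat.eq_zero_or_pos m with rfl | hm0
    · simp; linarith
    have h1 : (Nat.log 2 m : ℝ) * Real.log 2 ≤ Real.log m := by
      rw [← Real.log_pow]
      refine Real.log_le_log (by positivity) ?_
      exact_mod_cast Nat.pow_log_le_self 2 (by omega)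
    have h4 : Real.log m ≤ Real.log N := Real.log_le_log (by exact_mod_cast hm0) hm
    have h2 := Real.log_two_gt_d9
    have h3 : (0 : ℝ) ≤ Nat.log 2 m := Nat.cast_nonneg _
    push_cast
    nlinarith
  set S := ((Icc 1 X).filter (fun n => ¬ n.Coprime q)).filter IsPrimePow with hS
  have hsub : S ⊆ (q.primeFactors ×ˢ range (Nat.log 2 X + 1)).image fun x => x.1 ^ x.2 := by
    intro n hn
    simp only [hS, mem_filter, mem_Icc] at hn
    obtain ⟨⟨⟨hn1, hnX⟩, hcop⟩, hpp⟩ := hn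
    obtain ⟨p, k, hp, hk, rfl⟩ := hpp
    rw [← Nat.prime_iff] at hp
    refine mem_image.mpr ⟨(p, k), mem_product.mpr ⟨?_, ?_⟩, rfl⟩
    · rw [Nat.mem_primeFactors]
      refine ⟨hp, ?_, hq⟩
      by_contra h
      exact hcop (Nat.Coprime.pow_left _ ((Nat.Prime.coprime_iff_not_dvd hp).mpr h))
    · rw [mem_range, Nat.lt_succ_iff]
      exact Nat.le_log_of_pow_le (by norm_num) ((Nat.pow_le_pow_left hp.two_le k).trans hnX)
  have hcardq : (q.primeFactors.card : ℝ) ≤ 2 * L := by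
    refine le_trans ?_ (hlog2 q hqN)
    have h2 : 2 ^ q.primeFactors.card ≤ q := by
      calc 2 ^ q.primeFactors.card = ∏ p ∈ q.primeFactors, 2 := by simp
        _ ≤ ∏ p ∈ q.primeFactors, p := prod_le_prod' fun p hp => (Nat.prime_of_mem_primeFactors hp).two_le
        _ ≤ q := Nat.le_of_dvd (Nat.pos_of_ne_zero hq) (Nat.prod_primeFactors_dvd q)
    have := Nat.le_log_of_pow_le (by norm_num) h2
    exact_mod_cast (by omega : q.primeFactors.card ≤ Nat.log 2 q + 1)
  have hcard : (S.card : ℝ) ≤ 2 * L * (2 * L) := by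
    have h1 : S.card ≤ q.primeFactors.card * (Nat.log 2 X + 1) := by
      refine (card_le_card hsub).trans (card_image_le.trans ?_)
      rw [card_product, card_range]
    calc (S.card : ℝ) ≤ q.primeFactors.card * ((Nat.log 2 X + 1 : ℕ) : ℝ) := by exact_mod_cast h1
      _ ≤ _ := by
        have := hlog2 X hXN
        exact mul_le_mul hcardq this (by positivity) (by linarith)
  calc _ = ∑ n ∈ S, Λ n := by
        rw [hS, sum_filter IsPrimePow]
        refine sum_congr rfl fun n _ => ?_
        split_ifs with h
        · rfl
        · rw [vonMangoldt_apply, if_neg h]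
    _ ≤ ∑ n ∈ S, L := by
        refine sum_le_sum fun n hn => ?_
        simp only [hS, mem_filter, mem_Icc] at hn
        refine vonMangoldt_le_log.trans ?_
        have : Real.log n ≤ Real.log N := by
          refine Real.log_le_log (by exact_mod_cast hn.1.1.1) (le_trans ?_ hXN)
          exact_mod_cast hn.1.1.2
        linarith
    _ = S.card * L := by rw [sum_const, nsmul_eq_mul]
    _ ≤ 2 * L * (2 * L) * L := mul_le_mul_of_nonneg_right hcard (by linarith)
    _ = _ := by ring

lemma norm_psiW_sub_primitive_le {q : ℕ} [NeZero q] (χ : DirichletCharacter ℂ q) (J : ℕ) {N L : ℝ} (hN : 1 ≤ N)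
    (hqN : q ≤ N) (hL : 1 + Real.log N ≤ L) :
    ‖psiW J N χ - psiW J N χ.primitiveCharacter‖ ≤ 4 * L ^ 3 := by
  refine le_trans ?_ (sum_vonMangoldt_not_coprime_le (NeZero.ne q) hN hqN hL)
  rw [psiW, psiW, ← sum_sub_distrib, sum_filter]
  refine (norm_sum_le _ _).trans (sum_le_sum fun n _ => ?_)
  by_cases h : n.Coprime q
  · rw [if_neg (not_not.mpr h)]
    have := primitiveCharacter_apply_of_isCoprime χ (a := (n : ℤ)) (Nat.isCoprime_iff_coprime.mpr h)
    push_cast at this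
    rw [this, sub_self, norm_zero]
  · rw [if_pos h]
    have h1 : χ (n : ZMod q) = 0 := by
      apply MulChar.map_nonunit
      rwa [ZMod.isUnit_iff_coprime]
    rw [h1, mul_zero, zero_mul, zero_sub, norm_neg, norm_mul, norm_mul, norm_real, norm_real,
      Real.norm_of_nonneg vonMangoldt_nonneg, Real.norm_of_nonneg (wt_nonneg _ _)]
    calc Λ n * ‖χ.primitiveCharacter (n : ZMod _)‖ * wt J (n / N) ≤ Λ n * 1 * 1 := by
          refine mul_le_mul (mul_le_mul_of_nonneg_left (DirichletCharacter.norm_le_one _ _) vonMangoldt_nonneg)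
            (wt_le_one _ (by positivity)) (wt_nonneg _ _) (by simp)
      _ = Λ n := by ring

/-- The smoothly weighted Chebyshev function in an arithmetic progression. -/
noncomputable def psiAP (J : ℕ) (N : ℝ) (q a : ℕ) : ℝ :=
  ∑ n ∈ (Icc 1 ⌊N⌋₊).filter (fun n => n ≡ a [MOD q]), Λ n * wt J (n / N)

/-- The smoothly weighted Chebyshev function. -/
noncomputable def psiTot (J : ℕ) (N : ℝ) : ℝ := ∑ n ∈ Icc 1 ⌊N⌋₊, Λ n * wt J (n / N)

lemma totient_mul_psiAP {q : ℕ} [NeZero q] (J : ℕ) (N : ℝ) {a : ℕ} (ha : a.Coprime q) :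
    (q.totient : ℂ) * psiAP J N q a = ∑ χ : DirichletCharacter ℂ q, χ (a : ZMod q)⁻¹ * psiW J N χ := by
  have hu : IsUnit (a : ZMod q) := (ZMod.isUnit_iff_coprime _ _).mpr ha
  simp only [psiW, mul_sum]
  rw [sum_comm, psiAP, sum_filter]
  push_cast
  rw [mul_sum]
  refine sum_congr rfl fun n _ => ?_
  have h := sum_char_inv_mul_char_eq ℂ hu (n : ZMod q)
  calc _ = (if (a : ZMod q) = n then (q.totient : ℂ) else 0) * (Λ n * wt J (n / N)) := by
        have : n ≡ a [MOD q] ↔ (a : ZMod q) = n := by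
          rw [ZMod.natCast_eq_natCast_iff]; exact ⟨Nat.ModEq.symm, Nat.ModEq.symm⟩
        simp only [this]
        split_ifs <;> simp
    _ = _ := by
        rw [← h, sum_mul]
        exact sum_congr rfl fun χ _ => by ring

/-- The sum of `‖psiW χ‖` over primitive characters modulo `r`. -/
noncomputable def primSum (J : ℕ) (N : ℝ) (r : ℕ) : ℝ :=
  ∑ χ : DirichletCharacter ℂ r with χ.IsPrimitive, ‖psiW J N χ‖

lemma primSum_nonneg (J : ℕ) (N : ℝ) (r : ℕ) : 0 ≤ primSum J N r := sum_nonneg fun _ _ => norm_nonneg _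

lemma sum_norm_primitive_le {q : ℕ} [NeZero q] (J : ℕ) (N : ℝ) :
    ∑ χ : DirichletCharacter ℂ q with χ ≠ 1, ‖psiW J N χ.primitiveCharacter‖ ≤
      ∑ r ∈ q.divisors.erase 1, primSum J N r := by
  classical
  set T : Finset (Σ r : ℕ, DirichletCharacter ℂ r) :=
    (q.divisors.erase 1).sigma fun r => univ.filter fun χ : DirichletCharacter ℂ r => χ.IsPrimitive with hT
  set e : DirichletCharacter ℂ q → Σ r : ℕ, DirichletCharacter ℂ r := fun χ => ⟨χ.conductor, χ.primitiveCharacter⟩ with he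
  have hinj : Function.Injective e := by
    intro χ ψ h
    have key : ∀ x : Σ r : ℕ, DirichletCharacter ℂ r, ∀ hd : x.1 ∣ q, ∀ y : Σ r : ℕ, DirichletCharacter ℂ r, ∀ hd' : y.1 ∣ q,
        x = y → changeLevel hd x.2 = changeLevel hd' y.2 := by
      rintro x hd y hd' rfl; rfl
    have := key _ χ.conductor_dvd_level _ ψ.conductor_dvd_level h
    exact (changeLevel_primitiveCharacter χ).symm.trans (this.trans (changeLevel_primitiveCharacter ψ))
  have h1 : ∑ χ : DirichletCharacter ℂ q with χ ≠ 1, ‖psiW J N χ.primitiveCharacter‖ =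
      ∑ x ∈ (univ.filter fun χ : DirichletCharacter ℂ q => χ ≠ 1).image e, ‖psiW J N x.2‖ := by
    rw [sum_image hinj.injOn]
  rw [h1]
  calc _ ≤ ∑ x ∈ T, ‖psiW J N x.2‖ := by
        refine sum_le_sum_of_subset_of_nonneg ?_ fun _ _ _ => norm_nonneg _
        intro x hx
        obtain ⟨χ, hχ, rfl⟩ := mem_image.mp hx
        have hχ1 := (mem_filter.mp hχ).2
        simp only [hT, he, mem_sigma, mem_erase, Nat.mem_divisors, mem_filter, mem_univ, true_and]
        refine ⟨⟨fun h => hχ1 ?_, χ.conductor_dvd_level, NeZero.ne q⟩, χ.primitiveCharacter_isPrimitive⟩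
        exact eq_one_iff_conductor_eq_one.mpr h
    _ = _ := by rw [hT, sum_sigma]; rfl

lemma abs_psiAP_sub_le {q : ℕ} (hq : q ≠ 0) {J : ℕ} {N L : ℝ} (hN : 1 ≤ N) (hqN : q ≤ N) (hL : 1 + Real.log N ≤ L)
    {a : ℕ} (ha : a.Coprime q) :
    |psiAP J N q a - psiTot J N / q.totient| ≤
      4 * L ^ 3 + 1 / q.totient * ∑ r ∈ q.divisors.erase 1, primSum J N r := by
  classical
  have : NeZero q := ⟨hq⟩
  have hL0 : 0 ≤ L := by have := Real.log_nonneg hN; linarith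
  have hφ : (0 : ℝ) < q.totient := by exact_mod_cast Nat.totient_pos.mpr (Nat.pos_of_ne_zero hq)
  have hcard : (Fintype.card (DirichletCharacter ℂ q) : ℝ) = q.totient := by
    rw [← Nat.card_eq_fintype_card, card_eq_totient_of_hasEnoughRootsOfUnity]
  have h1 := totient_mul_psiAP J N ha
  rw [← add_sum_erase _ _ (mem_univ (1 : DirichletCharacter ℂ q))] at h1
  have hu : IsUnit (a : ZMod q) := (ZMod.isUnit_iff_coprime _ _).mpr ha
  have h11 : (1 : DirichletCharacter ℂ q) (a : ZMod q)⁻¹ = 1 := by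
    apply MulChar.one_apply
    have := ZMod.inv_mul_of_unit _ hu
    exact IsUnit.of_mul_eq_one _ this
  rw [h11, one_mul] at h1
  have hprin : ‖psiW J N (1 : DirichletCharacter ℂ q) - psiTot J N‖ ≤ 4 * L ^ 3 := by
    have h := norm_psiW_sub_primitive_le (1 : DirichletCharacter ℂ q) J hN hqN hL
    have e : psiW J N (1 : DirichletCharacter ℂ q).primitiveCharacter = psiTot J N := by
      rw [primitiveCharacter_one, psiW, psiTot]
      push_cast
      refine sum_congr rfl fun n _ => ?_
      rw [MulChar.one_apply, mul_one]
      rw [ZMod.isUnit_iff_coprime, conductor_one]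
      exact Nat.coprime_one_right n
    rwa [e] at h
  have e2 : (q.totient : ℂ) * ((psiAP J N q a - psiTot J N / q.totient : ℝ) : ℂ) =
      (psiW J N (1 : DirichletCharacter ℂ q) - psiTot J N) +
        ∑ χ ∈ univ.erase (1 : DirichletCharacter ℂ q), χ (a : ZMod q)⁻¹ * psiW J N χ := by
    push_cast
    have : (q.totient : ℂ) ≠ 0 := by exact_mod_cast hφ.ne'
    rw [mul_sub, h1, mul_div_cancel₀ _ this]; ring
  have h3 := congrArg norm e2
  rw [norm_mul, norm_real, Real.norm_eq_abs, norm_natCast] at h3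
  have h4 : ‖∑ χ ∈ univ.erase (1 : DirichletCharacter ℂ q), χ (a : ZMod q)⁻¹ * psiW J N χ‖ ≤
      (q.totient - 1) * (4 * L ^ 3) + ∑ r ∈ q.divisors.erase 1, primSum J N r := by
    calc _ ≤ ∑ χ ∈ univ.erase (1 : DirichletCharacter ℂ q), (4 * L ^ 3 + ‖psiW J N χ.primitiveCharacter‖) := by
          refine (norm_sum_le _ _).trans (sum_le_sum fun χ _ => ?_)
          rw [norm_mul]
          refine (mul_le_of_le_one_left (norm_nonneg _) (χ.norm_le_one _)).trans ?_
          have h5 := norm_psiW_sub_primitive_le χ J hN hqN hL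
          have h6 := norm_add_le (psiW J N χ - psiW J N χ.primitiveCharacter) (psiW J N χ.primitiveCharacter)
          rw [sub_add_cancel] at h6
          linarith
      _ ≤ _ := by
          rw [sum_add_distrib]
          refine add_le_add (le_of_eq ?_) ?_
          · rw [sum_const, nsmul_eq_mul, card_erase_of_mem (mem_univ _), card_univ,
              Nat.cast_sub Fintype.card_pos, hcard]; simp
          · refine le_trans (le_of_eq (sum_congr ?_ fun _ _ => rfl)) (sum_norm_primitive_le (q := q) J N)
            ext χ; simp
  have h5 : q.totient * |psiAP J N q a - psiTot J N / q.totient| ≤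
      q.totient * (4 * L ^ 3) + ∑ r ∈ q.divisors.erase 1, primSum J N r := by
    rw [h3]
    refine (norm_add_le _ _).trans ?_
    linarith
  rw [← le_div_iff₀' hφ] at h5
  refine h5.trans (le_of_eq ?_)
  field_simp

/-- The moduli in the level of distribution statement. -/
def moduli (Q p : ℕ) : Finset ℕ := (Icc 1 Q).filter fun q => Squarefree q ∧ ¬ p ∣ q

lemma mem_moduli {Q p q : ℕ} : q ∈ moduli Q p ↔ (1 ≤ q ∧ q ≤ Q) ∧ Squarefree q ∧ ¬ p ∣ q := by
  rw [moduli, mem_filter, mem_Icc]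

lemma sum_abs_psiAP_sub_le {J Q p : ℕ} {N L : ℝ} (hN : 1 ≤ N) (hQN : Q ≤ N) (hL : 1 + Real.log N ≤ L)
    {a : ℕ → ℕ} (ha : ∀ q, (a q).Coprime q) :
    ∑ q ∈ moduli Q p, |psiAP J N q (a q) - psiTot J N / q.totient| ≤
      4 * L ^ 3 * Q + L ^ 3 * ∑ r ∈ (moduli Q p).erase 1, 1 / r.totient * primSum J N r := by
  have hlog := Real.log_nonneg hN
  have hL0 : 0 ≤ L := by linarith
  have hcard : ((moduli Q p).card : ℝ) ≤ Q := by
    have : (moduli Q p).card ≤ Q := (card_filter_le _ _).trans (by simp)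
    exact_mod_cast this
  calc _ ≤ ∑ q ∈ moduli Q p, (4 * L ^ 3 + ∑ r ∈ q.divisors.erase 1, 1 / q.totient * primSum J N r) := by
        refine sum_le_sum fun q hq => ?_
        rw [mem_moduli] at hq
        have hqQ : (q : ℝ) ≤ Q := by exact_mod_cast hq.1.2
        rw [← mul_sum]
        exact abs_psiAP_sub_le (by omega) hN (by linarith) hL (ha q)
    _ ≤ 4 * L ^ 3 * Q + ∑ r ∈ (moduli Q p).erase 1, ∑ q ∈ (moduli Q p).filter (fun q => r ∣ q),
          1 / q.totient * primSum J N r := by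
        rw [sum_add_distrib, sum_const, nsmul_eq_mul]
        refine add_le_add ?_ (le_of_eq ?_)
        · rw [mul_comm]
          exact mul_le_mul_of_nonneg_left hcard (by positivity)
        · refine sum_comm' fun q r => ?_
          simp only [mem_erase, Nat.mem_divisors, mem_filter, mem_moduli]
          constructor
          · rintro ⟨⟨⟨h1, h2⟩, h3, h4⟩, h5, h6, h7⟩
            exact ⟨⟨⟨⟨h1, h2⟩, h3, h4⟩, h6⟩, h5, ⟨Nat.pos_of_dvd_of_pos h6 h1, (Nat.le_of_dvd h1 h6).trans h2⟩,
              h3.squarefree_of_dvd h6, fun h => h4 (h.trans h6)⟩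
          · rintro ⟨⟨⟨⟨h1, h2⟩, h3, h4⟩, h6⟩, h5, -⟩
            exact ⟨⟨⟨h1, h2⟩, h3, h4⟩, h5, h6, by omega⟩
    _ ≤ _ := by
        refine add_le_add le_rfl ?_
        rw [mul_sum]
        refine sum_le_sum fun r hr => ?_
        rw [mem_erase, mem_moduli] at hr
        rw [← sum_mul, ← mul_assoc]
        refine mul_le_mul_of_nonneg_right ?_ (primSum_nonneg _ _ _)
        have hQ1 : (1 : ℝ) ≤ Q := by exact_mod_cast hr.2.1.1.trans hr.2.1.2
        refine sum_one_div_totient_le (Q := Q) (by omega) (le_trans ?_ hL) _ fun q hq => ?_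
        · have := Real.log_le_log (by linarith) hQN
          linarith
        · rw [mem_filter, mem_moduli] at hq
          exact ⟨mem_Icc.mpr hq.1.1, hq.1.2.1, hq.2⟩

lemma sum_large_conductor_le {J : ℕ} (hJ : J ≠ 0) {Q p U R₀ : ℕ} {N L : ℝ} (hU : 1 ≤ U) (hUN : U ^ 2 ≤ N)
    (hQN : 2 * Q ≤ N) (hR₀ : 1 ≤ R₀) (hL : 1 + Real.log N ≤ L) :
    ∑ r ∈ ((moduli Q p).erase 1).filter (fun r => R₀ < r), 1 / r.totient * primSum J N r ≤
      (24 * kernNorm J + 8) * L ^ 9 * (2 * N / R₀ + 2 * N / √U + 4 * Q * √N + 8 * Q ^ 2 * U ^ 2) := by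
  have hU1 : (1 : ℝ) ≤ U := by exact_mod_cast hU
  have hN1 : 1 ≤ N := by nlinarith
  have hN : 0 < N := by linarith
  have hlog := Real.log_nonneg hN1
  have hL1 : 1 ≤ L := by linarith
  have hK := kernNorm_nonneg J
  have hR0 : (0 : ℝ) < R₀ := by exact_mod_cast hR₀
  rcases Nat.eq_zero_or_pos Q with rfl | hQ
  · simp [moduli]; positivity
  have hQ0 : (0 : ℝ) < Q := by exact_mod_cast hQ
  set I := (range (Nat.log 2 Q + 1)).filter (fun i => R₀ < 2 ^ (i + 1)) with hI
  have hdy : ∀ r ∈ ((moduli Q p).erase 1).filter (fun r => R₀ < r), 1 / (r.totient : ℝ) * primSum J N r ≤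
      ∑ i ∈ I, L ^ 2 * (1 / 2 ^ i) * (if r ∈ Icc 2 (2 ^ (i + 1)) then primSum J N r else 0) := by
    intro r hr
    rw [mem_filter, mem_erase, mem_moduli] at hr
    obtain ⟨⟨hr1, ⟨hr2, hrQ⟩, hsq, -⟩, hRr⟩ := hr
    have hr0 : (0 : ℝ) < r := by exact_mod_cast hr2
    have hlt := Nat.lt_pow_succ_log_self (b := 2) (by norm_num) r
    have hi : Nat.log 2 r ∈ I := by
      rw [hI, mem_filter, mem_range]
      exact ⟨Nat.lt_succ_of_le (Nat.log_mono_right hrQ), hRr.trans hlt⟩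
    refine le_trans ?_ (single_le_sum (fun i _ => ?_) hi)
    · rw [if_pos (mem_Icc.mpr ⟨by omega, hlt.le⟩)]
      refine mul_le_mul_of_nonneg_right ?_ (primSum_nonneg _ _ _)
      refine (one_div_totient_le hsq (L := L) ?_).trans ?_
      · have h1 : (r : ℝ) ≤ Q := by exact_mod_cast hrQ
        have := Real.log_le_log hr0 (by linarith : (r : ℝ) ≤ N)
        linarith
      · have : (2 : ℝ) ^ Nat.log 2 r ≤ r := by exact_mod_cast Nat.pow_log_le_self 2 (by omega)
        gcongr
    · have := primSum_nonneg J N r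
      split_ifs <;> positivity
  refine (sum_le_sum hdy).trans ?_
  rw [sum_comm]
  set B := (12 * kernNorm J + 4) * L ^ 8 * (2 * N / R₀ + 2 * N / √U + 4 * Q * √N + 8 * Q ^ 2 * U ^ 2) with hB
  have hB0 : 0 ≤ B := by positivity
  have hblock : ∀ i ∈ I, ∑ r ∈ ((moduli Q p).erase 1).filter (fun r => R₀ < r),
      L ^ 2 * (1 / 2 ^ i) * (if r ∈ Icc 2 (2 ^ (i + 1)) then primSum J N r else 0) ≤ B := by
    intro i hi
    rw [hI, mem_filter, mem_range] at hi
    have hiQ : 2 ^ i ≤ Q :=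
      (Nat.pow_le_pow_right (by norm_num) (by omega : i ≤ Nat.log 2 Q)).trans (Nat.pow_log_le_self 2 (by omega))
    have hiQ' : (2 : ℝ) ^ i ≤ Q := by exact_mod_cast hiQ
    have hiR : (R₀ : ℝ) ≤ 2 ^ i * 2 := by rw [← pow_succ]; exact_mod_cast hi.2.le
    set M : ℝ := 2 ^ i with hM
    have hM0 : 0 < M := by positivity
    have e2 : ((2 ^ (i + 1) : ℕ) : ℝ) = 2 * M := by push_cast; rw [pow_succ]; ring
    have hmv := sum_primitive_psiW_le hJ (R := 2 ^ (i + 1)) hU hUN (by rw [e2]; linarith)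
    rw [e2] at hmv
    calc _ ≤ L ^ 2 * (1 / M) * ∑ r ∈ Icc 2 (2 ^ (i + 1)), primSum J N r := by
          rw [← mul_sum, ← sum_filter]
          refine mul_le_mul_of_nonneg_left ?_ (by positivity)
          refine sum_le_sum_of_subset_of_nonneg (fun r hr => (mem_filter.mp hr).2)
            fun _ _ _ => primSum_nonneg _ _ _
      _ ≤ L ^ 2 * (1 / M) * ((12 * kernNorm J + 4) * L ^ 6 *
            (N + 2 * M * N / √U + (2 * M) ^ 2 * √N + (2 * M) ^ 3 * U ^ 2)) := by
          refine mul_le_mul_of_nonneg_left (hmv.trans ?_) (by positivity)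
          gcongr
      _ = (12 * kernNorm J + 4) * L ^ 8 * (N / M + 2 * N / √U + 4 * M * √N + 8 * M ^ 2 * U ^ 2) := by
          field_simp; ring
      _ ≤ B := by
          rw [hB]
          have : N / M ≤ 2 * N / R₀ := by
            rw [div_le_div_iff₀ hM0 hR0]; nlinarith
          gcongr
  refine (sum_le_sum hblock).trans ?_
  rw [sum_const, nsmul_eq_mul]
  have hcount : (I.card : ℝ) ≤ 2 * L := by
    have h0 : I.card ≤ Nat.log 2 Q + 1 := (card_filter_le _ _).trans (by simp)
    have h0' : (I.card : ℝ) ≤ Nat.log 2 Q + 1 := by exact_mod_cast h0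
    have h1 : (Nat.log 2 Q : ℝ) * Real.log 2 ≤ Real.log Q := by
      rw [← Real.log_pow]
      refine Real.log_le_log (by positivity) ?_
      exact_mod_cast Nat.pow_log_le_self 2 (by omega)
    have h4 : Real.log Q ≤ Real.log N := Real.log_le_log hQ0 (by linarith)
    have h2 := Real.log_two_gt_d9
    have h3 : (0 : ℝ) ≤ Nat.log 2 Q := Nat.cast_nonneg _
    nlinarith
  calc _ ≤ 2 * L * B := mul_le_mul_of_nonneg_right hcount hB0
    _ = _ := by rw [hB]; ring

lemma eventually_log_pow_le {ε : ℝ} (hε : 0 < ε) (c : ℝ) (K : ℕ) :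
    ∀ᶠ N : ℝ in atTop, c * Real.log N ^ K ≤ N ^ ε := by
  have h := (isLittleO_log_rpow_rpow_atTop (K : ℝ) hε).const_mul_left c
  have h2 := h.bound (c := 1) one_pos
  filter_upwards [h2, eventually_ge_atTop (1 : ℝ)] with N hN h1
  rw [one_mul, Real.norm_of_nonneg (by positivity : 0 ≤ N ^ ε), Real.rpow_natCast] at hN
  exact (le_abs_self _).trans hN

set_option maxHeartbeats 1600000 in
/-- A Bombieri–Vinogradov theorem for squarefree moduli avoiding the multiples of a suitable large prime. -/
theorem bombieri_vinogradov (A : ℕ) {δ : ℝ} (hδ : 0 < δ) (hδ1 : δ < 1 / 2) (D : ℕ) :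
    ∃ J : ℕ, J ≠ 0 ∧ ∃ N₀ : ℝ, ∀ N ≥ N₀, ∃ p : ℕ, p.Prime ∧ D < p ∧ ∀ a : ℕ → ℕ, (∀ q, (a q).Coprime q) →
      ∑ q ∈ moduli ⌊N ^ (1 / 2 - δ)⌋₊ p, |psiAP J N q (a q) - psiTot J N / q.totient| ≤ N / Real.log N ^ A := by
  set b := A + 13 with hb
  set m := 2 * b + A + 4 with hm
  set j := 2 * m + 1 with hj
  set J := 5 * j + 6 with hJ
  have hJ0 : J ≠ 0 := by omega
  obtain ⟨C, hC0, hC⟩ := exists_norm_psiW_le j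
  obtain ⟨l₀, hl₀, hexc⟩ := exists_exceptional_prime D
  have hK := kernNorm_nonneg J
  set CJ := 24 * kernNorm J + 8 with hCJ
  have hCJ0 : 0 < CJ := by positivity
  refine ⟨J, hJ0, ?_⟩
  rw [← Filter.eventually_atTop]
  have t40 : Tendsto (fun N : ℝ => Real.log N ^ (1 / 40 : ℝ)) atTop atTop :=
    (tendsto_rpow_atTop (by norm_num)).comp Real.tendsto_log_atTop
  have E3 : ∀ᶠ N : ℝ in atTop, b * Real.log (Real.log N) ^ 1 ≤ Real.log N ^ (1 / 40 : ℝ) :=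
    Real.tendsto_log_atTop.eventually (eventually_log_pow_le (by norm_num) b 1)
  filter_upwards [eventually_ge_atTop (4 : ℝ), t40.eventually_ge_atTop l₀, E3,
    eventually_log_pow_le (ε := δ / 4) (by positivity) (32 + 2 ^ 20 * CJ) (A + 13),
    Real.tendsto_log_atTop.eventually_ge_atTop (8 * C + 2 ^ 18 * CJ + 1),
    eventually_log_pow_le (ε := δ / 2) (by positivity) 2 0] with N hN4 hl hlr hN1 hlogN hNU
  have hN0 : 0 < N := by linarith
  have hN1' : 1 ≤ N := by linarith
  set ℓ := Real.log N with hℓ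
  set l := ℓ ^ (1 / 40 : ℝ) with hldef
  have hℓ1 : 1 ≤ ℓ := by
    have : 0 ≤ 8 * C + 2 ^ 18 * CJ := by positivity
    linarith
  have hℓ0 : 0 < ℓ := by linarith
  have hl40 : l ^ 40 = ℓ := by
    rw [hldef, ← Real.rpow_natCast, ← Real.rpow_mul hℓ0.le]; norm_num
  have hl1 : 1 ≤ l := by linarith
  obtain ⟨p, hp, hDp, hne⟩ := hexc l hl
  refine ⟨p, hp, hDp, fun a ha => ?_⟩
  set Q := ⌊N ^ (1 / 2 - δ)⌋₊ with hQ
  set U := ⌊N ^ (δ / 2)⌋₊ with hU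
  set R₀ := ⌊ℓ ^ b⌋₊ with hR₀
  set L := 1 + ℓ with hL
  have hL2 : L ≤ 2 * ℓ := by linarith
  have hL0 : 0 < L := by linarith
  have hNε : 0 < N ^ (δ / 4) := by positivity
  set Z := N ^ (1 - δ / 4) with hZ
  have hZ0 : 0 < Z := by positivity
  have hZN : Z * N ^ (δ / 4) = N := by
    rw [hZ, ← Real.rpow_add hN0]; norm_num
  have hQle : (Q : ℝ) ≤ N ^ (1 / 2 - δ) := Nat.floor_le (by positivity)
  have hU0 : (U : ℝ) ≤ N ^ (δ / 2) := Nat.floor_le (by positivity)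
  have hUge : N ^ (δ / 2) / 2 ≤ U := by
    have := Nat.sub_one_lt_floor (N ^ (δ / 2))
    rw [pow_zero, mul_one] at hNU
    linarith
  have hU1 : 1 ≤ U := by
    apply Nat.le_floor
    rw [pow_zero, mul_one] at hNU
    push_cast; linarith
  have hU1r : (1 : ℝ) ≤ U := by exact_mod_cast hU1
  have hmono : ∀ x y : ℝ, x ≤ y → N ^ x ≤ N ^ y := fun x y h => Real.rpow_le_rpow_of_exponent_le hN1' h
  have hUN : (U : ℝ) ^ 2 ≤ N := by
    calc (U : ℝ) ^ 2 ≤ (N ^ (δ / 2)) ^ 2 := by gcongr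
      _ = N ^ δ := by rw [← Real.rpow_natCast, ← Real.rpow_mul hN0.le]; norm_num
      _ ≤ N ^ (1 : ℝ) := hmono _ _ (by linarith)
      _ = N := Real.rpow_one N
  have hsqN : √N = N ^ (1 / 2 : ℝ) := Real.sqrt_eq_rpow N
  have hs2 : 2 ≤ √N := by
    rw [show (2 : ℝ) = √4 by rw [show (4 : ℝ) = 2 ^ 2 by norm_num, Real.sqrt_sq (by norm_num)]]
    exact Real.sqrt_le_sqrt hN4
  have hQs : (Q : ℝ) ≤ √N := hQle.trans (by rw [hsqN]; exact hmono _ _ (by linarith))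
  have hQN : 2 * (Q : ℝ) ≤ N := by
    have := Real.mul_self_sqrt hN0.le
    nlinarith
  have hR₀1 : 1 ≤ R₀ := Nat.le_floor (by push_cast; exact one_le_pow₀ hℓ1)
  have hR₀le : (R₀ : ℝ) ≤ ℓ ^ b := Nat.floor_le (by positivity)
  have hR₀ge : ℓ ^ b / 2 ≤ R₀ := by
    have h1 := Nat.sub_one_lt_floor (ℓ ^ b)
    have h2 : (1 : ℝ) ≤ R₀ := by exact_mod_cast hR₀1
    rcases le_or_gt (ℓ ^ b) 2 with h | h
    · linarith
    · linarith
  have hR₀0 : (0 : ℝ) < R₀ := by exact_mod_cast hR₀1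
  -- the four power-saving quantities
  have z1 : (Q : ℝ) ≤ Z := hQle.trans (hmono _ _ (by linarith))
  have z2 : N / √U ≤ 2 * Z := by
    have h1 : N ^ (δ / 4) / 2 ≤ √U := by
      apply Real.le_sqrt_of_sq_le
      have : (N ^ (δ / 4)) ^ 2 = N ^ (δ / 2) := by
        rw [← Real.rpow_natCast, ← Real.rpow_mul hN0.le]; congr 1; push_cast; ring
      rw [div_pow, this]
      linarith
    rw [div_le_iff₀ (by positivity)]
    nlinarith
  have z3 : (Q : ℝ) * √N ≤ Z := by
    calc (Q : ℝ) * √N ≤ N ^ (1 / 2 - δ) * N ^ (1 / 2 : ℝ) := by rw [hsqN]; gcongr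
      _ = N ^ (1 - δ) := by rw [← Real.rpow_add hN0]; congr 1; ring
      _ ≤ _ := hmono _ _ (by linarith)
  have z4 : (Q : ℝ) ^ 2 * U ^ 2 ≤ Z := by
    calc (Q : ℝ) ^ 2 * U ^ 2 ≤ (N ^ (1 / 2 - δ)) ^ 2 * (N ^ (δ / 2)) ^ 2 := by gcongr
      _ = N ^ (1 - δ) := by
        rw [← Real.rpow_natCast, ← Real.rpow_natCast, ← Real.rpow_mul hN0.le, ← Real.rpow_mul hN0.le,
          ← Real.rpow_add hN0]; congr 1; push_cast; ring
      _ ≤ _ := hmono _ _ (by linarith)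
  have z5 : N / R₀ ≤ 2 * (N / ℓ ^ b) := by
    rw [div_le_iff₀ hR₀0, mul_div_assoc', div_mul_eq_mul_div, le_div_iff₀ (by positivity)]
    nlinarith
  have hbig := sum_large_conductor_le (p := p) hJ0 hU1 hUN hQN hR₀1 (le_refl L)
  have hsmall : ∑ r ∈ ((moduli Q p).erase 1).filter (fun r => ¬ R₀ < r), 1 / r.totient * primSum J N r ≤
      C * N / ℓ ^ (A + 4) := by
    have hterm : ∀ r ∈ ((moduli Q p).erase 1).filter (fun r => ¬ R₀ < r), 1 / (r.totient : ℝ) * primSum J N r ≤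
        ℓ ^ b * (C * N / ℓ ^ m) := by
      intro r hr
      rw [mem_filter, mem_erase, mem_moduli, not_lt] at hr
      obtain ⟨⟨hr1, ⟨hr2, hrQ⟩, hsq, hpr⟩, hrR⟩ := hr
      have : NeZero r := ⟨by omega⟩
      have hr0 : (0 : ℝ) < r := by exact_mod_cast hr2
      have hrb : (r : ℝ) ≤ ℓ ^ b := le_trans (by exact_mod_cast hrR) hR₀le
      have hlogr : Real.log r ≤ l := by
        refine (Real.log_le_log hr0 hrb).trans ?_
        rw [Real.log_pow]
        rwa [pow_one] at hlr
      have hφ : 1 / (r.totient : ℝ) ≤ 1 := by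
        have : (1 : ℝ) ≤ r.totient := by exact_mod_cast Nat.totient_pos.mpr hr2
        rw [div_le_one (by linarith)]; exact this
      have hψ : ∀ χ : DirichletCharacter ℂ r, χ.IsPrimitive → ‖psiW J N χ‖ ≤ C * N / ℓ ^ m := by
        intro χ hχ
        have hχ1 := ne_one_of_isPrimitive hχ hr1
        refine (hC r χ l N hN0 hχ1 hsq (by linarith) hlogr (hne r χ hχ1 hχ hsq hlogr hpr) ?_).trans ?_
        · rw [← hℓ, ← hl40]; exact pow_le_pow_right₀ hl1 (by norm_num)
        · rw [← hℓ, div_le_div_iff₀ (by positivity) (by positivity)]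
          have h1 : l ^ (19 * (j + 1)) ≤ ℓ ^ (m + 1) := by
            rw [← hl40, ← pow_mul]; exact pow_le_pow_right₀ hl1 (by omega)
          calc C * N * l ^ (19 * (j + 1)) * ℓ ^ m ≤ C * N * ℓ ^ (m + 1) * ℓ ^ m := by gcongr
            _ = C * N * ℓ ^ j := by rw [mul_assoc, ← pow_add]; congr 2; omega
      calc 1 / (r.totient : ℝ) * primSum J N r ≤ 1 * primSum J N r :=
            mul_le_mul_of_nonneg_right hφ (primSum_nonneg _ _ _)
        _ = primSum J N r := one_mul _
        _ ≤ ∑ χ : DirichletCharacter ℂ r with χ.IsPrimitive, C * N / ℓ ^ m :=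
            sum_le_sum fun χ hχ => hψ χ (mem_filter.mp hχ).2
        _ = ((univ.filter fun χ : DirichletCharacter ℂ r => χ.IsPrimitive).card : ℝ) * (C * N / ℓ ^ m) := by
            rw [sum_const, nsmul_eq_mul]
        _ ≤ r * (C * N / ℓ ^ m) := mul_le_mul_of_nonneg_right (card_primitive_le r) (by positivity)
        _ ≤ _ := mul_le_mul_of_nonneg_right hrb (by positivity)
    refine (sum_le_sum hterm).trans ?_
    rw [sum_const, nsmul_eq_mul]
    have hcard : ((((moduli Q p).erase 1).filter (fun r => ¬ R₀ < r)).card : ℝ) ≤ ℓ ^ b := by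
      refine le_trans ?_ hR₀le
      have : (((moduli Q p).erase 1).filter (fun r => ¬ R₀ < r)).card ≤ (Icc 1 R₀).card := by
        refine card_le_card fun r hr => ?_
        rw [mem_filter, mem_erase, mem_moduli] at hr
        rw [mem_Icc]; omega
      rw [Nat.card_Icc, Nat.add_sub_cancel] at this
      exact_mod_cast this
    calc _ ≤ ℓ ^ b * (ℓ ^ b * (C * N / ℓ ^ m)) := mul_le_mul_of_nonneg_right hcard (by positivity)
      _ = C * N / ℓ ^ (A + 4) := by
        have : ℓ ^ m = ℓ ^ b * ℓ ^ b * ℓ ^ (A + 4) := by rw [← pow_add, ← pow_add]; congr 1; omega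
        rw [this]; field_simp
  refine (sum_abs_psiAP_sub_le hN1' (by linarith) (le_refl L) ha).trans ?_
  rw [← sum_filter_add_sum_filter_not ((moduli Q p).erase 1) (fun r => R₀ < r)]
  have hZle : Z * ((32 + 2 ^ 20 * CJ) * ℓ ^ (A + 13)) ≤ N := by
    rw [← hZN]; exact mul_le_mul_of_nonneg_left hN1 hZ0.le
  calc 4 * L ^ 3 * Q + L ^ 3 * (∑ r ∈ ((moduli Q p).erase 1).filter (fun r => R₀ < r), 1 / (r.totient : ℝ) * primSum J N r +
        ∑ r ∈ ((moduli Q p).erase 1).filter (fun r => ¬ R₀ < r), 1 / (r.totient : ℝ) * primSum J N r)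
      ≤ 4 * (2 * ℓ) ^ 3 * Z + (2 * ℓ) ^ 3 * (CJ * (2 * ℓ) ^ 9 * (4 * (N / ℓ ^ b) + 4 * Z + 4 * Z + 8 * Z) +
        C * N / ℓ ^ (A + 4)) := by
        have hb2 : (24 * kernNorm J + 8) * L ^ 9 * (2 * N / R₀ + 2 * N / √U + 4 * Q * √N + 8 * Q ^ 2 * U ^ 2) ≤
            CJ * (2 * ℓ) ^ 9 * (4 * (N / ℓ ^ b) + 4 * Z + 4 * Z + 8 * Z) := by
          have h9 : L ^ 9 ≤ (2 * ℓ) ^ 9 := pow_le_pow_left₀ hL0.le hL2 9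
          have e1 : 2 * N / R₀ = 2 * (N / R₀) := by ring
          have e2 : 2 * N / √(U : ℝ) = 2 * (N / √U) := by ring
          refine mul_le_mul (mul_le_mul_of_nonneg_left h9 hCJ0.le) ?_ (by positivity) (by positivity)
          rw [e1, e2]
          linarith
        have h3 : L ^ 3 ≤ (2 * ℓ) ^ 3 := pow_le_pow_left₀ hL0.le hL2 3
        have hnn : 0 ≤ ∑ r ∈ ((moduli Q p).erase 1).filter (fun r => R₀ < r), 1 / (r.totient : ℝ) * primSum J N r +
            ∑ r ∈ ((moduli Q p).erase 1).filter (fun r => ¬ R₀ < r), 1 / (r.totient : ℝ) * primSum J N r :=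
          add_nonneg (sum_nonneg fun r _ => mul_nonneg (by positivity) (primSum_nonneg _ _ _))
            (sum_nonneg fun r _ => mul_nonneg (by positivity) (primSum_nonneg _ _ _))
        refine add_le_add ?_ (mul_le_mul h3 (add_le_add (hbig.trans hb2) hsmall) hnn (by positivity))
        exact mul_le_mul (mul_le_mul_of_nonneg_left h3 (by norm_num)) z1 (by positivity) (by positivity)
    _ = 32 * (Z * ℓ ^ 3) + 2 ^ 16 * CJ * (Z * ℓ ^ 12) + 2 ^ 14 * CJ * (ℓ ^ 12 * (N / ℓ ^ b)) + 8 * C * (ℓ ^ 3 * (N / ℓ ^ (A + 4))) := by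
        ring
    _ ≤ N / ℓ ^ (A + 1) * (8 * C + 2 ^ 18 * CJ + 1) := by
        have e1 : ℓ ^ 12 * (N / ℓ ^ b) = N / ℓ ^ (A + 1) := by
          rw [hb, show A + 13 = 12 + (A + 1) by ring, pow_add]; field_simp
        have e2 : ℓ ^ 3 * (N / ℓ ^ (A + 4)) = N / ℓ ^ (A + 1) := by
          rw [show A + 4 = 3 + (A + 1) by ring, pow_add]; field_simp
        have e3 : (Z * ℓ ^ 12) * (32 + 2 ^ 20 * CJ) ≤ N / ℓ ^ (A + 1) := by
          rw [le_div_iff₀ (by positivity)]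
          refine le_trans (le_of_eq ?_) hZle
          rw [show A + 13 = 12 + (A + 1) by ring, pow_add]; ring
        have e4 : Z * ℓ ^ 3 ≤ Z * ℓ ^ 12 := by
          refine mul_le_mul_of_nonneg_left (pow_le_pow_right₀ hℓ1 (by norm_num)) hZ0.le
        rw [e1, e2]
        have h5 : 0 ≤ N / ℓ ^ (A + 1) := by positivity
        have h6 : 0 ≤ CJ * (Z * ℓ ^ 12) := by positivity
        have h7 : 0 ≤ CJ * (N / ℓ ^ (A + 1)) := by positivity
        nlinarith
    _ ≤ N / ℓ ^ (A + 1) * ℓ := mul_le_mul_of_nonneg_left hlogN (by positivity)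
    _ = N / ℓ ^ A := by rw [pow_succ]; field_simp

end

section

open Finset

section Tensor

variable {L α β γ : Type*} [Fintype L] [DecidableEq L] [Fintype α] [DecidableEq α] [Fintype β] [DecidableEq β]
  [Fintype γ] [DecidableEq γ]

lemma prod_sum_eq_sum_prod (f : L → α → ℝ) : ∏ l, ∑ a, f l a = ∑ x : L → α, ∏ l, f l (x l) := by
  rw [prod_univ_sum, Fintype.piFinset_univ]

/-- Push-forward of a product weight along coordinatewise maps. -/
lemma sum_prod_map (w : L → α → ℝ) (e : L → α → γ) (G : (L → γ) → ℝ) :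
    ∑ x : L → α, (∏ l, w l (x l)) * G (fun l => e l (x l)) =
      ∑ X : L → γ, (∏ l, ∑ a, if e l a = X l then w l a else 0) * G X := by
  simp only [prod_sum_eq_sum_prod, sum_mul]
  rw [sum_comm]
  refine sum_congr rfl fun x _ => ?_
  rw [sum_eq_single (fun l => e l (x l))]
  · simp
  · intro X _ hX
    obtain ⟨l, hl⟩ := Function.ne_iff.mp hX
    rw [prod_eq_zero (mem_univ l), zero_mul]
    rw [if_neg]; exact fun h => hl h.symm
  · simp

/-- The quadratic form attached to a product kernel. -/
def quadForm (κ : L → α → α → ℝ) (f : (L → α) → ℝ) : ℝ :=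
  ∑ x : L → α, ∑ y : L → α, f x * f y * ∏ l, κ l (x l) (y l)

lemma quadForm_eq_sum_sq (κ : L → α → α → ℝ) (D : L → β → ℝ) (T : L → β → α → ℝ)
    (h : ∀ l a b, κ l a b = ∑ r, D l r * T l r a * T l r b) (f : (L → α) → ℝ) :
    quadForm κ f = ∑ r : L → β, (∏ l, D l (r l)) * (∑ x : L → α, f x * ∏ l, T l (r l) (x l)) ^ 2 := by
  calc quadForm κ f = ∑ x : L → α, ∑ y : L → α, ∑ r : L → β,
        f x * f y * ∏ l, D l (r l) * T l (r l) (x l) * T l (r l) (y l) := by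
        simp only [quadForm, h, prod_sum_eq_sum_prod, mul_sum]
    _ = ∑ x : L → α, ∑ r : L → β, ∑ y : L → α,
        f x * f y * ∏ l, D l (r l) * T l (r l) (x l) * T l (r l) (y l) :=
        sum_congr rfl fun x _ => sum_comm
    _ = ∑ r : L → β, ∑ x : L → α, ∑ y : L → α,
        f x * f y * ∏ l, D l (r l) * T l (r l) (x l) * T l (r l) (y l) := sum_comm
    _ = _ := by
        refine sum_congr rfl fun r _ => ?_
        rw [sq, sum_mul_sum, mul_sum]
        refine sum_congr rfl fun x _ => ?_
        rw [mul_sum]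
        refine sum_congr rfl fun y _ => ?_
        simp only [prod_mul_distrib]; ring

lemma sum_sq_subtype_le {δ : Type*} [Fintype δ] [DecidableEq δ] (D : L → δ → ℝ) (hD : ∀ l r, 0 ≤ D l r)
    (e : β → δ) (he : Function.Injective e) (H : (L → δ) → ℝ) :
    ∑ r : L → β, (∏ l, D l (e (r l))) * H (fun l => e (r l)) ^ 2 ≤ ∑ r : L → δ, (∏ l, D l (r l)) * H r ^ 2 := by
  have hinj : Function.Injective (fun (r : L → β) l => e (r l)) := fun r s h =>
    funext fun l => he (congrFun h l)
  calc _ = ∑ r ∈ univ.map ⟨_, hinj⟩, (∏ l, D l (r l)) * H r ^ 2 := by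
        rw [sum_map]; rfl
    _ ≤ _ := sum_le_sum_of_subset_of_nonneg (subset_univ _) fun r _ _ =>
        mul_nonneg (prod_nonneg fun l _ => hD l _) (sq_nonneg _)

/-- A product kernel dominated coordinatewise by a diagonal one. -/
lemma quadForm_le_diag (κ : L → α → α → ℝ) (D : L → β → ℝ) (T : L → β → α → ℝ) (hD : ∀ l r, 0 ≤ D l r)
    (h : ∀ l a b, κ l a b = ∑ r, D l r * T l r a * T l r b)
    (E : L → γ → ℝ) (V : L → γ → α → ℝ) (hE : ∀ l r, 0 ≤ E l r) (d : L → α → ℝ)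
    (hd : ∀ l a b, κ l a b + ∑ r, E l r * V l r a * V l r b = if a = b then d l a else 0) (f : (L → α) → ℝ) :
    quadForm κ f ≤ ∑ x : L → α, (∏ l, d l (x l)) * f x ^ 2 := by
  have h1 := quadForm_eq_sum_sq (fun l a b => if a = b then d l a else 0)
    (fun l (r : β ⊕ γ) => Sum.elim (D l) (E l) r) (fun l (r : β ⊕ γ) => Sum.elim (T l) (V l) r)
    (fun l a b => by rw [Fintype.sum_sum_type, ← hd, h]; rfl) f
  have h2 : quadForm (fun l a b => if a = b then d l a else 0) f = ∑ x : L → α, (∏ l, d l (x l)) * f x ^ 2 := by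
    rw [quadForm]
    refine sum_congr rfl fun x _ => ?_
    rw [sum_eq_single x]
    · simp; ring
    · intro y _ hy
      obtain ⟨l, hl⟩ := Function.ne_iff.mp hy
      rw [prod_eq_zero (mem_univ l), mul_zero]
      rw [if_neg]; exact fun h => hl h.symm
    · simp
  rw [← h2, h1, quadForm_eq_sum_sq κ D T h f]
  exact sum_sq_subtype_le (fun l (r : β ⊕ γ) => Sum.elim (D l) (E l) r)
    (fun l r => by cases r <;> simp [hD, hE]) Sum.inl Sum.inl_injective
    (fun r => ∑ x : L → α, f x * ∏ l, Sum.elim (T l) (V l) (r l) (x l))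

lemma quadForm_ge {δ : Type*} [Fintype δ] [DecidableEq δ] (κ : L → α → α → ℝ) (D : L → δ → ℝ) (T : L → δ → α → ℝ)
    (hD : ∀ l r, 0 ≤ D l r) (h : ∀ l a b, κ l a b = ∑ r, D l r * T l r a * T l r b)
    (e : β → δ) (he : Function.Injective e) (f : (L → α) → ℝ) :
    ∑ r : L → β, (∏ l, D l (e (r l))) * (∑ x : L → α, f x * ∏ l, T l (e (r l)) (x l)) ^ 2 ≤ quadForm κ f := by
  rw [quadForm_eq_sum_sq κ D T h f]
  exact sum_sq_subtype_le D hD e he (fun r => ∑ x : L → α, f x * ∏ l, T l (r l) (x l))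

/-- Coordinatewise comparison of product weights against antitone functions. -/
lemma sum_prod_le_of_coord [Preorder γ] (μ ν : L → γ → ℝ) (hμ : ∀ l c, 0 ≤ μ l c) (hν : ∀ l c, 0 ≤ ν l c)
    (C : L → ℝ) (hC : ∀ l, 0 ≤ C l)
    (h : ∀ l (f : γ → ℝ), Antitone f → (∀ c, 0 ≤ f c) → ∑ c, μ l c * f c ≤ C l * ∑ c, ν l c * f c)
    (G : (L → γ) → ℝ) (hG : Antitone G) (hG0 : ∀ X, 0 ≤ G X) :
    ∑ X : L → γ, (∏ l, μ l (X l)) * G X ≤ (∏ l, C l) * ∑ X : L → γ, (∏ l, ν l (X l)) * G X := by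
  have key : ∀ s : Finset L, ∑ X : L → γ, (∏ l, μ l (X l)) * G X ≤
      (∏ l ∈ s, C l) * ∑ X : L → γ, (∏ l, (if l ∈ s then ν l else μ l) (X l)) * G X := by
    intro s
    induction s using Finset.induction_on with
    | empty => simp
    | insert m s hm ih =>
      refine ih.trans ?_
      rw [prod_insert hm, mul_comm (C m), mul_assoc]
      refine mul_le_mul_of_nonneg_left ?_ (prod_nonneg fun l _ => hC l)
      have split : ∀ τ : L → γ → ℝ, ∑ X : L → γ, (∏ l, τ l (X l)) * G X =
          ∑ Y : {j // j ≠ m} → γ, (∏ j : {j // j ≠ m}, τ j (Y j)) *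
            ∑ c, τ m c * G ((Equiv.funSplitAt m γ).symm (c, Y)) := by
        intro τ
        rw [← (Equiv.funSplitAt m γ).symm.sum_comp, Fintype.sum_prod_type, sum_comm]
        refine sum_congr rfl fun Y _ => ?_
        rw [mul_sum]
        refine sum_congr rfl fun c _ => ?_
        rw [Fintype.prod_eq_mul_prod_subtype_ne _ m]
        have e1 : (Equiv.funSplitAt m γ).symm (c, Y) m = c := by simp
        have e2 : ∀ j : {j // j ≠ m}, (Equiv.funSplitAt m γ).symm (c, Y) j = Y j := fun j => by simp [j.2]
        simp only [e1, e2]; ring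
      rw [split, split, mul_sum]
      refine sum_le_sum fun Y _ => ?_
      have e3 : ∏ j : {j // j ≠ m}, (if (j : L) ∈ insert m s then ν j else μ j) (Y j) =
          ∏ j : {j // j ≠ m}, (if (j : L) ∈ s then ν j else μ j) (Y j) :=
        prod_congr rfl fun j _ => by simp [mem_insert, j.2]
      rw [e3, mul_left_comm]
      refine mul_le_mul_of_nonneg_left ?_ (prod_nonneg fun j _ => ?_)
      · rw [if_neg hm, if_pos (mem_insert_self m s)]
        refine h m _ (fun c c' hc => hG fun l => ?_) fun c => hG0 _
        by_cases hl : l = m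
        · subst hl; simpa using hc
        · simp [hl]
      · split_ifs
        · exact hν _ _
        · exact hμ _ _
  simpa using key univ

end Tensor

section Kernels

variable {L ι : Type*} [Fintype L] [DecidableEq L] [Fintype ι] [DecidableEq ι]

/-- Density of the simultaneous divisibility conditions at one prime. -/
def kap (z : ℝ) : Option ι → Option ι → ℝ
  | none, none => 1
  | none, some _ => z
  | some _, none => z
  | some i, some j => if i = j then z else 0

/-- Inverse of the diagonalizing transform at one prime. -/
def tinv (z : ℝ) : Option ι → Option ι → ℝ
  | none, none => 1
  | none, some _ => -z
  | some i, s => if s = some i then 1 else 0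

/-- The sieve weights attached to the diagonalized weights `Y`. -/
def lam (z : L → ℝ) (Y : (L → Option ι) → ℝ) (x : L → Option ι) : ℝ :=
  ∑ s, Y s * ∏ l, tinv (z l) (x l) (s l)

/-- Indicator of a color. -/
def br (i : ι) (s : Option ι) : ℝ := if s = some i then 1 else 0

/-- Squares decomposing the kernel: the weights. -/
noncomputable def decW (z c : ℝ) : Option ι ⊕ (ι × ι) → ℝ
  | Sum.inl none => 1
  | Sum.inl (some _) => z * (1 - c * z)
  | Sum.inr _ => z ^ 2 / 2

/-- Squares decomposing the kernel: the linear forms. -/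
def decT (z : ℝ) : Option ι ⊕ (ι × ι) → Option ι → ℝ
  | Sum.inl none, none => 1
  | Sum.inl none, some _ => z
  | Sum.inl (some i), s => br i s
  | Sum.inr x, s => br x.1 s - br x.2 s

lemma sum_br (s : Option ι) : ∑ i, br i s = if s = none then 0 else 1 := by
  cases s <;> simp [br]

lemma sum_br_mul (a b : Option ι) : ∑ i, br i a * br i b = if a = none then 0 else if a = b then 1 else 0 := by
  cases a <;> cases b <;> simp [br, eq_comm]

lemma sum_pair_mul (a b : Option ι) : ∑ x : ι × ι, (br x.1 a - br x.2 a) * (br x.1 b - br x.2 b) =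
    2 * Fintype.card ι * (∑ i, br i a * br i b) - 2 * ((∑ i, br i a) * ∑ i, br i b) := by
  rw [Fintype.sum_prod_type]
  have : ∀ i j : ι, (br i a - br j a) * (br i b - br j b) =
      br i a * br i b + br j a * br j b - br i a * br j b - br j a * br i b := fun i j => by ring
  simp only [this, sum_sub_distrib, sum_add_distrib, sum_const, card_univ, nsmul_eq_mul,
    ← mul_sum, ← sum_mul]
  ring

lemma kap_eq_sum (z : ℝ) (a b : Option ι) :
    kap z a b = ∑ r, decW z (Fintype.card ι) r * decT z r a * decT z r b := by
  rw [Fintype.sum_sum_type, Fintype.sum_option]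
  have h1 : ∑ x : ι × ι, decW z (Fintype.card ι) (Sum.inr x) * decT z (Sum.inr x) a * decT z (Sum.inr x) b =
      z ^ 2 / 2 * ∑ x : ι × ι, (br x.1 a - br x.2 a) * (br x.1 b - br x.2 b) := by
    rw [mul_sum]; exact sum_congr rfl fun x _ => by simp only [decW, decT]; ring
  have h2 : ∑ i : ι, decW z (Fintype.card ι) (Sum.inl (some i)) * decT z (Sum.inl (some i)) a * decT z (Sum.inl (some i)) b =
      z * (1 - Fintype.card ι * z) * ∑ i, br i a * br i b := by
    rw [mul_sum]; exact sum_congr rfl fun x _ => by simp only [decW, decT]; ring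
  rw [h1, h2, sum_pair_mul, sum_br_mul, sum_br, sum_br]
  cases a <;> cases b <;> simp [kap, decW, decT]
  split_ifs <;> ring

lemma sum_lam_mul {β κ : Type*} [Fintype κ] [DecidableEq κ] (z : L → ℝ) (Y : (L → Option ι) → ℝ) (e : κ → Option ι)
    (T : L → β → κ → ℝ) (r : L → β) :
    ∑ x : L → κ, lam z Y (fun l => e (x l)) * ∏ l, T l (r l) (x l) =
      ∑ s, Y s * ∏ l, ∑ a, T l (r l) a * tinv (z l) (e a) (s l) := by
  simp only [lam, prod_sum_eq_sum_prod, sum_mul, mul_sum]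
  rw [sum_comm]
  refine sum_congr rfl fun s _ => sum_congr rfl fun x _ => ?_
  rw [prod_mul_distrib]; ring

/-- Diagonal weights dominating the first quadratic form. -/
noncomputable def diagW (k z : ℝ) : Option ι → ℝ
  | none => 1 + (z / (1 + z)) ^ 2
  | some _ => z / (1 + z) + k * z ^ 2

/-- The forms measuring the loss in the domination by the diagonal. -/
noncomputable def lossT (z : ℝ) : Option (Option (ι × ι)) → Option ι → ℝ
  | none, none => z / (1 + z)
  | none, some _ => z
  | some none, none => 0
  | some none, some _ => 1
  | some (some x), s => br x.1 s - br x.2 s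

/-- The weights of the forms measuring the loss. -/
noncomputable def lossW (z : ℝ) : Option (Option (ι × ι)) → ℝ
  | none => 1
  | some none => (z / (1 + z)) ^ 2 - (z - z / (1 + z)) ^ 2
  | some (some _) => z ^ 2 / 2

lemma decT_comp_tinv (z z' : ℝ) (r : Option ι ⊕ (ι × ι)) (s : Option ι) :
    ∑ a, decT z r a * tinv z' a s = match r with
      | Sum.inl none => if s = none then 1 else z - z'
      | Sum.inl (some i) => br i s
      | Sum.inr x => br x.1 s - br x.2 s := by
  rw [Fintype.sum_option]
  rcases r with (_ | i) | x <;> cases s <;> simp [decT, tinv, br] <;> ring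

/-- The first quadratic form is dominated by a diagonal one. -/
theorem quadForm_kap_le (z : L → ℝ) (hz : ∀ l, 0 ≤ z l) (hz1 : ∀ l, Fintype.card ι * z l ≤ 1) (hk : 1 ≤ Fintype.card ι)
    (Y : (L → Option ι) → ℝ) :
    quadForm (fun l => kap (z l / (1 + z l))) (lam z Y) ≤
      ∑ s, (∏ l, diagW (Fintype.card ι) (z l) (s l)) * Y s ^ 2 := by
  have hk1 : (1 : ℝ) ≤ Fintype.card ι := by exact_mod_cast hk
  have hw : ∀ l, 0 ≤ z l / (1 + z l) := fun l => by have := hz l; positivity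
  have hwz : ∀ l, z l / (1 + z l) ≤ z l := fun l => by
    have := hz l; exact div_le_self this (by linarith)
  have hD : ∀ l r, 0 ≤ decW (ι := ι) (z l / (1 + z l)) (Fintype.card ι) r := by
    intro l r
    have h0 := hw l; have h1 := hwz l; have h2 := hz1 l
    rcases r with (_ | i) | x
    · exact zero_le_one
    · refine mul_nonneg h0 ?_
      nlinarith
    · exact div_nonneg (sq_nonneg _) (by norm_num)
  set T' : L → Option ι ⊕ (ι × ι) → Option ι → ℝ := fun l r s => ∑ a, decT (z l / (1 + z l)) r a * tinv (z l) a s with hT'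
  set κ : L → Option ι → Option ι → ℝ := fun l a b =>
    ∑ r, decW (z l / (1 + z l)) (Fintype.card ι) r * T' l r a * T' l r b with hκ
  have h1 : quadForm (fun l => kap (z l / (1 + z l))) (lam z Y) = quadForm κ Y := by
    rw [quadForm_eq_sum_sq _ (fun l => decW (z l / (1 + z l)) (Fintype.card ι)) (fun l => decT (z l / (1 + z l)))
      (fun l a b => kap_eq_sum _ a b), quadForm_eq_sum_sq κ (fun l => decW (z l / (1 + z l)) (Fintype.card ι)) T'
      (fun l a b => rfl)]
    refine sum_congr rfl fun r _ => ?_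
    congr 2
    exact sum_lam_mul z Y id (fun l => decT (z l / (1 + z l))) r
  rw [h1]
  refine quadForm_le_diag κ _ T' hD (fun l a b => rfl) (fun l => lossW (z l)) (fun l => lossT (z l)) ?_ _ ?_ Y
  · intro l r
    have h0 := hz l
    have hzl1 : z l ≤ 1 := by have := hz1 l; nlinarith
    rcases r with _ | _ | x
    · exact zero_le_one
    · simp only [lossW]
      have h2 : z l - z l / (1 + z l) ≤ z l / (1 + z l) := by
        rw [sub_le_iff_le_add, ← add_div, le_div_iff₀ (by linarith)]; nlinarith
      have h3 : 0 ≤ z l - z l / (1 + z l) := sub_nonneg.mpr (hwz l)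
      nlinarith
    · exact div_nonneg (sq_nonneg _) (by norm_num)
  · intro l a b
    have h0 : 1 + z l ≠ 0 := by have := hz l; positivity
    simp only [hκ, hT', decT_comp_tinv]
    rw [Fintype.sum_sum_type, Fintype.sum_option, Fintype.sum_option, Fintype.sum_option]
    have e1 : ∑ x : ι × ι, decW (z l / (1 + z l)) (Fintype.card ι) (Sum.inr x) * (br x.1 a - br x.2 a) * (br x.1 b - br x.2 b) =
        (z l / (1 + z l)) ^ 2 / 2 * ∑ x : ι × ι, (br x.1 a - br x.2 a) * (br x.1 b - br x.2 b) := by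
      rw [mul_sum]; exact sum_congr rfl fun x _ => by simp only [decW]; ring
    have e2 : ∑ i : ι, decW (z l / (1 + z l)) (Fintype.card ι) (Sum.inl (some i)) * br i a * br i b =
        z l / (1 + z l) * (1 - Fintype.card ι * (z l / (1 + z l))) * ∑ i, br i a * br i b := by
      rw [mul_sum]; exact sum_congr rfl fun x _ => by simp only [decW]; ring
    have e3 : ∑ x : ι × ι, lossW (z l) (some (some x)) * lossT (z l) (some (some x)) a * lossT (z l) (some (some x)) b =
        z l ^ 2 / 2 * ∑ x : ι × ι, (br x.1 a - br x.2 a) * (br x.1 b - br x.2 b) := by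
      rw [mul_sum]; exact sum_congr rfl fun x _ => by simp only [lossW, lossT]; ring
    rw [e1, e2, e3, sum_pair_mul, sum_br_mul, sum_br, sum_br]
    have hw' : z l * (z l / (1 + z l)) = z l - z l / (1 + z l) := by field_simp; ring
    rcases a with _ | a <;> rcases b with _ | b <;>
      simp only [decW, lossW, lossT, diagW, reduceCtorEq, if_true, if_false, Option.some.injEq] <;>
      generalize z l / (1 + z l) = w at *
    · ring
    · linear_combination hw'
    · linear_combination hw'
    · split_ifs <;> ring

end Kernels

section Lower

variable {L ι : Type*} [Fintype L] [DecidableEq L] [Fintype ι] [DecidableEq ι]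

/-- Sign of a coloring at one prime. -/
def sgn : Option ι → ℝ
  | none => 1
  | some _ => -1

/-- Weight of adding the color `m` at a prime. -/
def addW (z : ℝ) {m : ι} : Option {i : ι // i ≠ m} → Bool → ℝ
  | none, true => z
  | none, false => 1
  | some _, true => 0
  | some _, false => 1

/-- Adding the color `m` at an uncolored prime. -/
def addC {m : ι} : Option {i : ι // i ≠ m} → Bool → Option ι
  | none, true => some m
  | none, false => none
  | some i, _ => some i

lemma decT_comp_tinv_sub (z : ℝ) {m : ι} (r : Option {i : ι // i ≠ m}) (s : Option ι) :
    (∑ a : Option {i : ι // i ≠ m}, decT z (Sum.inl r) a * tinv z (a.map Subtype.val) s) * sgn s =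
      sgn (r.map Subtype.val) * ∑ b : Bool, if addC r b = s then addW z r b else 0 := by
  rw [Fintype.sum_option, Fintype.sum_bool]
  rcases r with _ | i
  · rcases s with _ | j
    · simp [decT, tinv, sgn, addC, addW]
    · by_cases hj : j = m
      · subst hj
        have : ∀ x : {i : ι // i ≠ j}, j ≠ x := fun x h => x.2 h.symm
        simp [decT, tinv, sgn, addC, addW, this]
      · have h1 : ∑ x : {i : ι // i ≠ m}, (if j = (x : ι) then z else 0) = z := by
          rw [sum_eq_single (⟨j, hj⟩ : {i : ι // i ≠ m})]
          · simp
          · intro b _ hb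
            rw [if_neg]; intro h; apply hb; ext; exact h.symm
          · simp
        simp [decT, tinv, sgn, addC, addW, h1, Ne.symm hj]
  · have h1 : ∀ x : {i : ι // i ≠ m}, (br i (some x) : ℝ) = if x = i then 1 else 0 := fun x => by simp [br]
    simp only [decT, h1, Option.map_none, Option.map_some, addC, addW]
    have h2 : (br i none : ℝ) = 0 := by simp [br]
    simp only [h2, zero_mul, zero_add, ite_mul, one_mul, sum_ite_eq', mem_univ, if_true]
    rcases s with _ | j
    · simp [tinv]
    · simp only [tinv, sgn, Option.some.injEq]
      by_cases h : j = (i : ι)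
      · simp [h]
      · simp [h, Ne.symm h]

/-- The second quadratic form, restricted to tuples whose `m`-th entry is trivial, is bounded below by squares. -/
theorem le_quadForm_kap (z : L → ℝ) (hz : ∀ l, 0 ≤ z l) (hz1 : ∀ l, Fintype.card ι * z l ≤ 1) (m : ι)
    (F : (L → Option ι) → ℝ) :
    ∑ r : L → Option {i : ι // i ≠ m}, (∏ l, decW (z l) (Fintype.card {i : ι // i ≠ m}) (Sum.inl (r l))) *
        (∑ A : L → Bool, (∏ l, addW (z l) (r l) (A l)) * F (fun l => addC (r l) (A l))) ^ 2 ≤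
      quadForm (fun l => kap (z l)) (fun x : L → Option {i : ι // i ≠ m} =>
        lam z (fun s => (∏ l, sgn (s l)) * F s) (fun l => (x l).map Subtype.val)) := by
  have hcard : (Fintype.card {i : ι // i ≠ m} : ℝ) ≤ Fintype.card ι := by
    exact_mod_cast Fintype.card_subtype_le _
  have hD : ∀ l r, 0 ≤ decW (ι := {i : ι // i ≠ m}) (z l) (Fintype.card {i : ι // i ≠ m}) r := by
    intro l r
    have h0 := hz l; have h2 := hz1 l
    rcases r with (_ | i) | x
    · exact zero_le_one
    · refine mul_nonneg h0 ?_
      nlinarith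
    · exact div_nonneg (sq_nonneg _) (by norm_num)
  refine le_trans (le_of_eq ?_) (quadForm_ge _ (fun l => decW (z l) (Fintype.card {i : ι // i ≠ m})) (fun l => decT (z l)) hD
    (fun l a b => kap_eq_sum _ a b) Sum.inl Sum.inl_injective _)
  refine sum_congr rfl fun r _ => ?_
  congr 1
  have h1 := sum_lam_mul z (fun s => (∏ l, sgn (s l)) * F s) (fun a : Option {i : ι // i ≠ m} => a.map Subtype.val)
    (fun l (r : Option {i : ι // i ≠ m}) => decT (z l) (Sum.inl r)) r
  have h2 : ∑ s, (∏ l, sgn (s l)) * F s * ∏ l, ∑ a, decT (z l) (Sum.inl (r l)) a * tinv (z l) (Option.map Subtype.val a) (s l) =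
      (∏ l, sgn ((r l).map Subtype.val)) * ∑ s, (∏ l, ∑ b : Bool, if addC (r l) b = s l then addW (z l) (r l) b else 0) * F s := by
    rw [mul_sum]
    refine sum_congr rfl fun s _ => ?_
    rw [← mul_assoc, ← prod_mul_distrib]
    calc _ = (∏ l, (∑ a, decT (z l) (Sum.inl (r l)) a * tinv (z l) (Option.map Subtype.val a) (s l)) * sgn (s l)) * F s := by
          rw [prod_mul_distrib]; ring
      _ = _ := by
          congr 1
          exact prod_congr rfl fun l _ => decT_comp_tinv_sub (z l) (r l) (s l)
  rw [h1, h2, ← sum_prod_map (fun l => addW (z l) (r l)) (fun l => addC (r l)) F, mul_pow, ← prod_pow]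
  have h3 : ∏ l, sgn ((r l).map Subtype.val) ^ 2 = 1 := by
    refine prod_eq_one fun l _ => ?_
    cases r l <;> simp [sgn]
  rw [h3, one_mul]

end Lower

section Families

variable {L ι : Type*} [Fintype L] [DecidableEq L] [Fintype ι] [DecidableEq ι]

local notation "𝔨" => Fintype.card ι

/-- The weight of a subset at one prime. -/
def bw (z : ℝ) (b : Bool) : ℝ := if b then z else 1

/-- The logarithmic size of a set of primes. -/
def lsize (ℓ : L → ℝ) (A : L → Bool) : ℝ := ∑ l, if A l then ℓ l else 0

/-- The weight of a set of primes. -/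
def setW (z : L → ℝ) (A : L → Bool) : ℝ := ∏ l, bw (z l) (A l)

/-- The one-dimensional truncated weighted sum. -/
noncomputable def trunc (z ℓ : L → ℝ) (g : ℝ → ℝ) (v : ℝ) : ℝ :=
  ∑ A : L → Bool, setW z A * (g (lsize ℓ A) * if lsize ℓ A ≤ v then 1 else 0)

/-- The number of grid points `1 - j / K` above `S`. -/
noncomputable def gridCount (K : ℕ) (S : ℝ) : ℕ := ((range K).filter fun j : ℕ => S ≤ 1 - j / K).card

/-- A coloring as a family of indicators. -/
def colorInd (s : Option ι) (i : ι) : Bool := decide (s = some i)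

/-- The diagonalized sieve weight. -/
noncomputable def sieveF (ℓ : L → ℝ) (g : ℝ → ℝ) (ρ : ℝ) (s : L → Option ι) : ℝ :=
  (∏ i, g (lsize ℓ fun l => colorInd (s l) i)) *
    if ∑ i, lsize ℓ (fun l => colorInd (s l) i) ≤ ρ then 1 else 0

lemma bw_nonneg {z : ℝ} (hz : 0 ≤ z) (b : Bool) : 0 ≤ bw z b := by
  unfold bw; split_ifs <;> linarith

lemma setW_nonneg {z : L → ℝ} (hz : ∀ l, 0 ≤ z l) (A : L → Bool) : 0 ≤ setW z A :=
  prod_nonneg fun l _ => bw_nonneg (hz l) _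

lemma lsize_nonneg {ℓ : L → ℝ} (hℓ : ∀ l, 0 ≤ ℓ l) (A : L → Bool) : 0 ≤ lsize ℓ A :=
  sum_nonneg fun l _ => by split_ifs <;> simp [hℓ]

lemma lsize_mono {ℓ : L → ℝ} (hℓ : ∀ l, 0 ≤ ℓ l) : Monotone (lsize ℓ) := by
  intro A B h
  refine sum_le_sum fun l _ => ?_
  have := h l
  revert this
  cases A l <;> cases B l <;> simp [hℓ]

lemma trunc_nonneg {z ℓ : L → ℝ} (hz : ∀ l, 0 ≤ z l) {g : ℝ → ℝ} (hg0 : ∀ t, 0 ≤ g t) (v : ℝ) :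
    0 ≤ trunc z ℓ g v :=
  sum_nonneg fun A _ => mul_nonneg (setW_nonneg hz A) (mul_nonneg (hg0 _) (by split_ifs <;> norm_num))

lemma trunc_mono {z ℓ : L → ℝ} (hz : ∀ l, 0 ≤ z l) {g : ℝ → ℝ} (hg0 : ∀ t, 0 ≤ g t) :
    Monotone (trunc z ℓ g) := by
  intro v w h
  refine sum_le_sum fun A _ => mul_le_mul_of_nonneg_left (mul_le_mul_of_nonneg_left ?_ (hg0 _)) (setW_nonneg hz A)
  split_ifs <;> first | (exfalso; linarith) | norm_num

lemma gridCount_antitone (K : ℕ) : Antitone (gridCount K) := by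
  intro S T h
  exact card_le_card (monotone_filter_right _ fun j _ hj => h.trans hj)

lemma le_gridCount {K : ℕ} {S : ℝ} (hS : 0 ≤ S) : (K : ℝ) * (1 - S) ≤ gridCount K S := by
  rcases Nat.eq_zero_or_pos K with rfl | hK
  · simp
  have hK' : (0 : ℝ) < K := by exact_mod_cast hK
  rcases le_or_gt S 1 with h1 | h1
  · have hsub : (range (⌈(K : ℝ) * (1 - S)⌉₊)) ⊆ (range K).filter fun j : ℕ => S ≤ 1 - j / K := by
      intro j hj
      have hj' : (j : ℝ) < K * (1 - S) := Nat.lt_ceil.mp (mem_range.mp hj)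
      refine mem_filter.mpr ⟨mem_range.mpr ?_, ?_⟩
      · have : (j : ℝ) < K := by nlinarith
        exact_mod_cast this
      · have : (j : ℝ) / K ≤ 1 - S := by rw [div_le_iff₀ hK']; linarith
        linarith
    have := card_le_card hsub
    rw [card_range] at this
    exact (Nat.le_ceil _).trans (by exact_mod_cast this)
  · exact le_trans (by nlinarith) (Nat.cast_nonneg _)

lemma sum_grid_ge {K : ℕ} (f : ℝ → ℝ) (hf : Monotone f) (hf0 : ∀ v, 0 ≤ f v) (S : ℝ) :
    ∑ i ∈ range (gridCount K S), f (i / K) ≤ ∑ j ∈ range K, f (1 - j / K - S) := by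
  set n := gridCount K S with hn
  rcases Nat.eq_zero_or_pos n with h0 | hpos
  · rw [h0]; simpa using sum_nonneg fun j _ => hf0 _
  have hnK : n ≤ K := by
    rw [hn]; exact (card_filter_le _ _).trans (by simp)
  have hK' : (0 : ℝ) < K := by exact_mod_cast (hpos.trans_le hnK)
  have hS : S ≤ 1 - ((n - 1 : ℕ) : ℝ) / K := by
    by_contra hcon
    push Not at hcon
    have hsub : ((range K).filter fun j : ℕ => S ≤ 1 - j / K) ⊆ range (n - 1) := by
      intro j hj
      have h1 := (mem_filter.mp hj).2
      rw [mem_range]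
      by_contra h2
      push Not at h2
      have h3 : ((n - 1 : ℕ) : ℝ) / K ≤ j / K := by gcongr
      linarith
    have := card_le_card hsub
    rw [card_range] at this
    change n ≤ n - 1 at this
    omega
  rw [← sum_range_reflect]
  refine le_trans (sum_le_sum fun j hj => ?_) (sum_le_sum_of_subset_of_nonneg
    (range_mono hnK) fun j _ _ => hf0 _)
  refine hf ?_
  have hj' : j ≤ n - 1 := by have := mem_range.mp hj; omega
  rw [Nat.cast_sub hj', sub_div]
  linarith

lemma sum_push_mul {δ γ : Type*} [Fintype δ] [Fintype γ] [DecidableEq γ] (v : δ → ℝ) (j : δ → γ) (f : γ → ℝ) :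
    ∑ c, (∑ a, if j a = c then v a else 0) * f c = ∑ a, v a * f (j a) := by
  simp only [sum_mul]
  rw [sum_comm]
  exact sum_congr rfl fun a _ => by simp

lemma sum_prod_le_of_coord_map {α β γ : Type*} [Fintype α] [DecidableEq α] [Fintype β] [DecidableEq β]
    [Fintype γ] [DecidableEq γ] [Preorder γ] (w : L → α → ℝ) (w' : L → β → ℝ) (e : α → γ) (e' : β → γ)
    (hw : ∀ l a, 0 ≤ w l a) (hw' : ∀ l a, 0 ≤ w' l a) (C : L → ℝ) (hC : ∀ l, 0 ≤ C l)
    (h : ∀ l (f : γ → ℝ), Antitone f → (∀ c, 0 ≤ f c) → ∑ a, w l a * f (e a) ≤ C l * ∑ b, w' l b * f (e' b))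
    (G : (L → γ) → ℝ) (hG : Antitone G) (hG0 : ∀ X, 0 ≤ G X) :
    ∑ x : L → α, (∏ l, w l (x l)) * G (fun l => e (x l)) ≤
      (∏ l, C l) * ∑ x : L → β, (∏ l, w' l (x l)) * G (fun l => e' (x l)) := by
  rw [sum_prod_map w (fun _ => e) G, sum_prod_map w' (fun _ => e') G]
  refine sum_prod_le_of_coord (fun l c => ∑ a, if e a = c then w l a else 0)
    (fun l c => ∑ a, if e' a = c then w' l a else 0) (fun l c => sum_nonneg fun a _ => ?_)
    (fun l c => sum_nonneg fun a _ => ?_) C hC (fun l f hf hf0 => ?_) G hG hG0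
  · split_ifs <;> simp [hw]
  · split_ifs <;> simp [hw']
  · rw [sum_push_mul, sum_push_mul]; exact h l f hf hf0

lemma colorInd_injective : Function.Injective (colorInd (ι := ι)) := by
  intro s t h
  rcases s with _ | i
  · rcases t with _ | j
    · rfl
    · have := congrFun h j; simp [colorInd] at this
  · have := congrFun h i; simp [colorInd] at this; exact this.symm

lemma prod_bw_colorInd_some (z : ℝ) (i : ι) : ∏ j, bw z (colorInd (some i) j) = z := by
  rw [prod_eq_single i]
  · simp [bw, colorInd]
  · intro j _ hj; simp [bw, colorInd, hj.symm]
  · simp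

lemma prod_bw_colorInd_none (z : ℝ) : ∏ j : ι, bw z (colorInd none j) = 1 := by
  simp [bw, colorInd]

lemma colorInd_none_le (c : ι → Bool) : colorInd none ≤ c := by
  intro i; simp [colorInd]

lemma sum_prod_bw (z : ℝ) : ∑ c : ι → Bool, ∏ i, bw z (c i) = (1 + z) ^ 𝔨 := by
  rw [← prod_sum_eq_sum_prod (fun _ : ι => bw z)]
  simp [bw, add_comm]

lemma sum_color_le_sum (F : (ι → Bool) → ℝ) (hF : ∀ c, 0 ≤ F c) :
    F (colorInd none) + ∑ i, F (colorInd (some i)) ≤ ∑ c, F c := by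
  rw [← Fintype.sum_option fun s => F (colorInd s)]
  calc _ = ∑ c ∈ univ.map ⟨_, colorInd_injective⟩, F c := by rw [sum_map]; rfl
    _ ≤ _ := sum_le_sum_of_subset_of_nonneg (subset_univ _) fun c _ _ => hF c

lemma diagW_sum_le {z : ℝ} (hz : 0 ≤ z) (hk : 1 ≤ 𝔨) (f : (ι → Bool) → ℝ) (hf : Antitone f)
    (hf0 : ∀ c, 0 ≤ f c) :
    ∑ a : Option ι, diagW (𝔨) z a * f (colorInd a) ≤
      (1 + 2 * (𝔨 : ℝ) ^ 2 * z ^ 2) * ∑ c, (∏ i, bw z (c i)) * f c := by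
  have hk1 : (1 : ℝ) ≤ 𝔨 := by exact_mod_cast hk
  have h1 := sum_color_le_sum (fun c => (∏ i : ι, bw z (c i)) * f c)
    fun c => mul_nonneg (prod_nonneg fun i _ => bw_nonneg hz _) (hf0 c)
  simp only [prod_bw_colorInd_none, prod_bw_colorInd_some, one_mul] at h1
  refine le_trans ?_ (mul_le_mul_of_nonneg_left h1 (by positivity))
  rw [Fintype.sum_option]
  simp only [diagW]
  have hw : z / (1 + z) ≤ z := div_le_self hz (by linarith)
  have hw0 : 0 ≤ z / (1 + z) := by positivity
  have h2 : ∑ i, (z / (1 + z) + 𝔨 * z ^ 2) * f (colorInd (some i)) ≤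
      ∑ i, z * f (colorInd (some i)) + (𝔨) ^ 2 * z ^ 2 * f (colorInd none) := by
    calc _ ≤ ∑ i : ι, (z * f (colorInd (some i)) + 𝔨 * z ^ 2 * f (colorInd none)) := by
          refine sum_le_sum fun i _ => ?_
          rw [add_mul]
          exact add_le_add (mul_le_mul_of_nonneg_right hw (hf0 _))
            (mul_le_mul_of_nonneg_left (hf (colorInd_none_le _)) (by positivity))
      _ = _ := by
          rw [sum_add_distrib, sum_const, card_univ, nsmul_eq_mul]; ring
  have h3 : 0 ≤ ∑ i, z * f (colorInd (some i)) := sum_nonneg fun i _ => mul_nonneg hz (hf0 _)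
  have h4 := hf0 (colorInd none)
  have h5 : (z / (1 + z)) ^ 2 ≤ (𝔨) ^ 2 * z ^ 2 := by
    rw [← mul_pow]; exact pow_le_pow_left₀ hw0 (by nlinarith) 2
  have h6 : (z / (1 + z)) ^ 2 * f (colorInd none) ≤ (𝔨) ^ 2 * z ^ 2 * f (colorInd none) :=
    mul_le_mul_of_nonneg_right h5 h4
  have h7 : 0 ≤ 2 * (𝔨 : ℝ) ^ 2 * z ^ 2 * ∑ i, z * f (colorInd (some i)) := by positivity
  nlinarith

lemma family_sum_le {z k : ℝ} (hz : 0 ≤ z) (hk : (𝔨 : ℝ) ≤ k) (hkz : k * z ≤ 1)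
    (f : (ι → Bool) → ℝ) (hf : Antitone f) (hf0 : ∀ c, 0 ≤ f c) :
    ∑ c, (∏ i, bw z (c i)) * f c ≤ (1 + (2 * k ^ 2 + 2 * k) * z ^ 2) *
      ∑ a : Option ι, (decW z (𝔨) (Sum.inl a) * (if a = none then 1 else 1 / (1 + z)) ^ 2) *
        f (colorInd a) := by
  set k' : ℝ := ((𝔨 : ℕ) : ℝ) with hk'
  have hk'0 : 0 ≤ k' := Nat.cast_nonneg _
  have hk0 : 0 ≤ k := hk'0.trans hk
  have hk'z : k' * z ≤ 1 := (mul_le_mul_of_nonneg_right hk hz).trans hkz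
  have h1 := sum_color_le_sum (fun c => (∏ i : ι, bw z (c i)) * (f (colorInd none) - f c))
    fun c => mul_nonneg (prod_nonneg fun i _ => bw_nonneg hz _) (sub_nonneg.mpr (hf (colorInd_none_le c)))
  simp only [prod_bw_colorInd_none, prod_bw_colorInd_some, one_mul, sub_self, zero_add, mul_sub,
    sum_sub_distrib, ← sum_mul, sum_prod_bw, sum_const, card_univ, nsmul_eq_mul] at h1
  rw [← hk'] at h1
  have h2 : (1 + z) ^ 𝔨 ≤ 1 + k' * z + (k' * z) ^ 2 := by
    have e1 : (1 + z) ^ 𝔨 ≤ Real.exp (k' * z) := by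
      rw [Real.exp_nat_mul]
      exact pow_le_pow_left₀ (by linarith) (by linarith [Real.add_one_le_exp z]) _
    have e2 := Real.abs_exp_sub_one_sub_id_le (x := k' * z) (by rw [abs_of_nonneg (by positivity)]; exact hk'z)
    linarith [(abs_le.mp e2).2]
  rw [Fintype.sum_option]
  simp only [decW, if_true, reduceCtorEq, if_false, one_pow, mul_one, one_mul]
  set c1 : ℝ := z * (1 - k' * z) * (1 / (1 + z)) ^ 2 with hc1
  have hc : z - (k' + 2) * z ^ 2 ≤ c1 := by
    have e1 : 1 - 2 * z ≤ (1 / (1 + z)) ^ 2 := by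
      rw [div_pow, one_pow, le_div_iff₀ (by positivity)]
      nlinarith [pow_nonneg hz 3, pow_nonneg hz 2]
    have e2 : 0 ≤ z * (1 - k' * z) := mul_nonneg hz (by linarith)
    have e3 := mul_le_mul_of_nonneg_left e1 e2
    rw [hc1]
    have : 0 ≤ k' * z ^ 3 := by positivity
    nlinarith
  have hc10 : 0 ≤ c1 := mul_nonneg (mul_nonneg hz (by linarith)) (by positivity)
  have h3 : ∑ i, z * f (colorInd (some i)) ≤ ∑ i, c1 * f (colorInd (some i)) +
      k' * (k' + 2) * z ^ 2 * f (colorInd none) := by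
    calc _ ≤ ∑ i : ι, (c1 * f (colorInd (some i)) + (k' + 2) * z ^ 2 * f (colorInd none)) := by
          refine sum_le_sum fun i _ => ?_
          have e1 := mul_le_mul_of_nonneg_right hc (hf0 (colorInd (some i)))
          have e2 : (k' + 2) * z ^ 2 * f (colorInd (some i)) ≤ (k' + 2) * z ^ 2 * f (colorInd none) :=
            mul_le_mul_of_nonneg_left (hf (colorInd_none_le _)) (by positivity)
          nlinarith
      _ = _ := by
          rw [sum_add_distrib, sum_const, card_univ, nsmul_eq_mul]; ring
  have h4 := hf0 (colorInd none)
  have h5 : 0 ≤ ∑ i, c1 * f (colorInd (some i)) := sum_nonneg fun i _ => mul_nonneg hc10 (hf0 _)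
  have h6 := mul_le_mul_of_nonneg_right h2 h4
  have h7 : (k' * (k' + 2) * z ^ 2 + (k' * z) ^ 2) * f (colorInd none) ≤
      (2 * k ^ 2 + 2 * k) * z ^ 2 * f (colorInd none) := by
    refine mul_le_mul_of_nonneg_right ?_ h4
    have e1 : k' ^ 2 ≤ k ^ 2 := pow_le_pow_left₀ hk'0 hk 2
    have : 2 * k' ^ 2 + 2 * k' ≤ 2 * k ^ 2 + 2 * k := by linarith
    nlinarith [mul_le_mul_of_nonneg_right this (sq_nonneg z)]
  have h8 : 0 ≤ (2 * k ^ 2 + 2 * k) * z ^ 2 * ∑ i, c1 * f (colorInd (some i)) := by positivity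
  nlinarith

/-- Product weights times an antitone function of the total size. -/
lemma antitone_famG {ℓ : L → ℝ} (hℓ : ∀ l, 0 ≤ ℓ l) {g h : ℝ → ℝ} (hg : Antitone g) (hg0 : ∀ t, 0 ≤ g t)
    (hh : Antitone h) (hh0 : ∀ t, 0 ≤ h t) :
    Antitone fun X : L → ι → Bool => (∏ i, g (lsize ℓ fun l => X l i) ^ 2) * h (∑ i, lsize ℓ fun l => X l i) := by
  intro X X' hX
  have h1 : ∀ i, lsize ℓ (fun l => X l i) ≤ lsize ℓ fun l => X' l i := fun i => lsize_mono hℓ fun l => hX l i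
  refine mul_le_mul (prod_le_prod (fun i _ => sq_nonneg _) fun i _ => pow_le_pow_left₀ (hg0 _) (hg (h1 i)) 2)
    (hh (sum_le_sum fun i _ => h1 i)) (hh0 _) (prod_nonneg fun i _ => sq_nonneg _)

lemma sum_family_eq (z ℓ : L → ℝ) (g h : ℝ → ℝ) :
    ∑ X : L → ι → Bool, (∏ l, ∏ i, bw (z l) (X l i)) *
        ((∏ i, g (lsize ℓ fun l => X l i) ^ 2) * h (∑ i, lsize ℓ fun l => X l i)) =
      ∑ A : ι → L → Bool, (∏ i, setW z (A i) * g (lsize ℓ (A i)) ^ 2) * h (∑ i, lsize ℓ (A i)) := by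
  rw [← (Equiv.piComm fun (_ : L) (_ : ι) => Bool).symm.sum_comp]
  refine sum_congr rfl fun A _ => ?_
  simp only [Equiv.piComm_symm, Equiv.piComm_apply, Function.swap]
  rw [prod_comm, prod_mul_distrib, mul_assoc]
  rfl

end Families

section Ratio

variable {L ι : Type*} [Fintype L] [DecidableEq L] [Fintype ι] [DecidableEq ι]

local notation "𝔨" => Fintype.card ι

/-- Sums over families of sets of primes. -/
noncomputable def famSum (κ : Type*) [Fintype κ] [DecidableEq κ] (z ℓ : L → ℝ) (g h : ℝ → ℝ) : ℝ :=
  ∑ A : κ → L → Bool, (∏ i, setW z (A i) * g (lsize ℓ (A i)) ^ 2) * h (∑ i, lsize ℓ (A i))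

lemma famSum_mono (κ : Type*) [Fintype κ] [DecidableEq κ] {z ℓ : L → ℝ} (hz : ∀ l, 0 ≤ z l) (hℓ : ∀ l, 0 ≤ ℓ l)
    (g : ℝ → ℝ) {h h' : ℝ → ℝ} (hh : ∀ t, 0 ≤ t → h t ≤ h' t) : famSum κ z ℓ g h ≤ famSum κ z ℓ g h' :=
  sum_le_sum fun A _ => mul_le_mul_of_nonneg_left
    (hh _ (sum_nonneg fun i _ => lsize_nonneg hℓ _))
    (prod_nonneg fun i _ => mul_nonneg (setW_nonneg hz _) (sq_nonneg _))

lemma famSum_const (κ : Type*) [Fintype κ] [DecidableEq κ] (z ℓ : L → ℝ) (g : ℝ → ℝ) :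
    famSum κ z ℓ g (fun _ => 1) = (∑ A, setW z A * g (lsize ℓ A) ^ 2) ^ Fintype.card κ := by
  have := prod_sum_eq_sum_prod (fun (_ : κ) (A : L → Bool) => setW z A * g (lsize ℓ A) ^ 2)
  rw [prod_const, card_univ] at this
  simp [famSum, this]

lemma famSum_id (κ : Type*) [Fintype κ] [DecidableEq κ] (z ℓ : L → ℝ) (g : ℝ → ℝ) :
    famSum κ z ℓ g (fun t => t) = Fintype.card κ * (∑ A, setW z A * g (lsize ℓ A) ^ 2 * lsize ℓ A) *
      (∑ A, setW z A * g (lsize ℓ A) ^ 2) ^ (Fintype.card κ - 1) := by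
  simp only [famSum, mul_sum]
  rw [sum_comm]
  have : ∀ j : κ, ∑ A : κ → L → Bool, (∏ i, setW z (A i) * g (lsize ℓ (A i)) ^ 2) * lsize ℓ (A j) =
      (∑ A, setW z A * g (lsize ℓ A) ^ 2 * lsize ℓ A) * (∑ A, setW z A * g (lsize ℓ A) ^ 2) ^ (Fintype.card κ - 1) := by
    intro j
    have h1 := prod_sum_eq_sum_prod (fun (i : κ) (A : L → Bool) =>
      setW z A * g (lsize ℓ A) ^ 2 * if i = j then lsize ℓ A else 1)
    rw [Fintype.prod_eq_mul_prod_subtype_ne _ j] at h1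
    have h2 : ∀ i : {i // i ≠ j}, ∑ A, setW z A * g (lsize ℓ A) ^ 2 * (if (i : κ) = j then lsize ℓ A else 1) =
        ∑ A, setW z A * g (lsize ℓ A) ^ 2 := fun i => by simp [i.2]
    have h3 : Fintype.card {i // i ≠ j} = Fintype.card κ - 1 := by
      rw [Fintype.card_subtype_compl, Fintype.card_subtype_eq]
    rw [prod_congr rfl fun i _ => h2 i, prod_const, card_univ, h3] at h1
    simp only [if_true] at h1
    rw [h1]
    refine sum_congr rfl fun A _ => ?_
    have h4 : ∏ i, (if i = j then lsize ℓ (A i) else 1) = lsize ℓ (A j) := by simp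
    conv_rhs => rw [prod_mul_distrib, h4]
  rw [sum_congr rfl fun j _ => this j, sum_const, card_univ, nsmul_eq_mul, ← mul_sum]
  ring

lemma famSum_le_mul {z ℓ : L → ℝ} (hz : ∀ l, 0 ≤ z l) (hℓ : ∀ l, 0 ≤ ℓ l) (g : ℝ → ℝ) {h : ℝ → ℝ}
    (hh : Antitone h) (m : ι) :
    famSum ι z ℓ g h ≤ (∑ A, setW z A * g (lsize ℓ A) ^ 2) * famSum {i : ι // i ≠ m} z ℓ g h := by
  rw [famSum, ← (Equiv.funSplitAt m (L → Bool)).symm.sum_comp, Fintype.sum_prod_type, famSum, sum_mul_sum]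
  refine sum_le_sum fun A _ => sum_le_sum fun B _ => ?_
  rw [Fintype.prod_eq_mul_prod_subtype_ne _ m, Fintype.sum_eq_add_sum_subtype_ne _ m]
  have e1 : (Equiv.funSplitAt m (L → Bool)).symm (A, B) m = A := by simp
  have e2 : ∀ j : {j // j ≠ m}, (Equiv.funSplitAt m (L → Bool)).symm (A, B) j = B j := fun j => by simp [j.2]
  simp only [e1, e2]
  rw [mul_assoc]
  refine mul_le_mul_of_nonneg_left (mul_le_mul_of_nonneg_left (hh ?_) ?_) ?_
  · linarith [lsize_nonneg hℓ A]
  · exact prod_nonneg fun i _ => mul_nonneg (setW_nonneg hz _) (sq_nonneg _)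
  · exact mul_nonneg (setW_nonneg hz _) (sq_nonneg _)

/-- The diagonal form, summed over the grid. -/
lemma sum_grid_diag_le {z ℓ : L → ℝ} (hz : ∀ l, 0 ≤ z l) (hℓ : ∀ l, 0 ≤ ℓ l) (hk : 1 ≤ 𝔨)
    {g : ℝ → ℝ} (hg : Antitone g) (hg0 : ∀ t, 0 ≤ g t) (K : ℕ) :
    ∑ j ∈ range K, ∑ s : L → Option ι, (∏ l, diagW (𝔨) (z l) (s l)) *
        sieveF ℓ g (1 - j / K) s ^ 2 ≤
      (∏ l, (1 + 2 * (𝔨 : ℝ) ^ 2 * z l ^ 2)) * famSum ι z ℓ g (fun t => gridCount K t) := by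
  rw [famSum, ← sum_family_eq z ℓ g (fun t => gridCount K t)]
  have hh : Antitone fun t => (gridCount K t : ℝ) := fun s t h => Nat.cast_le.mpr (gridCount_antitone K h)
  refine le_trans (le_of_eq ?_) (sum_prod_le_of_coord_map (fun l => diagW (ι := ι) (𝔨) (z l))
    (fun l (c : ι → Bool) => ∏ i, bw (z l) (c i)) colorInd id (fun l a => ?_)
    (fun l c => prod_nonneg fun i _ => bw_nonneg (hz l) _) _ (fun l => by positivity)
    (fun l f hf hf0 => diagW_sum_le (hz l) hk f hf hf0) _ (antitone_famG hℓ hg hg0 hh fun t => Nat.cast_nonneg _)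
    fun X => mul_nonneg (prod_nonneg fun i _ => sq_nonneg _) (Nat.cast_nonneg _))
  · rw [sum_comm]
    refine sum_congr rfl fun s _ => ?_
    rw [← mul_sum]
    congr 1
    simp only [sieveF, mul_pow, ← mul_sum, prod_pow]
    congr 1
    simp [gridCount, ite_pow]
  · have := hz l
    cases a <;> simp only [diagW] <;> positivity

lemma inner_ge {z ℓ : L → ℝ} (hz : ∀ l, 0 ≤ z l) (hℓ : ∀ l, 0 ≤ ℓ l) {g : ℝ → ℝ} (hg : Antitone g)
    (hg0 : ∀ t, 0 ≤ g t) (ρ : ℝ) (m : ι) (r : L → Option {i : ι // i ≠ m}) :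
    (∏ l, if r l = none then 1 else 1 / (1 + z l)) * ((∏ i, g (lsize ℓ fun l => colorInd (r l) i)) *
        trunc z ℓ g (ρ - ∑ i, lsize ℓ fun l => colorInd (r l) i)) ≤
      ∑ A : L → Bool, (∏ l, addW (z l) (r l) (A l)) * sieveF ℓ g ρ (fun l => addC (r l) (A l)) := by
  set S := ∑ i, lsize ℓ fun l => colorInd (r l) i with hS
  set Pg := ∏ i, g (lsize ℓ fun l => colorInd (r l) i) with hPg
  have hterm : ∀ A : L → Bool, (∏ l, addW (z l) (r l) (A l)) * sieveF ℓ g ρ (fun l => addC (r l) (A l)) =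
      Pg * ((∏ l, addW (z l) (r l) (A l)) * (g (lsize ℓ A) * if lsize ℓ A ≤ ρ - S then 1 else 0)) := by
    intro A
    by_cases hA : ∀ l, r l ≠ none → A l = false
    · have e1 : (fun l => colorInd (addC (r l) (A l)) m) = A := by
        funext l
        have := hA l
        cases h : r l with
        | none => cases A l <;> simp [addC, colorInd]
        | some i => rw [h] at this; simp [addC, colorInd, i.2, this]
      have e2 : ∀ i : {i : ι // i ≠ m}, (fun l => colorInd (addC (r l) (A l)) (i : ι)) = fun l => colorInd (r l) i := by
        intro i; funext l
        cases h : r l with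
        | none => cases A l <;> simp [addC, colorInd, i.2.symm]
        | some j => simp [addC, colorInd, Subtype.ext_iff]
      rw [sieveF, Fintype.prod_eq_mul_prod_subtype_ne _ m, Fintype.sum_eq_add_sum_subtype_ne _ m, e1]
      simp only [e2]
      rw [← hS, ← hPg]
      have : (lsize ℓ A + S ≤ ρ) ↔ (lsize ℓ A ≤ ρ - S) := ⟨fun h => by linarith, fun h => by linarith⟩
      simp only [this]; ring
    · push Not at hA
      obtain ⟨l, hl, hAl⟩ := hA
      have : ∏ l, addW (z l) (r l) (A l) = 0 := by
        refine prod_eq_zero (mem_univ l) ?_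
        obtain ⟨i, hi⟩ := Option.ne_none_iff_exists'.mp hl
        rw [hi]
        cases h : A l
        · exact absurd h hAl
        · rfl
      rw [this]; ring
  rw [sum_congr rfl fun A _ => hterm A, ← mul_sum, mul_left_comm]
  refine mul_le_mul_of_nonneg_left ?_ (prod_nonneg fun i _ => hg0 _)
  have hC : ∀ l, 0 < (if r l = none then 1 else 1 + z l) := fun l => by
    have := hz l; split_ifs <;> linarith
  have hant : Antitone fun A : L → Bool => g (lsize ℓ A) * if lsize ℓ A ≤ ρ - S then (1 : ℝ) else 0 := by
    intro A B h
    have h1 := lsize_mono hℓ h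
    refine mul_le_mul (hg h1) ?_ (by split_ifs <;> norm_num) (hg0 _)
    split_ifs <;> first | (exfalso; linarith) | norm_num
  have key := sum_prod_le_of_coord (fun l => bw (z l)) (fun l => addW (z l) (r l)) (fun l b => bw_nonneg (hz l) b)
    (fun l b => by cases r l <;> cases b <;> simp [addW, hz l]) (fun l => if r l = none then 1 else 1 + z l)
    (fun l => (hC l).le) (fun l f hf hf0 => by
      have h1 := hf (Bool.false_le true)
      have h2 := mul_le_mul_of_nonneg_left h1 (hz l)
      cases r l <;> simp [bw, addW] <;> linarith) _ hant
    fun A => mul_nonneg (hg0 _) (by split_ifs <;> norm_num)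
  have hprod : (∏ l, if r l = none then 1 else 1 / (1 + z l)) * (∏ l, if r l = none then 1 else 1 + z l) = 1 := by
    rw [← prod_mul_distrib]
    refine prod_eq_one fun l _ => ?_
    have := hz l
    split_ifs
    · simp
    · field_simp
  calc _ ≤ (∏ l, if r l = none then 1 else 1 / (1 + z l)) * ((∏ l, if r l = none then 1 else 1 + z l) * _) :=
        mul_le_mul_of_nonneg_left key (prod_nonneg fun l _ => by
          have := hz l; split_ifs <;> positivity)
    _ = _ := by rw [← mul_assoc, hprod, one_mul]

/-- The restricted forms, summed over the grid. -/
lemma le_sum_grid {z ℓ : L → ℝ} (hz : ∀ l, 0 ≤ z l) (hz1 : ∀ l, 𝔨 * z l ≤ 1) (hℓ : ∀ l, 0 ≤ ℓ l)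
    {g : ℝ → ℝ} (hg : Antitone g) (hg0 : ∀ t, 0 ≤ g t) (K : ℕ) (m : ι) :
    famSum {i : ι // i ≠ m} z ℓ g (fun t => ∑ i ∈ range (gridCount K t), trunc z ℓ g (i / K) ^ 2) ≤
      (∏ l, (1 + (2 * (𝔨 : ℝ) ^ 2 + 2 * 𝔨) * z l ^ 2)) *
      ∑ j ∈ range K, ∑ r : L → Option {i : ι // i ≠ m},
        (∏ l, decW (z l) (Fintype.card {i : ι // i ≠ m}) (Sum.inl (r l))) *
        (∑ A : L → Bool, (∏ l, addW (z l) (r l) (A l)) * sieveF ℓ g (1 - j / K) (fun l => addC (r l) (A l))) ^ 2 := by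
  have hcard : (Fintype.card {i : ι // i ≠ m} : ℝ) ≤ 𝔨 := by
    exact_mod_cast Fintype.card_subtype_le _
  have hD : ∀ l (r : Option {i : ι // i ≠ m}), 0 ≤ decW (z l) (Fintype.card {i : ι // i ≠ m}) (Sum.inl r) := by
    intro l r
    have h0 := hz l; have h2 := hz1 l
    cases r with
    | none => exact zero_le_one
    | some i =>
      refine mul_nonneg h0 ?_
      nlinarith
  set h : ℝ → ℝ := fun t => ∑ i ∈ range (gridCount K t), trunc z ℓ g (i / K) ^ 2 with hh
  have hanti : Antitone h := fun s t hst =>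
    sum_le_sum_of_subset_of_nonneg (range_mono (gridCount_antitone K hst)) fun i _ _ => sq_nonneg _
  have hh0 : ∀ t, 0 ≤ h t := fun t => sum_nonneg fun i _ => sq_nonneg _
  rw [famSum, ← sum_family_eq z ℓ g h]
  refine le_trans (sum_prod_le_of_coord_map (fun l (c : {i : ι // i ≠ m} → Bool) => ∏ i, bw (z l) (c i))
    (fun l (a : Option {i : ι // i ≠ m}) => decW (z l) (Fintype.card {i : ι // i ≠ m}) (Sum.inl a) *
      (if a = none then 1 else 1 / (1 + z l)) ^ 2) id colorInd
    (fun l c => prod_nonneg fun i _ => bw_nonneg (hz l) _) (fun l a => mul_nonneg (hD l a) (sq_nonneg _)) _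
    (fun l => by positivity) (fun l f hf hf0 => family_sum_le (hz l) hcard (hz1 l) f hf hf0) _
    (antitone_famG hℓ hg hg0 hanti hh0) fun X => mul_nonneg (prod_nonneg fun i _ => sq_nonneg _) (hh0 _)) ?_
  refine mul_le_mul_of_nonneg_left ?_ (prod_nonneg fun l _ => by positivity)
  rw [sum_comm]
  refine sum_le_sum fun r _ => ?_
  rw [prod_mul_distrib, mul_assoc, ← mul_sum]
  refine mul_le_mul_of_nonneg_left ?_ (prod_nonneg fun l _ => hD l _)
  have h1 := sum_grid_ge (K := K) (fun v => trunc z ℓ g v ^ 2)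
    (fun v w hvw => pow_le_pow_left₀ (trunc_nonneg hz hg0 v) (trunc_mono hz hg0 hvw) 2) (fun v => sq_nonneg _)
    (∑ i, lsize ℓ fun l => colorInd (r l) i)
  rw [prod_pow, prod_pow]
  refine le_trans (mul_le_mul_of_nonneg_left (mul_le_mul_of_nonneg_left h1 (sq_nonneg _)) (sq_nonneg _)) ?_
  rw [mul_sum, mul_sum]
  refine sum_le_sum fun j _ => ?_
  rw [← mul_pow, ← mul_pow]
  refine pow_le_pow_left₀ (mul_nonneg (prod_nonneg fun l _ => ?_)
    (mul_nonneg (prod_nonneg fun i _ => hg0 _) (trunc_nonneg hz hg0 _))) (inner_ge hz hℓ hg hg0 _ m r) 2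
  have := hz l
  split_ifs <;> positivity

lemma sum_range_ge_of_monotone {b : ℕ → ℝ} (hb : Monotone b) (n0 n : ℕ) :
    ∑ i ∈ range n0, b i + b n0 * ((n : ℝ) - n0) ≤ ∑ i ∈ range n, b i := by
  rcases le_total n0 n with h | h
  · induction n, h using Nat.le_induction with
    | base => simp
    | succ n hn ih =>
      rw [sum_range_succ]; push_cast
      have := hb hn; linarith
  · induction n0, h using Nat.le_induction with
    | base => simp
    | succ k hk ih =>
      rw [sum_range_succ]; push_cast
      have h1 := hb (Nat.le_succ k)
      have h2 : (n : ℝ) ≤ k := by exact_mod_cast hk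
      have h3 : b (k + 1) * ((n : ℝ) - k) ≤ b k * (n - k) := mul_le_mul_of_nonpos_right h1 (by linarith)
      have : b k ≤ b (k+1) := h1
      nlinarith

/-- Convexity argument comparing the two sums. -/
lemma sum_mul_famSum_le (κ : Type*) [Fintype κ] [DecidableEq κ] {z ℓ : L → ℝ} (hz : ∀ l, 0 ≤ z l)
    (hℓ : ∀ l, 0 ≤ ℓ l) (g : ℝ → ℝ) (K n0 : ℕ) (hκ : 1 ≤ Fintype.card κ)
    {b : ℕ → ℝ} (hb : Monotone b)
    (h : n0 * (∑ A, setW z A * g (lsize ℓ A) ^ 2) ≤ K * ((∑ A, setW z A * g (lsize ℓ A) ^ 2) -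
      Fintype.card κ * ∑ A, setW z A * g (lsize ℓ A) ^ 2 * lsize ℓ A)) :
    (∑ i ∈ range n0, b i) * famSum κ z ℓ g (fun t => gridCount K t) ≤
      n0 * famSum κ z ℓ g (fun t => ∑ i ∈ range (gridCount K t), b i) := by
  set B0 := ∑ A, setW z A * g (lsize ℓ A) ^ 2 with hB0
  set B1 := ∑ A, setW z A * g (lsize ℓ A) ^ 2 * lsize ℓ A with hB1
  have hB00 : 0 ≤ B0 := sum_nonneg fun A _ => mul_nonneg (setW_nonneg hz _) (sq_nonneg _)
  set Pc := famSum κ z ℓ g (fun t => gridCount K t) with hPc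
  set P0 := famSum κ z ℓ g (fun _ => 1) with hP0
  have lin : ∀ a c : ℝ, ∀ u : ℝ → ℝ, famSum κ z ℓ g (fun t => a * 1 + c * u t) = a * P0 + c * famSum κ z ℓ g u := by
    intro a c u
    simp only [hP0, famSum, mul_sum, ← sum_add_distrib]
    exact sum_congr rfl fun A _ => by ring
  have h1 : n0 * P0 ≤ Pc := by
    have e1 : famSum κ z ℓ g (fun t => (K : ℝ) * 1 + (-K) * t) ≤ Pc :=
      famSum_mono κ hz hℓ g fun t ht => by have := le_gridCount (K := K) ht; linarith
    rw [lin, famSum_id, hP0, famSum_const, ← hB0, ← hB1] at e1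
    refine le_trans ?_ e1
    rw [hP0, famSum_const, ← hB0]
    obtain ⟨c, hc⟩ : ∃ c, Fintype.card κ = c + 1 := ⟨Fintype.card κ - 1, by omega⟩
    have e2 := mul_le_mul_of_nonneg_right h (pow_nonneg hB00 c)
    rw [hc] at e2 ⊢
    simp only [Nat.add_sub_cancel]
    rw [pow_succ]
    linarith
  have h2 : (∑ i ∈ range n0, b i - b n0 * n0) * P0 + b n0 * Pc ≤
      famSum κ z ℓ g (fun t => ∑ i ∈ range (gridCount K t), b i) := by
    rw [hPc, ← lin]
    refine famSum_mono κ hz hℓ g fun t _ => ?_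
    have := sum_range_ge_of_monotone hb n0 (gridCount K t); linarith
  have h3 : ∑ i ∈ range n0, b i ≤ n0 * b n0 := by
    calc _ ≤ ∑ i ∈ range n0, b n0 := sum_le_sum fun i hi => hb (mem_range.mp hi).le
      _ = _ := by simp
  have h4 := mul_le_mul_of_nonneg_left h2 (Nat.cast_nonneg (α := ℝ) n0)
  have h5 := mul_nonneg (sub_nonneg.mpr h3) (sub_nonneg.mpr h1)
  nlinarith

/-- A grid parameter for which the sieve weights have a good ratio. -/
theorem exists_good_parameter {z ℓ : L → ℝ} (hz : ∀ l, 0 ≤ z l) (hz1 : ∀ l, 𝔨 * z l ≤ 1)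
    (hℓ : ∀ l, 0 ≤ ℓ l) (hk : 2 ≤ 𝔨) {g : ℝ → ℝ} (hg : Antitone g) (hg0 : ∀ t, 0 ≤ g t) {K : ℕ}
    (hK : K ≠ 0) (n0 : ℕ)
    (h : n0 * (∑ A, setW z A * g (lsize ℓ A) ^ 2) ≤ K * ((∑ A, setW z A * g (lsize ℓ A) ^ 2) -
      (𝔨 - 1) * ∑ A, setW z A * g (lsize ℓ A) ^ 2 * lsize ℓ A)) :
    ∃ ρ : ℝ, ρ ≤ 1 ∧ ∃ T : ℝ, g 0 ^ (2 * 𝔨) ≤ T ∧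
      quadForm (fun l => kap (z l / (1 + z l))) (lam z fun s : L → Option ι => (∏ l, sgn (s l)) * sieveF ℓ g ρ s) ≤ T ∧
      𝔨 * (∑ i ∈ range n0, trunc z ℓ g (i / K) ^ 2) * T ≤
        (∏ l, (1 + 2 * (𝔨 : ℝ) ^ 2 * z l ^ 2)) *
        (∏ l, (1 + (2 * (𝔨 : ℝ) ^ 2 + 2 * 𝔨) * z l ^ 2)) *
        (∑ A, setW z A * g (lsize ℓ A) ^ 2) * n0 *
        ∑ m : ι, quadForm (fun l => kap (z l)) (fun x : L → Option {i : ι // i ≠ m} =>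
          lam z (fun s => (∏ l, sgn (s l)) * sieveF ℓ g ρ s) (fun l => (x l).map Subtype.val)) := by
  set B0 := ∑ A, setW z A * g (lsize ℓ A) ^ 2 with hB0
  have hB00 : 0 ≤ B0 := sum_nonneg fun A _ => mul_nonneg (setW_nonneg hz _) (sq_nonneg _)
  set C1 := ∏ l, (1 + 2 * (𝔨 : ℝ) ^ 2 * z l ^ 2) with hC1
  have hC10 : 0 ≤ C1 := prod_nonneg fun l _ => by positivity
  set C2 := ∏ l, (1 + (2 * (𝔨 : ℝ) ^ 2 + 2 * 𝔨) * z l ^ 2) with hC2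
  have hC20 : 0 ≤ C2 := prod_nonneg fun l _ => by positivity
  set Bs := ∑ i ∈ range n0, trunc z ℓ g (i / K) ^ 2 with hBs
  have hBs0 : 0 ≤ Bs := sum_nonneg fun i _ => sq_nonneg _
  set T : ℕ → ℝ := fun j => ∑ s : L → Option ι, (∏ l, diagW (𝔨) (z l) (s l)) *
        sieveF ℓ g (1 - j / K) s ^ 2 with hT
  set U : ℕ → ι → ℝ := fun j m => ∑ r : L → Option {i : ι // i ≠ m},
        (∏ l, decW (z l) (Fintype.card {i : ι // i ≠ m}) (Sum.inl (r l))) *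
        (∑ A : L → Bool, (∏ l, addW (z l) (r l) (A l)) * sieveF ℓ g (1 - j / K) (fun l => addC (r l) (A l))) ^ 2 with hU
  have hK' : (0 : ℝ) < K := by exact_mod_cast Nat.pos_of_ne_zero hK
  have hcard : ∀ m : ι, Fintype.card {i : ι // i ≠ m} = 𝔨 - 1 := fun m => by
    rw [Fintype.card_subtype_compl, Fintype.card_subtype_eq]
  have hone : ∀ m : ι, Bs * ∑ j ∈ range K, T j ≤ C1 * C2 * B0 * n0 * ∑ j ∈ range K, U j m := by
    intro m
    have e1 := sum_grid_diag_le (ι := ι) hz hℓ (by omega) hg hg0 K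
    have e2 := famSum_le_mul (ι := ι) hz hℓ g (h := fun t => gridCount K t)
      (fun s t h => Nat.cast_le.mpr (gridCount_antitone K h)) m
    have e3 := sum_mul_famSum_le {i : ι // i ≠ m} hz hℓ g K n0 (by rw [hcard]; omega)
      (b := fun i => trunc z ℓ g (i / K) ^ 2)
      (fun i j hij => pow_le_pow_left₀ (trunc_nonneg hz hg0 _) (trunc_mono hz hg0 (by gcongr)) 2)
      (by rw [hcard, Nat.cast_sub (by omega), Nat.cast_one]; exact h)
    have e4 := le_sum_grid hz hz1 hℓ hg hg0 K m
    calc Bs * ∑ j ∈ range K, T j ≤ Bs * (C1 * (B0 * famSum {i : ι // i ≠ m} z ℓ g fun t => gridCount K t)) :=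
          mul_le_mul_of_nonneg_left (e1.trans (mul_le_mul_of_nonneg_left e2 hC10)) hBs0
      _ = C1 * B0 * (Bs * famSum {i : ι // i ≠ m} z ℓ g fun t => gridCount K t) := by ring
      _ ≤ C1 * B0 * (n0 * (C2 * ∑ j ∈ range K, U j m)) :=
          mul_le_mul_of_nonneg_left (e3.trans (mul_le_mul_of_nonneg_left e4 (Nat.cast_nonneg _))) (by positivity)
      _ = _ := by ring
  obtain ⟨j, hj, hj2⟩ : ∃ j ∈ range K, 𝔨 * Bs * T j ≤ C1 * C2 * B0 * n0 * ∑ m, U j m := by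
    refine exists_le_of_sum_le (nonempty_range_iff.mpr hK) ?_
    have hsw : ∑ j ∈ range K, ∑ m, U j m = ∑ m, ∑ j ∈ range K, U j m := sum_comm
    rw [← mul_sum, ← mul_sum, hsw]
    calc 𝔨 * Bs * ∑ j ∈ range K, T j = ∑ m : ι, Bs * ∑ j ∈ range K, T j := by
          rw [sum_const, card_univ, nsmul_eq_mul]; ring
      _ ≤ ∑ m, C1 * C2 * B0 * n0 * ∑ j ∈ range K, U j m := sum_le_sum fun m _ => hone m
      _ = _ := (mul_sum _ _ _).symm
  have hdiag : ∀ l (a : Option ι), 0 ≤ diagW (𝔨) (z l) a := fun l a => by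
    have := hz l
    cases a <;> simp only [diagW] <;> positivity
  refine ⟨1 - j / K, by have : (0 : ℝ) ≤ j / K := by positivity
                        linarith, T j, ?_, ?_, hj2.trans ?_⟩
  · have hj' : (j : ℝ) / K ≤ 1 := by
      rw [div_le_one hK']; exact_mod_cast (mem_range.mp hj).le
    refine le_trans ?_ (single_le_sum (f := fun s : L → Option ι => (∏ l, diagW (𝔨) (z l) (s l)) *
        sieveF ℓ g (1 - j / K) s ^ 2) (fun s _ => mul_nonneg (prod_nonneg fun l _ => hdiag l _) (sq_nonneg _))
      (mem_univ fun _ => none))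
    have e1 : ∀ i : ι, lsize ℓ (fun _ => colorInd none i) = 0 := fun i => by simp [lsize, colorInd]
    simp only [sieveF, e1, sum_const_zero, sub_nonneg, hj', if_true, mul_one, prod_const, card_univ,
      diagW]
    rw [← pow_mul, mul_comm (𝔨) 2]
    refine le_mul_of_one_le_left (pow_nonneg (hg0 _) _) ?_
    calc (1 : ℝ) = ∏ _l : L, (1 : ℝ) := by simp
      _ ≤ _ := prod_le_prod (fun _ _ => zero_le_one) fun l _ => by nlinarith [sq_nonneg (z l / (1 + z l))]
  · refine (quadForm_kap_le z hz hz1 (by omega) _).trans (le_of_eq ?_)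
    refine sum_congr rfl fun s _ => ?_
    have : (∏ l, sgn (s l)) ^ 2 = 1 := by
      rw [← prod_pow]
      refine prod_eq_one fun l _ => ?_
      cases s l <;> simp [sgn]
    rw [mul_pow, this, one_mul]
  · exact mul_le_mul_of_nonneg_left (sum_le_sum fun m _ => le_quadForm_kap z hz hz1 m _) (by positivity)

end Ratio

end

section

open Finset Real
open ArithmeticFunction (vonMangoldt vonMangoldt_apply_prime vonMangoldt_le_log vonMangoldt_mul_zeta vonMangoldt_nonneg vonMangoldt_sum
  sum_Ioc_mul_zeta_eq_sum)

section CoprimeSums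

lemma mul_le_sub_of_antitone_deriv {H Γ : ℝ → ℝ} {a b : ℝ} (hab : a ≤ b)
    (hΓ : ∀ t ∈ Set.Icc a b, HasDerivAt Γ (H t) t) (hH : AntitoneOn H (Set.Icc a b)) :
    H b * (b - a) ≤ Γ b - Γ a ∧ Γ b - Γ a ≤ H a * (b - a) := by
  have hc : ContinuousOn Γ (Set.Icc a b) := fun t ht => (hΓ t ht).continuousAt.continuousWithinAt
  have hd : DifferentiableOn ℝ Γ (interior (Set.Icc a b)) := fun t ht =>
    (hΓ t (interior_subset ht)).differentiableAt.differentiableWithinAt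
  have ha : a ∈ Set.Icc a b := ⟨le_rfl, hab⟩
  have hb : b ∈ Set.Icc a b := ⟨hab, le_rfl⟩
  constructor
  · refine (convex_Icc a b).mul_sub_le_image_sub_of_le_deriv hc hd (fun t ht => ?_) a ha b hb hab
    have ht' := interior_subset ht
    rw [(hΓ t ht').deriv]; exact hH ht' hb ht'.2
  · refine (convex_Icc a b).image_sub_le_mul_sub_of_deriv_le hc hd (fun t ht => ?_) a ha b hb hab
    have ht' := interior_subset ht
    rw [(hΓ t ht').deriv]; exact hH ha ht' ht'.1

variable {W c : ℕ} {P : ℕ → Prop} [DecidablePred P] {H Γ : ℝ → ℝ}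

lemma card_coprime_block (W j : ℕ) :
    ((Ioc (W * j) (W * (j + 1))).filter (Nat.Coprime W)).card = W.totient := by
  have h := Nat.filter_coprime_Ico_eq_totient W (W * j + 1)
  have e : Ioc (W * j) (W * (j + 1)) = Ico (W * j + 1) (W * j + 1 + W) := by
    ext n; simp only [mem_Ioc, mem_Ico, mul_add, mul_one]; omega
  rw [e]; exact h

lemma sum_block_succ (W J : ℕ) (f : ℕ → ℝ) :
    ∑ n ∈ (Ioc 0 (W * (J + 1))).filter P, f n =
      ∑ n ∈ (Ioc 0 (W * J)).filter P, f n + ∑ n ∈ (Ioc (W * J) (W * (J + 1))).filter P, f n := by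
  rw [← sum_union]
  · congr 1
    rw [← filter_union, Ioc_union_Ioc_eq_Ioc (Nat.zero_le _) (Nat.mul_le_mul_left _ (Nat.le_succ _))]
  · refine disjoint_filter_filter (disjoint_left.mpr fun n hn hn' => ?_)
    rw [mem_Ioc] at hn hn'; omega

lemma sum_block_ge (hc : ∀ j, ((Ioc (W * j) (W * (j + 1))).filter P).card = c)
    (hW : 1 ≤ W) (hΓ : ∀ t, 1 ≤ t → HasDerivAt Γ (H t) t) (hH : AntitoneOn H (Set.Ici 1)) (J : ℕ) :
    (c : ℝ) / W * (Γ (W * (J + 1)) - Γ W) ≤ ∑ n ∈ (Ioc 0 (W * J)).filter P, H n := by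
  have hW' : (1 : ℝ) ≤ W := by exact_mod_cast hW
  induction J with
  | zero => simp
  | succ J ih =>
    rw [sum_block_succ]
    have hJ : (1 : ℝ) ≤ W * (J + 1) := by
      have : (0 : ℝ) ≤ J := Nat.cast_nonneg _
      nlinarith
    have h1 : (c : ℝ) * H (W * (J + 1)) ≤ ∑ n ∈ (Ioc (W * J) (W * (J + 1))).filter P, H n := by
      rw [← hc J, ← nsmul_eq_mul]
      refine card_nsmul_le_sum _ _ _ fun n hn => ?_
      have hn' := mem_Ioc.mp (mem_filter.mp hn).1
      have : 1 ≤ n := by omega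
      exact hH (Set.mem_Ici.mpr (by exact_mod_cast this)) (Set.mem_Ici.mpr hJ) (by exact_mod_cast hn'.2)
    have h2 := (mul_le_sub_of_antitone_deriv (H := H) (Γ := Γ) (a := W * (J + 1)) (b := W * ((J + 1 : ℕ) + 1))
      (by push_cast; nlinarith) (fun t ht => hΓ t (hJ.trans ht.1))
      (hH.mono fun t ht => Set.mem_Ici.mpr (hJ.trans ht.1))).2
    have h3 : (c : ℝ) / W * (Γ (W * ((J + 1 : ℕ) + 1)) - Γ (W * (J + 1))) ≤ c * H (W * (J + 1)) := by
      refine (mul_le_mul_of_nonneg_left h2 (by positivity)).trans (le_of_eq ?_)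
      push_cast; field_simp; ring
    linarith

lemma sum_block_le (hc : ∀ j, ((Ioc (W * j) (W * (j + 1))).filter P).card = c)
    (hW : 1 ≤ W) (hΓ : ∀ t, 1 ≤ t → HasDerivAt Γ (H t) t) (hH : AntitoneOn H (Set.Ici 1)) {J : ℕ} (hJ : 1 ≤ J) :
    ∑ n ∈ (Ioc 0 (W * (J + 1))).filter P, H n ≤ 2 * c * H 1 + (c : ℝ) / W * (Γ (W * J) - Γ W) := by
  have hW' : (1 : ℝ) ≤ W := by exact_mod_cast hW
  have hblock : ∀ (J : ℕ) (s : ℝ), 1 ≤ s → s ≤ W * J + 1 →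
      ∑ n ∈ (Ioc (W * J) (W * (J + 1))).filter P, H n ≤ (c : ℝ) * H s := by
    intro J s hs hsJ
    rw [← hc J, ← nsmul_eq_mul]
    refine sum_le_card_nsmul _ _ _ fun n hn => ?_
    have hn' := mem_Ioc.mp (mem_filter.mp hn).1
    have h4 : (W : ℝ) * J + 1 ≤ n := by exact_mod_cast hn'.1
    exact hH (Set.mem_Ici.mpr hs) (Set.mem_Ici.mpr (hs.trans (hsJ.trans h4))) (hsJ.trans h4)
  induction J, hJ using Nat.le_induction with
  | base =>
    have h0 := hblock 0 1 le_rfl (by simp)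
    have h1 := hblock 1 1 le_rfl (by simp)
    rw [sum_block_succ, sum_block_succ W 0]
    simp only [Nat.cast_one, mul_one, sub_self, mul_zero, Ioc_self, filter_empty, sum_empty] at *
    linarith
  | succ J hJ ih =>
    rw [sum_block_succ]
    have hJ1 : (1 : ℝ) ≤ J := by exact_mod_cast hJ
    have hJ' : (1 : ℝ) ≤ W * J := by nlinarith
    have h1 := hblock (J + 1) (W * ((J + 1 : ℕ))) (by push_cast; nlinarith) (by linarith)
    have h2 := (mul_le_sub_of_antitone_deriv (H := H) (Γ := Γ) (a := W * J) (b := W * ((J + 1 : ℕ)))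
      (by push_cast; nlinarith) (fun t ht => hΓ t (hJ'.trans ht.1))
      (hH.mono fun t ht => Set.mem_Ici.mpr (hJ'.trans ht.1))).1
    have h3 : c * H (W * ((J + 1 : ℕ))) ≤ (c : ℝ) / W * (Γ (W * ((J + 1 : ℕ))) - Γ (W * J)) := by
      refine (le_of_eq ?_).trans (mul_le_mul_of_nonneg_left h2 (by positivity))
      push_cast; field_simp; ring
    linarith

/-- Sums over integers coprime to `W` of functions of the logarithm. -/
theorem abs_sum_coprime_log_sub_le (hW : 1 ≤ W) {R : ℕ} (hR : 2 ≤ R) {γ Γ : ℝ → ℝ} (hγ : Antitone γ) (hγ0 : ∀ t, 0 ≤ γ t)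
    (hΓ : ∀ t, 0 ≤ t → HasDerivAt Γ (γ t) t) {v : ℝ} (hv0 : 0 ≤ v) (hv1 : v ≤ 1) :
    |∑ n ∈ (Icc 1 R).filter (fun n : ℕ => W.Coprime n ∧ log n / log R ≤ v), γ (log n / log R) / n -
      (W.totient : ℝ) / W * log R * (Γ v - Γ 0)| ≤ 2 * W * γ 0 := by
  have hW' : (1 : ℝ) ≤ W := by exact_mod_cast hW
  have hR' : (2 : ℝ) ≤ R := by exact_mod_cast hR
  set lr := log R with hlr
  have hl : 0 < lr := log_pos (by linarith)
  set H : ℝ → ℝ := fun t => γ (log t / lr) / t with hHdef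
  set Γ' : ℝ → ℝ := fun t => lr * Γ (log t / lr) with hΓ'
  have hH : AntitoneOn H (Set.Ici 1) := by
    intro s hs t ht hst
    have hs' : (1 : ℝ) ≤ s := hs
    refine div_le_div₀ (hγ0 _) (hγ ?_) (by linarith) hst
    gcongr
  have hΓd : ∀ t, 1 ≤ t → HasDerivAt Γ' (H t) t := by
    intro t ht
    have h1 : HasDerivAt (fun t => log t / lr) (t⁻¹ / lr) t := (hasDerivAt_log (by linarith)).div_const _
    have h2 := ((hΓ (log t / lr) (div_nonneg (log_nonneg ht) hl.le)).comp t h1).const_mul lr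
    refine h2.congr_deriv ?_
    change _ = γ (log t / lr) / t
    field_simp
  have hmono : ∀ s t, 1 ≤ s → s ≤ t → Γ' s ≤ Γ' t := fun s t hs hst => by
    have := (mul_le_sub_of_antitone_deriv (H := H) (Γ := Γ') hst (fun u hu => hΓd u (hs.trans hu.1))
      (hH.mono fun u hu => Set.mem_Ici.mpr (hs.trans hu.1))).1
    have h0 : 0 ≤ H t := div_nonneg (hγ0 _) (by linarith)
    nlinarith
  set X := exp (v * lr) with hX
  have hX1 : 1 ≤ X := one_le_exp (by positivity)
  have hXv : Γ' X = lr * Γ v := by simp only [hΓ', hX, log_exp]; field_simp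
  have h1v : Γ' 1 = lr * Γ 0 := by simp [hΓ']
  have hH1 : H 1 = γ 0 := by simp [hHdef]
  have hφ1 : (W.totient : ℝ) / W ≤ 1 := by
    rw [div_le_one (by linarith)]; exact_mod_cast Nat.totient_le W
  have hφ0 : 0 ≤ (W.totient : ℝ) / W := by positivity
  have hφW : 2 * W.totient * γ 0 ≤ 2 * W * γ 0 := by
    have : (W.totient : ℝ) ≤ W := by exact_mod_cast Nat.totient_le W
    nlinarith [hγ0 0]
  set J := ⌊X / W⌋₊ with hJ
  have hJ1 : (W : ℝ) * J ≤ X := by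
    have := Nat.floor_le (a := X / W) (by positivity)
    rw [le_div_iff₀ (by linarith)] at this; linarith
  have hJ2 : X < W * (J + 1) := by
    have := Nat.lt_floor_add_one (X / W)
    rw [div_lt_iff₀ (by linarith)] at this; linarith
  have hmem : ∀ n : ℕ, 1 ≤ n → (log n / lr ≤ v ↔ (n : ℝ) ≤ X) := by
    intro n hn
    rw [div_le_iff₀ hl, hX, log_le_iff_le_exp (by exact_mod_cast hn)]
  have hXR : X ≤ R := by
    rw [hX, ← le_log_iff_exp_le (by linarith)]; nlinarith
  have hΓW : Γ' W - Γ' 1 ≤ W * γ 0 := by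
    have := (mul_le_sub_of_antitone_deriv (H := H) (Γ := Γ') hW' (fun u hu => hΓd u hu.1)
      (hH.mono fun u hu => Set.mem_Ici.mpr hu.1)).2
    rw [hH1] at this
    nlinarith [hγ0 0]
  have hgoal : (W.totient : ℝ) / W * lr * (Γ v - Γ 0) = (W.totient : ℝ) / W * (Γ' X - Γ' 1) := by
    rw [hXv, h1v]; ring
  have hHn : ∀ n : ℕ, 0 ≤ H n := fun n => div_nonneg (hγ0 _) (Nat.cast_nonneg _)
  rw [hgoal, abs_sub_le_iff]
  constructor
  · have hsub : ∀ J' : ℕ, J ≤ J' → ∑ n ∈ (Icc 1 R).filter (fun n : ℕ => W.Coprime n ∧ log n / lr ≤ v), H n ≤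
        ∑ n ∈ (Ioc 0 (W * (J' + 1))).filter (Nat.Coprime W), H n := by
      intro J' hJ'
      refine sum_le_sum_of_subset_of_nonneg (fun n hn => ?_) fun n _ _ => hHn n
      obtain ⟨h1, h2, h3⟩ := mem_filter.mp hn
      have h4 := (mem_Icc.mp h1).1
      refine mem_filter.mpr ⟨mem_Ioc.mpr ⟨h4, ?_⟩, h2⟩
      have h5 : (n : ℝ) < W * (J + 1) := ((hmem n h4).mp h3).trans_lt hJ2
      have h6 : n < W * (J + 1) := by exact_mod_cast h5
      exact h6.le.trans (Nat.mul_le_mul_left _ (by omega))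
    rcases Nat.eq_zero_or_pos J with h0 | hpos
    · have h1 := hsub 1 (by omega)
      have h2 := sum_block_le (card_coprime_block W) hW hΓd hH (le_refl 1)
      simp only [Nat.cast_one, mul_one, sub_self, mul_zero, add_zero] at h2
      rw [hH1] at h2
      have h3 : 0 ≤ (W.totient : ℝ) / W * (Γ' X - Γ' 1) := mul_nonneg hφ0 (sub_nonneg.mpr (hmono _ _ le_rfl hX1))
      linarith
    · have h1 := hsub J le_rfl
      have h2 := sum_block_le (card_coprime_block W) hW hΓd hH hpos
      rw [hH1] at h2
      have hJ3 : (1 : ℝ) ≤ W * J := by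
        have : (1 : ℝ) ≤ J := by exact_mod_cast hpos
        nlinarith
      have h3 := mul_le_mul_of_nonneg_left (hmono _ _ hJ3 hJ1) hφ0
      have h4 := mul_le_mul_of_nonneg_left (hmono _ _ le_rfl hW') hφ0
      linarith
  · have hsub : ∑ n ∈ (Ioc 0 (W * J)).filter (Nat.Coprime W), H n ≤
        ∑ n ∈ (Icc 1 R).filter (fun n : ℕ => W.Coprime n ∧ log n / lr ≤ v), H n := by
      refine sum_le_sum_of_subset_of_nonneg (fun n hn => ?_) fun n _ _ => hHn n
      obtain ⟨h1, h2⟩ := mem_filter.mp hn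
      have h3 := mem_Ioc.mp h1
      have h4 : (n : ℝ) ≤ X := le_trans (by exact_mod_cast h3.2) hJ1
      have h5 : n ≤ R := by exact_mod_cast h4.trans hXR
      exact mem_filter.mpr ⟨mem_Icc.mpr ⟨h3.1, h5⟩, h2, (hmem n h3.1).mpr h4⟩
    have h2 := sum_block_ge (card_coprime_block W) hW hΓd hH J
    have h3 := mul_le_mul_of_nonneg_left (hmono _ _ hX1 hJ2.le) hφ0
    have h4 : (W.totient : ℝ) / W * (Γ' W - Γ' 1) ≤ W * γ 0 :=
      (mul_le_mul_of_nonneg_left hΓW hφ0).trans (mul_le_of_le_one_left (mul_nonneg (by linarith) (hγ0 0)) hφ1)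
    have h5 : 0 ≤ W * γ 0 := mul_nonneg (by linarith) (hγ0 0)
    linarith

end CoprimeSums

section SievePrimes

/-- The primes in `(D, R]` other than `p₁`. -/
def sievePrimes (D p₁ R : ℕ) : Finset ℕ := (Icc 1 R).filter fun p => p.Prime ∧ D < p ∧ p ≠ p₁

variable {D p₁ R : ℕ}

local notation "𝕃" => sievePrimes D p₁ R

lemma mem_sievePrimes {p : ℕ} : p ∈ 𝕃 ↔ p ≤ R ∧ p.Prime ∧ D < p ∧ p ≠ p₁ := by
  simp only [sievePrimes, mem_filter, mem_Icc]
  exact ⟨fun h => ⟨h.1.2, h.2⟩, fun h => ⟨⟨h.2.1.one_lt.le, h.1⟩, h.2⟩⟩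

/-- The density attached to a prime. -/
noncomputable def zp (l : 𝕃) : ℝ := 1 / ((l : ℕ) - 1 : ℝ)

/-- The relative logarithm of a prime. -/
noncomputable def lp (l : 𝕃) : ℝ := log (l : ℕ) / log R

/-- The product of a set of primes. -/
def natProd (A : 𝕃 → Bool) : ℕ := ∏ l, if A l then (l : ℕ) else 1

lemma prime_coe (l : 𝕃) : (l : ℕ).Prime := (mem_sievePrimes.mp l.2).2.1

lemma two_le_coe (l : 𝕃) : (2 : ℝ) ≤ (l : ℕ) := by exact_mod_cast (prime_coe l).two_le

lemma zp_nonneg (l : 𝕃) : 0 ≤ zp l := by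
  have := two_le_coe l
  exact div_nonneg zero_le_one (by linarith)

lemma zp_div (l : 𝕃) : zp l / (1 + zp l) = 1 / (l : ℕ) := by
  have := two_le_coe l
  have h1 : ((l : ℕ) : ℝ) - 1 ≠ 0 := by linarith
  have h2 : ((l : ℕ) : ℝ) ≠ 0 := by linarith
  have h3 : 1 + zp l = (l : ℕ) / ((l : ℕ) - 1 : ℝ) := by unfold zp; field_simp; ring
  rw [h3, zp]; field_simp

lemma inv_le_zp (l : 𝕃) : 1 / ((l : ℕ) : ℝ) ≤ zp l := by
  have := two_le_coe l
  exact one_div_le_one_div_of_le (by linarith) (by linarith)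

lemma zp_le (l : 𝕃) (hD : 1 ≤ D) : zp l ≤ 1 / D := by
  have h1 : D + 1 ≤ (l : ℕ) := (mem_sievePrimes.mp l.2).2.2.1
  have h2 : (D : ℝ) + 1 ≤ (l : ℕ) := by exact_mod_cast h1
  have h3 : (1 : ℝ) ≤ D := by exact_mod_cast hD
  exact one_div_le_one_div_of_le (by linarith) (by linarith)

lemma lp_nonneg (l : 𝕃) : 0 ≤ lp l :=
  div_nonneg (log_nonneg (by linarith [two_le_coe l])) (log_natCast_nonneg R)

lemma sum_zp_sq_le (hD : 2 ≤ D) : ∑ l : 𝕃, zp l ^ 2 ≤ 2 / D := by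
  have hD' : (2 : ℝ) ≤ D := by exact_mod_cast hD
  have h0 : ∑ l : 𝕃, zp l ^ 2 = ∑ p ∈ 𝕃, (((p - 1 : ℕ) : ℝ) ^ 2)⁻¹ := by
    rw [← sum_coe_sort (𝕃) fun p => (((p - 1 : ℕ) : ℝ) ^ 2)⁻¹]
    refine sum_congr rfl fun l _ => ?_
    rw [zp, Nat.cast_sub (prime_coe l).one_lt.le, Nat.cast_one, one_div, inv_pow]
  rw [h0]
  have h1 : ∑ p ∈ 𝕃, (((p - 1 : ℕ) : ℝ) ^ 2)⁻¹ ≤ ∑ n ∈ Ioc (D - 1) (D + R), ((n : ℝ) ^ 2)⁻¹ := by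
    rw [← sum_image (f := fun n : ℕ => ((n : ℝ) ^ 2)⁻¹) (g := fun p => p - 1)]
    · refine sum_le_sum_of_subset_of_nonneg (fun n hn => ?_) fun n _ _ => by positivity
      obtain ⟨p, hp, rfl⟩ := mem_image.mp hn
      have := mem_sievePrimes.mp hp
      rw [mem_Ioc]; omega
    · intro p hp q hq h
      have h1 := (mem_sievePrimes.mp hp).2.1.one_lt
      have h2 := (mem_sievePrimes.mp hq).2.1.one_lt
      simp only at h; omega
  refine h1.trans ((sum_Ioc_inv_sq_le_sub (by omega) (by omega)).trans ?_)
  rw [Nat.cast_sub (by omega), Nat.cast_one]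
  have h2 : ((D : ℝ) - 1)⁻¹ ≤ 2 / D := by
    rw [inv_eq_one_div, div_le_div_iff₀ (by linarith) (by linarith)]; linarith
  have h3 : (0 : ℝ) ≤ ((D + R : ℕ) : ℝ)⁻¹ := by positivity
  linarith

lemma prod_one_add_mul_zp_sq_le (hD : 2 ≤ D) {c : ℝ} (hc : 0 ≤ c) :
    ∏ l : 𝕃, (1 + c * zp l ^ 2) ≤ exp (2 * c / D) := by
  calc _ ≤ ∏ l : 𝕃, exp (c * zp l ^ 2) :=
        prod_le_prod (fun l _ => by positivity) fun l _ => by linarith [add_one_le_exp (c * zp l ^ 2)]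
    _ = exp (c * ∑ l : 𝕃, zp l ^ 2) := by rw [← exp_sum, mul_sum]
    _ ≤ _ := by
        rw [exp_le_exp]
        refine (mul_le_mul_of_nonneg_left (sum_zp_sq_le hD) hc).trans (le_of_eq (by ring))

lemma natProd_pos (A : 𝕃 → Bool) : 0 < natProd A :=
  prod_pos fun l _ => by split_ifs; exacts [(prime_coe l).pos, one_pos]

lemma log_natProd (A : 𝕃 → Bool) : log (natProd A) / log R = lsize lp A := by
  rw [natProd, Nat.cast_prod, log_prod, sum_div]
  · refine sum_congr rfl fun l _ => ?_
    split_ifs <;> simp [lp]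
  · intro l _
    split_ifs
    · exact_mod_cast (prime_coe l).ne_zero
    · simp

lemma dvd_natProd_iff (A : 𝕃 → Bool) {p : ℕ} (hp : p.Prime) :
    p ∣ natProd A ↔ ∃ l, A l = true ∧ (l : ℕ) = p := by
  rw [natProd, hp.prime.dvd_finsetProd_iff]
  constructor
  · rintro ⟨l, _, hl⟩
    split_ifs at hl with h
    · exact ⟨l, h, ((Nat.prime_dvd_prime_iff_eq hp (prime_coe l)).mp hl).symm⟩
    · exact absurd (Nat.dvd_one.mp hl) hp.one_lt.ne'
  · rintro ⟨l, h, rfl⟩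
    exact ⟨l, mem_univ _, by simp [h]⟩

lemma natProd_injective : Function.Injective (natProd (D := D) (p₁ := p₁) (R := R)) := by
  intro A B h
  funext l
  have h1 := dvd_natProd_iff A (prime_coe l)
  have h2 := dvd_natProd_iff B (prime_coe l)
  rw [h] at h1
  have h3 : ∀ C : 𝕃 → Bool, (∃ l', C l' = true ∧ (l' : ℕ) = l) ↔ C l = true :=
    fun C => ⟨fun ⟨l', h, e⟩ => by rwa [Subtype.ext e] at h, fun h => ⟨l, h, rfl⟩⟩
  rw [h3] at h1 h2
  have := h1.symm.trans h2
  rcases hA : A l <;> rcases hB : B l <;> simp_all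

lemma prod_bw_inv (A : 𝕃 → Bool) :
    ∏ l : 𝕃, bw (1 / ((l : ℕ) : ℝ)) (A l) = 1 / natProd A := by
  rw [natProd, Nat.cast_prod, one_div, ← prod_inv_distrib]
  refine prod_congr rfl fun l _ => ?_
  unfold bw; split_ifs <;> simp

lemma coprime_primorial_iff {n : ℕ} : (primorial D).Coprime n ↔ ∀ p, p.Prime → p ∣ n → D < p := by
  constructor
  · intro h p hp hpn
    by_contra hD
    push Not at hD
    have h1 : p ∣ primorial D := by
      rw [primorial]
      exact dvd_prod_of_mem _ (mem_filter.mpr ⟨mem_range.mpr (by omega), hp⟩)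
    have := Nat.dvd_gcd h1 hpn
    rw [h] at this
    exact hp.one_lt.ne' (Nat.dvd_one.mp this)
  · intro h
    refine Nat.Coprime.prod_left fun p hp => ?_
    have hp' := (mem_filter.mp hp).2
    have hp2 := mem_range.mp (mem_filter.mp hp).1
    refine (Nat.Prime.coprime_iff_not_dvd hp').mpr fun hd => ?_
    have := h p hp' hd
    omega

lemma natProd_coprime (A : 𝕃 → Bool) : (primorial D).Coprime (natProd A) := by
  rw [coprime_primorial_iff]
  intro p hp hpA
  obtain ⟨l, -, rfl⟩ := (dvd_natProd_iff A hp).mp hpA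
  exact (mem_sievePrimes.mp l.2).2.2.1

lemma sum_le_sum_of_injOn {α β : Type*} [DecidableEq β] {s : Finset α} {t : Finset β} (φ : α → β)
    (hφ : ∀ a ∈ s, φ a ∈ t) (hinj : Set.InjOn φ s) {f : α → ℝ} {h : β → ℝ} (hf : ∀ a ∈ s, f a ≤ h (φ a))
    (hh : ∀ b ∈ t, 0 ≤ h b) : ∑ a ∈ s, f a ≤ ∑ b ∈ t, h b := by
  calc _ ≤ ∑ a ∈ s, h (φ a) := sum_le_sum hf
    _ = ∑ b ∈ s.image φ, h b := (sum_image hinj).symm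
    _ ≤ _ := sum_le_sum_of_subset_of_nonneg (image_subset_iff.mpr hφ) fun b hb _ => hh b hb

variable {γ : ℝ → ℝ}

lemma sum_setW_le (hD : 2 ≤ D) (hR : 2 ≤ R) (hγ : Antitone γ) (hγ0 : ∀ t, 0 ≤ γ t) {v : ℝ} (hv : v ≤ 1) :
    ∑ A : 𝕃 → Bool, setW zp A * (γ (lsize lp A) * if lsize lp A ≤ v then 1 else 0) ≤
      exp (2 / D) * ∑ n ∈ (Icc 1 R).filter (fun n : ℕ => (primorial D).Coprime n ∧
        log n / log R ≤ v), γ (log n / log R) / n := by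
  have hlr : 0 < log R := log_pos (by exact_mod_cast hR)
  have hant : Antitone fun A : 𝕃 → Bool =>
      γ (lsize lp A) * if lsize lp A ≤ v then (1 : ℝ) else 0 := by
    intro A B h
    have h1 := lsize_mono lp_nonneg h
    refine mul_le_mul (hγ h1) ?_ (by split_ifs <;> norm_num) (hγ0 _)
    split_ifs <;> first | (exfalso; linarith) | norm_num
  have key := sum_prod_le_of_coord (fun l : 𝕃 => bw (zp l)) (fun l => bw (1 / ((l : ℕ) : ℝ)))
    (fun l b => bw_nonneg (zp_nonneg l) b) (fun l b => bw_nonneg (by positivity) b) (fun l => 1 + 1 * zp l ^ 2)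
    (fun l => by positivity) (fun l f hf hf0 => by
      have h1 := hf (Bool.false_le true)
      have h2 : zp l - 1 / ((l : ℕ) : ℝ) ≤ zp l ^ 2 := by
        have := two_le_coe l
        have h3 : zp l - 1 / ((l : ℕ) : ℝ) = zp l * (1 / ((l : ℕ) : ℝ)) := by
          have h1 : ((l : ℕ) : ℝ) - 1 ≠ 0 := by linarith
          unfold zp; field_simp; ring
        rw [h3, sq]
        exact mul_le_mul_of_nonneg_left (inv_le_zp l) (zp_nonneg l)
      have h4 : (zp l - 1 / ((l : ℕ) : ℝ)) * f true ≤ zp l ^ 2 * f false :=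
        mul_le_mul h2 h1 (hf0 _) (sq_nonneg _)
      have h5 : 0 ≤ zp l ^ 2 * (1 / ((l : ℕ) : ℝ) * f true) := mul_nonneg (sq_nonneg _) (mul_nonneg (by positivity) (hf0 _))
      rw [Fintype.sum_bool, Fintype.sum_bool]
      simp only [bw, if_true, Bool.false_eq_true, if_false]
      nlinarith) _ hant fun A => mul_nonneg (hγ0 _) (by split_ifs <;> norm_num)
  refine key.trans ?_
  have hprod : ∏ l : 𝕃, (1 + 1 * zp l ^ 2) ≤ exp (2 / D) := by
    have := prod_one_add_mul_zp_sq_le (D := D) (p₁ := p₁) (R := R) hD zero_le_one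
    rwa [mul_one] at this
  refine mul_le_mul hprod ?_ (sum_nonneg fun A _ => mul_nonneg
    (prod_nonneg fun l _ => bw_nonneg (by positivity) _) (mul_nonneg (hγ0 _) (by split_ifs <;> norm_num)))
    (exp_nonneg _)
  rw [← sum_filter_of_ne (p := fun A => lsize lp A ≤ v)
    (fun A _ h => by by_contra hc; simp [hc] at h)]
  refine sum_le_sum_of_injOn natProd (fun A hA => ?_) natProd_injective.injOn (fun A hA => ?_) fun n _ =>
    div_nonneg (hγ0 _) (Nat.cast_nonneg _)
  · have hA' := (mem_filter.mp hA).2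
    rw [mem_filter, mem_Icc, log_natProd]
    refine ⟨⟨natProd_pos A, ?_⟩, natProd_coprime A, hA'⟩
    have h1 := hA'.trans hv
    rw [← log_natProd, div_le_one hlr] at h1
    have := (log_le_log_iff (by exact_mod_cast natProd_pos A) (by exact_mod_cast (by omega : 0 < R))).mp h1
    exact_mod_cast this
  · have hA' := (mem_filter.mp hA).2
    rw [prod_bw_inv, log_natProd, if_pos hA', mul_one]
    exact le_of_eq (by ring)

lemma inv_natProd_le (A : 𝕃 → Bool) : 1 / (natProd A : ℝ) ≤ setW zp A := by
  rw [← prod_bw_inv, setW]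
  refine prod_le_prod (fun l _ => bw_nonneg (by positivity) _) fun l _ => ?_
  unfold bw; split_ifs
  · exact inv_le_zp l
  · exact le_rfl

lemma sum_coprime_inv_sq_le (hD : 2 ≤ D) :
    ∑ b ∈ (Icc 1 R).filter (fun b : ℕ => b = 1 ∨ D < b), 1 / (b : ℝ) ^ 2 ≤ 1 + 1 / (D : ℝ) := by
  have h1 : (Icc 1 R).filter (fun b : ℕ => b = 1 ∨ D < b) ⊆ insert 1 (Ioc D (D + R)) := by
    intro b hb
    rw [mem_filter, mem_Icc] at hb
    rw [mem_insert, mem_Ioc]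
    omega
  refine (sum_le_sum_of_subset_of_nonneg h1 fun b _ _ => by positivity).trans ?_
  rw [sum_insert (by rw [mem_Ioc]; omega)]
  have := sum_Ioc_inv_sq_le_sub (α := ℝ) (k := D) (n := D + R) (by omega) (by omega)
  simp only [one_div] at this ⊢
  have h3 : (0 : ℝ) ≤ ((D + R : ℕ) : ℝ)⁻¹ := by positivity
  simp only [Nat.cast_one, one_pow, inv_one]
  linarith

lemma le_sum_setW (hD : 2 ≤ D) (hR : 2 ≤ R) (hp₁ : p₁.Prime) (hDp : D < p₁) (hγ : Antitone γ) (hγ0 : ∀ t, 0 ≤ γ t)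
    {v : ℝ} :
    ∑ n ∈ (Icc 1 R).filter (fun n : ℕ => (primorial D).Coprime n ∧
        log n / log R ≤ v), γ (log n / log R) / n ≤ exp (2 / D) *
    ∑ A : 𝕃 → Bool, setW zp A * (γ (lsize lp A) * if lsize lp A ≤ v then 1 else 0) := by
  have hlr : 0 < log R := log_pos (by exact_mod_cast hR)
  have hD' : (2 : ℝ) ≤ D := by exact_mod_cast hD
  set Z := ∑ A : 𝕃 → Bool, setW zp A * (γ (lsize lp A) * if lsize lp A ≤ v then 1 else 0) with hZ
  set s := (Icc 1 R).filter (fun n : ℕ => (primorial D).Coprime n ∧ log n / log R ≤ v) with hs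
  set B := (Icc 1 R).filter (fun b : ℕ => b = 1 ∨ D < b) with hB
  have hch : ∀ n ∈ s, ∃ t : (𝕃 → Bool) × ℕ × ℕ, t.2.1 ∈ B ∧ t.2.2 ∈ ({1, p₁} : Finset ℕ) ∧
      n = natProd t.1 * t.2.1 ^ 2 * t.2.2 := by
    intro n hn
    obtain ⟨h1, h2, -⟩ := mem_filter.mp hn
    obtain ⟨hn1, hnR⟩ := mem_Icc.mp h1
    rw [coprime_primorial_iff] at h2
    obtain ⟨a, b, hab, ha⟩ := Nat.sq_mul_squarefree n
    have hb0 : b ≠ 0 := by rintro rfl; simp at hab; omega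
    have ha0 : a ≠ 0 := by rintro rfl; simp at hab; omega
    set A : 𝕃 → Bool := fun l => decide ((l : ℕ) ∣ a) with hA
    have hbn : b ∣ n := hab ▸ (dvd_pow_self b two_ne_zero).mul_right a
    have han : a ∣ n := hab ▸ Dvd.intro_left _ rfl
    set c := if p₁ ∣ a then p₁ else 1 with hc
    have hac : a = natProd A * c := by
      have e1 : a = ∏ p ∈ a.primeFactors, p := (Nat.prod_primeFactors_of_squarefree ha).symm
      have e2 : natProd A = ∏ p ∈ a.primeFactors.filter (fun p => p ≠ p₁), p := by
        rw [natProd, prod_coe_sort (𝕃) (fun p => if decide (p ∣ a) then p else 1)]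
        simp only [decide_eq_true_eq]
        rw [← prod_filter]
        refine prod_congr ?_ fun _ _ => rfl
        ext p
        simp only [mem_filter, mem_sievePrimes, Nat.mem_primeFactors]
        constructor
        · rintro ⟨⟨_, hp, _, hne⟩, hd⟩; exact ⟨⟨hp, hd, ha0⟩, hne⟩
        · rintro ⟨⟨hp, hd, _⟩, hne⟩
          exact ⟨⟨(Nat.le_of_dvd (by omega) (hd.trans han)).trans hnR, hp, h2 p hp (hd.trans han), hne⟩, hd⟩
      rw [e2, hc]
      conv_lhs => rw [e1, ← prod_filter_mul_prod_filter_not _ (fun p => p ≠ p₁)]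
      congr 1
      simp only [not_not]
      rw [filter_eq']
      by_cases h : p₁ ∣ a
      · rw [if_pos h, if_pos (Nat.mem_primeFactors.mpr ⟨hp₁, h, ha0⟩), prod_singleton]
      · rw [if_neg h, if_neg fun h' => h (Nat.mem_primeFactors.mp h').2.1, prod_empty]
    refine ⟨(A, b, c), ?_, ?_, ?_⟩
    · refine mem_filter.mpr ⟨mem_Icc.mpr ⟨Nat.pos_of_ne_zero hb0, (Nat.le_of_dvd (by omega) hbn).trans hnR⟩, ?_⟩
      by_cases hb1 : b = 1
      · exact Or.inl hb1
      · refine Or.inr ((h2 _ (Nat.minFac_prime hb1) ((Nat.minFac_dvd b).trans hbn)).trans_le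
          (Nat.minFac_le (Nat.pos_of_ne_zero hb0)))
    · simp only [hc, mem_insert, mem_singleton]; split_ifs <;> simp
    · rw [← hab, hac]; ring
  choose! φ hφ1 hφ2 hφ3 using hch
  have key : ∑ n ∈ s, γ (log n / log R) / n ≤
      ∑ t ∈ (univ : Finset (𝕃 → Bool)) ×ˢ (B ×ˢ ({1, p₁} : Finset ℕ)),
        (setW zp t.1 * (γ (lsize lp t.1) * if lsize lp t.1 ≤ v then 1 else 0)) * (1 / (t.2.1 : ℝ) ^ 2 * (1 / (t.2.2 : ℝ))) := by
    refine sum_le_sum_of_injOn φ (fun n hn => ?_) (fun n hn m hm h => ?_) (fun n hn => ?_) fun t _ => ?_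
    · simp only [mem_product, mem_univ, true_and]
      exact ⟨hφ1 n hn, hφ2 n hn⟩
    · rw [hφ3 n hn, hφ3 m hm, h]
    · have e := hφ3 n hn
      have hn1 := mem_filter.mp hn
      have hnpos := (mem_Icc.mp hn1.1).1
      have h1 : natProd (φ n).1 ≤ n := Nat.le_of_dvd hnpos (Dvd.intro _ ((mul_assoc _ _ _).symm.trans e.symm))
      have h2 : lsize lp (φ n).1 ≤ log n / log R := by
        rw [← log_natProd]
        gcongr
        exact_mod_cast natProd_pos _
      rw [if_pos (h2.trans hn1.2.2), mul_one]
      have h3 : ((n : ℕ) : ℝ) = natProd (φ n).1 * ((φ n).2.1 : ℝ) ^ 2 * (φ n).2.2 := by exact_mod_cast e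
      calc γ (log n / log R) / n ≤ γ (lsize lp (φ n).1) / n := by
            gcongr; exact hγ h2
        _ = 1 / (natProd (φ n).1 : ℝ) * γ (lsize lp (φ n).1) * (1 / ((φ n).2.1 : ℝ) ^ 2 * (1 / ((φ n).2.2 : ℝ))) := by
            rw [h3]; simp only [div_eq_mul_inv, mul_inv]; ring
        _ ≤ _ := by
            refine mul_le_mul_of_nonneg_right (mul_le_mul_of_nonneg_right (inv_natProd_le _) (hγ0 _)) (by positivity)
    · exact mul_nonneg (mul_nonneg (setW_nonneg zp_nonneg _) (mul_nonneg (hγ0 _) (by split_ifs <;> norm_num)))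
        (by positivity)
  refine key.trans ?_
  have hfac : ∑ t ∈ (univ : Finset (𝕃 → Bool)) ×ˢ (B ×ˢ ({1, p₁} : Finset ℕ)),
        (setW zp t.1 * (γ (lsize lp t.1) * if lsize lp t.1 ≤ v then 1 else 0)) * (1 / (t.2.1 : ℝ) ^ 2 * (1 / (t.2.2 : ℝ))) =
      Z * ((∑ b ∈ B, 1 / (b : ℝ) ^ 2) * ∑ c ∈ ({1, p₁} : Finset ℕ), 1 / (c : ℝ)) := by
    rw [sum_product, hZ, sum_mul]
    refine sum_congr rfl fun A _ => ?_
    rw [sum_mul_sum, ← sum_product', mul_sum]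
  rw [hfac, mul_comm]
  have hZ0 : 0 ≤ Z := sum_nonneg fun A _ =>
    mul_nonneg (setW_nonneg zp_nonneg _) (mul_nonneg (hγ0 _) (by split_ifs <;> norm_num))
  refine mul_le_mul_of_nonneg_right ?_ hZ0
  have h1 : ∑ c ∈ ({1, p₁} : Finset ℕ), 1 / (c : ℝ) ≤ 1 + 1 / D := by
    rw [sum_pair hp₁.one_lt.ne]
    have : (D : ℝ) ≤ p₁ := by exact_mod_cast hDp.le
    have := one_div_le_one_div_of_le (by linarith) this
    simp only [Nat.cast_one, div_one]; linarith
  have h2 := sum_coprime_inv_sq_le (R := R) hD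
  have h3 : 1 + 1 / (D : ℝ) ≤ exp (1 / D) := by linarith [add_one_le_exp (1 / (D : ℝ))]
  calc _ ≤ exp (1 / D) * exp (1 / D) := mul_le_mul (h2.trans h3) (h1.trans h3)
        (sum_nonneg fun _ _ => by positivity) (exp_nonneg _)
    _ = _ := by rw [← exp_add]; ring_nf

/-- One-dimensional sums over sets of primes. -/
theorem sum_setW_bounds (hD : 2 ≤ D) (hR : 2 ≤ R) (hp₁ : p₁.Prime) (hDp : D < p₁) (hγ : Antitone γ) (hγ0 : ∀ t, 0 ≤ γ t)
    {Γ : ℝ → ℝ} (hΓ : ∀ t, 0 ≤ t → HasDerivAt Γ (γ t) t) {v : ℝ} (hv0 : 0 ≤ v) (hv1 : v ≤ 1) :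
    ((primorial D).totient : ℝ) / primorial D * log R * (Γ v - Γ 0) - 2 * primorial D * γ 0 ≤ exp (2 / D) *
      ∑ A : 𝕃 → Bool, setW zp A * (γ (lsize lp A) * if lsize lp A ≤ v then 1 else 0) ∧
    ∑ A : 𝕃 → Bool, setW zp A * (γ (lsize lp A) * if lsize lp A ≤ v then 1 else 0) ≤
      exp (2 / D) * (((primorial D).totient : ℝ) / primorial D * log R * (Γ v - Γ 0) + 2 * primorial D * γ 0) := by
  have h1 := abs_sub_le_iff.mp (abs_sum_coprime_log_sub_le (W := primorial D) (primorial_pos D) hR hγ hγ0 hΓ hv0 hv1)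
  constructor
  · exact le_trans (by linarith [h1.2]) (le_sum_setW hD hR hp₁ hDp hγ hγ0)
  · exact (sum_setW_le hD hR hγ hγ0 hv1).trans (mul_le_mul_of_nonneg_left (by linarith [h1.1]) (exp_nonneg _))

end SievePrimes

section Expansion

/-- Weighted count of an arithmetic progression. -/
lemma abs_sum_wt_sub_le {J : ℕ} (hJ : J ≠ 0) {N : ℝ} (hN : 1 ≤ N) {Q : ℕ} (hQ : 1 ≤ Q) (a : ℕ) :
    |∑ n ∈ (Icc 1 ⌊N⌋₊).filter (fun n => n ≡ a [MOD Q]), wt J (n / N) - N / (J + 1) / Q| ≤ 2 := by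
  have hQ' : (1 : ℝ) ≤ Q := by exact_mod_cast hQ
  have hN0 : 0 < N := by linarith
  set H : ℝ → ℝ := fun t => wt J (t / N) with hHdef
  set Γ : ℝ → ℝ := fun t => -(N / (J + 1)) * wt (J + 1) (t / N) with hΓdef
  have hanti : Antitone H := fun s t hst => wt_antitone J (by gcongr)
  have hΓ : ∀ t, HasDerivAt Γ (H t) t := by
    intro t
    have h1 : ∀ x : ℝ, HasDerivAt (wt (J + 1)) (-((J + 1) * wt J x)) x := by
      intro x
      rcases lt_trichotomy x 1 with h | h | h
      · have e : (fun y : ℝ => (1 - y) ^ (J + 1)) =ᶠ[nhds x] wt (J + 1) := by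
          filter_upwards [Iio_mem_nhds h] with y hy
          rw [wt_eq_pow (le_of_lt hy)]
        refine HasDerivAt.congr_of_eventuallyEq ?_ e.symm
        refine (((hasDerivAt_id x).const_sub 1).pow (J + 1)).congr_deriv ?_
        rw [wt_eq_pow h.le]; simp
      · subst h
        rw [wt_eq_zero hJ le_rfl, mul_zero, neg_zero]
        rw [hasDerivAt_iff_isLittleO_nhds_zero]
        have e1 : wt (J + 1) 1 = 0 := wt_eq_zero (by omega) le_rfl
        simp only [e1, sub_zero, smul_zero]
        have hb : (fun y : ℝ => wt (J + 1) (1 + y)) =O[nhds 0] fun y => y ^ (J + 1) := by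
          refine Asymptotics.IsBigO.of_bound 1 (Filter.Eventually.of_forall fun y => ?_)
          rw [one_mul, norm_pow, norm_of_nonneg (wt_nonneg _ _), wt]
          refine pow_le_pow_left₀ (le_max_left _ _) (max_le (norm_nonneg _) ?_) _
          rw [norm_eq_abs]; linarith [neg_abs_le y]
        refine hb.trans_isLittleO ?_
        have := Asymptotics.isLittleO_pow_pow (𝕜 := ℝ) (m := 1) (n := J + 1) (by omega)
        simpa using this
      · have e : (fun _ : ℝ => (0 : ℝ)) =ᶠ[nhds x] wt (J + 1) := by
          filter_upwards [Ioi_mem_nhds h] with y hy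
          rw [wt_eq_zero (by omega) (le_of_lt hy)]
        rw [wt_eq_zero hJ h.le, mul_zero, neg_zero]
        exact (hasDerivAt_const x (0 : ℝ)).congr_of_eventuallyEq e.symm
    have h2 := ((h1 (t / N)).comp t ((hasDerivAt_id t).div_const N)).const_mul (-(N / (J + 1)))
    refine h2.congr_deriv ?_
    change _ = wt J (t / N)
    have : (J : ℝ) + 1 ≠ 0 := by positivity
    field_simp
  have hc : ∀ j, ((Ioc (Q * j) (Q * (j + 1))).filter (fun n => n ≡ a [MOD Q])).card = 1 := by
    intro j
    have h := Nat.Ioc_filter_modEq_card (Q * j) (Q * (j + 1)) (r := Q) (by omega) a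
    have e : (((Q * (j + 1) : ℕ) : ℚ) - a) / Q = (((Q * j : ℕ) : ℚ) - a) / Q + 1 := by
      have : (Q : ℚ) ≠ 0 := by positivity
      push_cast; field_simp; ring
    rw [e, Int.floor_add_one] at h
    have h' : (((Ioc (Q * j) (Q * (j + 1))).filter (fun n => n ≡ a [MOD Q])).card : ℤ) = 1 := by
      rw [h]; simp
    exact_mod_cast h'
  obtain ⟨M, hM⟩ := exists_nat_gt N
  have hMQ : N ≤ Q * (M + 1 : ℕ) := by push_cast; nlinarith
  have hΓ0 : ∀ t, N ≤ t → Γ t = 0 := fun t ht => by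
    rw [hΓdef]; simp only; rw [wt_eq_zero (by omega) ((one_le_div hN0).mpr ht), mul_zero]
  have hsum : ∑ n ∈ (Icc 1 ⌊N⌋₊).filter (fun n => n ≡ a [MOD Q]), wt J (n / N) =
      ∑ n ∈ (Ioc 0 (Q * (M + 1 + 1))).filter (fun n => n ≡ a [MOD Q]), H n := by
    refine sum_subset (fun n hn => ?_) fun n hn hn' => ?_
    · rw [mem_filter, mem_Icc] at hn
      rw [mem_filter, mem_Ioc]
      refine ⟨⟨hn.1.1, ?_⟩, hn.2⟩
      have h1 := (Nat.le_floor_iff hN0.le).mp hn.1.2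
      have h2 : (n : ℝ) ≤ (Q * (M + 1 + 1) : ℕ) := h1.trans (by push_cast at hMQ ⊢; nlinarith)
      exact_mod_cast h2
    · rw [mem_filter, mem_Ioc] at hn
      rw [mem_filter, mem_Icc] at hn'
      refine wt_eq_zero hJ ((one_le_div hN0).mpr ?_)
      by_contra h
      push Not at h
      exact hn' ⟨⟨hn.1.1, Nat.le_floor h.le⟩, hn.2⟩
  have hH1 : H 1 ≤ 1 := wt_le_one J (by positivity)
  have hN1 : N / (J + 1) / Q = 1 / Q * (0 - Γ 0) := by
    simp [hΓdef, wt]; ring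
  have hΓm : Monotone Γ := monotone_of_hasDerivAt_nonneg hΓ fun t => wt_nonneg _ _
  have hup := sum_block_le hc hQ (fun t _ => hΓ t) (hanti.antitoneOn _) (J := M + 1) (by omega)
  have hlo := sum_block_ge hc hQ (fun t _ => hΓ t) (hanti.antitoneOn _) (M + 1 + 1)
  rw [hΓ0 _ hMQ] at hup
  rw [hΓ0 _ (by push_cast at hMQ ⊢; nlinarith)] at hlo
  rw [hsum, hN1, abs_sub_le_iff]
  simp only [Nat.cast_one, mul_one] at hup hlo
  have h1 : 1 / (Q : ℝ) * (0 - Γ Q) ≤ 1 / Q * (0 - Γ 0) :=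
    mul_le_mul_of_nonneg_left (by linarith [hΓm (by linarith : (0 : ℝ) ≤ Q)]) (by positivity)
  have h2 : 1 / (Q : ℝ) * (0 - Γ 0) - 1 / Q * (0 - Γ Q) ≤ 1 := by
    have h3 := (mul_le_sub_of_antitone_deriv (H := H) (Γ := Γ) (a := 0) (b := Q) (by linarith)
      (fun t _ => hΓ t) (hanti.antitoneOn _)).2
    have h4 : H 0 = 1 := by simp [hHdef, wt]
    rw [h4] at h3
    rw [← mul_sub, one_div, inv_mul_le_iff₀ (by linarith)]; linarith
  constructor <;> linarith

variable {D p₁ R : ℕ} {ι : Type*} [Fintype ι] [DecidableEq ι]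

/-- The divisibility conditions imposed by a coloring. -/
def hit (h : ι → ℕ) (x : sievePrimes D p₁ R → Option ι) (n : ℕ) : Prop :=
  ∀ l i, x l = some i → (l : ℕ) ∣ n + h i

instance (h : ι → ℕ) (x : sievePrimes D p₁ R → Option ι) (n : ℕ) : Decidable (hit h x n) :=
  inferInstanceAs (Decidable (∀ l i, x l = some i → (l : ℕ) ∣ n + h i))

/-- The linear form whose square is the sieve weight. -/
def sieveForm (h : ι → ℕ) (f : (sievePrimes D p₁ R → Option ι) → ℝ) (n : ℕ) : ℝ :=
  ∑ x, if hit h x n then f x else 0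

/-- The set of primes colored by one of two colorings. -/
def joint {L : Type*} (x y : L → Option ι) (l : L) : Bool := (x l).isSome || (y l).isSome

lemma abs_sum_sieveForm_sq_sub_le (h : ι → ℕ) (f : (sievePrimes D p₁ R → Option ι) → ℝ) (S : Finset ℕ) (c : ℕ → ℝ)
    (κ : sievePrimes D p₁ R → Option ι → Option ι → ℝ) (μ : ℝ)
    (e : (sievePrimes D p₁ R → Option ι) → (sievePrimes D p₁ R → Option ι) → ℝ)
    (he : ∀ x y, |∑ n ∈ S.filter (fun n => hit h x n ∧ hit h y n), c n - μ * ∏ l, κ l (x l) (y l)| ≤ e x y) :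
    |∑ n ∈ S, c n * sieveForm h f n ^ 2 - μ * quadForm κ f| ≤ ∑ x, ∑ y, |f x| * |f y| * e x y := by
  have h1 : ∑ n ∈ S, c n * sieveForm h f n ^ 2 =
      ∑ x, ∑ y, f x * f y * ∑ n ∈ S.filter (fun n => hit h x n ∧ hit h y n), c n := by
    have h2 : ∀ n, c n * sieveForm h f n ^ 2 =
        ∑ x, ∑ y, f x * f y * if hit h x n ∧ hit h y n then c n else 0 := by
      intro n
      rw [sq, sieveForm, sum_mul_sum, mul_sum]
      refine sum_congr rfl fun x _ => ?_
      rw [mul_sum]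
      refine sum_congr rfl fun y _ => ?_
      by_cases h1 : hit h x n <;> by_cases h2 : hit h y n <;> simp [h1, h2]; ring
    rw [sum_congr rfl fun n _ => h2 n, sum_comm]
    refine sum_congr rfl fun x _ => ?_
    rw [sum_comm]
    exact sum_congr rfl fun y _ => by rw [sum_filter, mul_sum]
  rw [h1, quadForm, mul_sum, ← sum_sub_distrib]
  refine (abs_sum_le_sum_abs _ _).trans (sum_le_sum fun x _ => ?_)
  rw [mul_sum, ← sum_sub_distrib]
  refine (abs_sum_le_sum_abs _ _).trans (sum_le_sum fun y _ => ?_)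
  rw [← abs_mul, mul_left_comm, ← mul_sub, abs_mul]
  exact mul_le_mul_of_nonneg_left (he x y) (abs_nonneg _)

lemma exists_modEq_iff_hit (h : ι → ℕ) (v₀ : ℕ) (t : sievePrimes D p₁ R → Option ι) (s : Finset (sievePrimes D p₁ R)) :
    ∃ a, ∀ n, (n ≡ v₀ [MOD primorial D] ∧ ∀ l ∈ s, ∀ i, t l = some i → (l : ℕ) ∣ n + h i) ↔
      n ≡ a [MOD primorial D * ∏ l ∈ s, if (t l).isSome then (l : ℕ) else 1] := by
  induction s using Finset.induction_on with
  | empty => exact ⟨v₀, fun n => by simp⟩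
  | insert l s hl ih =>
    obtain ⟨a, ha⟩ := ih
    rw [prod_insert hl]
    cases ht : t l with
    | none =>
      refine ⟨a, fun n => ?_⟩
      simp only [Option.isSome_none, Bool.false_eq_true, if_false, one_mul, ← ha n, forall_mem_insert, ht, reduceCtorEq,
        false_imp_iff, implies_true, true_and]
    | some i =>
      have hco : (primorial D * ∏ l ∈ s, if (t l).isSome then (l : ℕ) else 1).Coprime l := by
        refine Nat.Coprime.mul_left ?_ (Nat.Coprime.prod_left fun l' hl' => ?_)
        · rw [coprime_primorial_iff]
          intro p hp hpl
          rw [(Nat.prime_dvd_prime_iff_eq hp (prime_coe l)).mp hpl]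
          exact (mem_sievePrimes.mp l.2).2.2.1
        · split_ifs
          · refine (Nat.coprime_primes (prime_coe _) (prime_coe _)).mpr fun e => hl ?_
            rwa [← Subtype.ext e]
          · exact Nat.coprime_one_left _
      obtain ⟨b, hb1, hb2⟩ := Nat.chineseRemainder hco a (((l : ℕ) - 1) * h i)
      refine ⟨b, fun n => ?_⟩
      have hl1 : 1 ≤ (l : ℕ) := (prime_coe l).pos
      have key : (l : ℕ) ∣ n + h i ↔ n ≡ ((l : ℕ) - 1) * h i [MOD l] := by
        have e1 : ((l : ℕ) - 1) * h i + h i = l * h i := by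
          conv_rhs => rw [← Nat.sub_add_cancel hl1, add_mul, one_mul]
        rw [← Nat.modEq_zero_iff_dvd]
        constructor
        · intro hn
          refine Nat.ModEq.add_right_cancel' (h i) (hn.trans ?_)
          rw [e1]; exact (Nat.modEq_zero_iff_dvd.mpr (dvd_mul_right _ _)).symm
        · intro hn
          refine (hn.add_right (h i)).trans ?_
          rw [e1]; exact Nat.modEq_zero_iff_dvd.mpr (dvd_mul_right _ _)
      simp only [Option.isSome_some, if_true, forall_mem_insert, ht, Option.some.injEq, forall_eq']
      rw [mul_left_comm, mul_comm (l : ℕ), ← Nat.modEq_and_modEq_iff_modEq_mul hco, key]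
      constructor
      · rintro ⟨h1, h2, h3⟩
        exact ⟨((ha n).mp ⟨h1, h3⟩).trans hb1.symm, h2.trans hb2.symm⟩
      · rintro ⟨h1, h2⟩
        have h3 := (ha n).mpr (h1.trans hb1)
        exact ⟨h3.1, h2.trans hb2, h3.2⟩

lemma eq_of_dvd_add {h : ι → ℕ} (hh : Function.Injective h) (hD : ∀ i, h i ≤ D) (l : sievePrimes D p₁ R) {n : ℕ} {i j : ι}
    (hi : (l : ℕ) ∣ n + h i) (hj : (l : ℕ) ∣ n + h j) : i = j := by
  have hl := (mem_sievePrimes.mp l.2).2.2.1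
  refine hh (Nat.ModEq.eq_of_lt_of_lt (m := l) (Nat.ModEq.add_left_cancel' n ?_) ((hD i).trans_lt hl) ((hD j).trans_lt hl))
  exact (Nat.modEq_zero_iff_dvd.mpr hi).trans (Nat.modEq_zero_iff_dvd.mpr hj).symm

lemma hit_cases {h : ι → ℕ} (hh : Function.Injective h) (hD : ∀ i, h i ≤ D) (v₀ : ℕ)
    (x y : sievePrimes D p₁ R → Option ι) :
    ((∃ a, ∀ n, (n ≡ v₀ [MOD primorial D] ∧ hit h x n ∧ hit h y n) ↔ n ≡ a [MOD primorial D * natProd (joint x y)]) ∧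
      ∀ ζ : sievePrimes D p₁ R → ℝ, ∏ l, kap (ζ l) (x l) (y l) = setW ζ (joint x y)) ∨
    ((∀ n, ¬ (hit h x n ∧ hit h y n)) ∧ ∀ ζ : sievePrimes D p₁ R → ℝ, ∏ l, kap (ζ l) (x l) (y l) = 0) := by
  by_cases hc : ∀ l i j, x l = some i → y l = some j → i = j
  · refine Or.inl ⟨?_, fun ζ => ?_⟩
    · obtain ⟨a, ha⟩ := exists_modEq_iff_hit (D := D) (p₁ := p₁) (R := R) h v₀ (fun l => (x l).or (y l)) univ
      refine ⟨a, fun n => ?_⟩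
      have e : natProd (joint x y) = ∏ l, if ((x l).or (y l)).isSome then (l : ℕ) else 1 :=
        prod_congr rfl fun l _ => by simp [joint]
      rw [e, ← ha n, and_congr_right_iff]
      intro _
      constructor
      · rintro ⟨h1, h2⟩ l _ i hi
        rcases Option.or_eq_some_iff.mp hi with h3 | ⟨_, h3⟩
        exacts [h1 l i h3, h2 l i h3]
      · intro H
        refine ⟨fun l i hi => H l (mem_univ _) i (by simp [hi]), fun l i hi => ?_⟩
        cases hx : x l with
        | none => exact H l (mem_univ _) i (by simp [hx, hi])
        | some j =>
          have := hc l j i hx hi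
          exact H l (mem_univ _) i (by simp [hx, this])
    · refine prod_congr rfl fun l _ => ?_
      have := hc l
      cases hx : x l <;> cases hy : y l <;> simp_all [kap, bw, joint]
  · push Not at hc
    obtain ⟨l, i, j, hi, hj, hij⟩ := hc
    exact Or.inr ⟨fun n hn => hij (eq_of_dvd_add hh hD l (hn.1 l i hi) (hn.2 l j hj)), fun ζ =>
      prod_eq_zero (mem_univ l) (by rw [hi, hj]; simp [kap, hij])⟩

/-- Expansion of the unweighted sum. -/
theorem abs_sum_wt_sieveForm_sub_le {J : ℕ} (hJ : J ≠ 0) {N : ℝ} (hN : 1 ≤ N) {h : ι → ℕ} (hh : Function.Injective h)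
    (hD : ∀ i, h i ≤ D) (v₀ : ℕ) (f : (sievePrimes D p₁ R → Option ι) → ℝ) :
    |∑ n ∈ (Icc 1 ⌊N⌋₊).filter (fun n => n ≡ v₀ [MOD primorial D]), wt J (n / N) * sieveForm h f n ^ 2 -
      N / (J + 1) / primorial D * quadForm (fun l => kap (zp l / (1 + zp l))) f| ≤ 2 * (∑ x, |f x|) ^ 2 := by
  refine (abs_sum_sieveForm_sq_sub_le h f _ _ _ _ (fun _ _ => 2) fun x y => ?_).trans (le_of_eq ?_)
  · rcases hit_cases hh hD v₀ x y with ⟨⟨a, ha⟩, hk⟩ | ⟨hn, hk⟩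
    · rw [hk, filter_filter, filter_congr fun n _ => ha n]
      simp only [setW, zp_div, prod_bw_inv]
      have := abs_sum_wt_sub_le hJ hN (Q := primorial D * natProd (joint x y))
        (Nat.mul_pos (primorial_pos D) (natProd_pos _)) a
      push_cast at this
      rwa [mul_one_div, div_div (N / (J + 1))]
    · rw [hk, filter_false_of_mem fun n _ => hn n]; simp
  · rw [sq, sum_mul_sum, mul_sum]
    refine sum_congr rfl fun x _ => ?_
    rw [mul_sum]
    exact sum_congr rfl fun y _ => by ring

lemma inv_totient_natProd (A : sievePrimes D p₁ R → Bool) : setW zp A = 1 / (natProd A).totient := by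
  have h1 : ∀ s : Finset (sievePrimes D p₁ R), (∏ l ∈ s, if A l then (l : ℕ) else 1).totient =
      ∏ l ∈ s, if A l then (l : ℕ) - 1 else 1 := by
    intro s
    induction s using Finset.induction_on with
    | empty => simp
    | insert l s hl ih =>
      rw [prod_insert hl, prod_insert hl, Nat.totient_mul, ih]
      · split_ifs
        · rw [Nat.totient_prime (prime_coe l)]
        · simp
      · refine Nat.Coprime.prod_right fun l' hl' => ?_
        split_ifs
        · refine (Nat.coprime_primes (prime_coe _) (prime_coe _)).mpr fun e => hl ?_
          rwa [Subtype.ext e]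
        all_goals simp
  rw [natProd, h1, Nat.cast_prod, one_div, ← prod_inv_distrib]
  refine prod_congr rfl fun l _ => ?_
  unfold bw; split_ifs
  · rw [Nat.cast_sub (prime_coe l).one_lt.le, zp]; simp
  · simp

/-- Expansion of the sum weighted by the von Mangoldt function. -/
theorem abs_sum_vonMangoldt_sieveForm_sub_le {J : ℕ} (hJ : J ≠ 0) {N : ℝ} (hN : 1 ≤ N) {h : ι → ℕ}
    (hh : Function.Injective h) (hD : ∀ i, h i ≤ D) {b v₀ : ℕ} (hb : ∀ i, h i ≠ b) (hbD : b ≤ D)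
    (hv : (v₀ + b).Coprime (primorial D)) {E : ℕ → ℝ}
    (hE : ∀ q a, a.Coprime q → |psiAP J N q a - psiTot J N / q.totient| ≤ E q)
    (f : (sievePrimes D p₁ R → Option ι) → ℝ) :
    |∑ n ∈ (Icc 1 ⌊N⌋₊).filter (fun n => n ≡ v₀ [MOD primorial D]),
        vonMangoldt (n + b) * wt J ((n + b : ℕ) / N) * sieveForm h f n ^ 2 -
      psiTot J N / (primorial D).totient * quadForm (fun l => kap (zp l)) f| ≤
    ∑ x, ∑ y, |f x| * |f y| * (E (primorial D * natProd (joint x y)) + D ^ 2) := by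
  have hE0 : ∀ q, 0 ≤ E q := fun q => (abs_nonneg _).trans (hE q 1 (Nat.coprime_one_left q))
  refine abs_sum_sieveForm_sq_sub_le h f _ _ _ _ _ fun x y => ?_
  rcases hit_cases hh hD v₀ x y with ⟨⟨a, ha⟩, hk⟩ | ⟨hn, hk⟩
  · rw [hk, filter_filter, filter_congr fun n _ => ha n, inv_totient_natProd]
    set Q := primorial D * natProd (joint x y) with hQ
    have hφ : psiTot J N / (primorial D).totient * (1 / (natProd (joint x y)).totient) = psiTot J N / Q.totient := by
      rw [hQ, Nat.totient_mul (natProd_coprime _), Nat.cast_mul]; field_simp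
    rw [hφ]
    have hco : (a + b).Coprime Q := by
      obtain ⟨h1, h2, h3⟩ := (ha a).mpr rfl
      refine Nat.Coprime.mul_right ?_ (Nat.Coprime.prod_right fun l _ => ?_)
      · rw [Nat.coprime_iff_gcd_eq_one, (h1.add_right b).gcd_eq]; exact hv
      · split_ifs with hl
        · refine ((Nat.Prime.coprime_iff_not_dvd (prime_coe l)).mpr fun hd => ?_).symm
          have hc : ∃ i, (l : ℕ) ∣ a + h i := by
            simp only [joint, Bool.or_eq_true, Option.isSome_iff_exists] at hl
            rcases hl with ⟨i, hi⟩ | ⟨i, hi⟩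
            exacts [⟨i, h2 l i hi⟩, ⟨i, h3 l i hi⟩]
          obtain ⟨i, hi⟩ := hc
          have hlD := (mem_sievePrimes.mp l.2).2.2.1
          refine hb i (Nat.ModEq.eq_of_lt_of_lt (m := l) (Nat.ModEq.add_left_cancel' a ?_) ((hD i).trans_lt hlD)
            (hbD.trans_lt hlD))
          exact (Nat.modEq_zero_iff_dvd.mpr hi).trans (Nat.modEq_zero_iff_dvd.mpr hd).symm
        · exact Nat.coprime_one_right _
    set c : ℕ → ℝ := fun n => vonMangoldt n * wt J (n / N) with hc
    have hc0 : ∀ n, 0 ≤ c n := fun n => mul_nonneg vonMangoldt_nonneg (wt_nonneg _ _)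
    have hshift : ∑ n ∈ (Icc 1 ⌊N⌋₊).filter (fun n => n ≡ a [MOD Q]), c (n + b) =
        ∑ n ∈ (Ioc b (⌊N⌋₊ + b)).filter (fun n => n ≡ a + b [MOD Q]), c n := by
      refine sum_bij (fun n _ => n + b) (fun n hn => ?_) (fun n _ m _ e => by simpa using e) (fun n hn => ?_) fun _ _ => rfl
      · rw [mem_filter, mem_Icc] at hn
        rw [mem_filter, mem_Ioc]; exact ⟨by omega, hn.2.add_right b⟩
      · rw [mem_filter, mem_Ioc] at hn
        refine ⟨n - b, ?_, by omega⟩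
        rw [mem_filter, mem_Icc]
        refine ⟨by omega, Nat.ModEq.add_right_cancel' b ?_⟩
        rw [Nat.sub_add_cancel (by omega)]; exact hn.2
    have hsplit : ∑ n ∈ (Ioc b (⌊N⌋₊ + b)).filter (fun n => n ≡ a + b [MOD Q]), c n +
        ∑ n ∈ (Icc 1 b).filter (fun n => n ≡ a + b [MOD Q]), c n = psiAP J N Q (a + b) := by
      rw [← sum_union]
      · rw [← filter_union, psiAP]
        refine (sum_subset (fun n hn => ?_) fun n hn hn' => ?_).symm
        · rw [mem_filter, mem_Icc] at hn
          rw [mem_filter, mem_union, mem_Ioc, mem_Icc]; exact ⟨by omega, hn.2⟩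
        · rw [mem_filter, mem_union, mem_Ioc, mem_Icc] at hn
          rw [mem_filter, mem_Icc] at hn'
          have : ⌊N⌋₊ < n := by by_contra h'; exact hn' ⟨⟨by omega, by omega⟩, hn.2⟩
          have h3 : N < n := (Nat.floor_lt (by linarith)).mp this
          simp only [hc, wt_eq_zero hJ ((one_le_div (by linarith)).mpr h3.le), mul_zero]
      · refine disjoint_filter_filter (disjoint_left.mpr fun n h1 h2 => ?_)
        rw [mem_Ioc] at h1; rw [mem_Icc] at h2; omega
    have hsmall : ∑ n ∈ (Icc 1 b).filter (fun n => n ≡ a + b [MOD Q]), c n ≤ (D : ℝ) ^ 2 := by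
      have hbD' : (b : ℝ) ≤ D := by exact_mod_cast hbD
      calc _ ≤ ∑ n ∈ (Icc 1 b).filter (fun n => n ≡ a + b [MOD Q]), (D : ℝ) := by
            refine sum_le_sum fun n hn => ?_
            have hn' := mem_Icc.mp (mem_filter.mp hn).1
            have h1 : (n : ℝ) ≤ b := by exact_mod_cast hn'.2
            have h2 : (0 : ℝ) < n := by exact_mod_cast hn'.1
            calc c n ≤ log n * 1 := mul_le_mul vonMangoldt_le_log
                  (wt_le_one J (by positivity)) (wt_nonneg _ _) (log_natCast_nonneg n)
              _ ≤ D := by linarith [log_le_sub_one_of_pos h2]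
        _ ≤ ∑ n ∈ Icc 1 b, (D : ℝ) := sum_le_sum_of_subset_of_nonneg (filter_subset _ _) fun _ _ _ => by positivity
        _ ≤ _ := by
            rw [sum_const, Nat.card_Icc, nsmul_eq_mul, Nat.add_sub_cancel, sq]; gcongr
    have hs0 : 0 ≤ ∑ n ∈ (Icc 1 b).filter (fun n => n ≡ a + b [MOD Q]), c n := sum_nonneg fun n _ => hc0 n
    have h4 := abs_le.mp (hE Q (a + b) hco)
    change |∑ n ∈ (Icc 1 ⌊N⌋₊).filter (fun n => n ≡ a [MOD Q]), c (n + b) - _| ≤ _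
    rw [hshift, abs_le]
    constructor <;> linarith [h4.1, h4.2]
  · rw [hk, filter_false_of_mem fun n _ => hn n]
    simp only [sum_empty, mul_zero, sub_self, abs_zero]
    exact add_nonneg (hE0 _) (sq_nonneg _)

end Expansion

section Polylog

variable {D p₁ R : ℕ} {ι : Type*} [Fintype ι] [DecidableEq ι]

local notation "𝕃" => sievePrimes D p₁ R

local notation "𝔨" => Fintype.card ι

/-- Indicator of the sets of primes of relative size at most `v`. -/
noncomputable def upTo (v : ℝ) (B : 𝕃 → Bool) : ℝ := if lsize lp B ≤ v then 1 else 0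

lemma upTo_nonneg (v : ℝ) (B : 𝕃 → Bool) : 0 ≤ upTo v B := by
  unfold upTo; split_ifs <;> norm_num

lemma upTo_antitone (v : ℝ) : Antitone (upTo (D := D) (p₁ := p₁) (R := R) v) := by
  intro A B h
  have h1 := lsize_mono lp_nonneg h
  unfold upTo
  split_ifs <;> first | (exfalso; linarith) | norm_num

lemma natProd_le_of_lsize_le (hR : 2 ≤ R) {v : ℕ} {A : 𝕃 → Bool} (h : lsize lp A ≤ v) :
    natProd A ≤ R ^ v := by
  have hlr : 0 < log R := log_pos (by exact_mod_cast hR)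
  rw [← log_natProd, div_le_iff₀ hlr, ← log_pow] at h
  have := (log_le_log_iff (by exact_mod_cast natProd_pos A) (by positivity)).mp h
  exact_mod_cast this

lemma setW_mul (z z' : 𝕃 → ℝ) (A : 𝕃 → Bool) :
    setW z A * setW z' A = setW (fun l => z l * z' l) A := by
  rw [setW, setW, ← prod_mul_distrib]
  exact prod_congr rfl fun l _ => by unfold bw; split_ifs <;> simp

lemma setW_inv_mul (c : ℝ) (A : 𝕃 → Bool) :
    setW (fun l : 𝕃 => c / (l : ℕ)) A = setW (fun _ => c) A / natProd A := by
  rw [div_eq_mul_one_div, ← prod_bw_inv, ← setW, setW_mul]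
  congr 1; funext l; ring

lemma sum_setW_upTo_le (hR : 2 ≤ R) (C v : ℕ) :
    ∑ B : 𝕃 → Bool, setW (fun l : 𝕃 => (C : ℝ) / (l : ℕ)) B * upTo v B ≤ (1 + v * log R) ^ C := by
  set g : ℝ → ℝ := fun t => if t ≤ v then 1 else 0 with hg
  have h1 := sum_prod_le_of_coord_map (fun l : 𝕃 => bw ((C : ℝ) / (l : ℕ)))
    (fun (l : 𝕃) (c : Fin C → Bool) => ∏ i, bw (1 / ((l : ℕ) : ℝ)) (c i)) id
    (fun c => decide (∃ i, c i = true)) (fun l b => bw_nonneg (by positivity) b)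
    (fun l c => prod_nonneg fun i _ => bw_nonneg (by positivity) _) (fun _ => 1) (fun _ => zero_le_one) (fun l f hf hf0 => by
      have := sum_color_le_sum (fun c : Fin C → Bool => (∏ i, bw (1 / ((l : ℕ) : ℝ)) (c i)) * f (decide (∃ i, c i = true)))
        fun c => mul_nonneg (prod_nonneg fun i _ => bw_nonneg (by positivity) _) (hf0 _)
      simp only [prod_bw_colorInd_none, prod_bw_colorInd_some] at this
      rw [one_mul]
      refine le_trans (le_of_eq ?_) this
      simp [bw, colorInd]; ring) (upTo (v : ℝ)) (upTo_antitone _) (upTo_nonneg _)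
  refine h1.trans ?_
  rw [prod_const_one, one_mul]
  calc _ ≤ ∑ X : 𝕃 → Fin C → Bool,
        (∏ l : 𝕃, ∏ i, bw (1 / ((l : ℕ) : ℝ)) (X l i)) *
        ((∏ i, g (lsize lp fun l => X l i) ^ 2) * (fun _ => (1 : ℝ)) (∑ i, lsize lp fun l => X l i)) := by
        refine sum_le_sum fun X _ => mul_le_mul_of_nonneg_left ?_
          (prod_nonneg fun l _ => prod_nonneg fun i _ => bw_nonneg (by positivity) _)
        rw [mul_one]
        unfold upTo
        split_ifs with h
        · refine le_of_eq (prod_eq_one fun i _ => ?_).symm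
          have : lsize lp (fun l => X l i) ≤ v := le_trans (lsize_mono lp_nonneg fun l => by
            cases hx : X l i
            · exact Bool.false_le _
            · intro _; exact decide_eq_true ⟨i, hx⟩) h
          simp [hg, this]
        · exact prod_nonneg fun i _ => sq_nonneg _
    _ = (∑ A : 𝕃 → Bool, setW (fun l : 𝕃 => 1 / ((l : ℕ) : ℝ)) A * g (lsize lp A) ^ 2) ^ C := by
        rw [sum_family_eq (fun l : 𝕃 => 1 / ((l : ℕ) : ℝ)) lp g (fun _ => 1)]
        have := famSum_const (Fin C) (fun l : 𝕃 => 1 / ((l : ℕ) : ℝ)) lp g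
        rwa [Fintype.card_fin] at this
    _ ≤ _ := by
        refine pow_le_pow_left₀ (sum_nonneg fun A _ => mul_nonneg (setW_nonneg (fun l => by positivity) _) (sq_nonneg _)) ?_ C
        have h2 := sum_inv_le_log (R ^ v)
        rw [Nat.cast_pow, log_pow] at h2
        refine le_trans ?_ h2
        rw [← sum_filter_of_ne (p := fun A => lsize lp A ≤ v) (fun A _ h => by by_contra hc; simp [hg, hc] at h)]
        refine sum_le_sum_of_injOn natProd (fun A hA => ?_) natProd_injective.injOn (fun A hA => ?_) fun n _ => by positivity
        · exact mem_Icc.mpr ⟨natProd_pos A, natProd_le_of_lsize_le hR (mem_filter.mp hA).2⟩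
        · simp only [hg, if_pos (mem_filter.mp hA).2, one_pow, mul_one, setW, prod_bw_inv]; exact le_rfl

/-- The colored primes. -/
def colored {L : Type*} (x : L → Option ι) (l : L) : Bool := (x l).isSome

variable {f : (sievePrimes D p₁ R → Option ι) → ℝ} {M : ℝ}

lemma sum_abs_le (hR : 2 ≤ R) (hM : ∀ x, |f x| ≤ M * upTo 1 (colored x)) :
    ∑ x, |f x| ≤ M * (R * (1 + log R) ^ 𝔨) := by
  have hM0 : 0 ≤ M := by
    have := (abs_nonneg _).trans (hM fun _ => none)
    simpa [upTo, colored, lsize] using this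
  have h1 := sum_prod_le_of_coord_map (fun (_ : 𝕃) (_ : Option ι) => (1 : ℝ))
    (fun _ => bw (𝔨 : ℝ)) Option.isSome id (fun _ _ => zero_le_one) (fun l b => bw_nonneg (by positivity) b)
    (fun _ => 1) (fun _ => zero_le_one) (fun l f hf hf0 => le_of_eq (by
      rw [Fintype.sum_option]; simp [bw]; ring)) (upTo (1 : ℝ)) (upTo_antitone _) (upTo_nonneg _)
  simp only [prod_const_one, one_mul] at h1
  refine (sum_le_sum fun x _ => hM x).trans ?_
  rw [← mul_sum]
  refine mul_le_mul_of_nonneg_left (h1.trans ?_) hM0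
  have h2 := sum_setW_upTo_le (D := D) (p₁ := p₁) hR (𝔨) 1
  rw [Nat.cast_one, one_mul] at h2
  refine le_trans ?_ (mul_le_mul_of_nonneg_left h2 (Nat.cast_nonneg R))
  rw [mul_sum]
  refine sum_le_sum fun B _ => ?_
  change setW (fun _ => (𝔨 : ℝ)) B * upTo 1 B ≤ _
  have hc0 : 0 ≤ setW (fun _ : 𝕃 => (𝔨 : ℝ)) B := setW_nonneg (fun _ => by positivity) B
  have hn : (0 : ℝ) < natProd B := by exact_mod_cast natProd_pos B
  rw [setW_inv_mul]
  by_cases h : lsize lp B ≤ 1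
  · have h3 : (natProd B : ℝ) ≤ R := by
      have := natProd_le_of_lsize_le hR (v := 1) (A := B) (by simpa using h)
      rw [pow_one] at this; exact_mod_cast this
    rw [upTo, if_pos h, mul_one, mul_one, mul_div_assoc', le_div_iff₀ hn]
    nlinarith
  · rw [upTo, if_neg h]; simp

lemma sum_abs_mul_joint_le (hR : 2 ≤ R) (hM : ∀ x, |f x| ≤ M * upTo 1 (colored x)) (E : ℕ → ℝ) (hE : ∀ q, 0 ≤ E q)
    {T V : ℝ} (hV : 0 < V) (hT : ∀ B : 𝕃 → Bool, lsize lp B ≤ 2 → E (natProd B) ≤ T / natProd B) :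
    ∑ x, ∑ y, |f x| * |f y| * E (natProd (joint x y)) ≤ M ^ 2 *
      (V * ∑ B : 𝕃 → Bool, upTo 2 B * E (natProd B) +
        T / V * (1 + 2 * log R) ^ (((𝔨 + 1) ^ 2) ^ 2)) := by
  set C : ℕ := (𝔨 + 1) ^ 2 with hC
  have hstep : ∑ x, ∑ y, |f x| * |f y| * E (natProd (joint x y)) ≤
      M ^ 2 * ∑ B : 𝕃 → Bool, setW (fun _ => (C : ℝ)) B * (upTo 2 B * E (natProd B)) := by
    have h1 : ∀ x y, |f x| * |f y| * E (natProd (joint x y)) ≤ M ^ 2 * (upTo 2 (joint x y) * E (natProd (joint x y))) := by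
      intro x y
      rw [← mul_assoc]
      refine mul_le_mul_of_nonneg_right ?_ (hE _)
      refine (mul_le_mul (hM x) (hM y) (abs_nonneg _) ((abs_nonneg _).trans (hM x))).trans ?_
      rw [mul_mul_mul_comm, ← sq]
      refine mul_le_mul_of_nonneg_left ?_ (sq_nonneg _)
      have h2 : lsize lp (joint x y) ≤ lsize lp (colored x) + lsize lp (colored y) := by
        rw [lsize, lsize, lsize, ← sum_add_distrib]
        refine sum_le_sum fun l _ => ?_
        have := lp_nonneg l
        cases hx : x l <;> cases hy : y l <;> simp [joint, colored, hx, hy, this]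
      unfold upTo
      split_ifs <;> first | (exfalso; linarith) | norm_num
    refine (sum_le_sum fun x _ => sum_le_sum fun y _ => h1 x y).trans ?_
    simp only [← mul_sum]
    refine mul_le_mul_of_nonneg_left ?_ (sq_nonneg _)
    have h3 := sum_prod_map (fun (_ : 𝕃) (_ : Option ι × Option ι) => (1 : ℝ))
      (fun _ a => a.1.isSome || a.2.isSome) (fun B => upTo 2 B * E (natProd B))
    rw [← (Equiv.arrowProdEquivProdArrow _ (fun _ => Option ι) (fun _ => Option ι)).symm.sum_comp,
      Fintype.sum_prod_type] at h3
    simp only [prod_const_one, one_mul] at h3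
    refine (le_of_eq h3).trans (sum_le_sum fun B _ => mul_le_mul_of_nonneg_right ?_
      (mul_nonneg (upTo_nonneg _ _) (hE _)))
    refine prod_le_prod (fun l _ => sum_nonneg fun a _ => by split_ifs <;> norm_num) fun l _ => ?_
    cases B l with
    | true =>
      calc _ ≤ ∑ a : Option ι × Option ι, (1 : ℝ) := sum_le_sum fun a _ => by split_ifs <;> norm_num
        _ = _ := by simp [bw, hC, Fintype.card_prod, sq]
    | false =>
      rw [Fintype.sum_prod_type, Fintype.sum_option, Fintype.sum_option]
      simp [bw]
  refine hstep.trans (mul_le_mul_of_nonneg_left ?_ (sq_nonneg _))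
  have h4 := sum_setW_upTo_le (D := D) (p₁ := p₁) hR (C ^ 2) 2
  push_cast at h4
  have hT0 : 0 ≤ T := by
    have := (hE _).trans (hT (fun _ => false) (by simp [lsize]))
    simpa [natProd] using this
  refine le_trans ?_ (add_le_add le_rfl (mul_le_mul_of_nonneg_left h4 (by positivity)))
  rw [mul_sum, mul_sum, ← sum_add_distrib]
  refine sum_le_sum fun B _ => ?_
  by_cases hB : lsize lp B ≤ 2
  · rw [upTo, if_pos hB, one_mul, mul_one, setW_inv_mul]
    set c := setW (fun _ : 𝕃 => (C : ℝ)) B with hc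
    have hc0 : 0 ≤ c := setW_nonneg (fun _ => by positivity) B
    have hn : (0 : ℝ) < natProd B := by exact_mod_cast natProd_pos B
    have e1 : setW (fun _ : 𝕃 => (C : ℝ) ^ 2) B = c ^ 2 := by
      rw [sq c, hc, setW_mul]; congr 1; funext l; ring
    rw [e1]
    have hEB := hE (natProd B)
    rcases le_or_gt c V with h | h
    · have : 0 ≤ T / V * (c ^ 2 / natProd B) := by positivity
      nlinarith
    · have h5 : c ≤ c ^ 2 / V := by rw [le_div_iff₀ hV, sq]; exact mul_le_mul_of_nonneg_left h.le hc0
      calc c * E (natProd B) ≤ c ^ 2 / V * (T / natProd B) := mul_le_mul h5 (hT B hB) hEB (by positivity)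
        _ = T / V * (c ^ 2 / natProd B) := by ring
        _ ≤ _ := by nlinarith
  · rw [upTo, if_neg hB]; simp

lemma sum_lsize_colorInd (s : 𝕃 → Option ι) :
    ∑ i, lsize lp (fun l => colorInd (s l) i) = lsize lp (colored s) := by
  simp only [lsize]
  rw [sum_comm]
  refine sum_congr rfl fun l _ => ?_
  have key : ∀ o : Option ι, ∑ i, (if colorInd o i then lp l else 0) = if o.isSome then lp l else 0 := by
    rintro (_ | i) <;> simp [colorInd]
  exact key (s l)

lemma abs_lam_le (hR : 2 ≤ R) {g : ℝ → ℝ} (hg : Antitone g) (hg0 : ∀ t, 0 ≤ g t) {ρ : ℝ} (hρ : ρ ≤ 1)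
    (x : 𝕃 → Option ι) :
    |lam zp (fun s => (∏ l, sgn (s l)) * sieveF lp g ρ s) x| ≤
      g 0 ^ 𝔨 * (1 + log R) ^ (2 * 𝔨) * upTo 1 (colored x) := by
  have hF : ∀ s : 𝕃 → Option ι, |(∏ l, sgn (s l)) * sieveF lp g ρ s| ≤
      g 0 ^ 𝔨 * upTo 1 (colored s) := by
    intro s
    have h1 : |∏ l, sgn (s l)| = 1 := by
      rw [abs_prod]; exact prod_eq_one fun l _ => by cases s l <;> simp [sgn]
    have h2 : ∏ i, g (lsize lp fun l => colorInd (s l) i) ≤ g 0 ^ 𝔨 := by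
      rw [← card_univ, ← prod_const]
      exact prod_le_prod (fun i _ => hg0 _) fun i _ => hg (lsize_nonneg lp_nonneg _)
    have h0 : 0 ≤ ∏ i, g (lsize lp fun l => colorInd (s l) i) := prod_nonneg fun i _ => hg0 _
    rw [abs_mul, h1, one_mul, sieveF, sum_lsize_colorInd, abs_mul, abs_of_nonneg h0]
    refine mul_le_mul h2 ?_ (abs_nonneg _) (h0.trans h2)
    unfold upTo
    split_ifs <;> first | (exfalso; linarith) | norm_num
  have hz := sum_prod_le_of_coord_map (fun (l : 𝕃) a => |tinv (zp l) (x l) a|)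
    (fun l : 𝕃 => bw (((2 * 𝔨 : ℕ) : ℝ) / (l : ℕ))) Option.isSome id (fun _ _ => abs_nonneg _)
    (fun l b => bw_nonneg (by positivity) b) (fun _ => 1) (fun _ => zero_le_one) (fun l f hf hf0 => by
      have hl := two_le_coe l
      have h1 := hf (Bool.false_le true)
      have h2 : 𝔨 * zp l ≤ ((2 * 𝔨 : ℕ) : ℝ) / (l : ℕ) := by
        have : zp l ≤ 2 / (l : ℕ) := by
          rw [zp, div_le_div_iff₀ (by linarith) (by linarith)]; linarith
        refine (mul_le_mul_of_nonneg_left this (Nat.cast_nonneg _)).trans (le_of_eq (by push_cast; ring))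
      have h3 := mul_le_mul_of_nonneg_right h2 (hf0 true)
      have h4 : 0 ≤ 𝔨 * zp l * f true := mul_nonneg (mul_nonneg (Nat.cast_nonneg _) (zp_nonneg l)) (hf0 _)
      rw [Fintype.sum_option, Fintype.sum_bool, one_mul]
      cases x l with
      | none => simp [tinv, bw, abs_of_nonneg (zp_nonneg l)] at h3 ⊢; linarith
      | some i =>
        simp only [tinv, bw, reduceCtorEq, if_false, abs_zero, zero_mul, zero_add, if_true, Bool.false_eq_true, one_mul,
          Option.some.injEq, Option.isSome_some, id]
        rw [sum_eq_single i (fun j _ hj => by simp [hj]) (by simp)]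
        simp only [if_true, abs_one, one_mul]; linarith) (upTo (1 : ℝ)) (upTo_antitone _) (upTo_nonneg _)
  simp only [prod_const_one, one_mul] at hz
  have h2 := sum_setW_upTo_le (D := D) (p₁ := p₁) hR (2 * 𝔨) 1
  rw [Nat.cast_one, one_mul] at h2
  have hterm : ∀ s, |(∏ l, sgn (s l)) * sieveF lp g ρ s * ∏ l, tinv (zp l) (x l) (s l)| ≤
      g 0 ^ 𝔨 * upTo 1 (colored x) * ((∏ l, |tinv (zp l) (x l) (s l)|) * upTo 1 (colored s)) := by
    intro s
    rw [abs_mul, abs_prod]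
    have hP : 0 ≤ ∏ l, |tinv (zp l) (x l) (s l)| := prod_nonneg fun _ _ => abs_nonneg _
    by_cases hs : ∀ l i, x l = some i → s l = some i
    · have hle : upTo 1 (colored s) ≤ upTo 1 (colored x) := upTo_antitone _ fun l => by
        cases hx : x l with
        | none => simp [colored, hx]
        | some i => simp [colored, hx, hs l i hx]
      have hsq : upTo (D := D) (p₁ := p₁) (R := R) 1 (colored s) ≤ upTo 1 (colored x) * upTo 1 (colored s) := by
        unfold upTo at hle ⊢; split_ifs at hle ⊢ <;> linarith
      calc _ ≤ g 0 ^ 𝔨 * (upTo 1 (colored x) * upTo 1 (colored s)) * ∏ l, |tinv (zp l) (x l) (s l)| :=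
            mul_le_mul_of_nonneg_right ((hF s).trans (mul_le_mul_of_nonneg_left hsq (pow_nonneg (hg0 _) _))) hP
        _ = _ := by ring
    · push Not at hs
      obtain ⟨l, i, hx, hsl⟩ := hs
      have h0 : ∏ l, |tinv (zp l) (x l) (s l)| = 0 :=
        prod_eq_zero (mem_univ l) (by rw [hx]; simp [tinv, hsl])
      rw [h0]; simp
  rw [lam]
  refine (abs_sum_le_sum_abs _ _).trans ((sum_le_sum fun s _ => hterm s).trans ?_)
  rw [← mul_sum, mul_right_comm (g 0 ^ 𝔨) ((1 + log R) ^ (2 * 𝔨))]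
  exact mul_le_mul_of_nonneg_left (hz.trans h2) (mul_nonneg (pow_nonneg (hg0 _) _) (upTo_nonneg _ _))

end Polylog

section Cutoff

open Filter Topology

/-- The untruncated cutoff. -/
noncomputable def cut (k c u : ℝ) : ℝ := 1 / (c + k * max u 0)

/-- The truncated cutoff. -/
noncomputable def cutT (k c T u : ℝ) : ℝ := if u ≤ T then cut k c u else 0

variable {k c T : ℝ}

lemma cut_pos (hk : 0 < k) (hc : 0 < c) (u : ℝ) : 0 < cut k c u := by
  unfold cut; have := le_max_right u 0; positivity

lemma cut_antitone (hk : 0 < k) (hc : 0 < c) : Antitone (cut k c) := fun u v h => by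
  unfold cut; have := le_max_right u 0; gcongr

lemma cutT_nonneg (hk : 0 < k) (hc : 0 < c) (u : ℝ) : 0 ≤ cutT k c T u := by
  unfold cutT; split_ifs; exacts [(cut_pos hk hc u).le, le_rfl]

lemma cutT_antitone (hk : 0 < k) (hc : 0 < c) : Antitone (cutT k c T) := fun u v h => by
  have := cut_antitone hk hc h
  have := cut_pos hk hc u
  unfold cutT
  split_ifs <;> linarith

lemma hasDerivAt_cut (hk : 0 < k) (hc : 0 < c) {t : ℝ} (ht : 0 ≤ t) :
    HasDerivAt (fun t => log (c + k * t) / k) (cut k c t) t := by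
  have h0 : c + k * t ≠ 0 := by positivity
  refine ((((hasDerivAt_id t).const_mul k).const_add c).log h0 |>.div_const k).congr_deriv ?_
  rw [cut, max_eq_left ht]; field_simp; simp [h0]

lemma hasDerivAt_cut_sq (hk : 0 < k) (hc : 0 < c) {t : ℝ} (ht : 0 ≤ t) :
    HasDerivAt (fun t => -(c + k * t)⁻¹ / k) (cut k c t ^ 2) t := by
  have h0 : c + k * t ≠ 0 := by positivity
  refine ((((hasDerivAt_id t).const_mul k).const_add c).inv h0 |>.neg.div_const k).congr_deriv ?_
  rw [cut, max_eq_left ht]; simp; field_simp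

/-- The one-dimensional integral of the cutoff. -/
noncomputable def cutInt (k c T v : ℝ) : ℝ := log (1 + k * min v T / c) / k

lemma sum_setW_bounds_of_le {D R p₁ : ℕ} (hD : 2 ≤ D) (hR : 2 ≤ R) (hp₁ : p₁.Prime) (hDp : D < p₁) {γ Γ : ℝ → ℝ}
    (hγ : Antitone γ) (hγ0 : ∀ t, 0 ≤ γ t) (hΓ : ∀ t, 0 ≤ t → HasDerivAt Γ (γ t) t) {v : ℝ} (hv0 : 0 ≤ v) (hv1 : v ≤ 1)
    {η u I : ℝ} (hη : exp (2 / D) ≤ η) (hI : Γ v - Γ 0 = I)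
    (hu : 2 * primorial D * γ 0 ≤ u * ((primorial D).totient / primorial D * log R)) :
    (primorial D).totient / primorial D * log R * (I - u) ≤ η * ∑ A : sievePrimes D p₁ R → Bool,
      setW zp A * (γ (lsize lp A) * if lsize lp A ≤ v then 1 else 0) ∧
    ∑ A : sievePrimes D p₁ R → Bool, setW zp A * (γ (lsize lp A) * if lsize lp A ≤ v then 1 else 0) ≤
      η * ((primorial D).totient / primorial D * log R * (I + u)) := by
  have h := sum_setW_bounds (D := D) (R := R) hD hR hp₁ hDp hγ hγ0 hΓ hv0 hv1
  rw [hI] at h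
  have hpos : 0 ≤ ∑ A : sievePrimes D p₁ R → Bool, setW zp A * (γ (lsize lp A) * if lsize lp A ≤ v then 1 else 0) :=
    sum_nonneg fun A _ => mul_nonneg (setW_nonneg zp_nonneg _) (mul_nonneg (hγ0 _) (by split_ifs <;> norm_num))
  have h3 : 0 ≤ (primorial D).totient / primorial D * log R * I + 2 * primorial D * γ 0 :=
    nonneg_of_mul_nonneg_right (hpos.trans h.2) (exp_pos _)
  refine ⟨le_trans (by linarith [h.1]) (mul_le_mul_of_nonneg_right hη hpos), h.2.trans ?_⟩
  exact mul_le_mul hη (by linarith) h3 ((exp_pos _).le.trans hη)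

set_option maxHeartbeats 400000 in
/-- The ratio of the two sieve sums is as large as the corresponding ratio of integrals. -/
theorem eventually_ratio {κ K n0 : ℕ} (hκ : 2 ≤ κ) (hc : 0 < c) (hT : 0 < T) (hT1 : T ≤ 1) (hK : n0 < K)
    (h1 : K * ((κ - 1) / κ * (cutInt κ c T T - c * (T / (c * (c + κ * T))))) < (K - n0) * (T / (c * (c + κ * T)))) {τ : ℝ}
    (hτ0 : 0 ≤ τ)
    (h2 : τ * n0 * (T / (c * (c + κ * T))) < κ * ∑ i ∈ range n0, cutInt κ c T (i / K) ^ 2) :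
    ∀ᶠ D : ℕ in atTop, ∀ᶠ R : ℕ in atTop, ∀ p₁ : ℕ, p₁.Prime → D < p₁ →
      n0 * (∑ A : sievePrimes D p₁ R → Bool, setW zp A * cutT κ c T (lsize lp A) ^ 2) ≤
        K * ((∑ A : sievePrimes D p₁ R → Bool, setW zp A * cutT κ c T (lsize lp A) ^ 2) -
        (κ - 1) * ∑ A : sievePrimes D p₁ R → Bool, setW zp A * cutT κ c T (lsize lp A) ^ 2 * lsize lp A) ∧
      τ * ((primorial D).totient / primorial D * log R) * ((∏ l : sievePrimes D p₁ R, (1 + 2 * (κ : ℝ) ^ 2 * zp l ^ 2)) *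
        (∏ l : sievePrimes D p₁ R, (1 + (2 * (κ : ℝ) ^ 2 + 2 * κ) * zp l ^ 2)) *
        (∑ A : sievePrimes D p₁ R → Bool, setW zp A * cutT κ c T (lsize lp A) ^ 2) * n0) ≤
      κ * ∑ i ∈ range n0, trunc (zp (D := D) (p₁ := p₁) (R := R)) lp (cutT κ c T) (i / K) ^ 2 := by
  set m := T / (c * (c + κ * T)) with hm
  set a : ℕ → ℝ := fun i => cutInt κ c T (i / K) with ha
  set b := cutInt κ c T T with hb
  have hk : (0 : ℝ) < κ := by exact_mod_cast (by omega : 0 < κ)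
  have hk2 : (2 : ℝ) ≤ κ := by exact_mod_cast hκ
  have hm0 : 0 < m := by positivity
  have hKn : (0 : ℝ) < K - n0 := by rw [sub_pos]; exact_mod_cast hK
  have hK0 : (0 : ℝ) < K := by exact_mod_cast (by omega : 0 < K)
  have ev : ∀ᶠ p : ℝ × ℝ in 𝓝 1 ×ˢ 𝓝 0,
      K * ((κ - 1) / κ * (p.1 * (b + p.2) - c * (p.1⁻¹ * (m - p.2)))) < (K - n0) * (p.1⁻¹ * (m - p.2)) ∧
      τ * (p.1 * (p.1 * (m + p.2) * n0)) < κ * ∑ i ∈ range n0, max 0 (p.1⁻¹ * (a i - p.2)) ^ 2 := by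
    rw [← nhds_prod_eq]
    have hinv : ContinuousAt (fun p : ℝ × ℝ => p.1⁻¹) (1, 0) := continuousAt_fst.inv₀ one_ne_zero
    refine ((ContinuousAt.eventually_lt (x₀ := ((1 : ℝ), (0 : ℝ))) (by fun_prop) (by fun_prop) ?_).and
      (ContinuousAt.eventually_lt (x₀ := ((1 : ℝ), (0 : ℝ))) (by fun_prop) ?_ ?_))
    · simpa using h1
    · refine continuousAt_const.mul (tendsto_finsetSum _ fun i _ => ?_)
      exact (ContinuousAt.pow (ContinuousAt.sup continuousAt_const (by fun_prop)) 2)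
    · have hpos : ∀ i, 0 ≤ a i := fun i => by
        have : 0 ≤ min ((i : ℝ) / K) T := le_min (by positivity) hT.le
        have : 0 ≤ κ * min ((i : ℝ) / K) T / c := by positivity
        exact div_nonneg (log_nonneg (by linarith)) hk.le
      simp only [sub_zero, add_zero, inv_one, one_mul, max_eq_right (hpos _)]
      linarith
  set C := 2 * (2 * (κ : ℝ) ^ 2) + 2 * (2 * (κ : ℝ) ^ 2 + 2 * κ) with hC
  have hC2 : 2 ≤ C := by nlinarith
  have hη : Tendsto (fun D : ℕ => exp (C / D)) atTop (𝓝 1) := by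
    have := (tendsto_const_div_atTop_nhds_zero_nat C).rexp
    rwa [exp_zero] at this
  filter_upwards [(hη.eventually ev.curry), eventually_ge_atTop 2] with D hD hD2
  have hD0 : (0 : ℝ) < D := by exact_mod_cast (by omega : 0 < D)
  set η := exp (C / D) with hηdef
  have hη0 : 0 < η := exp_pos _
  have hη1 : exp (2 / D) ≤ η := exp_le_exp.mpr (by gcongr)
  set w := ((primorial D).totient : ℝ) / primorial D with hw
  have hw0 : 0 < w := div_pos (by exact_mod_cast Nat.totient_pos.mpr (primorial_pos D)) (by exact_mod_cast primorial_pos D)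
  set U := 2 * (primorial D : ℝ) * (1 / c + 1 / c ^ 2) with hU
  have hE : Tendsto (fun R : ℕ => w * log R) atTop atTop :=
    (tendsto_log_atTop.comp tendsto_natCast_atTop_atTop).const_mul_atTop hw0
  filter_upwards [(hE.const_div_atTop U).eventually hD, eventually_ge_atTop 2, hE.eventually_gt_atTop 0] with R hR hR2 hE0 p₁ hp₁ hDp
  set E := w * log R with hEdef
  obtain ⟨e1, e2⟩ := hR
  set u := U / E with hu
  have huE : U = u * E := by rw [hu]; field_simp
  set B0 := ∑ A : sievePrimes D p₁ R → Bool, setW zp A * cutT κ c T (lsize lp A) ^ 2 with hB0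
  have hcut0 : cut κ c 0 = 1 / c := by simp [cut]
  have hi1 : (0:ℝ) < 1 / c := by positivity
  have hi2 : (0:ℝ) < 1 / c ^ 2 := by positivity
  have hW0 : (0 : ℝ) ≤ primorial D := Nat.cast_nonneg _
  have hg1 : ∀ v, 0 ≤ v → v ≤ 1 →
      E * (cutInt κ c v v - u) ≤ η *
        ∑ A : sievePrimes D p₁ R → Bool, setW zp A * (cut κ c (lsize lp A) * if lsize lp A ≤ v then 1 else 0) ∧
      ∑ A : sievePrimes D p₁ R → Bool, setW zp A * (cut κ c (lsize lp A) * if lsize lp A ≤ v then 1 else 0) ≤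
        η * (E * (cutInt κ c v v + u)) := by
    intro v hv0 hv1
    refine sum_setW_bounds_of_le hD2 hR2 hp₁ hDp (cut_antitone hk hc) (fun t => (cut_pos hk hc t).le)
      (fun t ht => hasDerivAt_cut hk hc ht) hv0 hv1 hη1 ?_ ?_
    · rw [cutInt, min_self, ← sub_div, ← log_div (by positivity) (by positivity)]
      congr 2; field_simp; ring
    · rw [hcut0, ← hw, ← hEdef, ← huE, hU]
      exact mul_le_mul_of_nonneg_left (by linarith) (by positivity)
  have hsq : ∀ A : sievePrimes D p₁ R → Bool, cutT κ c T (lsize lp A) ^ 2 =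
      cut κ c (lsize lp A) ^ 2 * if lsize lp A ≤ T then 1 else 0 := fun A => by
    unfold cutT; split_ifs <;> simp
  have hg2 : E * (m - u) ≤ η * B0 ∧ B0 ≤ η * (E * (m + u)) := by
    simp only [hB0, hsq]
    refine sum_setW_bounds_of_le hD2 hR2 hp₁ hDp (γ := fun t => cut κ c t ^ 2)
      (fun s t hst => pow_le_pow_left₀ (cut_pos hk hc _).le (cut_antitone hk hc hst) 2)
      (fun t => sq_nonneg _) (fun t ht => hasDerivAt_cut_sq hk hc ht) hT.le hT1 hη1 ?_ ?_
    · rw [hm]; field_simp; ring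
    · rw [hcut0, ← hw, ← hEdef, ← huE, hU, div_pow, one_pow]
      exact mul_le_mul_of_nonneg_left (by linarith) (by positivity)
  have hB0' : E * (η⁻¹ * (m - u)) ≤ B0 := by
    rw [mul_left_comm, inv_mul_le_iff₀ hη0]; exact hg2.1
  constructor
  · have hB1 : ∑ A : sievePrimes D p₁ R → Bool, setW zp A * cutT κ c T (lsize lp A) ^ 2 * lsize lp A =
        (∑ A : sievePrimes D p₁ R → Bool, setW zp A * (cut κ c (lsize lp A) * if lsize lp A ≤ T then 1 else 0) - c * B0) / κ := by
      rw [hB0, mul_sum, ← sum_sub_distrib, sum_div]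
      refine sum_congr rfl fun A _ => ?_
      rw [hsq]
      have h0 := lsize_nonneg lp_nonneg A
      have h3 : c + κ * lsize lp A ≠ 0 := by positivity
      split_ifs
      · rw [cut, max_eq_left h0]; field_simp; ring
      · ring
    rw [hB1]
    have h3 := (hg1 T hT.le hT1).2
    have h5 := mul_lt_mul_of_pos_left e1 hE0
    have h6 : K * ((κ - 1) * ((∑ A : sievePrimes D p₁ R → Bool,
        setW zp A * (cut κ c (lsize lp A) * if lsize lp A ≤ T then 1 else 0) - c * B0) / κ)) ≤
        E * (K * ((κ - 1) / κ * (η * (b + u) - c * (η⁻¹ * (m - u))))) := by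
      have hck := mul_le_mul_of_nonneg_left hB0' hc.le
      calc _ = K * ((κ - 1) / κ) * (∑ A : sievePrimes D p₁ R → Bool,
            setW zp A * (cut κ c (lsize lp A) * if lsize lp A ≤ T then 1 else 0) - c * B0) := by ring
        _ ≤ K * ((κ - 1) / κ) * (η * (E * (b + u)) - c * (E * (η⁻¹ * (m - u)))) :=
            mul_le_mul_of_nonneg_left (by linarith) (mul_nonneg hK0.le (div_nonneg (by linarith) hk.le))
        _ = _ := by ring
    have h7 := mul_le_mul_of_nonneg_left hB0' hKn.le
    linarith
  · have htr : ∀ i ∈ range n0, E ^ 2 * max 0 (η⁻¹ * (a i - u)) ^ 2 ≤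
        trunc (zp (D := D) (p₁ := p₁) (R := R)) lp (cutT κ c T) (i / K) ^ 2 := by
      intro i hi
      rw [← mul_pow]
      refine pow_le_pow_left₀ (mul_nonneg hE0.le (le_max_left _ _)) ?_ 2
      have hiK : (i : ℝ) / K ≤ 1 := by
        rw [div_le_one hK0]; exact_mod_cast ((mem_range.mp hi).trans hK).le
      have hmin0 : 0 ≤ min ((i : ℝ) / K) T := le_min (by positivity) hT.le
      have e : trunc (zp (D := D) (p₁ := p₁) (R := R)) lp (cutT κ c T) (i / K) = ∑ A : sievePrimes D p₁ R → Bool,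
          setW zp A * (cut κ c (lsize lp A) * if lsize lp A ≤ min ((i : ℝ) / K) T then 1 else 0) := by
        refine sum_congr rfl fun A _ => ?_
        simp only [cutT, le_min_iff]
        by_cases h3 : lsize lp A ≤ (i : ℝ) / K <;> by_cases h4 : lsize lp A ≤ T <;> simp [h3, h4]
      rw [mul_max_of_nonneg _ _ hE0.le, mul_zero]
      refine max_le (trunc_nonneg zp_nonneg (cutT_nonneg hk hc) _) ?_
      rw [e, mul_left_comm, inv_mul_le_iff₀ hη0]
      have h5 := (hg1 _ hmin0 ((min_le_left _ _).trans hiK)).1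
      rwa [cutInt, min_self, ← cutInt] at h5
    have hprod : (∏ l : sievePrimes D p₁ R, (1 + 2 * (κ : ℝ) ^ 2 * zp l ^ 2)) *
        (∏ l : sievePrimes D p₁ R, (1 + (2 * (κ : ℝ) ^ 2 + 2 * κ) * zp l ^ 2)) ≤ η := by
      refine (mul_le_mul (prod_one_add_mul_zp_sq_le hD2 (by positivity)) (prod_one_add_mul_zp_sq_le hD2 (by positivity))
        (prod_nonneg fun l _ => by positivity) (exp_nonneg _)).trans (le_of_eq ?_)
      rw [← exp_add, hηdef, hC]; congr 1; ring
    have hB00 : 0 ≤ B0 := sum_nonneg fun A _ => mul_nonneg (setW_nonneg zp_nonneg _) (sq_nonneg _)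
    calc _ ≤ τ * E * (η * (η * (E * (m + u))) * n0) := by
          refine mul_le_mul_of_nonneg_left (mul_le_mul_of_nonneg_right (mul_le_mul hprod hg2.2 hB00 hη0.le)
            (Nat.cast_nonneg _)) (mul_nonneg hτ0 hE0.le)
      _ = E ^ 2 * (τ * (η * (η * (m + u) * n0))) := by ring
      _ ≤ E ^ 2 * (κ * ∑ i ∈ range n0, max 0 (η⁻¹ * (a i - u)) ^ 2) := mul_le_mul_of_nonneg_left e2.le (sq_nonneg _)
      _ = κ * ∑ i ∈ range n0, E ^ 2 * max 0 (η⁻¹ * (a i - u)) ^ 2 := by rw [← mul_sum]; ring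
      _ ≤ _ := mul_le_mul_of_nonneg_left (sum_le_sum htr) hk.le

end Cutoff

section Assembly

variable {D p₁ R : ℕ} {ι : Type*} [Fintype ι] [DecidableEq ι]

local notation "𝕃" => sievePrimes D p₁ R

/-- Restriction of a weight to the tuples whose `m`-th entry is trivial. -/
def restr (f : (𝕃 → Option ι) → ℝ) (m : ι) (x : 𝕃 → Option {i : ι // i ≠ m}) : ℝ :=
  f fun l => (x l).map Subtype.val

lemma map_val_injective (m : ι) : Function.Injective
    fun (x : 𝕃 → Option {i : ι // i ≠ m}) l => (x l).map Subtype.val := fun _ _ hxy =>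
  funext fun l => Option.map_injective Subtype.val_injective (congrFun hxy l)

lemma sum_abs_restr_le (f : (𝕃 → Option ι) → ℝ) (m : ι) : ∑ x, |restr f m x| ≤ ∑ x, |f x| :=
  sum_le_sum_of_injOn (fun x l => (x l).map Subtype.val) (fun _ _ => mem_univ _) (map_val_injective m).injOn
    (fun _ _ => le_rfl) fun _ _ => abs_nonneg _

lemma sieveForm_sq_le (h : ι → ℕ) (f : (𝕃 → Option ι) → ℝ) (n : ℕ) :
    sieveForm h f n ^ 2 ≤ (∑ x, |f x|) ^ 2 := by
  refine sq_le_sq' ?_ ?_ <;> [refine neg_le_of_abs_le ?_; refine le_of_abs_le ?_] <;>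
  exact (abs_sum_le_sum_abs _ _).trans (sum_le_sum fun x _ => by split_ifs <;> simp)

lemma sieveForm_restr {h : ι → ℕ} (f : (𝕃 → Option ι) → ℝ) {n : ℕ} {m : ι}
    (hp : (n + h m).Prime) (hR : R < n + h m) :
    sieveForm (fun i : {i : ι // i ≠ m} => h i) (restr f m) n = sieveForm h f n := by
  refine Fintype.sum_of_injective _ (map_val_injective m) _ _ (fun x hx => if_neg fun hhit => hx ?_) fun x => ?_
  · have hne : ∀ l i, x l = some i → i ≠ m := by
      rintro l i hl rfl
      have h1 := (Nat.prime_dvd_prime_iff_eq (prime_coe l) hp).mp (hhit l i hl)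
      have h2 := (mem_sievePrimes.mp l.2).1
      omega
    refine ⟨fun l => match hx : x l with
      | none => none
      | some i => some ⟨i, hne l i hx⟩, funext fun l => ?_⟩
    dsimp only
    split <;> simp_all
  · have : hit (fun i : {i : ι // i ≠ m} => h i) x n ↔ hit h (fun l => (x l).map Subtype.val) n := by
      constructor
      · intro H l i hi
        obtain ⟨j, hj, rfl⟩ := Option.map_eq_some_iff.mp hi
        exact H l j hj
      · intro H l i hi
        exact H l i (by simp [hi])
    simp only [this, restr]

/-- Upper bound for the sums over primes when no translate has more than `M` primes. -/
lemma sum_vonMangoldt_le {J : ℕ} {N : ℝ} (hN : 1 ≤ N) (hDN : D ≤ N) {h : ι → ℕ} (hD : ∀ i, h i ≤ D)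
    {M n₁ v₀ : ℕ} (hM : ∀ n, n₁ < n → (univ.filter fun i => (n + h i).Prime).card ≤ M)
    (f : (𝕃 → Option ι) → ℝ) :
    ∑ m, ∑ n ∈ (Icc 1 ⌊N⌋₊).filter (fun n => n ≡ v₀ [MOD primorial D]),
        vonMangoldt (n + h m) * wt J ((n + h m : ℕ) / N) * sieveForm (fun i : {i : ι // i ≠ m} => h i) (restr f m) n ^ 2 ≤
      M * log (2 * N) * ∑ n ∈ (Icc 1 ⌊N⌋₊).filter (fun n => n ≡ v₀ [MOD primorial D]),
        wt J (n / N) * sieveForm h f n ^ 2 +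
      Fintype.card ι * (∑ x, |f x|) ^ 2 * log (2 * N) * (n₁ + 2 * sqrt (2 * N) + R) := by
  set S := (Icc 1 ⌊N⌋₊).filter (fun n => n ≡ v₀ [MOD primorial D]) with hS
  set Λs := (∑ x, |f x|) ^ 2 with hΛs
  set lg := log (2 * N) with hlg
  have hlg0 : 0 ≤ lg := log_nonneg (by linarith)
  have hΛ0 : 0 ≤ Λs := sq_nonneg _
  set a : ℕ → ℝ := fun n => (vonMangoldt n - if n.Prime then log n else 0) + if n ≤ R then lg else 0 with ha
  have hvp : ∀ n : ℕ, 0 ≤ vonMangoldt n - if n.Prime then log n else 0 := fun n => by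
    split_ifs with hp
    · rw [vonMangoldt_apply_prime hp, sub_self]
    · rw [sub_zero]; exact vonMangoldt_nonneg
  have ha0 : ∀ n, 0 ≤ a n := fun n => add_nonneg (hvp n) (by split_ifs <;> linarith)
  have hle : ∀ m, ∀ n ∈ S, n + h m ≤ ⌊2 * N⌋₊ := fun m n hn => by
    refine Nat.le_floor ?_
    have h1 := (Nat.le_floor_iff (by linarith)).mp (mem_Icc.mp (mem_filter.mp hn).1).2
    have h2 : (h m : ℝ) ≤ D := by exact_mod_cast hD m
    push_cast; linarith
  have hpt : ∀ m, ∀ n ∈ S, vonMangoldt (n + h m) * wt J ((n + h m : ℕ) / N) *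
      sieveForm (fun i : {i : ι // i ≠ m} => h i) (restr f m) n ^ 2 ≤
      (if (n + h m).Prime then lg * (wt J (n / N) * sieveForm h f n ^ 2) else 0) + Λs * a (n + h m) := by
    intro m n hn
    have hn1 := (mem_Icc.mp (mem_filter.mp hn).1).1
    have hF' : sieveForm (fun i : {i : ι // i ≠ m} => h i) (restr f m) n ^ 2 ≤ Λs :=
      (sieveForm_sq_le _ _ _).trans (pow_le_pow_left₀ (sum_nonneg fun _ _ => abs_nonneg _) (sum_abs_restr_le f m) 2)
    have hw1 : wt J ((n + h m : ℕ) / N) ≤ 1 := wt_le_one J (by positivity)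
    have hw0 := wt_nonneg J ((n + h m : ℕ) / N)
    have hlog : log (n + h m : ℕ) ≤ lg := by
      refine log_le_log (by exact_mod_cast (by omega : 0 < n + h m)) ?_
      exact (Nat.le_floor_iff (by linarith)).mp (hle m n hn)
    have hbd : ∀ b, vonMangoldt (n + h m) ≤ b → vonMangoldt (n + h m) * wt J ((n + h m : ℕ) / N) *
        sieveForm (fun i : {i : ι // i ≠ m} => h i) (restr f m) n ^ 2 ≤ Λs * b := fun b hb => by
      have hb0 := vonMangoldt_nonneg.trans hb
      calc _ ≤ b * 1 * Λs := mul_le_mul (mul_le_mul hb hw1 hw0 hb0) hF' (sq_nonneg _) (by linarith)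
        _ = _ := by ring
    have hmain : 0 ≤ lg * (wt J (n / N) * sieveForm h f n ^ 2) :=
      mul_nonneg hlg0 (mul_nonneg (wt_nonneg _ _) (sq_nonneg _))
    by_cases hp : (n + h m).Prime
    · rw [if_pos hp]
      by_cases hR : n + h m ≤ R
      · have := hbd (a (n + h m)) (by
          simp only [ha, if_pos hp, if_pos hR, vonMangoldt_apply_prime hp]; linarith)
        linarith
      · rw [sieveForm_restr f hp (not_le.mp hR), vonMangoldt_apply_prime hp]
        have hw2 : wt J ((n + h m : ℕ) / N) ≤ wt J (n / N) := wt_antitone J (by gcongr; omega)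
        have := mul_nonneg hΛ0 (ha0 (n + h m))
        refine le_trans (le_of_eq (mul_assoc _ _ _)) (le_trans (mul_le_mul hlog (mul_le_mul_of_nonneg_right hw2 (sq_nonneg _))
          (mul_nonneg hw0 (sq_nonneg _)) hlg0) (by linarith))
    · rw [if_neg hp, zero_add]
      refine hbd _ ?_
      simp only [ha, if_neg hp, sub_zero]
      split_ifs <;> linarith
  have hsa : ∀ m, ∑ n ∈ S, a (n + h m) ≤ (2 * sqrt (2 * N) + R) * lg := by
    intro m
    calc _ ≤ ∑ n ∈ Icc 1 ⌊2 * N⌋₊, a n := by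
          refine sum_le_sum_of_injOn (fun n => n + h m) (fun n hn => ?_) (fun x _ y _ e => by simpa using e)
            (fun _ _ => le_rfl) fun n _ => ha0 n
          exact mem_Icc.mpr ⟨by have := (mem_Icc.mp (mem_filter.mp hn).1).1; omega, hle m n hn⟩
      _ = (Chebyshev.psi (2 * N) - Chebyshev.theta (2 * N)) + ∑ n ∈ Icc 1 ⌊2 * N⌋₊, if n ≤ R then lg else 0 := by
          rw [sum_add_distrib, sum_sub_distrib, Chebyshev.psi, Chebyshev.theta, sum_filter]; rfl
      _ ≤ 2 * sqrt (2 * N) * lg + R * lg := by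
          refine add_le_add ((le_abs_self _).trans (Chebyshev.abs_psi_sub_theta_le_sqrt_mul_log (by linarith))) ?_
          rw [← sum_filter, sum_const, nsmul_eq_mul]
          gcongr
          calc _ ≤ (Icc 1 R).card := card_le_card fun n hn => by
                rw [mem_filter, mem_Icc] at hn; exact mem_Icc.mpr ⟨hn.1.1, hn.2⟩
            _ = R := by simp
      _ = _ := by ring
  calc _ ≤ ∑ m, ∑ n ∈ S, ((if (n + h m).Prime then lg * (wt J (n / N) * sieveForm h f n ^ 2) else 0) + Λs * a (n + h m)) :=
        sum_le_sum fun m _ => sum_le_sum fun n hn => hpt m n hn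
    _ = ∑ n ∈ S, (univ.filter fun i => (n + h i).Prime).card * (lg * (wt J (n / N) * sieveForm h f n ^ 2)) +
        ∑ m, Λs * ∑ n ∈ S, a (n + h m) := by
        simp only [sum_add_distrib, mul_sum]
        congr 1
        rw [sum_comm]
        exact sum_congr rfl fun n _ => by rw [← sum_filter, sum_const, nsmul_eq_mul]
    _ ≤ ∑ n ∈ S, (M * lg * (wt J (n / N) * sieveForm h f n ^ 2) + if n ≤ n₁ then Fintype.card ι * lg * Λs else 0) +
        ∑ m : ι, Λs * ((2 * sqrt (2 * N) + R) * lg) := by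
        refine add_le_add (sum_le_sum fun n hn => ?_) (sum_le_sum fun m _ => mul_le_mul_of_nonneg_left (hsa m) hΛ0)
        have hX0 : 0 ≤ wt J (n / N) * sieveForm h f n ^ 2 := mul_nonneg (wt_nonneg _ _) (sq_nonneg _)
        have hXΛ : wt J (n / N) * sieveForm h f n ^ 2 ≤ 1 * Λs :=
          mul_le_mul (wt_le_one J (by positivity)) (sieveForm_sq_le _ _ _) (sq_nonneg _) zero_le_one
        split_ifs with hn1
        · have hc : ((univ.filter fun i => (n + h i).Prime).card : ℝ) ≤ Fintype.card ι := by
            exact_mod_cast (card_filter_le _ _).trans (le_of_eq card_univ)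
          have e1 : ((univ.filter fun i => (n + h i).Prime).card : ℝ) * (lg * (wt J (n / N) * sieveForm h f n ^ 2)) ≤
              Fintype.card ι * (lg * (1 * Λs)) := by gcongr
          have e2 : 0 ≤ M * lg * (wt J (n / N) * sieveForm h f n ^ 2) := by positivity
          linarith
        · have hc : ((univ.filter fun i => (n + h i).Prime).card : ℝ) ≤ M := by exact_mod_cast hM n (not_le.mp hn1)
          rw [add_zero, mul_assoc]
          exact mul_le_mul_of_nonneg_right hc (mul_nonneg hlg0 hX0)
    _ ≤ _ := by
        rw [sum_add_distrib, ← mul_sum, ← sum_filter, sum_const, sum_const, card_univ, nsmul_eq_mul, nsmul_eq_mul]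
        have hcard : ((S.filter (· ≤ n₁)).card : ℝ) ≤ n₁ := by
          have : (S.filter (· ≤ n₁)).card ≤ (Icc 1 n₁).card := card_le_card fun n hn => by
            rw [mem_filter] at hn
            exact mem_Icc.mpr ⟨(mem_Icc.mp (mem_filter.mp hn.1).1).1, hn.2⟩
          rw [Nat.card_Icc, Nat.add_sub_cancel] at this
          exact_mod_cast this
        have := mul_le_mul_of_nonneg_right hcard (by positivity : 0 ≤ Fintype.card ι * lg * Λs)
        linarith

lemma exists_max_abs_psiAP (J : ℕ) (N : ℝ) (q : ℕ) : ∃ a, a.Coprime q ∧ ∀ b, b.Coprime q →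
    |psiAP J N q b - psiTot J N / q.totient| ≤ |psiAP J N q a - psiTot J N / q.totient| := by
  obtain ⟨a, ha, hmax⟩ := ((range (q + 2)).filter fun a => a.Coprime q).exists_max_image
    (fun a => |psiAP J N q a - psiTot J N / q.totient|) ⟨1, by simp⟩
  refine ⟨a, (mem_filter.mp ha).2, fun b hb => ?_⟩
  have h1 : psiAP J N q b = psiAP J N q (b % q) := by
    unfold psiAP; congr 1; ext n
    simp only [mem_filter, and_congr_right_iff]
    exact fun _ => ⟨fun h => h.trans (Nat.mod_modEq b q).symm, fun h => h.trans (Nat.mod_modEq b q)⟩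
  rw [h1]
  refine hmax _ (mem_filter.mpr ⟨mem_range.mpr ?_, by
    rw [Nat.coprime_iff_gcd_eq_one, (Nat.mod_modEq b q).gcd_eq]; exact hb⟩)
  rcases Nat.eq_zero_or_pos q with rfl | hq
  · rw [Nat.coprime_zero_right] at hb; simp [hb]
  · have := Nat.mod_lt b hq; omega

lemma abs_psiAP_sub_le_div {J : ℕ} {N : ℝ} {q : ℕ} (hq : Squarefree q) (hqN : q ≤ N) (a : ℕ) :
    |psiAP J N q a - psiTot J N / q.totient| ≤ 7 * N * (1 + log N) ^ 3 / q := by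
  have hq1 : (1 : ℝ) ≤ q := by exact_mod_cast Nat.pos_of_ne_zero hq.ne_zero
  have hN : 1 ≤ N := hq1.trans hqN
  have hl := log_nonneg hN
  have hN' : (⌊N⌋₊ : ℝ) ≤ N := Nat.floor_le (by linarith)
  have hterm : ∀ n ∈ Icc 1 ⌊N⌋₊, vonMangoldt n * wt J (n / N) ≤ log N := fun n hn => by
    have h1 := mem_Icc.mp hn
    have h2 : (n : ℝ) ≤ N := (by exact_mod_cast h1.2 : (n : ℝ) ≤ ⌊N⌋₊).trans hN'
    have h3 : (0 : ℝ) < n := by exact_mod_cast h1.1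
    calc _ ≤ log n * 1 := mul_le_mul vonMangoldt_le_log (wt_le_one J (by positivity)) (wt_nonneg _ _)
          (log_natCast_nonneg n)
      _ ≤ _ := by rw [mul_one]; exact log_le_log h3 h2
  have hpos : ∀ n : ℕ, 0 ≤ vonMangoldt n * wt J (n / N) := fun n => mul_nonneg vonMangoldt_nonneg (wt_nonneg _ _)
  have hT : psiTot J N ≤ N * log N := by
    calc _ ≤ ∑ n ∈ Icc 1 ⌊N⌋₊, log N := sum_le_sum hterm
      _ = ⌊N⌋₊ * log N := by rw [sum_const, Nat.card_Icc, nsmul_eq_mul, Nat.add_sub_cancel]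
      _ ≤ _ := by gcongr
  have hT' : psiTot J N / q.totient ≤ N * (1 + log N) ^ 3 / q := by
    have h1 := one_div_totient_le hq (L := 1 + log N) (by gcongr)
    calc _ = psiTot J N * (1 / q.totient) := by ring
      _ ≤ N * log N * ((1 + log N) ^ 2 * (1 / q)) := mul_le_mul hT h1 (by positivity) (by positivity)
      _ ≤ N * (1 + log N) * ((1 + log N) ^ 2 * (1 / q)) := by gcongr; linarith
      _ = _ := by ring
  have hA : psiAP J N q a ≤ 6 * N * (1 + log N) ^ 3 / q := by
    have h1 := (abs_le.mp (abs_sum_wt_sub_le one_ne_zero (N := 2 * N) (by linarith) (Q := q)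
      (by exact_mod_cast hq1) a)).2
    have h2 : psiAP J N q a ≤ ∑ n ∈ (Icc 1 ⌊2 * N⌋₊).filter (fun n => n ≡ a [MOD q]), 2 * log N * wt 1 (n / (2 * N)) := by
      refine (sum_le_sum fun n hn => ?_).trans (sum_le_sum_of_subset_of_nonneg (filter_subset_filter _
        (Icc_subset_Icc_right (Nat.floor_le_floor (by linarith)))) fun n _ _ => mul_nonneg (by positivity) (wt_nonneg _ _))
      have hn' := (mem_filter.mp hn).1
      refine (hterm n hn').trans ?_
      have h4 : (n : ℝ) ≤ N := (by exact_mod_cast (mem_Icc.mp hn').2 : (n : ℝ) ≤ ⌊N⌋₊).trans hN'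
      have h5 : (n : ℝ) / (2 * N) ≤ 1 / 2 := by rw [div_le_div_iff₀ (by linarith) (by norm_num)]; linarith
      rw [wt_eq_pow (by linarith), pow_one]
      nlinarith
    rw [← mul_sum] at h2
    have h3 : (1 : ℝ) ≤ N / q := (one_le_div (by linarith)).mpr hqN
    have h6 : 2 * N / ((1 : ℕ) + 1) / q = N / q := by push_cast; ring
    rw [h6] at h1
    calc _ ≤ 2 * log N * (3 * (N / q)) := h2.trans (mul_le_mul_of_nonneg_left (by linarith) (by positivity))
      _ ≤ 2 * (1 + log N) ^ 3 * (3 * (N / q)) := by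
          gcongr
          nlinarith [pow_nonneg hl 2, pow_nonneg hl 3]
      _ = _ := by ring
  have h0 : 0 ≤ psiAP J N q a := sum_nonneg fun n _ => hpos n
  have h0' : 0 ≤ psiTot J N / q.totient := div_nonneg (sum_nonneg fun n _ => hpos n) (by positivity)
  have : 7 * N * (1 + log N) ^ 3 / q = 6 * N * (1 + log N) ^ 3 / q + N * (1 + log N) ^ 3 / q := by ring
  have h7 : 0 ≤ N * (1 + log N) ^ 3 / q := by positivity
  rw [abs_le]; constructor <;> linarith

lemma squarefree_primorial_mul (B : 𝕃 → Bool) : Squarefree (primorial D * natProd B) := by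
  rw [Nat.squarefree_mul (natProd_coprime B), primorial, natProd]
  refine ⟨squarefree_prod_of_pairwise_isCoprime (fun p hp q hq hpq => Nat.coprime_iff_isRelPrime.mp
    ((Nat.coprime_primes (mem_filter.mp hp).2 (mem_filter.mp hq).2).mpr hpq)) fun p hp => (mem_filter.mp hp).2.prime.squarefree,
    squarefree_prod_of_pairwise_isCoprime (fun l _ l' _ hl => Nat.coprime_iff_isRelPrime.mp ?_) fun l _ => ?_⟩
  · have := (Nat.coprime_primes (prime_coe l) (prime_coe l')).mpr fun e => hl (Subtype.ext e)
    dsimp only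
    split_ifs <;> first | exact this | exact Nat.coprime_one_right _ | exact Nat.coprime_one_left _
  · split_ifs
    exacts [(prime_coe l).prime.squarefree, squarefree_one]

/-- The error coming from the distribution of primes in arithmetic progressions. -/
lemma sum_abs_mul_error_le (hR : 2 ≤ R) (hp₁ : p₁.Prime) (hDp : D < p₁) {f : (𝕃 → Option ι) → ℝ} {Mf : ℝ}
    (hf : ∀ x, |f x| ≤ Mf * upTo 1 (colored x)) {J : ℕ} {N : ℝ} {Q : ℕ} (hQ : primorial D * R ^ 2 ≤ Q) (hQN : Q ≤ N)
    {a : ℕ → ℕ} {Z V L : ℝ} (hV : 0 < V) (hL : 1 + log N ≤ L) (hRL : 1 + 2 * log R ≤ L)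
    (hZ : ∑ q ∈ moduli Q p₁, |psiAP J N q (a q) - psiTot J N / q.totient| ≤ Z) :
    ∑ x, ∑ y, |f x| * |f y| * |psiAP J N (primorial D * natProd (joint x y)) (a (primorial D * natProd (joint x y))) -
        psiTot J N / (primorial D * natProd (joint x y)).totient| ≤
      Mf ^ 2 * (V * Z + 7 * N * L ^ 3 / V * L ^ (((Fintype.card ι + 1) ^ 2) ^ 2)) := by
  set E : ℕ → ℝ := fun q => |psiAP J N q (a q) - psiTot J N / q.totient| with hE
  have hle : ∀ B : 𝕃 → Bool, lsize lp B ≤ 2 → primorial D * natProd B ≤ Q := fun B hB =>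
    (Nat.mul_le_mul_left _ (natProd_le_of_lsize_le hR (v := 2) (by exact_mod_cast hB))).trans hQ
  have hQ0 : 1 ≤ Q := le_trans (Nat.mul_pos (primorial_pos D) (by positivity)) hQ
  have hN : 1 ≤ N := le_trans (by exact_mod_cast hQ0) hQN
  have hlN := log_nonneg hN
  have hlR := log_natCast_nonneg R
  have hL0 : 0 ≤ L := by linarith
  refine (sum_abs_mul_joint_le hR hf (fun q => E (primorial D * q)) (fun _ => abs_nonneg _) hV
    (T := 7 * N * L ^ 3) fun B hB => ?_).trans ?_
  · have h1 := hle B hB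
    refine (abs_psiAP_sub_le_div (squarefree_primorial_mul B) (le_trans (by exact_mod_cast h1) hQN) _).trans ?_
    have h2 : (natProd B : ℝ) ≤ (primorial D * natProd B : ℕ) := by
      exact_mod_cast Nat.le_mul_of_pos_left _ (primorial_pos D)
    have h3 : (0 : ℝ) < natProd B := by exact_mod_cast natProd_pos B
    gcongr
  · refine mul_le_mul_of_nonneg_left (add_le_add (mul_le_mul_of_nonneg_left ?_ hV.le)
      (mul_le_mul_of_nonneg_left (pow_le_pow_left₀ (by positivity) hRL _) (by positivity))) (sq_nonneg _)
    refine le_trans ?_ hZ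
    rw [← sum_filter_of_ne (p := fun B => lsize lp B ≤ 2) (fun B _ h => by by_contra hc; simp [upTo, hc] at h)]
    refine sum_le_sum_of_injOn (fun B => primorial D * natProd B) (fun B hB => ?_) (fun B _ B' _ e => ?_) (fun B hB => ?_)
      fun _ _ => abs_nonneg _
    · refine mem_moduli.mpr ⟨⟨Nat.mul_pos (primorial_pos D) (natProd_pos B), hle B (mem_filter.mp hB).2⟩,
        squarefree_primorial_mul B, fun hd => ?_⟩
      rcases hp₁.dvd_mul.mp hd with h1 | h1
      · have := (coprime_primorial_iff (D := D) (n := p₁)).mpr fun p hp hpp =>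
          ((Nat.prime_dvd_prime_iff_eq hp hp₁).mp hpp) ▸ hDp
        exact hp₁.one_lt.ne' (Nat.dvd_one.mp (this ▸ Nat.dvd_gcd h1 dvd_rfl))
      · obtain ⟨l, -, hl⟩ := (dvd_natProd_iff B hp₁).mp h1
        exact (mem_sievePrimes.mp l.2).2.2.2 hl
    · exact natProd_injective (Nat.eq_of_mul_eq_mul_left (primorial_pos D) e)
    · rw [upTo, if_pos (mem_filter.mp hB).2, one_mul]

end Assembly

lemma log_factorial_eq_sum (X : ℕ) : log X.factorial = ∑ k ∈ Icc 1 X, log k := by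
  induction X with
  | zero => simp
  | succ n ih => rw [sum_Icc_succ_top (by omega), ← ih, Nat.factorial_succ, Nat.cast_mul,
      log_mul (by positivity) (by positivity), add_comm]

/-- A lower bound for the smoothed prime count along a sequence, from `Λ * 1 = log`. -/
theorem exists_le_psiTot {J : ℕ} (hJ : J ≠ 0) {ε : ℝ} (hε : 0 < ε) (hε1 : ε ≤ 1) (N₀ : ℝ) :
    ∃ N ≥ N₀, (1 - ε) * (N / (J + 1)) ≤ psiTot J N := by
  by_contra! hcon
  set C := ∑ n ∈ Icc 1 ⌊N₀⌋₊, vonMangoldt n with hC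
  set a : ℝ := (J + 1 : ℝ)⁻¹ with ha
  have ha0 : 0 < a := by positivity
  have hbd : ∀ Y : ℝ, 0 ≤ Y → psiTot J Y ≤ (1 - ε) * (Y * a) + C := fun Y hY => by
    have hC0 : 0 ≤ C := sum_nonneg fun _ _ => vonMangoldt_nonneg
    rcases le_or_gt N₀ Y with h | h
    · have := hcon Y h
      rw [div_eq_mul_inv] at this
      linarith
    · have : psiTot J Y ≤ C := (sum_le_sum fun n _ => mul_le_of_le_one_right vonMangoldt_nonneg
        (wt_le_one J (by positivity))).trans (sum_le_sum_of_subset_of_nonneg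
          (Icc_subset_Icc_right (Nat.floor_mono h.le)) fun _ _ _ => vonMangoldt_nonneg)
      have : 0 ≤ (1 - ε) * (Y * a) := mul_nonneg (by linarith) (by positivity)
      linarith
  obtain ⟨X, hX⟩ := exists_nat_gt (exp ((a + C + 3) / (ε * a)))
  have hX0 : (0 : ℝ) < X := (exp_pos _).trans hX
  have hX1 : 1 ≤ X := by exact_mod_cast hX0
  have hX1' : (1 : ℝ) ≤ X := by exact_mod_cast hX1
  have hlog : a + C + 3 < ε * a * log X := by
    rw [← div_lt_iff₀' (by positivity)]
    exact (lt_log_iff_exp_lt hX0).mpr hX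
  have hpsi : ∀ m ∈ Icc 1 X, psiTot J (X / m) = ∑ n ∈ Icc 1 X, 1 * vonMangoldt n * wt J ((m * n : ℕ) / X) := fun m hm => by
    have hm0 : (1 : ℝ) ≤ m := by exact_mod_cast (mem_Icc.mp hm).1
    have e : ∀ n : ℕ, (n : ℝ) / (X / m) = (m * n : ℕ) / X := fun n => by push_cast; field_simp
    simp only [psiTot, e, one_mul]
    refine sum_subset (Icc_subset_Icc_right (Nat.floor_le_of_le (div_le_self hX0.le hm0))) fun n hn hn' => ?_
    rw [wt_eq_zero hJ, mul_zero]
    rw [one_le_div hX0]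
    have : ⌊(X / m : ℝ)⌋₊ < n := by simp only [mem_Icc] at hn hn'; omega
    have := (Nat.floor_lt (by positivity)).mp this
    rw [div_lt_iff₀' (by linarith)] at this
    exact_mod_cast this.le
  have h1 : ∑ k ∈ Icc 1 X, log k * wt J (k / X) = ∑ m ∈ Icc 1 X, psiTot J (X / m) := by
    rw [sum_congr rfl hpsi, ← sum_mul_arith X (fun _ => 1) (fun n => vonMangoldt n) (fun n => wt J (n / X))]
    · refine sum_congr rfl fun k _ => ?_
      rw [← vonMangoldt_sum, Nat.sum_divisorsAntidiagonal' (fun a b => 1 * vonMangoldt b)]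
      simp
    · exact fun n hn => wt_eq_zero hJ ((one_le_div hX0).mpr (by exact_mod_cast hn.le))
  have h2 : ∑ m ∈ Icc 1 X, psiTot J (X / m) ≤ (1 - ε) * (X * a) * (1 + log X) + C * X := by
    calc _ ≤ ∑ m ∈ Icc 1 X, ((1 - ε) * (X * a) * (1 / m) + C) :=
          sum_le_sum fun m _ => (hbd _ (by positivity)).trans (le_of_eq (by ring))
      _ ≤ _ := by
          rw [sum_add_distrib, ← mul_sum, sum_const, Nat.card_Icc, nsmul_eq_mul, Nat.add_sub_cancel, mul_comm (X : ℝ) C]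
          have := mul_le_mul_of_nonneg_left (sum_inv_le_log X)
            (mul_nonneg (by linarith : 0 ≤ 1 - ε) (by positivity : 0 ≤ X * a))
          linarith
  have h3 := (abs_le.mp (abs_sum_wt_sub_le hJ hX1' le_rfl 0)).1
  simp only [Nat.floor_natCast, Nat.modEq_one, filter_true, Nat.cast_one, div_one] at h3
  have h4 : log X * ∑ k ∈ Icc 1 X, wt J (k / X) - X ≤ ∑ k ∈ Icc 1 X, log k * wt J (k / X) := by
    have h5 : ∑ k ∈ Icc 1 X, (log X - log k) ≤ X := by
      have h6 := pow_div_factorial_le_exp _ hX0.le X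
      rw [← log_le_iff_le_exp (by positivity), log_div (by positivity) (by positivity), log_pow,
        log_factorial_eq_sum] at h6
      simpa [sum_sub_distrib] using h6
    rw [mul_sum, sub_le_iff_le_add, ← sub_le_iff_le_add', ← sum_sub_distrib]
    refine (sum_le_sum fun k hk => ?_).trans h5
    rw [← sub_mul]
    have hk := mem_Icc.mp hk
    exact mul_le_of_le_one_right (sub_nonneg.mpr (log_le_log (by exact_mod_cast hk.1) (by exact_mod_cast hk.2)))
      (wt_le_one J (by positivity))
  have h5 := mul_le_mul_of_nonneg_left h3 (log_nonneg hX1')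
  have h6 := log_le_self hX0.le
  have h7 := mul_lt_mul_of_pos_left hlog hX0
  rw [div_eq_mul_inv, ← ha] at h5
  have h8 : 0 ≤ ε * (X * a) := by positivity
  nlinarith

section ManyPrimes

open Filter

variable {D p₁ R : ℕ} {ι : Type*} [Fintype ι] [DecidableEq ι]

lemma psiTot_nonneg (J : ℕ) (N : ℝ) : 0 ≤ psiTot J N :=
  sum_nonneg fun _ _ => mul_nonneg vonMangoldt_nonneg (wt_nonneg _ _)

/-- The sieve inequality when no translate of the tuple contains more than `M` primes. -/
lemma psiTot_mul_quadForm_le (hR : 2 ≤ R) (hp₁ : p₁.Prime) (hDp : D < p₁) {J : ℕ} (hJ : J ≠ 0) {N : ℝ} (hDN : D ≤ N)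
    {h : ι → ℕ} (hh : Function.Injective h) (hD : ∀ i, h i ≤ D) {v₀ : ℕ} (hv : ∀ i, (v₀ + h i).Coprime (primorial D))
    {M n₁ : ℕ} (hM : ∀ n, n₁ < n → (univ.filter fun i => (n + h i).Prime).card ≤ M)
    {f : (sievePrimes D p₁ R → Option ι) → ℝ} {Mf : ℝ} (hf : ∀ x, |f x| ≤ Mf * upTo 1 (colored x)) {Q : ℕ}
    (hQ : primorial D * R ^ 2 ≤ Q) (hQN : Q ≤ N) {Z V L : ℝ} (hV : 0 < V) (hL : 1 + log N ≤ L)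
    (hRL : 1 + 2 * log R ≤ L) (hZ : ∀ a : ℕ → ℕ, (∀ q, (a q).Coprime q) →
      ∑ q ∈ moduli Q p₁, |psiAP J N q (a q) - psiTot J N / q.totient| ≤ Z) {T : ℝ}
    (hT : quadForm (fun l => kap (zp l / (1 + zp l))) f ≤ T) :
    psiTot J N / (primorial D).totient * ∑ m, quadForm (fun l => kap (zp l)) (restr f m) ≤
      M * log (2 * N) * (N / (J + 1) / primorial D * T) +
      (Fintype.card ι * (Mf ^ 2 * (V * Z + 7 * N * L ^ 3 / V * L ^ ((Fintype.card ι ^ 2) ^ 2))) +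
      (∑ x, |f x|) ^ 2 * (2 * M * log (2 * N) + Fintype.card ι * D ^ 2 +
        Fintype.card ι * log (2 * N) * (n₁ + 2 * sqrt (2 * N) + R))) := by
  have hN : 1 ≤ N := by
    have : 1 * 1 ≤ primorial D * R ^ 2 := Nat.mul_le_mul (primorial_pos D) (Nat.pow_pos (by omega))
    have : (1 : ℝ) ≤ Q := by exact_mod_cast (this.trans hQ)
    linarith
  have hlog : 0 ≤ log (2 * N) := log_nonneg (by linarith)
  have hS := sum_vonMangoldt_le (J := J) (v₀ := v₀) hN hDN hD hM f
  have h1 := abs_le.mp (abs_sum_wt_sieveForm_sub_le hJ hN hh hD v₀ f)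
  choose a ha hmax using exists_max_abs_psiAP J N
  set F := ∑ x, |f x| with hF
  have h2 : ∀ m : ι, psiTot J N / (primorial D).totient * quadForm (fun l => kap (zp l)) (restr f m) -
      (Mf ^ 2 * (V * Z + 7 * N * L ^ 3 / V * L ^ ((Fintype.card ι ^ 2) ^ 2)) + F ^ 2 * D ^ 2) ≤
      ∑ n ∈ (Icc 1 ⌊N⌋₊).filter (fun n => n ≡ v₀ [MOD primorial D]),
        vonMangoldt (n + h m) * wt J ((n + h m : ℕ) / N) * sieveForm (fun i : {i : ι // i ≠ m} => h i) (restr f m) n ^ 2 := by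
    intro m
    have h3 := (abs_le.mp (abs_sum_vonMangoldt_sieveForm_sub_le hJ hN (h := fun i : {i : ι // i ≠ m} => h i)
      (hh.comp Subtype.val_injective) (fun i => hD i) (fun i e => i.2 (hh e)) (hD m) (hv m)
      (E := fun q => |psiAP J N q (a q) - psiTot J N / q.totient|) (fun q b hb => hmax q b hb) (restr f m))).1
    have hfm : ∀ x, |restr f m x| ≤ Mf * upTo 1 (colored x) := fun x => by
      refine (hf _).trans (le_of_eq ?_)
      congr 2; ext l; simp [colored]
    have h4 := sum_abs_mul_error_le hR hp₁ hDp hfm (J := J) hQ hQN hV hL hRL (hZ a ha)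
    have hc : Fintype.card {i : ι // i ≠ m} + 1 = Fintype.card ι := by
      have := Fintype.card_pos_iff.mpr ⟨m⟩
      rw [Fintype.card_subtype_compl, Fintype.card_subtype_eq]
      omega
    rw [hc] at h4
    have h5 : ∑ x, ∑ y, |restr f m x| * |restr f m y| * (D : ℝ) ^ 2 ≤ F ^ 2 * D ^ 2 := by
      simp only [← sum_mul, ← mul_sum]
      rw [← sq]
      gcongr
      exact sum_abs_restr_le f m
    simp only [mul_add, sum_add_distrib] at h3
    simp only [mul_add] at h4 ⊢
    linarith
  have h3 := sum_le_sum fun m (_ : m ∈ univ) => h2 m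
  rw [sum_sub_distrib, ← mul_sum, sum_const, card_univ, nsmul_eq_mul] at h3
  have h4 : N / (J + 1) / primorial D * quadForm (fun l => kap (zp l / (1 + zp l))) f ≤ N / (J + 1) / primorial D * T := by
    gcongr
  have h5 := mul_le_mul_of_nonneg_left (by linarith [h1.2] : ∑ n ∈ (Icc 1 ⌊N⌋₊).filter (fun n => n ≡ v₀ [MOD primorial D]),
    wt J (n / N) * sieveForm h f n ^ 2 ≤ N / (J + 1) / primorial D * T + 2 * F ^ 2) (by positivity : 0 ≤ M * log (2 * N))
  linarith

/-- A residue class avoiding all small primes. -/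
lemma exists_coprime_primorial {h : ι → ℕ} (hadm : ∀ p : ℕ, p.Prime → ∃ v : ℕ, ∀ i, ¬p ∣ v + h i) (D : ℕ) :
    ∃ v₀ : ℕ, ∀ i, (v₀ + h i).Coprime (primorial D) := by
  choose! v hv using hadm
  have hp : ∀ p ∈ (range (D + 1)).filter Nat.Prime, p.Prime := fun p hp => (mem_filter.mp hp).2
  obtain ⟨v₀, h₀⟩ := Nat.chineseRemainderOfFinset v id ((range (D + 1)).filter Nat.Prime) (fun p h => (hp p h).ne_zero)
    fun p h q h' hpq => (Nat.coprime_primes (hp p h) (hp q h')).mpr hpq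
  refine ⟨v₀, fun i => Nat.Coprime.prod_right fun p hm => ?_⟩
  rw [Nat.coprime_comm, (hp p hm).coprime_iff_not_dvd]
  exact fun hd => hv p (hp p hm) i (((h₀ p hm).add_right (h i)).dvd_iff dvd_rfl |>.mp hd)

/-- Collecting the error terms of the sieve. -/
lemma error_le {k M D n₁ A w R : ℕ} (hA : A = 8 * k + 3 + w) {N l F G r δ : ℝ} (hN : 1 ≤ N) (hl : 1 ≤ l) (hF0 : 0 ≤ F)
    (hr0 : 0 ≤ r) (hr : r ≤ 2 * l) (hF : F ≤ G * r ^ (2 * k) * (R * r ^ k)) (hR : (R : ℝ) ^ 2 ≤ N ^ (1 / 2 - 2 * δ))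
    (hR' : R ≤ sqrt N) (hl2 : log (2 * N) ≤ 2 * l)
    (hC : (4 * M + k * D ^ 2 + 2 * k * (n₁ + 5)) * 2 ^ (6 * k) * l ^ (6 * k + 1) ≤ N ^ (2 * δ)) :
    k * ((G * r ^ (2 * k)) ^ 2 * ((2 * l) ^ (4 * k + 3 + w) * (N / l ^ A) +
      7 * N * (2 * l) ^ 3 / (2 * l) ^ (4 * k + 3 + w) * (2 * l) ^ w)) +
    F ^ 2 * (2 * M * log (2 * N) + k * D ^ 2 + k * log (2 * N) * (n₁ + 2 * sqrt (2 * N) + R)) ≤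
      G ^ 2 * ((k * (2 ^ A + 7) + 1) * N) := by
  have hl0 : 0 < l := by linarith
  have hN0 : 0 < N := by linarith
  have hs1 : 1 ≤ sqrt N := by rwa [one_le_sqrt]
  have hs2 : sqrt (2 * N) ≤ 2 * sqrt N := by
    rw [sqrt_le_left (by positivity), mul_pow, sq_sqrt hN0.le]
    linarith
  have h1 : (G * r ^ (2 * k)) ^ 2 ≤ G ^ 2 * (2 * l) ^ (4 * k) := by
    rw [mul_pow, ← pow_mul, (by ring : 2 * k * 2 = 4 * k)]
    gcongr
  have h2 : (2 * l) ^ (4 * k) * ((2 * l) ^ (4 * k + 3 + w) * (N / l ^ A) +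
      7 * N * (2 * l) ^ 3 / (2 * l) ^ (4 * k + 3 + w) * (2 * l) ^ w) = (2 ^ A + 7) * N := by
    have e1 : (2 * l) ^ (4 * k) * (2 * l) ^ (4 * k + 3 + w) = 2 ^ A * l ^ A := by
      rw [← pow_add, ← mul_pow, hA]; congr 1; ring
    have e2 : (2 * l) ^ (4 * k + 3 + w) = (2 * l) ^ (4 * k) * (2 * l) ^ 3 * (2 * l) ^ w := by rw [pow_add, pow_add]
    calc _ = (2 * l) ^ (4 * k) * (2 * l) ^ (4 * k + 3 + w) * (N / l ^ A) +
        7 * N * ((2 * l) ^ (4 * k) * (2 * l) ^ 3 * (2 * l) ^ w) / (2 * l) ^ (4 * k + 3 + w) := by ring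
      _ = _ := by rw [e1, ← e2]; field_simp
  have h3 : k * ((G * r ^ (2 * k)) ^ 2 * ((2 * l) ^ (4 * k + 3 + w) * (N / l ^ A) +
      7 * N * (2 * l) ^ 3 / (2 * l) ^ (4 * k + 3 + w) * (2 * l) ^ w)) ≤ k * (G ^ 2 * ((2 ^ A + 7) * N)) := by
    rw [← h2, ← mul_assoc (G ^ 2)]
    gcongr
  have h4 : F ^ 2 ≤ G ^ 2 * (2 * l) ^ (6 * k) * N ^ (1 / 2 - 2 * δ) := by
    calc F ^ 2 ≤ (G * r ^ (2 * k) * (R * r ^ k)) ^ 2 := by gcongr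
      _ = G ^ 2 * r ^ (6 * k) * (R : ℝ) ^ 2 := by ring
      _ ≤ _ := by gcongr
  have h5 : 2 * M * log (2 * N) + k * D ^ 2 + k * log (2 * N) * (n₁ + 2 * sqrt (2 * N) + R) ≤
      (4 * M + k * D ^ 2 + 2 * k * (n₁ + 5)) * (l * sqrt N) := by
    have e1 : 1 ≤ l * sqrt N := one_le_mul_of_one_le_of_one_le hl hs1
    have e2 : l ≤ l * sqrt N := le_mul_of_one_le_right hl0.le hs1
    calc _ ≤ 2 * M * (2 * l) + k * D ^ 2 * 1 +
          k * (2 * l) * (n₁ * sqrt N + 2 * (2 * sqrt N) + sqrt N) := by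
          rw [mul_one]
          gcongr
          exact le_mul_of_one_le_right (by positivity) hs1
      _ ≤ 2 * M * (2 * (l * sqrt N)) + k * D ^ 2 * (l * sqrt N) +
          k * (2 * l) * (n₁ * sqrt N + 2 * (2 * sqrt N) + sqrt N) := by gcongr
      _ = _ := by ring
  have h6 : F ^ 2 * (2 * M * log (2 * N) + k * D ^ 2 + k * log (2 * N) * (n₁ + 2 * sqrt (2 * N) + R)) ≤
      G ^ 2 * N := by
    calc _ ≤ G ^ 2 * (2 * l) ^ (6 * k) * N ^ (1 / 2 - 2 * δ) * ((4 * M + k * D ^ 2 + 2 * k * (n₁ + 5)) * (l * sqrt N)) :=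
          mul_le_mul h4 h5 (by have := log_nonneg (by linarith : 1 ≤ 2 * N); positivity) (by positivity)
      _ = G ^ 2 * (N ^ (1 / 2 - 2 * δ) * N ^ (1 / 2 : ℝ)) *
          ((4 * M + k * D ^ 2 + 2 * k * (n₁ + 5)) * 2 ^ (6 * k) * l ^ (6 * k + 1)) := by
          rw [sqrt_eq_rpow]; ring
      _ ≤ G ^ 2 * (N ^ (1 / 2 - 2 * δ) * N ^ (1 / 2 : ℝ)) * N ^ (2 * δ) := by gcongr
      _ = G ^ 2 * N := by
          rw [mul_assoc, ← rpow_add hN0, ← rpow_add hN0]; ring_nf; rw [rpow_one]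
  linarith

end ManyPrimes

section

open Filter

variable {ι : Type*} [Fintype ι] [DecidableEq ι]

/-- The sieve weights at a given scale. -/
lemma exists_sieve_weights {D p₁ R : ℕ} (hR : 2 ≤ R) (hk : 2 ≤ Fintype.card ι) (hDk : Fintype.card ι ≤ D) {g : ℝ → ℝ}
    (hg : Antitone g) (hg0 : ∀ t, 0 ≤ g t) (hgp : 0 < g 0) {K n0 : ℕ} (hK : K ≠ 0) (hn0 : 0 < n0) {E : ℝ}
    (h1 : n0 * (∑ A : sievePrimes D p₁ R → Bool, setW zp A * g (lsize lp A) ^ 2) ≤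
        K * ((∑ A : sievePrimes D p₁ R → Bool, setW zp A * g (lsize lp A) ^ 2) -
        (Fintype.card ι - 1) * ∑ A : sievePrimes D p₁ R → Bool, setW zp A * g (lsize lp A) ^ 2 * lsize lp A))
    (h2 : E * ((∏ l : sievePrimes D p₁ R, (1 + 2 * (Fintype.card ι : ℝ) ^ 2 * zp l ^ 2)) *
        (∏ l : sievePrimes D p₁ R, (1 + (2 * (Fintype.card ι : ℝ) ^ 2 + 2 * Fintype.card ι) * zp l ^ 2)) *
        (∑ A : sievePrimes D p₁ R → Bool, setW zp A * g (lsize lp A) ^ 2) * n0) ≤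
      Fintype.card ι * ∑ i ∈ range n0, trunc (zp (D := D) (p₁ := p₁) (R := R)) lp g (i / K) ^ 2) :
    ∃ f : (sievePrimes D p₁ R → Option ι) → ℝ, ∃ U : ℝ, (g 0 ^ Fintype.card ι) ^ 2 ≤ U ∧
      (∀ x, |f x| ≤ g 0 ^ Fintype.card ι * (1 + log R) ^ (2 * Fintype.card ι) * upTo 1 (colored x)) ∧
      quadForm (fun l => kap (zp l / (1 + zp l))) f ≤ U ∧
      E * U ≤ ∑ m, quadForm (fun l => kap (zp l)) (restr f m) := by
  obtain ⟨ρ, hρ, U, hU0, hU1, hU2⟩ := exists_good_parameter (ι := ι) (L := sievePrimes D p₁ R) zp_nonneg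
    (fun l => by
      have e := zp_le l (by omega)
      have hD0 : (0 : ℝ) < D := by exact_mod_cast (by omega : 0 < D)
      rw [le_div_iff₀ hD0] at e
      have : (Fintype.card ι : ℝ) ≤ D := by exact_mod_cast hDk
      nlinarith [zp_nonneg l]) lp_nonneg hk hg hg0 hK n0 h1
  rw [mul_comm 2, pow_mul] at hU0
  refine ⟨_, U, hU0, fun x => abs_lam_le hR hg hg0 hρ x, hU1, ?_⟩
  refine le_of_mul_le_mul_left (le_trans ?_ hU2) (mul_pos (mul_pos (mul_pos
    (prod_pos fun l _ => by positivity) (prod_pos fun l _ => by positivity)) ?_) (by exact_mod_cast hn0))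
  · have := mul_le_mul_of_nonneg_right h2 ((sq_nonneg _).trans hU0)
    linarith
  · refine sum_pos' (fun A _ => mul_nonneg (setW_nonneg zp_nonneg _) (sq_nonneg _)) ⟨fun _ => false, mem_univ _, ?_⟩
    simp only [setW, bw, lsize]
    simpa using pow_pos hgp 2

/-- The sieve inequality at a given scale, with all error terms absorbed. -/
lemma scale_bound {h : ι → ℕ} (hh : Function.Injective h) {D p₁ R J M n₁ v₀ A w Q : ℕ} (hDh : ∀ i, h i ≤ D) (hv₀ : ∀ i, (v₀ + h i).Coprime (primorial D))
    (hcon : ∀ n, n₁ < n → (univ.filter fun i => (n + h i).Prime).card ≤ M) (hR : 2 ≤ R) (hp₁ : p₁.Prime) (hDp : D < p₁)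
    (hJ : J ≠ 0) (hw : w = (Fintype.card ι ^ 2) ^ 2) (hA : A = 8 * Fintype.card ι + 3 + w) {N l δ τ : ℝ} (hδ0 : 0 < δ)
    (hδ8 : δ < 1 / 8) (hτ0 : 0 < τ) (hN1 : 1 ≤ N) (hDN : D ≤ N) (hl : 1 ≤ l) (hlN : l = log N)
    (hl2 : log (2 * N) ≤ (1 + δ) * l) (hRlog : (1 / 4 - 2 * δ) * l ≤ log R) (hRlog' : log R ≤ l / 4)
    (hRsq : (R : ℝ) ^ 2 ≤ N ^ (1 / 2 - 2 * δ)) (hRs : R ≤ sqrt N) (hQ : primorial D * R ^ 2 ≤ Q) (hQN : Q ≤ N)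
    (hC : (4 * M + Fintype.card ι * D ^ 2 + 2 * Fintype.card ι * (n₁ + 5)) * 2 ^ (6 * Fintype.card ι) *
      l ^ (6 * Fintype.card ι + 1) ≤ N ^ (2 * δ))
    (hψ : (1 - δ) * (N / (J + 1)) ≤ psiTot J N)
    (hZ : ∀ a : ℕ → ℕ, (∀ q, (a q).Coprime q) →
      ∑ q ∈ moduli Q p₁, |psiAP J N q (a q) - psiTot J N / q.totient| ≤ N / l ^ A)
    {f : (sievePrimes D p₁ R → Option ι) → ℝ} {G U : ℝ} (hGp : 0 < G) (hG : G ^ 2 ≤ U)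
    (hfx : ∀ x, |f x| ≤ G * (1 + log R) ^ (2 * Fintype.card ι) * upTo 1 (colored x))
    (hU1 : quadForm (fun l => kap (zp l / (1 + zp l))) f ≤ U)
    (hkey : τ * ((primorial D).totient / primorial D * log R) * U ≤ ∑ m, quadForm (fun l => kap (zp l)) (restr f m))
    (hη : M * (1 + δ) < (1 - δ) * (τ * (1 / 4 - 2 * δ))) :
    ((1 - δ) * (τ * (1 / 4 - 2 * δ)) - M * (1 + δ)) * l ≤ (Fintype.card ι * (2 ^ A + 7) + 1) * ((J + 1) * primorial D) := by
  have hR1 : (1 : ℝ) ≤ R := by exact_mod_cast (by omega : 1 ≤ R)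
  have hr0 : 0 ≤ 1 + log R := by have := log_nonneg hR1; linarith
  have hU : 0 ≤ U := (sq_nonneg _).trans hG
  have hmain := psiTot_mul_quadForm_le hR hp₁ hDp hJ hDN hh hDh hv₀ hcon hfx hQ hQN
    (V := (2 * l) ^ (4 * Fintype.card ι + 3 + w)) (L := 2 * l) (by positivity) (by linarith) (by linarith) hZ hU1
  rw [← hw] at hmain
  have herr := error_le (M := M) (D := D) (n₁ := n₁) hA hN1 hl (sum_nonneg fun x _ => abs_nonneg (f x)) hr0 (by linarith)
    (sum_abs_le hR hfx) hRsq hRs (by nlinarith) hC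
  have hP0 : (0 : ℝ) < primorial D := by exact_mod_cast primorial_pos D
  have hφ0 : (0 : ℝ) < (primorial D).totient := by exact_mod_cast Nat.totient_pos.mpr (primorial_pos D)
  generalize ((primorial D).totient : ℝ) = φ at *
  generalize (primorial D : ℝ) = P at *
  obtain ⟨μ, hμ⟩ : ∃ μ, μ = N / (J + 1) / P := ⟨_, rfl⟩
  rw [← hμ] at hmain
  have hμ0 : 0 < μ := by rw [hμ]; positivity
  have hlow : (1 - δ) * (τ * (1 / 4 - 2 * δ)) * (l * (μ * U)) ≤
      psiTot J N / φ * ∑ m, quadForm (fun l => kap (zp l)) (restr f m) := by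
    calc _ = (1 - δ) * (N / (J + 1)) / φ * (τ * (φ / P * ((1 / 4 - 2 * δ) * l)) * U) := by rw [hμ]; field_simp
      _ ≤ _ := by
          have : 0 ≤ 1 / 4 - 2 * δ := by linarith
          exact mul_le_mul (by gcongr) (le_trans (by gcongr) hkey) (by positivity) (div_nonneg (psiTot_nonneg J N) hφ0.le)
  have hup : M * log (2 * N) * (μ * U) ≤ M * (1 + δ) * (l * (μ * U)) := by
    rw [mul_assoc (M : ℝ), mul_assoc (M : ℝ), ← mul_assoc (1 + δ)]
    gcongr
  have hfin : ((1 - δ) * (τ * (1 / 4 - 2 * δ)) - M * (1 + δ)) * (l * μ) * G ^ 2 ≤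
      (Fintype.card ι * (2 ^ A + 7) + 1) * N * G ^ 2 := by
    have := mul_le_mul_of_nonneg_left hG
      (mul_nonneg (sub_pos.mpr hη).le (by positivity : 0 ≤ l * μ))
    linarith
  have hfin := mul_le_mul_of_nonneg_right (le_of_mul_le_mul_right hfin (by positivity))
    (by positivity : 0 ≤ (J + 1) * P / N)
  refine le_of_eq_of_le ?_ (hfin.trans_eq ?_)
  · rw [hμ]; field_simp
  · field_simp

/-- The sieve theorem: a numerical inequality for the cutoff produces `M + 1` primes in translates of a tuple. -/
theorem exists_many_primes {h : ι → ℕ} (hh : Function.Injective h)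
    (hadm : ∀ p : ℕ, p.Prime → ∃ v : ℕ, ∀ i, ¬p ∣ v + h i) {k : ℕ} (hk : Fintype.card ι = k) (hk2 : 2 ≤ k) {c T : ℝ}
    {K n0 M : ℕ} (hc : 0 < c) (hT : 0 < T) (hT1 : T ≤ 1) (hK : n0 < K)
    (h1 : K * ((k - 1) / k * (cutInt k c T T - c * (T / (c * (c + k * T))))) < (K - n0) * (T / (c * (c + k * T))))
    (h2 : 4 * M * n0 * (T / (c * (c + k * T))) < k * ∑ i ∈ range n0, cutInt k c T (i / K) ^ 2) (n₁ : ℕ) :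
    ∃ n, n₁ < n ∧ M < (univ.filter fun i => (n + h i).Prime).card := by
  by_contra! hcon
  have hk0 : (0 : ℝ) < k := by exact_mod_cast (by omega : 0 < k)
  have hn0 : 0 < n0 := Nat.pos_of_ne_zero (by rintro rfl; simp at h2)
  have hn0' : (0 : ℝ) < n0 := by exact_mod_cast hn0
  have hm : 0 < n0 * (T / (c * (c + k * T))) := by positivity
  obtain ⟨τ, hτ, hτ2⟩ := _root_.exists_between ((lt_div_iff₀ hm).mpr (by rwa [← mul_assoc]) : 4 * (M : ℝ) < _)
  rw [lt_div_iff₀ hm, ← mul_assoc] at hτ2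
  have hM0 : (0 : ℝ) ≤ M := Nat.cast_nonneg M
  obtain ⟨δ, hδ, hδ0, hδ8⟩ : ∃ δ : ℝ, M * (1 + δ) < (1 - δ) * (τ * (1 / 4 - 2 * δ)) ∧ 0 < δ ∧ δ < 1 / 8 := by
    have h : ∀ᶠ δ : ℝ in nhds 0, M * (1 + δ) < (1 - δ) * (τ * (1 / 4 - 2 * δ)) :=
      ContinuousAt.eventually_lt (by fun_prop) (by fun_prop) (by norm_num; linarith)
    exact ((h.filter_mono nhdsWithin_le_nhds).and (Ioo_mem_nhdsGT (by norm_num : (0 : ℝ) < 1 / 8))).exists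
  obtain ⟨D, hDr, hDl⟩ := ((eventually_ratio hk2 hc hT hT1 hK h1 (by linarith) hτ2).and
    (eventually_ge_atTop (k + ∑ i, h i))).exists
  have hDh : ∀ i, h i ≤ D := fun i => by
    have := single_le_sum (fun j _ => Nat.zero_le (h j)) (mem_univ i)
    omega
  obtain ⟨v₀, hv₀⟩ := exists_coprime_primorial hadm D
  obtain ⟨w, hw⟩ : ∃ w, w = (k ^ 2) ^ 2 := ⟨_, rfl⟩
  obtain ⟨A, hA⟩ : ∃ A, A = 8 * k + 3 + w := ⟨_, rfl⟩
  obtain ⟨J, hJ, N₀, hBV⟩ := bombieri_vinogradov A hδ0 (by linarith) D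
  have hRt : Tendsto (fun N : ℝ => ⌊N ^ (1 / 4 - δ)⌋₊) atTop atTop :=
    tendsto_nat_floor_atTop.comp (tendsto_rpow_atTop (by linarith))
  obtain ⟨N₁, hN₁⟩ := eventually_atTop.mp ((hRt.eventually hDr).and <| (hRt.eventually_ge_atTop 2).and <|
    (eventually_ge_atTop (max N₀ (max 1 D))).and <| (tendsto_log_atTop.eventually_ge_atTop 1).and <|
    ((tendsto_rpow_atTop hδ0).eventually_ge_atTop (2 + primorial D)).and <|
    (eventually_log_pow_le (by linarith : 0 < 2 * δ) ((4 * M + k * D ^ 2 + 2 * k * (n₁ + 5)) * 2 ^ (6 * k)) (6 * k + 1)).and <|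
    tendsto_log_atTop.eventually_gt_atTop ((k * (2 ^ A + 7) + 1) * ((J + 1) * primorial D) /
      ((1 - δ) * (τ * (1 / 4 - 2 * δ)) - M * (1 + δ))))
  obtain ⟨N, hN, hψ⟩ := exists_le_psiTot hJ hδ0 (by linarith) N₁
  obtain ⟨hr, hR2, hNN, hl, hy, hC, hbig⟩ := hN₁ N hN
  rw [max_le_iff, max_le_iff] at hNN
  obtain ⟨hN0, hN1, hDN⟩ := hNN
  obtain ⟨R, hR⟩ : ∃ R, R = ⌊N ^ (1 / 4 - δ)⌋₊ := ⟨_, rfl⟩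
  obtain ⟨l, hldef⟩ : ∃ l, l = log N := ⟨_, rfl⟩
  rw [← hR] at hr hR2
  rw [← hldef] at hl hC hbig
  have hNpos : 0 < N := by linarith
  have hRle : (R : ℝ) ≤ N ^ (1 / 4 - δ) := hR ▸ Nat.floor_le (by positivity)
  have hRlt := Nat.lt_floor_add_one (N ^ (1 / 4 - δ))
  rw [← hR] at hRlt
  have hR2' : (2 : ℝ) ≤ R := by exact_mod_cast hR2
  have hRlog : (1 / 4 - 2 * δ) * l ≤ log R := by
    rw [hldef, ← log_rpow hNpos]
    refine log_le_log (by positivity) ?_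
    have e : N ^ (1 / 4 - δ) = N ^ (1 / 4 - 2 * δ) * N ^ δ := by rw [← rpow_add hNpos]; ring_nf
    have := mul_le_mul_of_nonneg_left (by linarith : 2 ≤ N ^ δ) (by positivity : 0 ≤ N ^ (1 / 4 - 2 * δ))
    linarith
  have hRlog' : log R ≤ l / 4 := by
    have := log_le_log (by linarith) hRle
    rw [log_rpow hNpos, ← hldef] at this
    nlinarith
  have hRsq : (R : ℝ) ^ 2 ≤ N ^ (1 / 2 - 2 * δ) := by
    calc (R : ℝ) ^ 2 ≤ (N ^ (1 / 4 - δ)) ^ 2 := by gcongr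
      _ = _ := by rw [sq, ← rpow_add hNpos]; ring_nf
  have hRs : (R : ℝ) ≤ sqrt N := by
    rw [sqrt_eq_rpow]
    exact hRle.trans (rpow_le_rpow_of_exponent_le hN1 (by linarith))
  have hl2 : log (2 * N) ≤ (1 + δ) * l := by
    rw [log_mul (by norm_num) (by linarith), ← hldef]
    have := log_le_log (by norm_num) (by linarith : 2 ≤ N ^ δ)
    rw [log_rpow hNpos, ← hldef] at this
    linarith
  have hQ : primorial D * R ^ 2 ≤ ⌊N ^ (1 / 2 - δ)⌋₊ := by
    refine Nat.le_floor ?_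
    push_cast
    calc (primorial D : ℝ) * (R : ℝ) ^ 2 ≤ N ^ δ * N ^ (1 / 2 - 2 * δ) := by gcongr; linarith
      _ = _ := by rw [← rpow_add hNpos]; ring_nf
  have hQN : (⌊N ^ (1 / 2 - δ)⌋₊ : ℝ) ≤ N :=
    (Nat.floor_le (by positivity)).trans (rpow_le_self_of_one_le hN1 (by linarith))
  obtain ⟨p₁, hp₁, hDp, hZ⟩ := hBV N hN0
  rw [← hldef] at hZ
  obtain ⟨hr1, hr2⟩ := hr p₁ hp₁ hDp
  subst hk
  have hgp : 0 < cutT (Fintype.card ι) c T 0 := by simp [cutT, cut, hT.le, hc]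
  obtain ⟨f, U, hG, hfx, hU1, hkey⟩ := exists_sieve_weights hR2 hk2 (by omega) (cutT_antitone hk0 hc) (cutT_nonneg hk0 hc) hgp
    (by omega) hn0 hr1 hr2
  have := scale_bound hh hDh hv₀ hcon hR2 hp₁ hDp hJ hw hA hδ0 hδ8 (by linarith) hN1 hDN hl hldef hl2 hRlog hRlog' hRsq hRs
    hQ hQN hC hψ hZ (pow_pos hgp _) hG hfx hU1 hkey hδ
  rw [div_lt_iff₀' (sub_pos.mpr hδ)] at hbig
  linarith

end

lemma log_factorial_eq_sum_vonMangoldt {X N : ℕ} (h : X ≤ N) :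
    log X.factorial = ∑ i ∈ Ioc 0 N, vonMangoldt i * (X / i : ℕ) := by
  have e := sum_Ioc_mul_zeta_eq_sum vonMangoldt X
  rw [vonMangoldt_mul_zeta] at e
  rw [log_factorial_eq_sum, ← sum_subset (Ioc_subset_Ioc_right h) fun i hi hi' => ?_, ← e]
  · rfl
  · simp only [mem_Ioc] at hi hi'
    rw [Nat.div_eq_of_lt (by omega), Nat.cast_zero, mul_zero]

lemma log_factorial_le {m : ℕ} (hm : m ≠ 0) : log m.factorial ≤ m * log m - m + log m / 2 + 1 := by
  obtain ⟨n, rfl⟩ := Nat.exists_eq_succ_of_ne_zero hm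
  have h := Stirling.log_stirlingSeq'_antitone (Nat.zero_le n)
  simp only [Function.comp_apply, Stirling.log_stirlingSeq_formula] at h
  have h0 : ((n.succ : ℕ) : ℝ) ≠ 0 := by positivity
  rw [log_mul (by norm_num) h0, log_div h0 (exp_ne_zero 1)] at h
  norm_num at h ⊢
  linarith

/-- Chebyshev's lower bound. -/
lemma le_psi {n : ℕ} (hn : n ≠ 0) : n * (14 * log 2 + 9 * log 3 + 5 * log 5) - log (30 * n : ℕ) - 3 ≤
    Chebyshev.psi (30 * n : ℕ) := by
  have hup : log (30 * n).factorial + log n.factorial - log (15 * n).factorial -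
      log (10 * n).factorial - log (6 * n).factorial ≤ Chebyshev.psi (30 * n : ℕ) := by
    rw [log_factorial_eq_sum_vonMangoldt le_rfl, log_factorial_eq_sum_vonMangoldt (by omega : n ≤ 30 * n),
      log_factorial_eq_sum_vonMangoldt (by omega : 15 * n ≤ 30 * n), log_factorial_eq_sum_vonMangoldt (by omega : 10 * n ≤ 30 * n),
      log_factorial_eq_sum_vonMangoldt (by omega : 6 * n ≤ 30 * n), ← sum_add_distrib, ← sum_sub_distrib, ← sum_sub_distrib,
      ← sum_sub_distrib, Chebyshev.psi, Nat.floor_natCast]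
    refine sum_le_sum fun i _ => ?_
    have e : 30 * n / i + n / i ≤ 15 * n / i + 10 * n / i + 6 * n / i + 1 := by
      rw [(by omega : 15 * n = 30 * n / 2), (by omega : 10 * n = 30 * n / 3), (by omega : 6 * n = 30 * n / 5),
        (by rw [Nat.mul_div_cancel_left n (by norm_num)] : n / i = 30 * n / 30 / i), Nat.div_right_comm _ 2, Nat.div_right_comm _ 3, Nat.div_right_comm _ 5,
        Nat.div_right_comm _ 30]
      omega
    have e' : ((30 * n / i : ℕ) : ℝ) + (n / i : ℕ) ≤ (15 * n / i : ℕ) + (10 * n / i : ℕ) + (6 * n / i : ℕ) + 1 := by exact_mod_cast e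
    nlinarith [vonMangoldt_nonneg (n := i)]
  have h1 := Stirling.le_log_factorial_stirling (by omega : 30 * n ≠ 0)
  have h2 := Stirling.le_log_factorial_stirling hn
  have h3 := log_factorial_le (by omega : 15 * n ≠ 0)
  have h4 := log_factorial_le (by omega : 10 * n ≠ 0)
  have h5 := log_factorial_le (by omega : 6 * n ≠ 0)
  have hn' : (n : ℝ) ≠ 0 := by exact_mod_cast hn
  have e30 : log 30 = log 2 + log 3 + log 5 := by
    rw [← log_mul, ← log_mul] <;> norm_num
  have e15 : log 15 = log 3 + log 5 := by rw [← log_mul] <;> norm_num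
  have e10 : log 10 = log 2 + log 5 := by rw [← log_mul] <;> norm_num
  have e6 : log 6 = log 2 + log 3 := by rw [← log_mul] <;> norm_num
  have hpi : 0 ≤ log (2 * π) := log_nonneg (by linarith [pi_gt_three])
  have hx : 0 ≤ log n := log_natCast_nonneg n
  have h2' := log_nonneg (by norm_num : (1 : ℝ) ≤ 2)
  have h3' := log_nonneg (by norm_num : (1 : ℝ) ≤ 3)
  have h5' := log_nonneg (by norm_num : (1 : ℝ) ≤ 5)
  push_cast at *
  rw [log_mul (by norm_num) hn'] at *
  simp only [e30, e15, e10, e6] at *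
  linarith

/-- An admissible tuple consisting of `k` primes beyond `k`. -/
lemma exists_prime_tuple {k n b d r : ℕ} (hn : n ≠ 0) (hb : 30 * n ≤ 2 ^ b) (hd0 : d ≠ 0) (hd : 2 ^ d ≤ k) (hr : k ≤ r ^ 2)
    (h : (k + 4 * k / d + r + 1) * b * 0.6931471808 + 3 ≤ (n : ℝ) * 27.638) :
    ∃ S ⊆ Ioc k (30 * n), S.card = k ∧ ∀ p ∈ S, p.Prime := by
  have hd0' : (0 : ℝ) < d := by exact_mod_cast Nat.pos_of_ne_zero hd0
  have hl2 := log_two_lt_d9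
  have hl2p : 0 < log 2 := log_pos (by norm_num)
  have hk1 : (1 : ℝ) < k := by
    have := Nat.one_lt_two_pow hd0
    exact_mod_cast this.trans_le hd
  have hupper : (k.primeCounting : ℝ) ≤ 4 * k / d + r := by
    have h1 := Chebyshev.pi_le_log4_mul_div hk1
    rw [Nat.floor_natCast, log_sqrt (by linarith), (by norm_num : (4 : ℝ) = 2 ^ 2), log_pow] at h1
    refine h1.trans (add_le_add ?_ ?_)
    · have h2 : d * log 2 ≤ log k := by
        rw [← log_pow]
        exact log_le_log (by positivity) (by exact_mod_cast hd)
      rw [div_le_div_iff₀ (by nlinarith) hd0']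
      push_cast
      nlinarith
    · exact sqrt_le_left (by positivity) |>.mpr (by exact_mod_cast hr)
  have hlower : (k + k.primeCounting : ℝ) ≤ (30 * n).primeCounting := by
    have h1 := (le_psi hn).trans (Chebyshev.psi_le_primeCounting_mul_log (30 * n))
    have h2 : log (30 * n : ℕ) ≤ b * log 2 := by
      rw [← log_pow]
      exact log_le_log (by exact_mod_cast (by omega : 0 < 30 * n)) (by exact_mod_cast hb)
    have h0 := log_pos (by exact_mod_cast (by omega : 1 < 30 * n) : (1 : ℝ) < (30 * n : ℕ))
    have h3 := log_two_gt_d9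
    have h4 := log_three_gt_d9
    have h5 := log_five_gt_d9
    have h6 : (n : ℝ) * 27.638 ≤ n * (14 * log 2 + 9 * log 3 + 5 * log 5) := by
      gcongr; linarith
    have h7 : (k + 4 * k / d + r + 1 : ℝ) * (b * log 2) ≤ (k + 4 * k / d + r + 1) * b * 0.6931471808 := by
      rw [mul_assoc _ (b : ℝ)]
      gcongr
    have h8 : (k + 4 * k / d + r + 1 : ℝ) * log (30 * n : ℕ) ≤ (k + 4 * k / d + r + 1) * (b * log 2) := by gcongr
    have h9 : (k + 4 * k / d + r + 1 : ℝ) * log (30 * n : ℕ) ≤ ((30 * n).primeCounting + 1) * log (30 * n : ℕ) := by linarith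
    linarith [le_of_mul_le_mul_right h9 h0]
  have hlower' : k + k.primeCounting ≤ (30 * n).primeCounting := by exact_mod_cast hlower
  rw [← Nat.primesLE_card_eq_primeCounting, ← Nat.primesLE_card_eq_primeCounting] at hlower'
  obtain ⟨S, hS, hc⟩ := exists_subset_card_eq (s := (30 * n).primesLE \ k.primesLE)
    (by have := le_card_sdiff k.primesLE (30 * n).primesLE; omega : k ≤ _)
  have hS' : ∀ p ∈ S, (p ≤ 30 * n ∧ k < p) ∧ p.Prime := fun p hp => by
    have := hS hp
    simp only [mem_sdiff, Nat.mem_primesLE, not_and] at this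
    exact ⟨⟨this.1.1, not_le.mp fun h => this.2 h this.1.2⟩, this.1.2⟩
  exact ⟨S, fun p hp => mem_Ioc.mpr (hS' p hp).1.symm, hc, fun p hp => (hS' p hp).2⟩

lemma admissible_of_primes {S : Finset ℕ} (hS : ∀ q ∈ S, q.Prime ∧ S.card < q) {p : ℕ} (hp : p.Prime) :
    ∃ v : ℕ, ∀ i : S, ¬p ∣ v + i := by
  rcases le_or_gt p S.card with h | h
  · exact ⟨0, fun i hd => by
      have := hS i i.2
      have := (Nat.prime_dvd_prime_iff_eq hp this.1).mp (by simpa using hd)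
      omega⟩
  · obtain ⟨r, hr, hr'⟩ := exists_mem_notMem_of_card_lt_card (s := S.image (· % p)) (t := range p)
      (card_image_le.trans_lt (by rwa [card_range]))
    refine ⟨p - r, fun i hd => hr' (mem_image.mpr ⟨i, i.2, ?_⟩)⟩
    have hrp := mem_range.mp hr
    have e : (i : ℕ) ≡ r [MOD p] := by
      refine Nat.ModEq.add_left_cancel' (p - r) ?_
      rw [Nat.sub_add_cancel hrp.le, Nat.ModEq, Nat.mod_self]
      exact Nat.mod_eq_zero_of_dvd hd
    rw [← Nat.mod_eq_of_lt hrp]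
    exact e

section

open Filter

/-- A lower Riemann sum for the squared logarithm. -/
lemma le_sum_log_sq {β : ℝ} (hβ : 0 < β) (t : ℕ) :
    (1 + β * t) * (log (1 + β * t) ^ 2 - 2 * log (1 + β * t) + 2) - 2 ≤
      β * ∑ i ∈ range (t + 1), log (1 + β * i) ^ 2 := by
  induction t with
  | zero => simp
  | succ t ih =>
    rw [sum_range_succ, mul_add]
    have hab : 1 + β * t ≤ 1 + β * (t + 1 : ℕ) := by push_cast; nlinarith
    have h1 : (1 : ℝ) ≤ 1 + β * t := le_add_of_nonneg_right (by positivity)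
    have := (mul_le_sub_of_antitone_deriv (H := fun y => -log y ^ 2)
      (Γ := fun y => -(y * (log y ^ 2 - 2 * log y + 2))) hab (fun y hy => ?_) fun y hy z hz hyz => ?_).1
    · push_cast at *
      linarith
    · have hy0 : y ≠ 0 := by linarith [hy.1]
      have hl := hasDerivAt_log hy0
      refine ((hasDerivAt_id y).mul (((hl.pow 2).sub (hl.const_mul 2)).add_const 2)).neg.congr_deriv ?_
      simp
      field_simp
      ring
    · have := log_nonneg (h1.trans hy.1)
      have := log_le_log (by linarith [hy.1]) hyz
      simp only [neg_le_neg_iff]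
      gcongr

/-- The sieve theorem with an explicit logarithmic cutoff. -/
lemma exists_many_primes_of_numeric {ι : Type*} [Fintype ι] [DecidableEq ι] {h : ι → ℕ} (hh : Function.Injective h)
    (hadm : ∀ p : ℕ, p.Prime → ∃ v : ℕ, ∀ i, ¬p ∣ v + h i) {k a t s K M : ℕ} (hk : Fintype.card ι = k) (hk2 : 2 ≤ k)
    (ha : 3 ≤ a) (ht : 0 < t) (hK : t + 1 + s < K) {l X : ℝ} (hl : l = a * log 2) (hX : X = 2 ^ a)
    (h1 : k * t * (l * X - X + 1) < (K - (t + 1 + s)) * (X - 1) ^ 2)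
    (h2 : 4 * M * (t + 1 + s) * K * X < k * t * (t * (l ^ 2 - 2 * l + 2) + s * l ^ 2)) (n₁ : ℕ) :
    ∃ n, n₁ < n ∧ M < (univ.filter fun i => (n + h i).Prime).card := by
  have hk0 : (0 : ℝ) < k := by exact_mod_cast (by omega : 0 < k)
  have ht0 : (0 : ℝ) < t := by exact_mod_cast ht
  have hK0 : (0 : ℝ) < K := by exact_mod_cast (by omega : 0 < K)
  have hX8 : 8 ≤ X := by
    rw [hX]
    exact_mod_cast Nat.pow_le_pow_right (by norm_num : 0 < 2) ha
  have hX1 : 0 < X - 1 := by linarith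
  have hl2 : 2 ≤ l := by
    have : (3 : ℝ) ≤ a := by exact_mod_cast ha
    rw [hl]
    nlinarith [log_two_gt_d9]
  have hlX : log X = l := by rw [hX, hl, log_pow]
  obtain ⟨T, hT⟩ : ∃ T : ℝ, T = t / K := ⟨_, rfl⟩
  obtain ⟨c, hc⟩ : ∃ c : ℝ, c = k * t / (K * (X - 1)) := ⟨_, rfl⟩
  have hT0 : 0 < T := by rw [hT]; positivity
  have hc0 : 0 < c := by rw [hc]; positivity
  have hm : T / (c * (c + k * T)) = K * (X - 1) ^ 2 / (k ^ 2 * t * X) := by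
    have : c + k * T = k * t * X / (K * (X - 1)) := by rw [hT, hc]; field_simp; ring
    rw [this, hT, hc]; field_simp
  have hcut : ∀ i : ℕ, i ≤ t → cutInt k c T (i / K) = log (1 + (X - 1) / t * i) / k := fun i hi => by
    have : (i : ℝ) / K ≤ T := by rw [hT]; gcongr
    rw [cutInt, min_eq_left this, hc]
    congr 3; field_simp
  have hcutT : ∀ v : ℝ, T ≤ v → cutInt k c T v = l / k := fun v hv => by
    rw [cutInt, min_eq_right hv, hc, hT, ← hlX]
    congr 2; field_simp; ring
  refine exists_many_primes hh hadm hk hk2 (c := c) (T := T) (K := K) (n0 := t + 1 + s) hc0 hT0 ?_ hK ?_ ?_ n₁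
  · rw [hT, div_le_one hK0]
    exact_mod_cast (by omega : t ≤ K)
  · rw [hm, hcutT T le_rfl]
    have e : l / k - c * (K * (X - 1) ^ 2 / (k ^ 2 * t * X)) = (l * X - X + 1) / (k * X) := by rw [hc]; field_simp; ring
    have h0 : 0 ≤ (l * X - X + 1) / (k * X) := div_nonneg (by nlinarith) (by positivity)
    rw [e]
    calc _ ≤ K * (1 * ((l * X - X + 1) / (k * X))) := by
          gcongr
          rw [div_le_one hk0]; linarith
      _ = K / (k ^ 2 * t * X) * (k * t * (l * X - X + 1)) := by field_simp
      _ < K / (k ^ 2 * t * X) * ((K - (t + 1 + s)) * (X - 1) ^ 2) := by gcongr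
      _ = _ := by push_cast; ring
  · have hs : t * (l ^ 2 - 2 * l + 2) + s * l ^ 2 ≤ k ^ 2 * ∑ i ∈ range (t + 1 + s), cutInt k c T (i / K) ^ 2 := by
      rw [sum_range_add, mul_add (_ ^ 2)]
      apply add_le_add
      · have e : ∀ i ∈ range (t + 1), cutInt k c T (i / K) ^ 2 = log (1 + (X - 1) / t * i) ^ 2 / (k : ℝ) ^ 2 :=
          fun i hi => by rw [hcut i (by have := mem_range.mp hi; omega), div_pow]
        rw [sum_congr rfl e, ← sum_div,
          mul_div_cancel₀ _ (pow_pos hk0 2).ne']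
        have h3 := le_sum_log_sq (div_pos hX1 ht0) t
        rw [div_mul_cancel₀ _ ht0.ne', add_sub_cancel, hlX, div_mul_eq_mul_div, le_div_iff₀ ht0] at h3
        refine le_of_mul_le_mul_left (le_trans ?_ h3) hX1
        nlinarith [mul_nonneg ht0.le (mul_nonneg (by linarith : 0 ≤ l) (by linarith : 0 ≤ l - 2))]
      · have e : ∀ i ∈ range s, cutInt k c T ((t + 1 + i : ℕ) / K) ^ 2 = (l / k) ^ 2 := fun i _ => by
          rw [hcutT _ (by rw [hT]; gcongr; omega)]
        apply le_of_eq
        rw [sum_congr rfl e, sum_const, card_range, nsmul_eq_mul]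
        field_simp
    rw [hm]
    calc _ = 4 * M * (t + 1 + s) * K * (X - 1) ^ 2 / (k ^ 2 * t * X) := by push_cast; ring
      _ ≤ 4 * M * (t + 1 + s) * K * X ^ 2 / (k ^ 2 * t * X) := by gcongr; linarith
      _ = 4 * M * (t + 1 + s) * K * X / (k ^ 2 * t) := by field_simp
      _ < k * t * (t * (l ^ 2 - 2 * l + 2) + s * l ^ 2) / (k ^ 2 * t) := by gcongr
      _ = (t * (l ^ 2 - 2 * l + 2) + s * l ^ 2) / k := by field_simp
      _ ≤ _ := by rw [div_le_iff₀ hk0]; linarith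

/-- Translates of a set of length `d` with many primes bound the gaps infinitely often. -/
lemma liminf_le_of_many_primes {S : Finset ℕ} {k d M : ℕ} (hS : S ⊆ Ioc k (k + d))
    (h : ∀ n₁, ∃ n, n₁ < n ∧ M < (univ.filter fun i : S => (n + (i : ℕ)).Prime).card) :
    liminf (fun n => Nat.nth Nat.Prime (n + M) - Nat.nth Nat.Prime n) atTop ≤ d := by
  refine liminf_le_of_frequently_le (frequently_atTop.mpr fun a => ?_)
  obtain ⟨n, hn, hM⟩ := h (Nat.nth Nat.Prime a)
  have hcount : Nat.count Nat.Prime (n + k + 1) + M < Nat.count Nat.Prime (n + k + d + 1) := by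
    rw [Nat.count_eq_card_filter_range, Nat.count_eq_card_filter_range]
    refine (Nat.add_lt_add_left hM _).trans_le ?_
    rw [← card_image_of_injective (univ.filter fun i : S => (n + (i : ℕ)).Prime) (f := fun i : S => n + (i : ℕ))
      fun x y e => Subtype.ext (Nat.add_left_cancel e), ← card_union_of_disjoint]
    · refine card_le_card (union_subset (fun x hx => ?_) fun x hx => ?_)
      · simp only [mem_filter, mem_range] at hx ⊢
        exact ⟨by omega, hx.2⟩
      · obtain ⟨i, hi, rfl⟩ := mem_image.mp hx
        have := mem_Ioc.mp (hS i.2)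
        exact mem_filter.mpr ⟨mem_range.mpr (by omega), (mem_filter.mp hi).2⟩
    · refine disjoint_left.mpr fun x hx hx' => ?_
      obtain ⟨i, _, rfl⟩ := mem_image.mp hx'
      have := mem_Ioc.mp (hS i.2)
      have := mem_range.mp (mem_filter.mp hx).1
      omega
  refine ⟨Nat.count Nat.Prime (n + k + 1), ?_, ?_⟩
  · refine (Nat.count_nth_of_infinite Nat.infinite_setOfPred_prime a).symm.trans_le (Nat.count_monotone _ ?_)
    exact hn.le.trans (by omega)
  · have h1 := Nat.nth_lt_of_lt_count hcount
    have h2 : n + k + 1 ≤ Nat.nth Nat.Prime (Nat.count Nat.Prime (n + k + 1)) :=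
      Nat.le_nth_count Nat.infinite_setOfPred_prime (n + k + 1)
    omega

/-- Numerical criterion for a bound on the gap to the `M`-th next prime. -/
theorem liminf_le_of_numeric {k n b r a t s K M d : ℕ} (e : ℕ) (hn : n ≠ 0) (hnd : 30 * n ≤ k + d) (hb : 30 * n ≤ 2 ^ b)
    (he0 : e ≠ 0) (he : 2 ^ e ≤ k) (hr : k ≤ r ^ 2) (h : (k + 4 * k / e + r + 1) * b * 0.6931471808 + 3 ≤ (n : ℝ) * 27.638)
    (ha : 3 ≤ a) (ht : 0 < t) (hK : t + 1 + s < K)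
    (h1 : k * t * (a * 0.6931471808 * 2 ^ a - 2 ^ a + 1) < ((K : ℝ) - (t + 1 + s)) * (2 ^ a - 1) ^ 2)
    (h2 : 4 * M * (t + 1 + s) * K * (2 : ℝ) ^ a <
      k * t * (t * ((a * 0.6931471803) ^ 2 - 2 * (a * 0.6931471803) + 2) + s * (a * 0.6931471803) ^ 2)) :
    liminf (fun n => Nat.nth Nat.Prime (n + M) - Nat.nth Nat.Prime n) atTop ≤ d := by
  obtain ⟨S, hS, hc, hp⟩ := exists_prime_tuple hn hb he0 he hr h
  have hk2 : 2 ≤ k := (Nat.one_lt_two_pow he0).trans_le he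
  have ha' : (3 : ℝ) ≤ a := by exact_mod_cast ha
  have hg := log_two_gt_d9
  have hl := log_two_lt_d9
  refine liminf_le_of_many_primes (hS.trans (Ioc_subset_Ioc_right hnd)) (exists_many_primes_of_numeric
    Subtype.val_injective (fun p hp' => admissible_of_primes (fun q hq => ⟨hp q hq, ?_⟩) hp')
    ((Fintype.card_coe S).trans hc) hk2 ha ht hK rfl rfl (h1.trans_le' ?_) (h2.trans_le ?_))
  · rw [hc]; exact (mem_Ioc.mp (hS hq)).1
  · gcongr
  · have e1 : ∀ x y : ℝ, 1 ≤ x → x ≤ y → x ^ 2 - 2 * x + 2 ≤ y ^ 2 - 2 * y + 2 := fun x y h1 h2 => by nlinarith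
    gcongr ?_ * (?_ * ?_ + ?_ * (_ * ?_) ^ 2)
    exact e1 _ _ (by linarith) (by gcongr)

end

end

end PrimeGaps

/-- With `Nat.nth Nat.Prime n` the `n`-th prime,
one has the unconditional bounds `H₂ ≤ 398130`, `H₃ ≤ 24797814`, `H₄ ≤ 1431556072`,
`H₅ ≤ 80550202480`, where `H_m = liminf_{n → ∞} (p_{n+m} - p_n)`. -/
theorem liminf_prime_gaps_Hm_bounds :
    Filter.liminf (fun n : ℕ => Nat.nth Nat.Prime (n + 2) - Nat.nth Nat.Prime n)
        Filter.atTop ≤ 398130 ∧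
    Filter.liminf (fun n : ℕ => Nat.nth Nat.Prime (n + 3) - Nat.nth Nat.Prime n)
        Filter.atTop ≤ 24797814 ∧
    Filter.liminf (fun n : ℕ => Nat.nth Nat.Prime (n + 4) - Nat.nth Nat.Prime n)
        Filter.atTop ≤ 1431556072 ∧
    Filter.liminf (fun n : ℕ => Nat.nth Nat.Prime (n + 5) - Nat.nth Nat.Prime n)
        Filter.atTop ≤ 80550202480 := by
  refine ⟨?_, ?_, ?_, ?_⟩
  · refine PrimeGaps.liminf_le_of_numeric (k := 20000) (n := 13937) (b := 19) (r := 142) (a := 13) (t := 4602) (s := 5368)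
      (K := 100000) 14 ?_ ?_ ?_ ?_ ?_ ?_ ?_ ?_ ?_ ?_ ?_ ?_ <;> norm_num
  · refine PrimeGaps.liminf_le_of_numeric (k := 1000000) (n := 859927) (b := 25) (r := 1000) (a := 19) (t := 3973) (s := 3804)
      (K := 100000) 19 ?_ ?_ ?_ ?_ ?_ ?_ ?_ ?_ ?_ ?_ ?_ ?_ <;> norm_num
  · refine PrimeGaps.liminf_le_of_numeric (k := 50000000) (n := 49385202) (b := 31) (r := 7072) (a := 25) (t := 3835) (s := 2852)
      (K := 100000) 25 ?_ ?_ ?_ ?_ ?_ ?_ ?_ ?_ ?_ ?_ ?_ ?_ <;> norm_num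
  · refine PrimeGaps.liminf_le_of_numeric (k := 2600000000) (n := 2771673416) (b := 37) (r := 50991) (a := 30) (t := 1995)
      (s := 2381) (K := 100000) 31 ?_ ?_ ?_ ?_ ?_ ?_ ?_ ?_ ?_ ?_ ?_ ?_ <;> norm_num
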